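/- The family {V_δ}_{δ>0} is uniformly Lipschitz continuous: there exists a constant K̄ > 0, independent of δ, such that for every δ > 0 and all m₁⁰, m₂⁰ ∈ P(𝕋^d), |V_δ(m₂⁰) − V_δ(m₁⁰)| ≤ K̄ d(m₁⁰, m₂⁰). -/

import Mathlib

/- Common framework for "On the long time convergence of potential MFG" (M. Masoero).

We work on the flat torus `𝕋^d`, modeled as `Td d := Fin d → AddCircle 1`.
Smooth functions on the torus are represented by `ℤ^d`-periodic functions on
`Vd d := Fin d → ℝ`; a function on `Vd d` is transported to the torus through the
canonical (measurable) section `secT : Td d → Vd d`.  Probability measures on the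
torus are `PTd d := ProbabilityMeasure (Td d)`, endowed with the 1-Wasserstein
distance `W1` defined through Kantorovich duality.  The Fokker--Planck equations
and their stationary analogues are stated in the sense of distributions, i.e.
against smooth periodic test functions; `σ` is the viscosity parameter
(everywhere `σ = 1` except in the non-convex example). -/

open MeasureTheory Real Set Filter

noncomputable section

abbrev Vd (d : ℕ) : Type := Fin d → ℝ
abbrev Td (d : ℕ) : Type := Fin d → AddCircle (1 : ℝ)

instance factOneposR : Fact ((0:ℝ) < 1) := ⟨one_pos⟩

/-- The canonical measurable section of the torus, with values in `[0,1)^d`. -/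
def secT {d : ℕ} (y : Td d) : Vd d := fun i => ((AddCircle.equivIco 1 0) (y i)).1

/-- The vector of `ℝ^d` associated with an integer vector. -/
def intVec {d : ℕ} (z : Fin d → ℤ) : Vd d := fun i => (z i : ℝ)

/-- Euclidean scalar product on `ℝ^d`. -/
def dotp {d : ℕ} (a b : Vd d) : ℝ := ∑ i, a i * b i

/-- Squared euclidean norm on `ℝ^d`. -/
def sqnorm {d : ℕ} (a : Vd d) : ℝ := ∑ i, (a i)^2

/-- Spatial gradient. -/
def gradv {d : ℕ} (g : Vd d → ℝ) (x : Vd d) : Vd d := fun i => fderiv ℝ g x (Pi.single i 1)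

/-- Second derivative of `g` at `x` in the directions `v, w`. -/
def D2 {d : ℕ} (g : Vd d → ℝ) (x v w : Vd d) : ℝ := fderiv ℝ (fun y => fderiv ℝ g y v) x w

/-- Laplacian. -/
def lapl {d : ℕ} (g : Vd d → ℝ) (x : Vd d) : ℝ := ∑ i, D2 g x (Pi.single i 1) (Pi.single i 1)

/-- Divergence of a vector field. -/
def divv {d : ℕ} (b : Vd d → Vd d) (x : Vd d) : ℝ :=
  ∑ i, fderiv ℝ (fun y => b y i) x (Pi.single i 1)

/-- Time derivative of a time dependent function. -/
def tderiv {d : ℕ} (u : ℝ → Vd d → ℝ) (t : ℝ) (x : Vd d) : ℝ := deriv (fun s => u s x) t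

abbrev PTd (d : ℕ) := ProbabilityMeasure (Td d)

/-- The 1-Wasserstein (Monge--Kantorovich) distance, via Kantorovich duality. -/
def W1 {d : ℕ} (μ ν : PTd d) : ℝ :=
  sSup { r | ∃ φ : Td d → ℝ, LipschitzWith 1 φ ∧
    r = (∫ y, φ y ∂(μ : Measure (Td d))) - ∫ y, φ y ∂(ν : Measure (Td d)) }

/-- The convex combination `(1-t) μ + t ν`. -/
def lineComb {d : ℕ} (t : ℝ) (μ ν : PTd d) : Measure (Td d) :=
  ENNReal.ofReal (1 - t) • (μ : Measure (Td d)) + ENNReal.ofReal t • (ν : Measure (Td d))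

/-- The standing assumptions of the paper: a Hamiltonian `H` (a `ℤ^d`-periodic function of
`(x,p)`), its convex conjugate `Hstar` in the `p` variable, a `C²` coupling function
`Fc` on `P(𝕋^d)` with flat derivative `Fd` (represented by periodic functions on `ℝ^d`),
with the regularity and growth conditions of the paper. -/
structure MFGSetting (d : ℕ) where
  H : Vd d → Vd d → ℝ
  Hstar : Vd d → Vd d → ℝ
  Fc : PTd d → ℝ
  Fd : Measure (Td d) → Vd d → ℝ
  Cbar : ℝ
  Cbar_pos : 0 < Cbar
  θ : ℝ
  θ_mem : θ ∈ Set.Ioo (0:ℝ) 1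
  Cg : ℝ
  Cg_pos : 0 < Cg
  CF : ℝ
  H_smooth : ContDiff ℝ 2 (fun q : Vd d × Vd d => H q.1 q.2)
  H_per : ∀ (x : Vd d) (z : Fin d → ℤ) (p : Vd d), H (x + intVec z) p = H x p
  Dpp_lip : ∃ L : ℝ, 0 ≤ L ∧ ∀ (x p₁ p₂ v w : Vd d),
    |D2 (fun p => H x p) p₁ v w - D2 (fun p => H x p) p₂ v w| ≤ L * ‖p₁ - p₂‖ * ‖v‖ * ‖w‖
  Dpp_lower : ∀ x p v : Vd d, Cbar⁻¹ * sqnorm v ≤ D2 (fun p' => H x p') p v v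
  Dpp_upper : ∀ x p v : Vd d, D2 (fun p' => H x p') p v v ≤ Cbar * sqnorm v
  Dxx_growth : ∀ x p v w : Vd d,
    |D2 (fun x' => H x' p) x v w| ≤ Cg * (1 + ‖p‖) ^ (1 + θ) * ‖v‖ * ‖w‖
  Dxp_growth : ∀ x p v w : Vd d,
    |fderiv ℝ (fun x' => fderiv ℝ (fun p' => H x' p') p v) x w| ≤ Cg * (1 + ‖p‖) ^ θ * ‖v‖ * ‖w‖
  Hstar_eq : ∀ x q : Vd d, IsLUB (Set.range fun p => dotp q p - H x p) (Hstar x q)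
  Fd_per : ∀ (μ : Measure (Td d)) (x : Vd d) (z : Fin d → ℤ), Fd μ (x + intVec z) = Fd μ x
  Fd_smooth : ∀ μ : Measure (Td d), IsProbabilityMeasure μ → ContDiff ℝ 2 (Fd μ)
  Fd_D2_bound : ∀ μ : Measure (Td d), IsProbabilityMeasure μ →
    ∀ x v w : Vd d, |D2 (Fd μ) x v w| ≤ CF * ‖v‖ * ‖w‖
  flat_deriv : ∀ μ ν : PTd d,
    Fc ν - Fc μ = ∫ t in Set.Icc (0:ℝ) 1,
      ((∫ y, Fd (lineComb t μ ν) (secT y) ∂(ν : Measure (Td d))) -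
        ∫ y, Fd (lineComb t μ ν) (secT y) ∂(μ : Measure (Td d)))
  Fd_normalized : ∀ μ : PTd d, (∫ y, Fd (μ : Measure (Td d)) (secT y) ∂(μ : Measure (Td d))) = 0
  Fc_bounded : ∃ M : ℝ, ∀ μ : PTd d, |Fc μ| ≤ M
  Fd_bounded : ∃ M : ℝ, ∀ (μ : PTd d) (x : Vd d), |Fd (μ : Measure (Td d)) x| ≤ M

/-- Smooth periodic test functions on `[0,∞) × 𝕋^d` (resp. `ℝ × 𝕋^d`). -/
def IsTestFun {d : ℕ} (φ : ℝ → Vd d → ℝ) : Prop :=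
  ContDiff ℝ 2 (fun q : ℝ × Vd d => φ q.1 q.2) ∧
  ∀ (t : ℝ) (x : Vd d) (z : Fin d → ℤ), φ t (x + intVec z) = φ t x

/-- The weak (distributional) formulation of the Fokker--Planck equation
`-∂ₜ m + σ Δ m + div(m α) = 0` between times `s₁` and `s₂`. -/
def FPeq {d : ℕ} (σ : ℝ) (m : ℝ → PTd d) (α : ℝ → Td d → Vd d) (s₁ s₂ : ℝ) : Prop :=
  ∀ φ : ℝ → Vd d → ℝ, IsTestFun φ →
    (∫ y, φ s₂ (secT y) ∂(m s₂ : Measure (Td d))) -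
      (∫ y, φ s₁ (secT y) ∂(m s₁ : Measure (Td d))) =
    ∫ s in s₁..s₂, ∫ y, (tderiv φ s (secT y) + σ * lapl (φ s) (secT y)
        - dotp (α s y) (gradv (φ s) (secT y))) ∂(m s : Measure (Td d))

/-- Continuity of a curve of measures with respect to the 1-Wasserstein distance. -/
def W1ContOn {d : ℕ} (m : ℝ → PTd d) (I : Set ℝ) : Prop :=
  ∀ t ∈ I, ∀ ε > 0, ∃ η > 0, ∀ s ∈ I, |s - t| < η → W1 (m s) (m t) < ε

/-- Continuity of a function on `P(𝕋^d)` with respect to the 1-Wasserstein distance. -/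
def W1Continuous {d : ℕ} (χ : PTd d → ℝ) : Prop :=
  ∀ μ : PTd d, ∀ ε > 0, ∃ η > 0, ∀ ν : PTd d, W1 μ ν < η → |χ ν - χ μ| < ε

/-- W1-closed subsets of `P(𝕋^d)`. -/
def IsClosedW1 {d : ℕ} (C : Set (PTd d)) : Prop :=
  ∀ μ : PTd d, (∀ ε > 0, ∃ ν ∈ C, W1 μ ν < ε) → μ ∈ C

/-- The running cost `∫ H*(x,α(s)) dm(s) + 𝓕(m(s))`. -/
def runCost {d : ℕ} (S : MFGSetting d) (m : ℝ → PTd d) (α : ℝ → Td d → Vd d) (s : ℝ) : ℝ :=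
  (∫ y, S.Hstar (secT y) (α s y) ∂(m s : Measure (Td d))) + S.Fc (m s)

/-- Admissible pairs `(m,α)` on `[0,T]` starting from `m₀` (with `α ∈ L²_m`). -/
def AdmOn {d : ℕ} (S : MFGSetting d) (σ : ℝ) (m₀ : PTd d) (T : ℝ)
    (m : ℝ → PTd d) (α : ℝ → Td d → Vd d) : Prop :=
  m 0 = m₀ ∧ W1ContOn m (Set.Icc 0 T) ∧
  (∀ s₁ s₂ : ℝ, 0 ≤ s₁ → s₁ ≤ s₂ → s₂ ≤ T → FPeq σ m α s₁ s₂) ∧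
  Measurable (fun q : ℝ × Td d => α q.1 q.2) ∧
  (∫⁻ s in Set.Ioc (0:ℝ) T, ∫⁻ y, ENNReal.ofReal (sqnorm (α s y)) ∂(m s : Measure (Td d))) < ⊤ ∧
  IntervalIntegrable (runCost S m α) volume 0 T

/-- Admissible pairs `(m,α)` on `[0,T]` starting from `m₀`, with `α` merely in `L¹_m`
(the class `Π_T` used for problems with prescribed endpoints). -/
def AdmOn1 {d : ℕ} (S : MFGSetting d) (σ : ℝ) (m₀ : PTd d) (T : ℝ)
    (m : ℝ → PTd d) (α : ℝ → Td d → Vd d) : Prop :=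
  m 0 = m₀ ∧ W1ContOn m (Set.Icc 0 T) ∧
  (∀ s₁ s₂ : ℝ, 0 ≤ s₁ → s₁ ≤ s₂ → s₂ ≤ T → FPeq σ m α s₁ s₂) ∧
  Measurable (fun q : ℝ × Td d => α q.1 q.2) ∧
  (∫⁻ s in Set.Ioc (0:ℝ) T, ∫⁻ y, ENNReal.ofReal (Real.sqrt (sqnorm (α s y)))
      ∂(m s : Measure (Td d))) < ⊤ ∧
  IntervalIntegrable (runCost S m α) volume 0 T

/-- The finite horizon cost. -/
def costT {d : ℕ} (S : MFGSetting d) (m : ℝ → PTd d) (α : ℝ → Td d → Vd d) (T : ℝ) : ℝ :=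
  ∫ s in (0:ℝ)..T, runCost S m α s

/-- The value `𝒰(T,m₀)` of the finite horizon problem. -/
def Ufun {d : ℕ} (S : MFGSetting d) (σ : ℝ) (T : ℝ) (m₀ : PTd d) : ℝ :=
  sInf { r | ∃ m α, AdmOn S σ m₀ T m α ∧ r = costT S m α T }

/-- Admissible pairs for the infinite horizon `δ`-discounted problem. -/
def AdmDisc {d : ℕ} (S : MFGSetting d) (σ : ℝ) (δ : ℝ) (m₀ : PTd d)
    (m : ℝ → PTd d) (α : ℝ → Td d → Vd d) : Prop :=
  m 0 = m₀ ∧ W1ContOn m (Set.Ici 0) ∧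
  (∀ s₁ s₂ : ℝ, 0 ≤ s₁ → s₁ ≤ s₂ → FPeq σ m α s₁ s₂) ∧
  Measurable (fun q : ℝ × Td d => α q.1 q.2) ∧
  (∫⁻ s in Set.Ioi (0:ℝ), ENNReal.ofReal (Real.exp (-δ * s)) *
      ∫⁻ y, ENNReal.ofReal (sqnorm (α s y)) ∂(m s : Measure (Td d))) < ⊤ ∧
  Integrable (fun s => Real.exp (-δ * s) * runCost S m α s) (volume.restrict (Set.Ioi 0))

/-- The discounted cost. -/
def costDisc {d : ℕ} (S : MFGSetting d) (δ : ℝ) (m : ℝ → PTd d) (α : ℝ → Td d → Vd d) : ℝ :=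
  ∫ s in Set.Ioi (0:ℝ), Real.exp (-δ * s) * runCost S m α s

/-- The value `𝒱_δ(m₀)` of the discounted problem. -/
def Vfun {d : ℕ} (S : MFGSetting d) (σ : ℝ) (δ : ℝ) (m₀ : PTd d) : ℝ :=
  sInf { r | ∃ m α, AdmDisc S σ δ m₀ m α ∧ r = costDisc S δ m α }

/-- `D_p H (x, p)`. -/
def DpH {d : ℕ} (S : MFGSetting d) (x p : Vd d) : Vd d :=
  fun i => fderiv ℝ (fun p' => S.H x p') p (Pi.single i 1)

/-- `C^{1,2}` regularity on `I × 𝕋^d` of a (periodic) time-dependent function. -/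
def Creg12 {d : ℕ} (u : ℝ → Vd d → ℝ) (I : Set ℝ) : Prop :=
  ContinuousOn (fun q : ℝ × Vd d => u q.1 q.2) (I ×ˢ Set.univ) ∧
  (∀ x : Vd d, ∀ t ∈ I, DifferentiableAt ℝ (fun s => u s x) t) ∧
  (∀ t ∈ I, ContDiff ℝ 2 (u t)) ∧
  (∀ t ∈ I, ∀ (x : Vd d) (z : Fin d → ℤ), u t (x + intVec z) = u t x)

/-- `(u,m)` is a classical solution of the `δ`-discounted MFG system on `[0,∞) × 𝕋^d`:
`-∂ₜ u - Δ u + δ u + H(x,Du) = F(x,m)` and `-∂ₜ m + Δ m + div(m D_pH(x,Du)) = 0`. -/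
def SolvesDiscMFG {d : ℕ} (S : MFGSetting d) (δ : ℝ) (u : ℝ → Vd d → ℝ) (m : ℝ → PTd d) : Prop :=
  Creg12 u (Set.Ici 0) ∧
  (∀ t ∈ Set.Ici (0:ℝ), ∀ x : Vd d,
    - tderiv u t x - lapl (u t) x + δ * u t x + S.H x (gradv (u t) x)
      = S.Fd (m t : Measure (Td d)) x) ∧
  W1ContOn m (Set.Ici 0) ∧
  (∀ s₁ s₂ : ℝ, 0 ≤ s₁ → s₁ ≤ s₂ →
    FPeq 1 m (fun s y => DpH S (secT y) (gradv (u s) (secT y))) s₁ s₂)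

/-- Admissible pairs for the stationary (ergodic) problem:
`σ Δ m + div(m α) = 0` in the sense of distributions and `α ∈ L²_m`. -/
def StatAdm {d : ℕ} (σ : ℝ) (m : PTd d) (α : Td d → Vd d) : Prop :=
  Measurable α ∧
  (∫⁻ y, ENNReal.ofReal (sqnorm (α y)) ∂(m : Measure (Td d))) < ⊤ ∧
  ∀ g : Vd d → ℝ, ContDiff ℝ 2 g → (∀ (x : Vd d) (z : Fin d → ℤ), g (x + intVec z) = g x) →
    (∫ y, (σ * lapl g (secT y) - dotp (α y) (gradv g (secT y))) ∂(m : Measure (Td d))) = 0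

/-- `ergInf S σ = -λ̄`, the value of the stationary minimization problem. -/
def ergInf {d : ℕ} (S : MFGSetting d) (σ : ℝ) : ℝ :=
  sInf { r | ∃ m α, StatAdm σ m α ∧
    r = (∫ y, S.Hstar (secT y) (α y) ∂(m : Measure (Td d))) + S.Fc m }

/-- The set of values over which the dynamic programming principle for a corrector
`χ` takes its infimum. -/
def DPPval {d : ℕ} (S : MFGSetting d) (σ : ℝ) (χ : PTd d → ℝ) (lam t : ℝ) (m₀ : PTd d) :
    Set ℝ :=
  { r | ∃ m α, AdmOn S σ m₀ t m α ∧
      r = (∫ s in (0:ℝ)..t, runCost S m α s) + χ (m t) + lam * t }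

/-- `χ` is a corrector function: it is continuous and satisfies the dynamic
programming principle with the critical value `λ`. -/
def IsCorrector {d : ℕ} (S : MFGSetting d) (σ : ℝ) (lam : ℝ) (χ : PTd d → ℝ) : Prop :=
  W1Continuous χ ∧ ∀ (m₀ : PTd d) (t : ℝ), 0 < t → χ m₀ = sInf (DPPval S σ χ lam t m₀)

/-- `(m,α)` is a calibrated curve (defined on all of `ℝ`). -/
def IsCalibrated {d : ℕ} (S : MFGSetting d) (σ : ℝ) (lam : ℝ)
    (m : ℝ → PTd d) (α : ℝ → Td d → Vd d) : Prop :=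
  W1ContOn m Set.univ ∧
  (∀ s₁ s₂ : ℝ, s₁ ≤ s₂ → FPeq σ m α s₁ s₂) ∧
  Measurable (fun q : ℝ × Td d => α q.1 q.2) ∧
  (∀ t₁ t₂ : ℝ, (∫⁻ s in Set.Ioc t₁ t₂,
      ∫⁻ y, ENNReal.ofReal (sqnorm (α s y)) ∂(m s : Measure (Td d))) < ⊤) ∧
  (∀ t₁ t₂ : ℝ, IntervalIntegrable (runCost S m α) volume t₁ t₂) ∧
  ∃ χ : PTd d → ℝ, IsCorrector S σ lam χ ∧ ∀ t₁ t₂ : ℝ, t₁ < t₂ →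
    χ (m t₁) = lam * (t₂ - t₁) + (∫ s in t₁..t₂, runCost S m α s) + χ (m t₂)

/-- The projected Mather set. -/
def MatherSet {d : ℕ} (S : MFGSetting d) (σ : ℝ) (lam : ℝ) : Set (PTd d) :=
  { μ | ∃ m α, IsCalibrated S σ lam m α ∧ m 0 = μ }

/-- Invariant subsets of the projected Mather set. -/
def IsInvariantMFG {d : ℕ} (S : MFGSetting d) (σ : ℝ) (lam : ℝ) (C : Set (PTd d)) : Prop :=
  ∀ μ ∈ C, ∃ m α, IsCalibrated S σ lam m α ∧ m 0 = μ ∧ ∀ t : ℝ, m t ∈ C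

/-- Minimal invariant subsets of the projected Mather set. -/
def IsMinimalInvariant {d : ℕ} (S : MFGSetting d) (σ : ℝ) (lam : ℝ) (N : Set (PTd d)) : Prop :=
  N.Nonempty ∧ N ⊆ MatherSet S σ lam ∧ IsClosedW1 N ∧ IsInvariantMFG S σ lam N ∧
  ∀ C : Set (PTd d), C ⊆ N → C.Nonempty → IsClosedW1 C → IsInvariantMFG S σ lam C → C = N

/-- `δ 𝒱_δ → -λ` uniformly as `δ → 0⁺`. -/
def IsLimitValueV {d : ℕ} (S : MFGSetting d) (σ : ℝ) (lam : ℝ) : Prop :=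
  ∀ ε > 0, ∃ δ₀ > 0, ∀ δ : ℝ, 0 < δ → δ ≤ δ₀ → ∀ μ : PTd d,
    |δ * Vfun S σ δ μ - (-lam)| < ε

/-- `𝒰(T,·)/T → -λ` uniformly as `T → ∞`. -/
def IsLimitValueU {d : ℕ} (S : MFGSetting d) (σ : ℝ) (lam : ℝ) : Prop :=
  ∀ ε > 0, ∃ T₀ : ℝ, ∀ T : ℝ, T₀ ≤ T → ∀ μ : PTd d,
    |Ufun S σ T μ / T - (-lam)| < ε

/-- A function `Φ` on `P(𝕋^d)` is `C¹` with flat derivative `dΦ` (normalized so that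
`∫ dΦ(m,·) dm = 0`, periodic in the space variable and jointly continuous). -/
def IsC1Flat {d : ℕ} (Φ : PTd d → ℝ) (dΦ : Measure (Td d) → Vd d → ℝ) : Prop :=
  (∀ (μ : Measure (Td d)) (x : Vd d) (z : Fin d → ℤ), dΦ μ (x + intVec z) = dΦ μ x) ∧
  (∀ μ ν : PTd d,
    Φ ν - Φ μ = ∫ t in Set.Icc (0:ℝ) 1,
      ((∫ y, dΦ (lineComb t μ ν) (secT y) ∂(ν : Measure (Td d))) -
        ∫ y, dΦ (lineComb t μ ν) (secT y) ∂(μ : Measure (Td d)))) ∧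
  (∀ μ : PTd d, (∫ y, dΦ (μ : Measure (Td d)) (secT y) ∂(μ : Measure (Td d))) = 0) ∧
  (∀ ε > 0, ∀ (μ : PTd d) (x : Vd d), ∃ η > 0, ∀ (ν : PTd d) (x' : Vd d),
    W1 μ ν < η → ‖x' - x‖ < η → |dΦ (ν : Measure (Td d)) x' - dΦ (μ : Measure (Td d)) x| < ε)



section torusA
variable {d : ℕ}

/-- projection to the torus -/
def piT (x : Vd d) : Td d := fun i => (x i : AddCircle (1:ℝ))

lemma piT_add (x y : Vd d) : piT (x + y) = piT x + piT y := by
  funext i; simp [piT]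

lemma piT_sub (x y : Vd d) : piT (x - y) = piT x - piT y := by
  funext i; simp [piT]

lemma piT_zero : piT (0 : Vd d) = 0 := by
  funext i; simp [piT]

lemma continuous_piT : Continuous (piT : Vd d → Td d) := by
  refine continuous_pi fun i => ?_
  exact (AddCircle.continuous_mk' (1:ℝ)).comp (continuous_apply i)

lemma measurable_piT : Measurable (piT : Vd d → Td d) := continuous_piT.measurable

lemma piT_secT (y : Td d) : piT (secT y) = y := by
  funext i
  simp only [piT, secT]
  exact (AddCircle.equivIco 1 0).symm_apply_apply (y i)

lemma measurable_secT : Measurable (secT : Td d → Vd d) := by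
  refine measurable_pi_iff.2 fun i => ?_
  exact measurable_subtype_coe.comp
    ((AddCircle.measurableEquivIco (1:ℝ) 0).measurable.comp (measurable_pi_apply i))

lemma piT_eq_iff {x y : Vd d} (h : piT x = piT y) : ∃ z : Fin d → ℤ, x = y + intVec z := by
  have : ∀ i, ∃ z : ℤ, x i = y i + z := by
    intro i
    have h1 : ((x i : ℝ) : AddCircle (1:ℝ)) = (y i : AddCircle (1:ℝ)) := congrFun h i
    have h2 : ((x i - y i : ℝ) : AddCircle (1:ℝ)) = 0 := by
      rw [AddCircle.coe_sub, h1, sub_self]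
    obtain ⟨n, hn⟩ := (AddCircle.coe_eq_zero_iff (p := (1:ℝ))).1 h2
    refine ⟨n, ?_⟩
    simp only [zsmul_eq_mul, mul_one] at hn
    linarith
  choose z hz using this
  exact ⟨z, funext fun i => by simp [intVec, hz i]⟩

/-- periodic function -/
def Per {E : Type*} (g : Vd d → E) : Prop := ∀ (x : Vd d) (z : Fin d → ℤ), g (x + intVec z) = g x

lemma Per.eq {E : Type*} {g : Vd d → E} (hg : Per g) {x y : Vd d} (h : piT x = piT y) : g x = g y := by
  obtain ⟨z, rfl⟩ := piT_eq_iff h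
  exact hg _ _

lemma Per.sec {E : Type*} {g : Vd d → E} (hg : Per g) (x : Vd d) : g (secT (piT x)) = g x :=
  hg.eq (piT_secT _)

lemma Per.sec_add {E : Type*} {g : Vd d → E} (hg : Per g) (y : Td d) (u : Vd d) :
    g (secT (y + piT u)) = g (secT y + u) := by
  refine hg.eq ?_
  rw [piT_secT, piT_add, piT_secT]

/-- minimal representative -/
def repT (y : Td d) : Vd d := fun i => ((AddCircle.equivIco 1 (-(1/2))) (y i)).1

lemma piT_repT (y : Td d) : piT (repT y) = y := by
  funext i
  simp only [piT, repT]
  exact (AddCircle.equivIco 1 (-(1/2))).symm_apply_apply (y i)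

lemma measurable_repT : Measurable (repT : Td d → Vd d) := by
  refine measurable_pi_iff.2 fun i => ?_
  exact measurable_subtype_coe.comp
    ((AddCircle.measurableEquivIco (1:ℝ) (-(1/2))).measurable.comp (measurable_pi_apply i))

lemma norm_piT_le (x : Vd d) : ‖piT x‖ ≤ ‖x‖ := by
  refine (pi_norm_le_iff_of_nonneg (norm_nonneg _)).2 fun i => ?_
  refine le_trans ?_ (norm_le_pi_norm x i)
  have h := UnitAddCircle.norm_eq (x := x i)
  have h2 : |x i - round (x i)| ≤ |x i| := by simpa using round_le (x i) 0
  calc ‖piT x i‖ = |x i - round (x i)| := h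
    _ ≤ _ := h2

lemma norm_repT (y : Td d) : ‖repT y‖ = ‖y‖ := by
  have h1 : ∀ i, ‖repT y i‖ = ‖y i‖ := by
    intro i
    have h2 : ((repT y i : ℝ) : AddCircle (1:ℝ)) = y i := congrFun (piT_repT y) i
    have h3 : repT y i ∈ Set.Ico (-(1/2):ℝ) (-(1/2)+1) := ((AddCircle.equivIco 1 (-(1/2))) (y i)).2
    rw [← h2]
    refine ((AddCircle.norm_coe_eq_abs_iff (1:ℝ) one_ne_zero).2 ?_).symm
    rw [abs_one, abs_le]
    have h4 := h3.1
    have h5 := h3.2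
    constructor <;> linarith
  simp only [Pi.norm_def]
  congr 1
  refine Finset.sup_congr rfl fun i _ => ?_
  exact NNReal.eq (h1 i)

lemma norm_Td_le (y : Td d) : ‖y‖ ≤ 1/2 := by
  refine (pi_norm_le_iff_of_nonneg (by norm_num)).2 fun i => ?_
  have := AddCircle.norm_le_half_period (1:ℝ) (x := y i) one_ne_zero
  simpa using this

lemma dist_Td_le (y y' : Td d) : dist y y' ≤ 1/2 := by
  rw [dist_eq_norm]; exact norm_Td_le _

lemma dist_add_piT (y : Td d) (u : Vd d) : dist (y + piT u) y ≤ ‖u‖ := by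
  rw [dist_eq_norm]; simpa using norm_piT_le u

lemma Per.lip {g : Vd d → ℝ} (hg : Per g) {L : ℝ} (hL : ∀ x x', |g x - g x'| ≤ L * ‖x - x'‖)
    (y y' : Td d) : |g (secT y) - g (secT y')| ≤ L * ‖y - y'‖ := by
  have h1 : g (secT y) = g (secT y' + repT (y - y')) := by
    rw [← hg.sec_add, piT_repT]; congr 2; abel
  rw [h1, ← norm_repT (y - y')]
  simpa using hL (secT y' + repT (y - y')) (secT y')

lemma Per.bdd {E : Type*} [SeminormedAddCommGroup E] {g : Vd d → E} (hg : Per g) (hc : Continuous g) :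
    ∃ C : ℝ, 0 ≤ C ∧ ∀ x, ‖g x‖ ≤ C := by
  have hK : IsCompact (Set.Icc (0 : Vd d) 1) := isCompact_Icc
  obtain ⟨C, hC⟩ := hK.exists_bound_of_continuousOn hc.continuousOn
  refine ⟨max C 0, le_max_right _ _, fun x => ?_⟩
  rw [← hg.sec x]
  refine le_trans (hC _ ?_) (le_max_left _ _)
  constructor <;> intro i
  · exact ((AddCircle.equivIco 1 0) (piT x i)).2.1
  · have := ((AddCircle.equivIco 1 0) (piT x i)).2.2
    simp only [zero_add] at this
    exact this.le

/-! ### W1 -/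

lemma lip_integrable {φ : Td d → ℝ} {L : NNReal} (hφ : LipschitzWith L φ) (μ : Measure (Td d))
    [IsFiniteMeasure μ] : Integrable φ μ := by
  have : Integrable φ (μ.restrict Set.univ) :=
    (hφ.continuous.continuousOn.integrableOn_compact isCompact_univ)
  simpa using this

lemma lip_int_diff_le {φ : Td d → ℝ} (hφ : LipschitzWith 1 φ) (μ ν : PTd d) :
    (∫ y, φ y ∂(μ : Measure (Td d))) - ∫ y, φ y ∂(ν : Measure (Td d)) ≤ 1 := by
  have h : ∀ y, |φ y - φ 0| ≤ 1/2 := fun y => by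
    have := hφ.dist_le_mul y 0
    rw [Real.dist_eq] at this
    have h2 := dist_Td_le y 0
    simp at this h2; linarith
  have i1 := lip_integrable hφ (μ : Measure (Td d))
  have i2 := lip_integrable hφ (ν : Measure (Td d))
  have h1 : (∫ y, φ y ∂(μ : Measure (Td d))) ≤ ∫ y, (φ 0 + 1/2) ∂(μ : Measure (Td d)) :=
    integral_mono i1 (integrable_const _) fun y => by have := abs_le.1 (h y); simp only; linarith
  have h2 : (∫ y, (φ 0 - 1/2) ∂(ν : Measure (Td d))) ≤ ∫ y, φ y ∂(ν : Measure (Td d)) :=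
    integral_mono (integrable_const _) i2 fun y => by have := abs_le.1 (h y); simp only; linarith
  simp at h1 h2
  linarith

lemma W1_bdd (μ ν : PTd d) : BddAbove { r | ∃ φ : Td d → ℝ, LipschitzWith 1 φ ∧
    r = (∫ y, φ y ∂(μ : Measure (Td d))) - ∫ y, φ y ∂(ν : Measure (Td d)) } := by
  refine ⟨1, ?_⟩
  rintro r ⟨φ, hφ, rfl⟩
  exact lip_int_diff_le hφ μ ν

lemma le_W1 {φ : Td d → ℝ} (hφ : LipschitzWith 1 φ) (μ ν : PTd d) :
    (∫ y, φ y ∂(μ : Measure (Td d))) - ∫ y, φ y ∂(ν : Measure (Td d)) ≤ W1 μ ν :=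
  le_csSup (W1_bdd μ ν) ⟨φ, hφ, rfl⟩

lemma W1_le {μ ν : PTd d} {C : ℝ} (h : ∀ φ : Td d → ℝ, LipschitzWith 1 φ →
    (∫ y, φ y ∂(μ : Measure (Td d))) - ∫ y, φ y ∂(ν : Measure (Td d)) ≤ C) : W1 μ ν ≤ C := by
  refine csSup_le ⟨_, 0, LipschitzWith.const' 0, rfl⟩ ?_
  rintro r ⟨φ, hφ, rfl⟩
  exact h φ hφ

lemma W1_nonneg (μ ν : PTd d) : 0 ≤ W1 μ ν := by
  have := le_W1 (LipschitzWith.const' (K := 1) (0:ℝ)) μ ν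
  simpa using this

lemma W1_symm (μ ν : PTd d) : W1 μ ν = W1 ν μ := by
  have key : ∀ μ ν : PTd d, W1 μ ν ≤ W1 ν μ := by
    intro μ ν
    refine W1_le fun φ hφ => ?_
    have := le_W1 (φ := fun y => - φ y) hφ.neg ν μ
    simp only [integral_neg] at this
    linarith
  exact le_antisymm (key _ _) (key _ _)

lemma W1_self (μ : PTd d) : W1 μ μ = 0 := by
  refine le_antisymm (W1_le fun φ hφ => by simp) (W1_nonneg _ _)

lemma W1_triangle (μ ν ξ : PTd d) : W1 μ ξ ≤ W1 μ ν + W1 ν ξ := by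
  refine W1_le fun φ hφ => ?_
  have h1 := le_W1 hφ μ ν
  have h2 := le_W1 hφ ν ξ
  linarith

lemma lip_W1 {φ : Td d → ℝ} {L : ℝ} (hL : 0 ≤ L) (hφ : ∀ y y', |φ y - φ y'| ≤ L * ‖y - y'‖)
    (μ ν : PTd d) :
    |(∫ y, φ y ∂(μ : Measure (Td d))) - ∫ y, φ y ∂(ν : Measure (Td d))| ≤ L * W1 μ ν := by
  rcases hL.eq_or_lt with rfl | hL
  · have h1 : φ = fun _ => φ 0 := funext fun y => by
      have := hφ y 0
      rw [zero_mul] at this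
      linarith [abs_nonpos_iff.1 this]
    rw [h1]; simp
  · have h0 : LipschitzWith 1 (fun y => L⁻¹ * φ y) := by
      refine LipschitzWith.of_dist_le_mul fun y y' => ?_
      rw [Real.dist_eq, ← mul_sub, abs_mul, abs_of_pos (inv_pos.2 hL), dist_eq_norm]
      simp only [NNReal.coe_one, one_mul]
      rw [inv_mul_le_iff₀ hL]
      exact hφ y y'
    have h1 := le_W1 h0 μ ν
    have h2 := le_W1 h0 ν μ
    rw [W1_symm ν μ] at h2
    simp only [integral_const_mul] at h1 h2
    rw [abs_le]
    constructor
    · have : L * (L⁻¹ * (∫ y, φ y ∂(ν : Measure (Td d))) - L⁻¹ * ∫ y, φ y ∂(μ : Measure (Td d))) ≤ L * W1 μ ν :=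
        mul_le_mul_of_nonneg_left h2 hL.le
      rw [← mul_sub, ← mul_assoc, mul_inv_cancel₀ hL.ne', one_mul] at this
      linarith
    · have : L * (L⁻¹ * (∫ y, φ y ∂(μ : Measure (Td d))) - L⁻¹ * ∫ y, φ y ∂(ν : Measure (Td d))) ≤ L * W1 μ ν :=
        mul_le_mul_of_nonneg_left h1 hL.le
      rw [← mul_sub, ← mul_assoc, mul_inv_cancel₀ hL.ne', one_mul] at this
      linarith

end torusA


section HstarB
variable {d : ℕ}

lemma sqnorm_le (v : Vd d) : sqnorm v ≤ d * ‖v‖^2 := by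
  unfold sqnorm
  calc ∑ i, (v i)^2 ≤ ∑ _i : Fin d, ‖v‖^2 := by
        refine Finset.sum_le_sum fun i _ => ?_
        have := norm_le_pi_norm v i
        rw [Real.norm_eq_abs] at this
        rw [← sq_abs]
        gcongr
    _ = d * ‖v‖^2 := by simp

lemma le_sqnorm (v : Vd d) : ‖v‖^2 ≤ sqnorm v := by
  have h0 : 0 ≤ sqnorm v := Finset.sum_nonneg fun i _ => sq_nonneg _
  have : ‖v‖ ≤ Real.sqrt (sqnorm v) := by
    refine (pi_norm_le_iff_of_nonneg (Real.sqrt_nonneg _)).2 fun i => ?_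
    rw [Real.norm_eq_abs, ← Real.sqrt_sq_eq_abs]
    refine Real.sqrt_le_sqrt ?_
    exact Finset.single_le_sum (f := fun i => (v i)^2) (fun i _ => sq_nonneg _) (Finset.mem_univ i)
  calc ‖v‖^2 ≤ (Real.sqrt (sqnorm v))^2 := by gcongr
    _ = _ := Real.sq_sqrt h0

lemma sqnorm_nonneg (v : Vd d) : 0 ≤ sqnorm v := Finset.sum_nonneg fun i _ => sq_nonneg _

lemma abs_dotp_le (a b : Vd d) : |dotp a b| ≤ d * ‖a‖ * ‖b‖ := by
  unfold dotp
  calc |∑ i, a i * b i| ≤ ∑ i, |a i * b i| := Finset.abs_sum_le_sum_abs _ _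
    _ ≤ ∑ _i : Fin d, ‖a‖ * ‖b‖ := by
        refine Finset.sum_le_sum fun i _ => ?_
        rw [abs_mul]
        have h1 := norm_le_pi_norm a i
        have h2 := norm_le_pi_norm b i
        rw [Real.norm_eq_abs] at h1 h2
        gcongr
    _ = _ := by simp; ring

lemma fderiv_eq_dotp (g : Vd d → ℝ) (x v : Vd d) : fderiv ℝ g x v = dotp v (gradv g x) := by
  conv_lhs => rw [show v = ∑ i, v i • (Pi.single i (1:ℝ) : Vd d) from by
    rw [← pi_eq_sum_univ' v]]
  rw [map_sum]
  simp [dotp, gradv]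

/-- 1D Taylor -/
lemma taylor1 {f f1 f2 : ℝ → ℝ} (h1 : ∀ t, HasDerivAt f (f1 t) t) (h2 : ∀ t, HasDerivAt f1 (f2 t) t)
    {a : ℝ} (ha : ∀ t, a ≤ f2 t) : f 0 + f1 0 + a / 2 ≤ f 1 := by
  have m1 : Monotone (fun t => f1 t - a * t) := by
    refine monotone_of_hasDerivAt_nonneg (f' := fun t => f2 t - a) (fun t => ?_) (fun t => ?_)
    · have := (h2 t).sub ((hasDerivAt_id' t).const_mul a)
      rw [mul_one] at this
      exact this
    · simpa using ha t
  have m2 : MonotoneOn (fun t => f t - f1 0 * t - a * t^2 / 2) (Set.Ici 0) := by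
    have hd : ∀ t, HasDerivAt (fun t => f t - f1 0 * t - a * t^2 / 2) (f1 t - f1 0 - a * t) t := by
      intro t
      have := ((h1 t).sub ((hasDerivAt_id' t).const_mul (f1 0))).sub
        ((((hasDerivAt_id' t).pow 2).const_mul a).div_const 2)
      refine HasDerivAt.congr_deriv this ?_
      push_cast; ring
    refine monotoneOn_of_deriv_nonneg (convex_Ici 0) (fun t _ => (hd t).continuousAt.continuousWithinAt)
      (fun t _ => (hd t).differentiableAt.differentiableWithinAt) fun t ht => ?_
    rw [(hd t).deriv]
    simp at ht
    have := m1 ht.le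
    simp at this
    linarith
  have := m2 (by simp : (0:ℝ) ∈ Set.Ici 0) (by simp : (1:ℝ) ∈ Set.Ici 0) zero_le_one
  simp at this
  linarith

lemma line_derivs {g : Vd d → ℝ} (hg : ContDiff ℝ 2 g) (x v : Vd d) :
    (∀ t : ℝ, HasDerivAt (fun t : ℝ => g (x + t • v)) (fderiv ℝ g (x + t • v) v) t) ∧
    (∀ t : ℝ, HasDerivAt (fun t : ℝ => fderiv ℝ g (x + t • v) v) (D2 g (x + t • v) v v) t) := by
  have hl : ∀ t : ℝ, HasDerivAt (fun t : ℝ => x + t • v) v t := by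
    intro t
    have := ((hasDerivAt_id t).smul_const v).const_add x
    simpa using this
  constructor
  · intro t
    have h1 : HasFDerivAt g (fderiv ℝ g (x + t • v)) (x + t • v) :=
      (hg.differentiable (by norm_num) _).hasFDerivAt
    exact h1.comp_hasDerivAt t (hl t)
  · intro t
    have hd : ContDiff ℝ 1 (fun y => fderiv ℝ g y v) :=
      (hg.fderiv_right (m := 1) (by norm_num)).clm_apply contDiff_const
    have h1 : HasFDerivAt (fun y => fderiv ℝ g y v) (fderiv ℝ (fun y => fderiv ℝ g y v) (x + t • v))
        (x + t • v) := (hd.differentiable (by norm_num) _).hasFDerivAt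
    exact h1.comp_hasDerivAt t (hl t)

lemma taylor_lower {g : Vd d → ℝ} (hg : ContDiff ℝ 2 g) (x v : Vd d) {a : ℝ}
    (ha : ∀ y, a ≤ D2 g y v v) : g x + fderiv ℝ g x v + a / 2 ≤ g (x + v) := by
  obtain ⟨h1, h2⟩ := line_derivs hg x v
  have := taylor1 h1 h2 (a := a) fun t => ha _
  simpa using this

lemma taylor_upper {g : Vd d → ℝ} (hg : ContDiff ℝ 2 g) (x v : Vd d) {b : ℝ}
    (hb : ∀ y, D2 g y v v ≤ b) : g (x + v) ≤ g x + fderiv ℝ g x v + b / 2 := by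
  obtain ⟨h1, h2⟩ := line_derivs hg x v
  have := taylor1 (fun t => (h1 t).neg) (fun t => (h2 t).neg) (a := -b) fun t => by
    simpa using hb _
  simp at this
  linarith

lemma intVec_single (i : Fin d) : intVec (Pi.single i 1 : Fin d → ℤ) = (Pi.single i 1 : Vd d) := by
  funext j
  by_cases h : j = i
  · subst h; simp [intVec]
  · simp [intVec, h]

lemma norm_single_le (i : Fin d) : ‖(Pi.single i 1 : Vd d)‖ ≤ 1 := by
  refine (pi_norm_le_iff_of_nonneg zero_le_one).2 fun j => ?_
  by_cases h : j = i
  · subst h; simp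
  · simp [h]

lemma Per.lip_of_D2 {g : Vd d → ℝ} (hp : Per g) (hg : ContDiff ℝ 2 g) {G : ℝ} 
    (hG : ∀ x v w, |D2 g x v w| ≤ G * ‖v‖ * ‖w‖) (x x' : Vd d) : |g x - g x'| ≤ d * G * ‖x - x'‖ := by
  rcases Nat.eq_zero_or_pos d with hd | hd
  · subst hd
    rw [Subsingleton.elim x x']; simp
  have hG0 : 0 ≤ G := by
    have h1 := hG 0 (fun _ => 1) (fun _ => 1)
    have h2 : ‖(fun _ => 1 : Vd d)‖ = 1 := by
      haveI : Nonempty (Fin d) := ⟨⟨0, hd⟩⟩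
      simp
    rw [h2] at h1
    have := abs_nonneg (D2 g 0 (fun _ => 1) (fun _ => 1))
    linarith
  have hb : ∀ x i, |gradv g x i| ≤ G := by
    intro x i
    have hs : ∀ y, |D2 g y (Pi.single i 1) (Pi.single i 1)| ≤ G := by
      intro y
      refine (hG y _ _).trans ?_
      have := norm_single_le i
      have h0 := norm_nonneg (Pi.single i 1 : Vd d)
      calc G * ‖(Pi.single i 1 : Vd d)‖ * ‖(Pi.single i 1 : Vd d)‖ ≤ G * 1 * 1 := by gcongr
        _ = G := by ring
    have h1 := taylor_lower hg x (Pi.single i 1) (a := -G) fun y => (abs_le.1 (hs y)).1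
    have h2 := taylor_upper hg x (Pi.single i 1) (b := G) fun y => (abs_le.1 (hs y)).2
    rw [← intVec_single, hp, intVec_single] at h1 h2
    rw [gradv, abs_le]
    constructor <;> linarith
  have hf : ∀ x, ‖fderiv ℝ g x‖ ≤ d * G := by
    intro x
    refine ContinuousLinearMap.opNorm_le_bound _ (by positivity) fun v => ?_
    rw [fderiv_eq_dotp, Real.norm_eq_abs]
    refine (abs_dotp_le _ _).trans ?_
    have : ‖gradv g x‖ ≤ G := (pi_norm_le_iff_of_nonneg hG0).2 fun i => hb x i
    calc d * ‖v‖ * ‖gradv g x‖ ≤ d * ‖v‖ * G := by gcongr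
      _ = _ := by ring
  have := Convex.norm_image_sub_le_of_norm_fderiv_le (𝕜 := ℝ) (f := g) (s := Set.univ) (x := x') (y := x)
    (fun x _ => hg.differentiable (by norm_num) x) (fun x _ => hf x) convex_univ trivial trivial
  simpa using this

lemma S_H_smooth_p (S : MFGSetting d) (x : Vd d) : ContDiff ℝ 2 (fun p => S.H x p) :=
  S.H_smooth.comp (contDiff_const.prodMk contDiff_id)

lemma S_H_smooth_x (S : MFGSetting d) (p : Vd d) : ContDiff ℝ 2 (fun x => S.H x p) :=
  S.H_smooth.comp (contDiff_id.prodMk contDiff_const)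

lemma S_H_xlip (S : MFGSetting d) (p x x' : Vd d) :
    |S.H x p - S.H x' p| ≤ d * (S.Cg * (1 + ‖p‖) ^ (1 + S.θ)) * ‖x - x'‖ :=
  Per.lip_of_D2 (g := fun x => S.H x p) (fun x z => S.H_per x z p) (S_H_smooth_x S p)
    (fun x v w => S.Dxx_growth x p v w) x x'

/-- quadratic growth of `H` -/
lemma S_H_growth (S : MFGSetting d) : ∃ c C : ℝ, 0 < c ∧ 0 < C ∧ (∀ x p, c * ‖p‖^2 - C ≤ S.H x p) ∧
    (∀ x p, S.H x p ≤ C * (1 + ‖p‖^2)) := by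
  have hc1 : Continuous (fun x => S.H x 0) := (S_H_smooth_x S 0).continuous
  obtain ⟨A, hA0, hA⟩ := Per.bdd (g := fun x => S.H x 0) (fun x z => S.H_per x z 0) hc1
  have hg : Continuous (fun x => fderiv ℝ (fun p => S.H x p) 0) := by
    have : ContDiff ℝ 1 (fun x => fderiv ℝ (fun p => S.H x p) 0) :=
      ContDiff.fderiv (m := 2) (n := 1) (f := fun x p => S.H x p) (g := fun _ => 0) S.H_smooth contDiff_const (le_of_eq one_add_one_eq_two)
    exact this.continuous
  obtain ⟨B, hB0, hB⟩ := Per.bdd (g := fun x => fderiv ℝ (fun p => S.H x p) 0)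
    (fun x z => by
      have : (fun p => S.H (x + intVec z) p) = fun p => S.H x p := funext fun p => S.H_per x z p
      simp only [this]) hg
  have hk := S.Cbar_pos
  have hki := inv_pos.2 hk
  have hlow : ∀ x p, -A - B * ‖p‖ + S.Cbar⁻¹ * ‖p‖^2 / 2 ≤ S.H x p := by
    intro x p
    have h1 := taylor_lower (S_H_smooth_p S x) 0 p (a := S.Cbar⁻¹ * ‖p‖^2) fun y =>
      (mul_le_mul_of_nonneg_left (le_sqnorm p) hki.le).trans (S.Dpp_lower x y p)
    have h2 := (fderiv ℝ (fun p => S.H x p) 0).le_of_opNorm_le (hB x) p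
    have h3 := hA x
    rw [Real.norm_eq_abs, abs_le] at h2 h3
    simp only [zero_add] at h1
    linarith [h2.1, h3.1]
  have hupp : ∀ x p, S.H x p ≤ A + B * ‖p‖ + S.Cbar * (d * ‖p‖^2) / 2 := by
    intro x p
    have h1 := taylor_upper (S_H_smooth_p S x) 0 p (b := S.Cbar * (d * ‖p‖^2)) fun y =>
      (S.Dpp_upper x y p).trans (mul_le_mul_of_nonneg_left (sqnorm_le p) hk.le)
    have h2 := (fderiv ℝ (fun p => S.H x p) 0).le_of_opNorm_le (hB x) p
    have h3 := hA x
    rw [Real.norm_eq_abs, abs_le] at h2 h3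
    simp only [zero_add] at h1
    linarith [h2.2, h3.2]
  set k := S.Cbar⁻¹ with hkdef
  refine ⟨k/4, A + B^2 / k + B + S.Cbar * d + 1, by positivity, by positivity, fun x p => ?_, fun x p => ?_⟩
  · refine le_trans ?_ (hlow x p)
    have : B * ‖p‖ ≤ B^2 / k + k / 4 * ‖p‖^2 := by
      have h := sq_nonneg (B / k - ‖p‖ / 2)
      have h4 : B^2 / k + k / 4 * ‖p‖^2 - B * ‖p‖ = k * (B / k - ‖p‖ / 2)^2 := by
        field_simp; ring
      nlinarith [mul_nonneg hki.le h]
    have hd : (0:ℝ) ≤ S.Cbar * d := by positivity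
    nlinarith
  · refine (hupp x p).trans ?_
    have h1 : ‖p‖ ≤ 1 + ‖p‖^2 := by nlinarith [norm_nonneg p, sq_nonneg (‖p‖ - 1)]
    have h2 : 0 ≤ B^2 / k := by positivity
    have h3 : 0 ≤ S.Cbar * d := by positivity
    have h5 := mul_le_mul_of_nonneg_left h1 hB0
    have h4 := sq_nonneg ‖p‖
    nlinarith [mul_nonneg hA0 h4, mul_nonneg h2 h4, mul_nonneg h3 h4]

lemma le_Hstar (S : MFGSetting d) (x q p : Vd d) : dotp q p - S.H x p ≤ S.Hstar x q :=
  (S.Hstar_eq x q).1 ⟨p, rfl⟩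

lemma Hstar_le (S : MFGSetting d) (x q : Vd d) {C : ℝ} (h : ∀ p, dotp q p - S.H x p ≤ C) : S.Hstar x q ≤ C :=
  (S.Hstar_eq x q).2 (by rintro _ ⟨p, rfl⟩; exact h p)

lemma Hstar_per (S : MFGSetting d) (q : Vd d) : Per (fun x => S.Hstar x q) := by
  intro x z
  refine le_antisymm (Hstar_le S _ _ fun p => ?_) (Hstar_le S _ _ fun p => ?_)
  · rw [S.H_per]; exact le_Hstar S x q p
  · rw [← S.H_per x z]; exact le_Hstar S _ q p

lemma dotp_add (a b p : Vd d) : dotp (a + b) p = dotp a p + dotp b p := by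
  simp [dotp, add_mul, Finset.sum_add_distrib]

lemma dotp_smul (t : ℝ) (a p : Vd d) : dotp (t • a) p = t * dotp a p := by
  simp [dotp, Finset.mul_sum, mul_assoc]

lemma Hstar_convex (S : MFGSetting d) (x : Vd d) : ConvexOn ℝ Set.univ (S.Hstar x) := by
  refine ⟨convex_univ, fun q _ q' _ a b ha hb hab => Hstar_le S _ _ fun p => ?_⟩
  have h1 := mul_le_mul_of_nonneg_left (le_Hstar S x q p) ha
  have h2 := mul_le_mul_of_nonneg_left (le_Hstar S x q' p) hb
  rw [dotp_add, dotp_smul, dotp_smul]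
  simp only [smul_eq_mul]
  have : S.H x p = a * S.H x p + b * S.H x p := by rw [← add_mul, hab, one_mul]
  linarith

lemma Hstar_growth (S : MFGSetting d) : ∃ c C : ℝ, 0 < c ∧ 0 < C ∧ (∀ x q, c * ‖q‖^2 - C ≤ S.Hstar x q) ∧
    (∀ x q, S.Hstar x q ≤ C * (1 + ‖q‖^2)) := by
  obtain ⟨c, C, hc, hC, hl, hu⟩ := S_H_growth S
  refine ⟨1 / (4 * C), C + d^2 / (4 * c), by positivity, by positivity, fun x q => ?_, fun x q => ?_⟩
  · -- take p = q / (2C)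
    have h1 := le_Hstar S x q ((1 / (2*C)) • q)
    have h2 := hu x ((1 / (2*C)) • q)
    have h3 : dotp q ((1 / (2*C)) • q) = 1 / (2*C) * sqnorm q := by
      simp [dotp, sqnorm, Finset.mul_sum]; congr 1; funext i; ring
    have h4 : ‖(1 / (2*C)) • q‖ = 1 / (2*C) * ‖q‖ := by
      rw [norm_smul, Real.norm_of_nonneg (by positivity)]
    rw [h3] at h1
    rw [h4] at h2
    have h5 := mul_le_mul_of_nonneg_left (le_sqnorm q) (by positivity : (0:ℝ) ≤ 1 / (2*C))
    have h6 : C * (1 + (1 / (2 * C) * ‖q‖) ^ 2) = C + 1 / (4*C) * ‖q‖^2 := by field_simp; ring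
    have h7 : 1 / (2*C) * ‖q‖^2 = 2 * (1 / (4*C) * ‖q‖^2) := by field_simp; ring
    have h8 : 0 ≤ (d:ℝ)^2 / (4 * c) := by positivity
    linarith
  · refine Hstar_le S x q fun p => ?_
    have h1 := (abs_le.1 (abs_dotp_le q p)).2
    have h2 := hl x p
    have h3 : d * ‖q‖ * ‖p‖ ≤ c * ‖p‖^2 + d^2 / (4*c) * ‖q‖^2 := by
      have : c * ‖p‖^2 + d^2 / (4*c) * ‖q‖^2 - d * ‖q‖ * ‖p‖ = c * (‖p‖ - d / (2*c) * ‖q‖)^2 := by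
        field_simp; ring
      nlinarith [mul_nonneg hc.le (sq_nonneg (‖p‖ - d / (2*c) * ‖q‖))]
    have h4 : 0 ≤ (d:ℝ)^2 / (4*c) := by positivity
    have h5 := sq_nonneg ‖q‖
    nlinarith

lemma rpow_absorb {θ : ℝ} (hθ : θ ∈ Set.Ioo (0:ℝ) 1) {η : ℝ} (hη : 0 < η) :
    ∃ C : ℝ, 0 ≤ C ∧ ∀ a : ℝ, 0 ≤ a → (1 + a) ^ (1 + θ) ≤ η * a^2 + C := by
  have h1 : Tendsto (fun x : ℝ => x ^ (1 - θ)) atTop atTop := tendsto_rpow_atTop (by linarith [hθ.2])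
  obtain ⟨M, hM⟩ := (tendsto_atTop.1 h1 (4 / η)).exists_forall_of_atTop
  set B := max M 2 with hB
  refine ⟨B ^ (1 + θ), by positivity, fun a ha => ?_⟩
  rcases le_total B (1 + a) with h | h
  · have h2 := hM (1 + a) ((le_max_left _ _).trans h)
    have h3 : (0:ℝ) < 1 + a := by linarith
    have h4 : (1 + a) ^ (1 + θ) * (1 + a) ^ (1 - θ) = (1 + a)^2 := by
      rw [← Real.rpow_add h3, show (1 + θ + (1 - θ)) = ((2:ℕ):ℝ) by push_cast; ring, Real.rpow_natCast]
    have h5 : (1 + a) ≤ 2 * a := by linarith [(le_max_right M 2).trans h]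
    have h6 : 0 ≤ (1 + a) ^ (1 + θ) := by positivity
    have h7 : (1 + a) ^ (1 + θ) * (4 / η) ≤ (2 * a)^2 := by
      calc _ ≤ (1 + a) ^ (1 + θ) * (1 + a) ^ (1 - θ) := by gcongr
        _ = (1+a)^2 := h4
        _ ≤ _ := by gcongr
    have h8 : (1 + a) ^ (1 + θ) ≤ η * a^2 := by
      have : (1 + a) ^ (1 + θ) = η / 4 * ((1 + a) ^ (1 + θ) * (4 / η)) := by field_simp
      rw [this]
      calc η / 4 * ((1 + a) ^ (1 + θ) * (4 / η)) ≤ η / 4 * (2 * a)^2 := by gcongr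
        _ = _ := by ring
    have : 0 ≤ B ^ (1 + θ) := by positivity
    linarith
  · have : (1 + a) ^ (1 + θ) ≤ B ^ (1 + θ) := Real.rpow_le_rpow (by linarith) h (by linarith [hθ.1])
    have h2 : 0 ≤ η * a^2 := by positivity
    linarith

/-- main modulus estimate for `H*` -/
lemma Hstar_mod (S : MFGSetting d) {η : ℝ} (hη : 0 < η) : ∃ C : ℝ, 0 < C ∧ ∀ x x' q k : Vd d, ‖k‖ ≤ 1 →
    S.Hstar x' (q + k) ≤ S.Hstar x q + (‖x' - x‖ + ‖k‖) * (η * ‖q‖^2 + C) := by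
  obtain ⟨c, C, hc, hC, hl, hu⟩ := S_H_growth S
  -- good p: ‖p‖ ≤ R (1+‖q‖)
  set D : ℝ := (d + 1) / c + 2 * C / c + 2 with hD
  have hD1 : 1 ≤ D := by
    have : 0 ≤ (d + 1 : ℝ) / c := by positivity
    have : 0 ≤ 2 * C / c := by positivity
    linarith
  have hDc : c * D = (d + 1) + 2 * C + 2 * c := by rw [hD]; field_simp
  -- absorb constants
  set B : ℝ := d * S.Cg * (4 * D) ^ (1 + S.θ) + d * (4 * D) with hB
  have hCg := S.Cg_pos
  have hB0 : 0 ≤ B := by positivity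
  obtain ⟨E, hE0, hE⟩ := rpow_absorb S.θ_mem (η := η / (B + 1)) (by positivity)
  refine ⟨B * E + 1, by positivity, fun x x' q k hk => ?_⟩
  set A := (‖x' - x‖ + ‖k‖) * (η * ‖q‖^2 + (B * E + 1)) with hA
  have hA0 : 0 ≤ A := by positivity
  have hqk : ‖q + k‖ ≤ ‖q‖ + 1 := (norm_add_le _ _).trans (by linarith)
  have good : ∀ p, ‖p‖ ≤ D * (2 + ‖q‖) → dotp (q + k) p - S.H x' p ≤ S.Hstar x q + A := by
    intro p hp
    have h1 := le_Hstar S x q p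
    have h2 := (abs_le.1 (abs_dotp_le k p)).2
    have h3 := (abs_le.1 (S_H_xlip S p x x')).2
    rw [dotp_add]
    have h4 : 1 + ‖p‖ ≤ 4 * D * (1 + ‖q‖) := by
      have := norm_nonneg q
      nlinarith
    have hθ := S.θ_mem
    have h5 : (1 + ‖p‖) ^ (1 + S.θ) ≤ (4 * D) ^ (1 + S.θ) * (1 + ‖q‖) ^ (1 + S.θ) := by
      rw [← Real.mul_rpow (by positivity) (by positivity)]
      exact Real.rpow_le_rpow (by positivity) h4 (by linarith [hθ.1])
    have h6 : (1 + ‖q‖) ≤ (1 + ‖q‖) ^ (1 + S.θ) := by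
      conv_lhs => rw [← Real.rpow_one (1 + ‖q‖)]
      exact Real.rpow_le_rpow_of_exponent_le (by linarith [norm_nonneg q]) (by linarith [hθ.1])
    have h7 := hE ‖q‖ (norm_nonneg q)
    set Y := (1 + ‖q‖) ^ (1 + S.θ) with hY
    have hY0 : 0 ≤ Y := by positivity
    have h8 : d * ‖k‖ * ‖p‖ ≤ ‖k‖ * (B * Y) := by
      have : ‖p‖ ≤ 4 * D * Y := by nlinarith [norm_nonneg p]
      calc d * ‖k‖ * ‖p‖ ≤ d * ‖k‖ * (4 * D * Y) := by gcongr
        _ = ‖k‖ * (d * (4 * D) * Y) := by ring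
        _ ≤ ‖k‖ * (B * Y) := by
          have : d * (4 * D) ≤ B := by
            have : 0 ≤ d * S.Cg * (4 * D) ^ (1 + S.θ) := by positivity
            linarith
          gcongr
    have h9 : d * (S.Cg * (1 + ‖p‖) ^ (1 + S.θ)) * ‖x - x'‖ ≤ ‖x' - x‖ * (B * Y) := by
      rw [norm_sub_rev x x']
      calc d * (S.Cg * (1 + ‖p‖) ^ (1 + S.θ)) * ‖x' - x‖ ≤ d * (S.Cg * ((4 * D) ^ (1 + S.θ) * Y)) * ‖x' - x‖ := by
            gcongr
        _ = ‖x' - x‖ * (d * S.Cg * (4 * D) ^ (1 + S.θ) * Y) := by ring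
        _ ≤ ‖x' - x‖ * (B * Y) := by
          have : d * S.Cg * (4 * D) ^ (1 + S.θ) ≤ B := by
            have : 0 ≤ d * (4 * D) := by positivity
            linarith
          gcongr
    have h10 : B * Y ≤ η * ‖q‖^2 + (B * E + 1) := by
      calc B * Y ≤ B * (η / (B + 1) * ‖q‖^2 + E) := by gcongr
        _ = B / (B + 1) * (η * ‖q‖^2) + B * E := by field_simp
        _ ≤ 1 * (η * ‖q‖^2) + B * E := by
          have : B / (B + 1) ≤ 1 := by rw [div_le_one (by positivity)]; linarith
          gcongr
        _ ≤ _ := by linarith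
    have h11 : (‖x' - x‖ + ‖k‖) * (B * Y) ≤ A := by rw [hA]; gcongr
    rw [add_mul] at h11
    linarith
  refine Hstar_le S _ _ fun p => ?_
  by_cases hp : ‖p‖ ≤ D * (2 + ‖q‖)
  · exact good p hp
  · push Not at hp
    refine le_trans ?_ (good 0 (by simp; positivity))
    have h1 := (abs_le.1 (abs_dotp_le (q + k) p)).2
    have h2 := hl x' p
    have h3 := hu x' 0
    simp only [norm_zero] at h3
    have h4 : dotp (q + k) (0 : Vd d) = 0 := by simp [dotp]
    rw [h4]
    have hp0 := norm_nonneg p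
    have hq0 := norm_nonneg q
    have h5 : d * ‖q + k‖ * ‖p‖ ≤ d * (‖q‖ + 1) * ‖p‖ := by gcongr
    have h6 : c * (D * (2 + ‖q‖)) * ‖p‖ ≤ c * ‖p‖^2 := by
      have := mul_le_mul_of_nonneg_right hp.le (mul_nonneg hc.le hp0)
      linarith
    have h7 : c * (D * (2 + ‖q‖)) * ‖p‖ = ((d + 1) + 2 * C + 2 * c) * (2 + ‖q‖) * ‖p‖ := by
      rw [← hDc]; ring
    have h8 : 1 ≤ ‖p‖ := by
      have : 1 * 1 ≤ D * (2 + ‖q‖) := by gcongr; linarith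
      linarith
    have h9 : 2 * C ≤ 2 * C * (2 + ‖q‖) * ‖p‖ := by
      have h12 : 1 * 1 ≤ (2 + ‖q‖) * ‖p‖ := by gcongr; linarith
      have h13 := mul_le_mul_of_nonneg_left h12 (by positivity : 0 ≤ 2 * C)
      linarith
    have h10 : d * (‖q‖ + 1) * ‖p‖ ≤ d * (2 + ‖q‖) * ‖p‖ := by
      rw [add_comm ‖q‖ 1]; gcongr; norm_num
    have h11 : 0 ≤ (1 + 2 * c) * (2 + ‖q‖) * ‖p‖ := by positivity
    have h12 : ((d + 1) + 2 * C + 2 * c) * (2 + ‖q‖) * ‖p‖ = d * (2 + ‖q‖) * ‖p‖ + 2 * C * (2 + ‖q‖) * ‖p‖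
      + (1 + 2 * c) * (2 + ‖q‖) * ‖p‖ := by ring
    linarith

end HstarB

open ProbabilityTheory

section PCsec
variable {d : ℕ}

/-- the Lagrangian on the torus -/
def Lt (S : MFGSetting d) (y : Td d) (q : Vd d) : ℝ := S.Hstar (secT y) q

lemma Lt_piT (S : MFGSetting d) (x q : Vd d) : Lt S (piT x) q = S.Hstar x q := (Hstar_per S q).sec x

lemma Lt_mod (S : MFGSetting d) {η : ℝ} (hη : 0 < η) : ∃ C : ℝ, 0 < C ∧ ∀ (y y' : Td d) (q k : Vd d), ‖k‖ ≤ 1 →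
    Lt S y' (q + k) ≤ Lt S y q + (‖y' - y‖ + ‖k‖) * (η * ‖q‖^2 + C) := by
  obtain ⟨C, hC, h⟩ := Hstar_mod S hη
  refine ⟨C, hC, fun y y' q k hk => ?_⟩
  have h1 := h (secT y) (secT y + repT (y' - y)) q k hk
  rw [← (Hstar_per S (q + k)).sec_add, piT_repT, add_sub_cancel, add_sub_cancel_left, norm_repT] at h1
  exact h1

lemma Lt_cont (S : MFGSetting d) : Continuous (fun p : Td d × Vd d => Lt S p.1 p.2) := by
  obtain ⟨C, hC, h⟩ := Lt_mod S one_pos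
  rw [continuous_iff_continuousAt]
  rintro ⟨y, q⟩
  have key : Tendsto (fun p : Td d × Vd d => (‖p.1 - y‖ + ‖p.2 - q‖) * (1 * ‖q‖^2 + 1 * ‖p.2‖^2 + C)) (nhds (y, q)) (nhds 0) := by
    have : ContinuousAt (fun p : Td d × Vd d => (‖p.1 - y‖ + ‖p.2 - q‖) * (1 * ‖q‖^2 + 1 * ‖p.2‖^2 + C)) (y, q) := by
      fun_prop
    have h2 := this.tendsto
    simpa using h2
  unfold ContinuousAt
  rw [tendsto_iff_norm_sub_tendsto_zero]
  refine squeeze_zero' (Eventually.of_forall fun p => norm_nonneg _) ?_ key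
  have hb : ∀ᶠ p : Td d × Vd d in nhds (y, q), ‖p.2 - q‖ < 1 := by
    have : ContinuousAt (fun p : Td d × Vd d => ‖p.2 - q‖) (y, q) := by fun_prop
    have h2 := this.tendsto
    simp at h2
    exact h2.eventually (gt_mem_nhds one_pos)
  filter_upwards [hb] with p hp
  have h1 := h y p.1 q (p.2 - q) hp.le
  have h2 := h p.1 y p.2 (q - p.2) (by rw [norm_sub_rev]; exact hp.le)
  rw [add_sub_cancel] at h1 h2
  rw [norm_sub_rev y, norm_sub_rev q] at h2
  rw [Real.norm_eq_abs, abs_le]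
  have h3 : 0 ≤ (‖p.1 - y‖ + ‖p.2 - q‖) * (1 * ‖q‖^2) := by positivity
  have h4 : 0 ≤ (‖p.1 - y‖ + ‖p.2 - q‖) * (1 * ‖p.2‖^2) := by positivity
  constructor <;> nlinarith

lemma Fc_lip (S : MFGSetting d) : ∃ LF : ℝ, 0 < LF ∧ ∀ μ ν : PTd d, |S.Fc ν - S.Fc μ| ≤ LF * W1 μ ν := by
  refine ⟨d * |S.CF| + 1, by positivity, fun μ ν => ?_⟩
  have hW := W1_nonneg μ ν
  rw [S.flat_deriv μ ν]
  have hb : ∀ t ∈ Set.Icc (0:ℝ) 1, ‖(∫ y, S.Fd (lineComb t μ ν) (secT y) ∂(ν : Measure (Td d))) -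
        ∫ y, S.Fd (lineComb t μ ν) (secT y) ∂(μ : Measure (Td d))‖ ≤ (d * |S.CF| + 1) * W1 μ ν := by
    intro t ht
    have hp : IsProbabilityMeasure (lineComb t μ ν) := by
      constructor
      simp only [lineComb, Measure.add_apply, Measure.smul_apply, measure_univ, smul_eq_mul, mul_one]
      rw [← ENNReal.ofReal_add (by linarith [ht.2]) ht.1]
      simp
    have h1 := (show Per (S.Fd (lineComb t μ ν)) from fun x z => S.Fd_per _ x z).lip
      (Per.lip_of_D2 (fun x z => S.Fd_per _ x z) (S.Fd_smooth _ hp) (G := |S.CF|) fun x v w =>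
        (S.Fd_D2_bound _ hp x v w).trans (by gcongr; exact le_abs_self _))
    have h2 := lip_W1 (by positivity) h1 ν μ
    rw [Real.norm_eq_abs]
    refine h2.trans ?_
    rw [W1_symm]
    gcongr; linarith
  have := norm_setIntegral_le_of_norm_le_const (μ := volume) (by simp) hb
  simpa using this

lemma W1ContOn.continuousOn_int {m : ℝ → PTd d} {I : Set ℝ} (hm : W1ContOn m I) {φ : Td d → ℝ} {L : NNReal}
    (hφ : LipschitzWith L φ) : ContinuousOn (fun s => ∫ y, φ y ∂(m s : Measure (Td d))) I := by
  rw [Metric.continuousOn_iff]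
  intro t ht ε hε
  obtain ⟨η, hη, h⟩ := hm t ht (ε / (L + 1)) (by positivity)
  refine ⟨η, hη, fun s hs hst => ?_⟩
  have h1 := h s hs hst
  have h2 := lip_W1 (φ := φ) L.2 (fun y y' => by
    have := hφ.dist_le_mul y y'
    rwa [Real.dist_eq, dist_eq_norm] at this) (m s) (m t)
  rw [Real.dist_eq]
  refine h2.trans_lt ?_
  have h3 : (L + 1) * W1 (m s) (m t) < ε := by
    rw [lt_div_iff₀ (by positivity)] at h1
    linarith
  have := W1_nonneg (m s) (m t)
  have h4 : (L:ℝ).toNNReal = L := by simp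
  have : (L:ℝ) * W1 (m s) (m t) ≤ (L + 1) * W1 (m s) (m t) := by gcongr; linarith
  exact lt_of_le_of_lt this h3

lemma measurable_curve {m : ℝ → PTd d} (hm : W1ContOn m (Set.Ici 0)) :
    Measurable (fun s : ℝ => (m (max s 0) : Measure (Td d))) := by
  have hc : ∀ {φ : Td d → ℝ} {L : NNReal}, LipschitzWith L φ →
      Continuous (fun s : ℝ => ∫ y, φ y ∂(m (max s 0) : Measure (Td d))) := by
    intro φ L hφ
    have h1 := hm.continuousOn_int hφ
    exact h1.comp_continuous (f := fun s : ℝ => max s 0) (by fun_prop) fun s => Set.mem_Ici.2 (le_max_right _ _)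
  refine Measurable.measure_of_isPiSystem_of_isProbabilityMeasure (S := {s | IsClosed s}) ?_ isPiSystem_isClosed ?_
  · rw [BorelSpace.measurable_eq (α := Td d), borel_eq_generateFrom_isClosed]
  · intro F hF
    have hpos : ∀ n : ℕ, (0:ℝ) < 1 / ((n:ℝ) + 1) := fun n => by positivity
    have hlim := fun s : ℝ => tendsto_integral_thickenedIndicator_of_isClosed (m (max s 0) : Measure (Td d)) hF hpos
      tendsto_one_div_add_atTop_nhds_zero_nat
    have h1 : Measurable (fun s : ℝ => (m (max s 0) : Measure (Td d)).real F) := by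
      refine measurable_of_tendsto_metrizable (fun n => ?_) (tendsto_pi_nhds.2 hlim)
      have hL := lipschitzWith_thickenedIndicator (hpos n) F
      have hL2 : LipschitzWith (1 * (1 / ((n:ℝ) + 1)).toNNReal⁻¹) (fun ω => (thickenedIndicator (hpos n) F ω : ℝ)) :=
        NNReal.isometry_coe.lipschitz.comp hL
      exact (hc hL2).measurable
    have h2 : (fun s : ℝ => (m (max s 0) : Measure (Td d)) F) =
        fun s => ENNReal.ofReal ((m (max s 0) : Measure (Td d)).real F) := by
      funext s
      rw [ofReal_measureReal]
    rw [h2]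
    exact h1.ennreal_ofReal

/-- the kernel of a W1-continuous curve -/
def mKer (m : ℝ → PTd d) (hm : W1ContOn m (Set.Ici 0)) : Kernel ℝ (Td d) :=
  ⟨fun s => (m (max s 0) : Measure (Td d)), measurable_curve hm⟩

lemma mKer_apply (m : ℝ → PTd d) (hm : W1ContOn m (Set.Ici 0)) {s : ℝ} (hs : 0 ≤ s) :
    mKer m hm s = (m s : Measure (Td d)) := by
  show (m (max s 0) : Measure (Td d)) = _
  rw [max_eq_left hs]

instance mKer_markov (m : ℝ → PTd d) (hm : W1ContOn m (Set.Ici 0)) : IsMarkovKernel (mKer m hm) :=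
  ⟨fun s => by show IsProbabilityMeasure (m (max s 0) : Measure (Td d)); infer_instance⟩

/-- space-time measure -/
def Mst (m : ℝ → PTd d) (hm : W1ContOn m (Set.Ici 0)) (a b : ℝ) : Measure (ℝ × Td d) :=
  (volume.restrict (Set.Ioc a b)) ⊗ₘ (mKer m hm)

instance Mst_fin (m : ℝ → PTd d) (hm : W1ContOn m (Set.Ici 0)) (a b : ℝ) : IsFiniteMeasure (Mst m hm a b) := by
  unfold Mst; infer_instance

lemma Mst_real {m : ℝ → PTd d} (hm : W1ContOn m (Set.Ici 0)) {a b : ℝ} (hab : a ≤ b) :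
    (Mst m hm a b).real Set.univ = b - a := by
  unfold Mst
  rw [measureReal_def, Measure.compProd_apply_univ]
  simp [hab]

lemma Mst_ae {m : ℝ → PTd d} (hm : W1ContOn m (Set.Ici 0)) {a b : ℝ} :
    ∀ᵐ q ∂(Mst m hm a b), q.1 ∈ Set.Ioc a b := by
  unfold Mst
  rw [Measure.ae_compProd_iff (measurableSet_Ioc.preimage measurable_fst)]
  filter_upwards [ae_restrict_mem measurableSet_Ioc] with s hs
  exact Eventually.of_forall fun _ => hs

lemma Mst_int {m : ℝ → PTd d} (hm : W1ContOn m (Set.Ici 0)) {a b : ℝ} (ha : 0 ≤ a) (hab : a ≤ b)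
    {g : ℝ × Td d → ℝ} (hg : Integrable g (Mst m hm a b)) :
    IntervalIntegrable (fun s => ∫ y, g (s, y) ∂(m s : Measure (Td d))) volume a b ∧
    ∫ s in a..b, ∫ y, g (s, y) ∂(m s : Measure (Td d)) = ∫ q, g q ∂(Mst m hm a b) := by
  unfold Mst at hg ⊢
  have h1 := Integrable.integral_compProd (f := g) hg
  have h2 := Measure.integral_compProd hg
  have he : ∀ s ∈ Set.Ioc a b, ∫ y, g (s, y) ∂(mKer m hm s) = ∫ y, g (s, y) ∂(m s : Measure (Td d)) := by
    intro s hs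
    rw [mKer_apply m hm (ha.trans hs.1.le)]
  constructor
  · rw [intervalIntegrable_iff_integrableOn_Ioc_of_le hab]
    refine IntegrableOn.congr_fun h1 ?_ measurableSet_Ioc
    exact he
  · rw [h2, intervalIntegral.integral_of_le hab]
    exact setIntegral_congr_fun measurableSet_Ioc fun s hs => (he s hs).symm

lemma energy_int {m : ℝ → PTd d} (hm : W1ContOn m (Set.Ici 0)) {α : ℝ → Td d → Vd d}
    (hα : Measurable (fun q : ℝ × Td d => α q.1 q.2)) {δ : ℝ} (hδ : 0 < δ)
    (hE : (∫⁻ s in Set.Ioi (0:ℝ), ENNReal.ofReal (Real.exp (-δ * s)) *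
      ∫⁻ y, ENNReal.ofReal (sqnorm (α s y)) ∂(m s : Measure (Td d))) < ⊤) {a b : ℝ} (ha : 0 ≤ a) :
    Integrable (fun q : ℝ × Td d => sqnorm (α q.1 q.2)) (Mst m hm a b) := by
  have hms : Measurable (fun q : ℝ × Td d => sqnorm (α q.1 q.2)) := by
    unfold sqnorm
    refine Finset.measurable_sum _ fun i _ => ?_
    exact ((measurable_pi_apply i).comp hα).pow_const 2
  refine ⟨hms.aestronglyMeasurable, ?_⟩
  rw [hasFiniteIntegral_iff_ofReal (Eventually.of_forall fun q => sqnorm_nonneg _)]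
  unfold Mst
  rw [Measure.lintegral_compProd hms.ennreal_ofReal]
  have h1 : ∫⁻ s in Set.Ioc a b, ∫⁻ y, ENNReal.ofReal (sqnorm (α s y)) ∂(mKer m hm s) ≤
      ENNReal.ofReal (Real.exp (δ * b)) * ∫⁻ s in Set.Ioi (0:ℝ), ENNReal.ofReal (Real.exp (-δ * s)) *
      ∫⁻ y, ENNReal.ofReal (sqnorm (α s y)) ∂(m s : Measure (Td d)) := by
    rw [← lintegral_const_mul' _ _ ENNReal.ofReal_ne_top]
    calc _ ≤ ∫⁻ s in Set.Ioc a b, ENNReal.ofReal (Real.exp (δ * b)) * (ENNReal.ofReal (Real.exp (-δ * s)) *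
          ∫⁻ y, ENNReal.ofReal (sqnorm (α s y)) ∂(m s : Measure (Td d))) := by
          refine setLIntegral_mono' measurableSet_Ioc fun s hs => ?_
          rw [mKer_apply m hm (ha.trans hs.1.le), ← mul_assoc, ← ENNReal.ofReal_mul (by positivity), ← Real.exp_add]
          refine le_mul_of_one_le_left (zero_le) ?_
          rw [ENNReal.one_le_ofReal]
          refine Real.one_le_exp ?_
          nlinarith [hs.2]
      _ ≤ _ := lintegral_mono_set fun s hs => lt_of_le_of_lt ha hs.1
  exact lt_of_le_of_lt h1 (ENNReal.mul_lt_top ENNReal.ofReal_lt_top hE)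

lemma measurable_Lα (S : MFGSetting d) {α : ℝ → Td d → Vd d}
    (hα : Measurable (fun q : ℝ × Td d => α q.1 q.2)) :
    Measurable (fun q : ℝ × Td d => Lt S q.2 (α q.1 q.2)) :=
  (Lt_cont S).measurable.comp (measurable_snd.prodMk hα)

lemma Lt_growth (S : MFGSetting d) : ∃ c C : ℝ, 0 < c ∧ 0 < C ∧ (∀ y q, c * ‖q‖^2 - C ≤ Lt S y q) ∧
    (∀ y q, Lt S y q ≤ C * (1 + ‖q‖^2)) := by
  obtain ⟨c, C, hc, hC, h1, h2⟩ := Hstar_growth S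
  exact ⟨c, C, hc, hC, fun y q => h1 _ _, fun y q => h2 _ _⟩

lemma Lα_int (S : MFGSetting d) {m : ℝ → PTd d} (hm : W1ContOn m (Set.Ici 0)) {α : ℝ → Td d → Vd d}
    (hα : Measurable (fun q : ℝ × Td d => α q.1 q.2)) {a b : ℝ}
    (hE : Integrable (fun q : ℝ × Td d => sqnorm (α q.1 q.2)) (Mst m hm a b)) :
    Integrable (fun q : ℝ × Td d => Lt S q.2 (α q.1 q.2)) (Mst m hm a b) := by
  obtain ⟨c, C, hc, hC, h1, h2⟩ := Lt_growth S
  refine Integrable.mono' (((integrable_const (1:ℝ)).add hE).const_mul C)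
    (measurable_Lα S hα).aestronglyMeasurable (Eventually.of_forall fun q => ?_)
  have h3 := h1 q.2 (α q.1 q.2)
  have h4 := h2 q.2 (α q.1 q.2)
  have h5 := le_sqnorm (α q.1 q.2)
  have h6 : 0 ≤ c * ‖α q.1 q.2‖^2 := by positivity
  have h7 := sqnorm_nonneg (α q.1 q.2)
  simp only [Pi.add_apply]
  rw [Real.norm_eq_abs, abs_le]
  constructor
  · nlinarith
  · nlinarith

end PCsec

open ProbabilityTheory

section PEsec
variable {d : ℕ}

/-- gaussian density of variance 2 -/
def gdens (z : Vd d) : ℝ := ∏ i, gaussianPDFReal 0 2 (z i)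

lemma gdens_eq (z : Vd d) : gdens z = (√(2 * π * (2:NNReal)))⁻¹ ^ d * Real.exp (-(∑ i, (z i)^2) / 4) := by
  unfold gdens gaussianPDFReal
  rw [Finset.prod_mul_distrib, ← Real.exp_sum]
  simp only [Finset.prod_const, Finset.card_univ, Fintype.card_fin]
  congr 2
  rw [← Finset.sum_neg_distrib, Finset.sum_div]
  refine Finset.sum_congr rfl fun i _ => ?_
  simp only [NNReal.coe_ofNat]
  ring

lemma gdens_nonneg (z : Vd d) : 0 ≤ gdens z := Finset.prod_nonneg fun _ _ => gaussianPDFReal_nonneg _ _ _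

lemma gdens_cont : Continuous (gdens : Vd d → ℝ) := by
  have : (gdens : Vd d → ℝ) = fun z => (√(2 * π * (2:NNReal)))⁻¹ ^ d * Real.exp (-(∑ i, (z i)^2) / 4) := by
    funext z; exact gdens_eq z
  rw [this]; fun_prop

lemma gdens_int : Integrable (gdens : Vd d → ℝ) := by
  exact Integrable.fintype_prod (𝕜 := ℝ) (f := fun _ : Fin d => gaussianPDFReal 0 2) fun i => integrable_gaussianPDFReal 0 2

lemma gdens_integral : ∫ z : Vd d, gdens z = 1 := by
  unfold gdens
  rw [integral_fintype_prod_volume_eq_prod (𝕜 := ℝ) (fun _ : Fin d => gaussianPDFReal 0 2)]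
  simp [integral_gaussianPDFReal_eq_one]

lemma gdens_fderiv (z : Vd d) (i : Fin d) : DifferentiableAt ℝ (gdens : Vd d → ℝ) z ∧
    fderiv ℝ gdens z (Pi.single i 1) = - (z i / 2) * gdens z := by
  have hE : (gdens : Vd d → ℝ) = fun z => (√(2 * π * (2:NNReal)))⁻¹ ^ d * Real.exp (-(∑ i, (z i)^2) / 4) := by
    funext z; exact gdens_eq z
  have hs : HasFDerivAt (fun z : Vd d => -(∑ i, (z i)^2) / 4)
      ((1/4:ℝ) • -(∑ j, (2 * (z j)^1) • (ContinuousLinearMap.proj j : Vd d →L[ℝ] ℝ))) z := by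
    have h1 : HasFDerivAt (fun z : Vd d => ∑ i, (z i)^2) (∑ j, (2 * (z j)^1) • (ContinuousLinearMap.proj j : Vd d →L[ℝ] ℝ)) z := by
      refine HasFDerivAt.fun_sum fun j _ => ?_
      have := (hasFDerivAt_apply (𝕜 := ℝ) j z).pow 2
      simpa using this
    have h2 := h1.neg.const_smul (1/4:ℝ)
    refine h2.congr_of_eventuallyEq (Eventually.of_forall fun z => ?_)
    simp; ring
  have hf := (hs.exp).const_mul ((√(2 * π * (2:NNReal)))⁻¹ ^ d)
  rw [hE]
  refine ⟨hf.differentiableAt, ?_⟩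
  rw [hf.fderiv]
  have h3 : (∑ j, (2 * (z j)^1) • (ContinuousLinearMap.proj j : Vd d →L[ℝ] ℝ)) (Pi.single i 1) = 2 * z i := by
    rw [ContinuousLinearMap.sum_apply, Finset.sum_eq_single i]
    · simp
    · intro j _ hj; simp [hj]
    · simp
  simp only [ContinuousLinearMap.smul_apply, ContinuousLinearMap.neg_apply, h3, smul_eq_mul]
  ring

lemma gdens_mom (i : Fin d) : Integrable (fun z : Vd d => |z i| * gdens z) := by
  have hx : Integrable (fun x : ℝ => x * gaussianPDFReal 0 2 x) := by
    have h := (integrable_mul_exp_neg_mul_sq (b := 1/4) (by norm_num)).const_mul ((√(2 * π * (2:NNReal)))⁻¹)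
    refine h.congr (Eventually.of_forall fun x => ?_)
    simp only [gaussianPDFReal, NNReal.coe_ofNat, sub_zero]
    rw [show -x^2/(2*2) = -(1/4)*x^2 by ring]
    ring
  have h := Integrable.fintype_prod (𝕜 := ℝ) (μ := fun _ : Fin d => (volume : Measure ℝ))
    (f := fun j : Fin d => if j = i then fun x => |x * gaussianPDFReal 0 2 x| else gaussianPDFReal 0 2) fun j => by
      by_cases hj : j = i
      · simp only [hj, if_true]; exact hx.abs
      · simp only [hj, if_false]; exact integrable_gaussianPDFReal 0 2
  refine h.congr (Eventually.of_forall fun z => ?_)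
  simp only [gdens]
  rw [← Finset.mul_prod_erase _ _ (Finset.mem_univ i), ← Finset.mul_prod_erase _ _ (Finset.mem_univ i)]
  simp only [if_true]
  rw [abs_mul, abs_of_nonneg (gaussianPDFReal_nonneg 0 2 (z i)), mul_assoc]
  congr 2
  refine Finset.prod_congr rfl fun j hj => ?_
  rw [if_neg (Finset.ne_of_mem_erase hj)]

/-- gaussian measure -/
def gam (d : ℕ) : Measure (Vd d) := volume.withDensity fun z => ENNReal.ofReal (gdens z)

instance gam_prob : IsProbabilityMeasure (gam d) := by
  constructor
  rw [gam, withDensity_apply _ MeasurableSet.univ, Measure.restrict_univ,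
    ← ofReal_integral_eq_lintegral_ofReal gdens_int (Eventually.of_forall gdens_nonneg), gdens_integral]
  simp

lemma gam_integral (g : Vd d → ℝ) : ∫ z, g z ∂(gam d) = ∫ z, g z * gdens z := by
  have := integral_withDensity_eq_integral_toReal_smul (μ := (volume : Measure (Vd d)))
    (f := fun z => ENNReal.ofReal (gdens z)) gdens_cont.measurable.ennreal_ofReal
    (Eventually.of_forall fun _ => ENNReal.ofReal_lt_top) g
  rw [gam, this]
  refine integral_congr_ae (Eventually.of_forall fun z => ?_)
  simp [ENNReal.toReal_ofReal (gdens_nonneg z), mul_comm]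

lemma gam_integrable (g : Vd d → ℝ) : Integrable g (gam d) ↔ Integrable (fun z => g z * gdens z) := by
  have := integrable_withDensity_iff_integrable_smul' (μ := (volume : Measure (Vd d))) (g := g)
    (f := fun z => ENNReal.ofReal (gdens z)) gdens_cont.measurable.ennreal_ofReal
    (Eventually.of_forall fun _ => ENNReal.ofReal_lt_top)
  rw [gam, this]
  refine integrable_congr (Eventually.of_forall fun z => ?_)
  simp [ENNReal.toReal_ofReal (gdens_nonneg z), mul_comm]

lemma gam_mom : Integrable (fun z : Vd d => ‖z‖) (gam d) := by
  have h : Integrable (fun z : Vd d => ∑ i, |z i|) (gam d) :=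
    integrable_finsetSum _ fun i _ => (gam_integrable _).2 (gdens_mom i)
  refine h.mono' continuous_norm.aestronglyMeasurable (Eventually.of_forall fun z => ?_)
  rw [norm_norm]
  refine (pi_norm_le_iff_of_nonneg (by positivity)).2 fun i => ?_
  rw [Real.norm_eq_abs]
  exact Finset.single_le_sum (f := fun i => |z i|) (fun _ _ => abs_nonneg _) (Finset.mem_univ i)

lemma gam_ibp {g : Vd d → ℝ} (hg : ContDiff ℝ 1 g) {C : ℝ} (hC : ∀ z, |g z| ≤ C) (i : Fin d)
    (hC' : ∀ z, |fderiv ℝ g z (Pi.single i 1)| ≤ C) :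
    ∫ z, z i * g z ∂(gam d) = 2 * ∫ z, fderiv ℝ g z (Pi.single i 1) ∂(gam d) := by
  have hgd : Continuous (fun z => fderiv ℝ g z (Pi.single i 1)) :=
    (hg.continuous_fderiv (by norm_num)).clm_apply continuous_const
  have key := integral_mul_fderiv_eq_neg_fderiv_mul_of_integrable (μ := (volume : Measure (Vd d))) (𝕜 := ℝ)
    (f := g) (g := gdens) (v := Pi.single i 1) ?_ ?_ ?_
    (fun z _ => hg.differentiable (by norm_num) z) (fun z _ => (gdens_fderiv z i).1)
  · rw [gam_integral, gam_integral]
    have h1 : ∀ z : Vd d, g z * fderiv ℝ gdens z (Pi.single i 1) = (-1/2) * (z i * g z * gdens z) := by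
      intro z; rw [(gdens_fderiv z i).2]; ring
    simp only [h1] at key
    rw [integral_const_mul] at key
    linarith
  · exact gdens_int.bdd_mul hgd.aestronglyMeasurable (c := C) (Eventually.of_forall hC')
  · have h2 : Integrable (fun z : Vd d => z i * gdens z) := by
      refine (gdens_mom i).mono ?_ (Eventually.of_forall fun z => ?_)
      · exact ((continuous_apply i).mul gdens_cont).aestronglyMeasurable
      · simp
    have := (h2.bdd_mul hg.continuous.aestronglyMeasurable (c := C) (Eventually.of_forall hC)).const_mul (-1/2)
    refine this.congr (Eventually.of_forall fun z => ?_)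
    simp only [(gdens_fderiv z i).2]; ring
  · exact gdens_int.bdd_mul hg.continuous.aestronglyMeasurable (c := C) (Eventually.of_forall hC)

end PEsec

section PE2sec
variable {d : ℕ}

lemma tf_slice {Φ : ℝ × Vd d → ℝ} {n : WithTop ℕ∞} (h : ContDiff ℝ n Φ) (hn : n ≠ 0) (s : ℝ) (x w : Vd d) :
    fderiv ℝ (fun y => Φ (s, y)) x w = fderiv ℝ Φ (s, x) (0, w) := by
  have h1 : HasFDerivAt Φ (fderiv ℝ Φ (s, x)) (s, x) := (h.differentiable hn _).hasFDerivAt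
  have h2 : HasFDerivAt (fun y : Vd d => (s, y)) (ContinuousLinearMap.inr ℝ ℝ (Vd d)) x := hasFDerivAt_prodMk_right s x
  have h3 := h1.comp x h2
  have h4 : fderiv ℝ (fun y => Φ (s, y)) x = _ := h3.fderiv
  rw [h4]; simp

lemma tf_fderiv_apply {Φ : ℝ × Vd d → ℝ} (h : ContDiff ℝ 2 Φ) (u : ℝ × Vd d) :
    ContDiff ℝ 1 (fun q => fderiv ℝ Φ q u) :=
  (h.fderiv_right (m := 1) (le_of_eq one_add_one_eq_two)).clm_apply contDiff_const

lemma tf_tderiv {φ : ℝ → Vd d → ℝ} (h : IsTestFun φ) (s : ℝ) (x : Vd d) :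
    tderiv φ s x = fderiv ℝ (fun q : ℝ × Vd d => φ q.1 q.2) (s, x) (1, 0) := by
  have h1 : HasFDerivAt (fun q : ℝ × Vd d => φ q.1 q.2) _ (s, x) := (h.1.differentiable (by norm_num) _).hasFDerivAt
  have h2 : HasDerivAt (fun r : ℝ => (r, x)) ((1:ℝ), (0 : Vd d)) s := (hasDerivAt_id' s).prodMk (hasDerivAt_const s x)
  have h3 := h1.comp_hasDerivAt s h2
  exact h3.deriv

lemma tf_grad {φ : ℝ → Vd d → ℝ} (h : IsTestFun φ) (s : ℝ) (x : Vd d) (i : Fin d) :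
    gradv (φ s) x i = fderiv ℝ (fun q : ℝ × Vd d => φ q.1 q.2) (s, x) (0, Pi.single i 1) :=
  tf_slice h.1 (by norm_num) s x _

lemma tf_D2 {φ : ℝ → Vd d → ℝ} (h : IsTestFun φ) (s : ℝ) (x v w : Vd d) :
    D2 (φ s) x v w = fderiv ℝ (fun q' => fderiv ℝ (fun q : ℝ × Vd d => φ q.1 q.2) q' (0, v)) (s, x) (0, w) := by
  unfold D2
  have h1 : (fun y => fderiv ℝ (φ s) y v) = fun y => (fun q' => fderiv ℝ (fun q : ℝ × Vd d => φ q.1 q.2) q' (0, v)) (s, y) := by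
    funext y; exact tf_slice h.1 (by norm_num) s y v
  rw [h1]
  exact tf_slice (tf_fderiv_apply h.1 _) (by norm_num) s x w

lemma tf_tderiv_cont {φ : ℝ → Vd d → ℝ} (h : IsTestFun φ) : Continuous (fun q : ℝ × Vd d => tderiv φ q.1 q.2) := by
  simp only [tf_tderiv h]
  exact (tf_fderiv_apply h.1 _).continuous

lemma tf_grad_cont {φ : ℝ → Vd d → ℝ} (h : IsTestFun φ) : Continuous (fun q : ℝ × Vd d => gradv (φ q.1) q.2) := by
  refine continuous_pi fun i => ?_
  simp only [tf_grad h]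
  exact (tf_fderiv_apply h.1 _).continuous

lemma tf_D2_cont {φ : ℝ → Vd d → ℝ} (h : IsTestFun φ) (v w : Vd d) : Continuous (fun q : ℝ × Vd d => D2 (φ q.1) q.2 v w) := by
  simp only [tf_D2 h]
  exact ((tf_fderiv_apply h.1 _).continuous_fderiv (by norm_num)).clm_apply continuous_const

lemma tf_lapl_cont {φ : ℝ → Vd d → ℝ} (h : IsTestFun φ) : Continuous (fun q : ℝ × Vd d => lapl (φ q.1) q.2) := by
  unfold lapl
  exact continuous_finsetSum _ fun i _ => tf_D2_cont h _ _

lemma Per.fder {g : Vd d → ℝ} (hg : Per g) : Per (fun x => fderiv ℝ g x) := by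
  intro x z
  have h1 : (fun y => g (y + intVec z)) = g := by funext y; exact hg y z
  have h2 := fderiv_comp_add_right (𝕜 := ℝ) (f := g) (x := x) (intVec z)
  rw [h1] at h2
  exact h2.symm

lemma Per.gradv {g : Vd d → ℝ} (hg : Per g) : Per (gradv g) := by
  intro x z
  funext i
  exact congrArg (fun l : Vd d →L[ℝ] ℝ => l (Pi.single i 1)) (hg.fder x z)

lemma Per.D2 {g : Vd d → ℝ} (hg : Per g) (v w : Vd d) : Per (fun x => D2 g x v w) := by
  intro x z
  have h1 : Per (fun y => fderiv ℝ g y v) := fun x z => congrArg (fun l : Vd d →L[ℝ] ℝ => l v) (hg.fder x z)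
  exact congrArg (fun l : Vd d →L[ℝ] ℝ => l w) (h1.fder x z)

lemma Per.lapl {g : Vd d → ℝ} (hg : Per g) : Per (lapl g) := by
  intro x z
  exact Finset.sum_congr rfl fun i _ => hg.D2 _ _ x z

lemma tf_tderiv_per {φ : ℝ → Vd d → ℝ} (h : IsTestFun φ) (s : ℝ) : Per (tderiv φ s) := by
  intro x z
  unfold tderiv
  congr 1
  funext r
  exact h.2 r x z

lemma tper_bdd {E : Type*} [SeminormedAddCommGroup E] {g : ℝ × Vd d → E} (hg : Continuous g)
    (hp : ∀ s, Per (fun x => g (s, x))) (S : ℝ) : ∃ C : ℝ, 0 ≤ C ∧ ∀ s, |s| ≤ S → ∀ x, ‖g (s, x)‖ ≤ C := by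
  have hK : IsCompact (Set.Icc (-S) S ×ˢ Set.Icc (0 : Vd d) 1) := isCompact_Icc.prod isCompact_Icc
  obtain ⟨C, hC⟩ := hK.exists_bound_of_continuousOn hg.continuousOn
  refine ⟨max C 0, le_max_right _ _, fun s hs x => ?_⟩
  rw [← (hp s).sec x]
  refine le_trans (hC (s, secT (piT x)) ⟨abs_le.1 hs, ?_⟩) (le_max_left _ _)
  constructor <;> intro i
  · exact ((AddCircle.equivIco 1 0) (piT x i)).2.1
  · have := ((AddCircle.equivIco 1 0) (piT x i)).2.2
    simp only [zero_add] at this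
    exact this.le

/-- the explicit diffusion with constant drift -/
def Xg (x v : Vd d) (s : ℝ) (z : Vd d) : Vd d := x + s • v + √s • z

lemma Xg_cont : Continuous (fun q : (Vd d × Vd d) × ℝ × Vd d => Xg q.1.1 q.1.2 q.2.1 q.2.2) := by
  unfold Xg; fun_prop

lemma EG_cont {g : ℝ × Vd d → ℝ} (hg : Continuous g) (hp : ∀ s, Per (fun x => g (s, x))) (x v : Vd d) :
    Continuous (fun s => ∫ z, g (s, Xg x v s z) ∂(gam d)) := by
  rw [continuous_iff_continuousAt]
  intro s
  obtain ⟨C, hC0, hC⟩ := tper_bdd hg hp (|s| + 1)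
  refine continuousAt_of_dominated (bound := fun _ => C) ?_ ?_ (integrable_const _) ?_
  · refine Eventually.of_forall fun s => Continuous.aestronglyMeasurable ?_
    unfold Xg; fun_prop
  · have : ∀ᶠ s' in nhds s, |s'| < |s| + 1 := continuous_abs.continuousAt.eventually (gt_mem_nhds (by simp))
    filter_upwards [this] with s' hs'
    exact Eventually.of_forall fun z => hC s' hs'.le _
  · refine Eventually.of_forall fun z => Continuous.continuousAt ?_
    unfold Xg; fun_prop

lemma per_int_gam {g : Vd d → ℝ} (hg : Continuous g) (hp : Per g) (x v : Vd d) (s : ℝ) :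
    Integrable (fun z => g (Xg x v s z)) (gam d) := by
  obtain ⟨C, hC0, hC⟩ := hp.bdd hg
  refine Integrable.mono' (integrable_const C) (Continuous.aestronglyMeasurable ?_) (Eventually.of_forall fun z => hC _)
  unfold Xg; fun_prop

/-- generator -/
def genr (φ : ℝ → Vd d → ℝ) (v : Vd d) (s : ℝ) (x : Vd d) : ℝ :=
  tderiv φ s x + 1 * lapl (φ s) x + dotp v (gradv (φ s) x)

lemma dotp_cont : Continuous (fun q : Vd d × Vd d => dotp q.1 q.2) := by
  unfold dotp; fun_prop

lemma genr_cont {φ : ℝ → Vd d → ℝ} (h : IsTestFun φ) (v : Vd d) : Continuous (fun q : ℝ × Vd d => genr φ v q.1 q.2) := by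
  unfold genr
  have h1 := tf_tderiv_cont h
  have h2 := tf_lapl_cont h
  have h3 := tf_grad_cont h
  have h4 : Continuous (fun q : ℝ × Vd d => dotp v (gradv (φ q.1) q.2)) := dotp_cont.comp (continuous_const.prodMk h3)
  exact (h1.add (h2.const_mul 1)).add h4

lemma genr_per {φ : ℝ → Vd d → ℝ} (h : IsTestFun φ) (v : Vd d) (s : ℝ) : Per (genr φ v s) := by
  intro x z
  unfold genr
  rw [tf_tderiv_per h s x z, (show Per (φ s) from h.2 s).lapl x z, (show Per (φ s) from h.2 s).gradv x z]

lemma tf_ibp {φ : ℝ → Vd d → ℝ} (h : IsTestFun φ) (x v : Vd d) {s : ℝ} (hs : 0 < s) :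
    ∫ z, dotp z (gradv (φ s) (Xg x v s z)) ∂(gam d) = 2 * √s * ∫ z, lapl (φ s) (Xg x v s z) ∂(gam d) := by
  have hper : Per (φ s) := h.2 s
  have hc2 : ContDiff ℝ 2 (φ s) := h.1.comp (contDiff_const.prodMk contDiff_id)
  have hgc : Continuous (gradv (φ s)) := (tf_grad_cont h).comp (continuous_const.prodMk continuous_id)
  obtain ⟨C1, hC10, hC1⟩ := hper.gradv.bdd hgc
  unfold dotp lapl
  have hint : ∀ i, Integrable (fun z : Vd d => z i * gradv (φ s) (Xg x v s z) i) (gam d) := by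
    intro i
    refine Integrable.mono' (gam_mom.mul_const C1) (Continuous.aestronglyMeasurable ?_) (Eventually.of_forall fun z => ?_)
    · unfold Xg; fun_prop
    · rw [norm_mul]
      exact mul_le_mul (norm_le_pi_norm z i) ((norm_le_pi_norm _ i).trans (hC1 _)) (norm_nonneg _) (norm_nonneg _)
  rw [integral_finsetSum _ fun i _ => hint i, integral_finsetSum, Finset.mul_sum]
  · refine Finset.sum_congr rfl fun i _ => ?_
    have hDc : Continuous (fun y => D2 (φ s) y (Pi.single i 1) (Pi.single i 1)) :=
      (tf_D2_cont h _ _).comp (continuous_const.prodMk continuous_id)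
    obtain ⟨C2, hC20, hC2⟩ := (hper.D2 (Pi.single i 1) (Pi.single i 1)).bdd hDc
    have hg1 : ContDiff ℝ 1 (fun y => fderiv ℝ (φ s) y (Pi.single i 1)) :=
      (hc2.fderiv_right (m := 1) (le_of_eq one_add_one_eq_two)).clm_apply contDiff_const
    have hX : ContDiff ℝ 1 (Xg x v s) := by unfold Xg; fun_prop
    have hXd : ∀ z, HasFDerivAt (Xg x v s) (√s • ContinuousLinearMap.id ℝ (Vd d)) z := fun z =>
      ((hasFDerivAt_id z).const_smul (√s)).const_add _
    have hfd : ∀ z, fderiv ℝ (fun z => gradv (φ s) (Xg x v s z) i) z (Pi.single i 1) =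
        √s * D2 (φ s) (Xg x v s z) (Pi.single i 1) (Pi.single i 1) := by
      intro z
      have h1 : HasFDerivAt (fun y => fderiv ℝ (φ s) y (Pi.single i 1)) _ (Xg x v s z) :=
        (hg1.differentiable (by norm_num) _).hasFDerivAt
      have h2 : fderiv ℝ (fun z => gradv (φ s) (Xg x v s z) i) z = _ := (h1.comp z (hXd z)).fderiv
      rw [h2]
      simp [D2]
    rw [gam_ibp (g := fun z => gradv (φ s) (Xg x v s z) i) (C := C1 + √s * C2) (hg1.comp hX) ?_ i ?_]
    · simp only [hfd]
      rw [integral_const_mul]; ring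
    · intro z
      have := (norm_le_pi_norm _ i).trans (hC1 (Xg x v s z))
      rw [Real.norm_eq_abs] at this
      have : 0 ≤ √s * C2 := by positivity
      linarith
    · intro z
      rw [hfd, abs_mul, abs_of_nonneg (Real.sqrt_nonneg s)]
      have := mul_le_mul_of_nonneg_left (hC2 (Xg x v s z)) (Real.sqrt_nonneg s)
      rw [Real.norm_eq_abs] at this
      linarith
  · intro i _
    have hDc : Continuous (fun y => D2 (φ s) y (Pi.single i 1) (Pi.single i 1)) :=
      (tf_D2_cont h _ _).comp (continuous_const.prodMk continuous_id)
    exact per_int_gam hDc (hper.D2 _ _) x v s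

lemma ito_deriv {φ : ℝ → Vd d → ℝ} (h : IsTestFun φ) (x v : Vd d) {s : ℝ} (hs : 0 < s) :
    HasDerivAt (fun s => ∫ z, φ s (Xg x v s z) ∂(gam d)) (∫ z, genr φ v s (Xg x v s z) ∂(gam d)) s := by
  obtain ⟨C1, hC10, hC1⟩ := tper_bdd (tf_tderiv_cont h) (fun s => tf_tderiv_per h s) (2 * s)
  obtain ⟨C2, hC20, hC2⟩ := tper_bdd (tf_grad_cont h) (fun s => (show Per (φ s) from h.2 s).gradv) (2 * s)
  have hper : Per (φ s) := h.2 s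
  have hφc : Continuous (fun q : ℝ × Vd d => φ q.1 q.2) := h.1.continuous
  have hgc := tf_grad_cont h
  have htc := tf_tderiv_cont h
  have hd : ∀ r ∈ Metric.ball s (s/2), ∀ z, HasDerivAt (fun r => φ r (Xg x v r z))
      (tderiv φ r (Xg x v r z) + dotp v (gradv (φ r) (Xg x v r z)) + (2 * √r)⁻¹ * dotp z (gradv (φ r) (Xg x v r z))) r := by
    intro r hr z
    rw [Metric.mem_ball, Real.dist_eq, abs_lt] at hr
    have hr0 : 0 < r := by linarith
    have h1 : HasFDerivAt (fun q : ℝ × Vd d => φ q.1 q.2) _ (r, Xg x v r z) :=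
      (h.1.differentiable (by norm_num) _).hasFDerivAt
    have h2 : HasDerivAt (fun r => Xg x v r z) (v + (2 * √r)⁻¹ • z) r := by
      have e1 := ((hasDerivAt_id' r).smul_const v).const_add x
      have e2 := (Real.hasDerivAt_sqrt hr0.ne').smul_const z
      refine (e1.add e2).congr_deriv ?_
      simp
    have h3 := h1.comp_hasDerivAt r ((hasDerivAt_id' r).prodMk h2)
    refine h3.congr_deriv ?_
    have e : ((1:ℝ), v + (2 * √r)⁻¹ • z) = ((1:ℝ), (0 : Vd d)) + ((0:ℝ), v + (2 * √r)⁻¹ • z) := by simp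
    rw [e, map_add, ← tf_tderiv h, ← tf_slice h.1 (by norm_num)]
    have e3 := fderiv_eq_dotp (φ r) (Xg x v r z) (v + (2 * √r)⁻¹ • z)
    have e4 : fderiv ℝ (fun y => φ (r, y).1 (r, y).2) (Xg x v r z) = fderiv ℝ (φ r) (Xg x v r z) := rfl
    rw [e4, e3, dotp_add, dotp_smul]; ring
  have key := hasDerivAt_integral_of_dominated_loc_of_deriv_le (μ := gam d) (s := Metric.ball s (s/2))
    (F := fun r z => φ r (Xg x v r z)) (x₀ := s)
    (F' := fun r z => tderiv φ r (Xg x v r z) + dotp v (gradv (φ r) (Xg x v r z)) + (2 * √r)⁻¹ * dotp z (gradv (φ r) (Xg x v r z)))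
    (bound := fun z => C1 + d * ‖v‖ * C2 + (2 * √(s/2))⁻¹ * (d * ‖z‖ * C2))
    (Metric.ball_mem_nhds s (by positivity)) ?_ ?_ ?_ ?_ ?_ ?_
  · refine key.2.congr_deriv ?_
    have hgs : Continuous (gradv (φ s)) := hgc.comp (continuous_const.prodMk continuous_id)
    have i1 : Integrable (fun z => tderiv φ s (Xg x v s z)) (gam d) :=
      per_int_gam (htc.comp (continuous_const.prodMk continuous_id)) (tf_tderiv_per h s) x v s
    have i2 : Integrable (fun z => lapl (φ s) (Xg x v s z)) (gam d) :=
      per_int_gam ((tf_lapl_cont h).comp (continuous_const.prodMk continuous_id)) hper.lapl x v s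
    have i3 : Integrable (fun z => dotp v (gradv (φ s) (Xg x v s z))) (gam d) :=
      per_int_gam (g := fun y => dotp v (gradv (φ s) y)) (dotp_cont.comp (continuous_const.prodMk hgs)) (fun y z => by
        show dotp _ _ = dotp _ _
        rw [hper.gradv y z]) x v s
    have i4 : Integrable (fun z => dotp z (gradv (φ s) (Xg x v s z))) (gam d) := by
      refine Integrable.mono' (gam_mom.const_mul (d * C2)) (Continuous.aestronglyMeasurable ?_) (Eventually.of_forall fun z => ?_)
      · have : Continuous fun z => gradv (φ s) (Xg x v s z) := by unfold Xg; fun_prop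
        exact dotp_cont.comp (continuous_id.prodMk this)
      · refine (abs_dotp_le _ _).trans ?_
        have := hC2 s (by rw [abs_of_pos hs]; linarith) (Xg x v s z)
        calc _ ≤ d * ‖z‖ * C2 := by gcongr
          _ = _ := by ring
    unfold genr
    have i13 : Integrable (fun z => tderiv φ s (Xg x v s z) + dotp v (gradv (φ s) (Xg x v s z))) (gam d) := i1.add i3
    have i12 : Integrable (fun z => tderiv φ s (Xg x v s z) + 1 * lapl (φ s) (Xg x v s z)) (gam d) := i1.add (i2.const_mul 1)
    rw [integral_add i13 (i4.const_mul _), integral_add i1 i3, integral_const_mul, tf_ibp h x v hs,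
      integral_add i12 i3, integral_add i1 (i2.const_mul 1), integral_const_mul]
    have : √s ≠ 0 := (Real.sqrt_pos.2 hs).ne'
    field_simp
    ring
  · refine Eventually.of_forall fun r => Continuous.aestronglyMeasurable ?_
    unfold Xg; fun_prop
  · exact per_int_gam (hφc.comp (continuous_const.prodMk continuous_id)) hper x v s
  · refine Continuous.aestronglyMeasurable ?_
    have hX : Continuous fun z => Xg x v s z := by unfold Xg; fun_prop
    have h1 : Continuous fun z => gradv (φ s) (Xg x v s z) := hgc.comp (continuous_const.prodMk hX)
    have h2 : Continuous fun z => tderiv φ s (Xg x v s z) := htc.comp (continuous_const.prodMk hX)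
    exact (h2.add (dotp_cont.comp (continuous_const.prodMk h1))).add ((dotp_cont.comp (continuous_id.prodMk h1)).const_mul _)
  · refine Eventually.of_forall fun z r hr => ?_
    rw [Metric.mem_ball, Real.dist_eq, abs_lt] at hr
    have hr0 : 0 < r := by linarith
    have hr2 : |r| ≤ 2 * s := by rw [abs_of_pos hr0]; linarith
    have e1 := hC1 r hr2 (Xg x v r z)
    have e2 := hC2 r hr2 (Xg x v r z)
    simp only at e1 e2
    refine (norm_add_le _ _).trans (add_le_add ((norm_add_le _ _).trans (add_le_add e1 ?_)) ?_)
    · refine (abs_dotp_le _ _).trans ?_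
      gcongr
    · rw [norm_mul, Real.norm_of_nonneg (by positivity)]
      have : √(s/2) ≤ √r := Real.sqrt_le_sqrt (by linarith)
      have h5 : |dotp z (gradv (φ r) (Xg x v r z))| ≤ d * ‖z‖ * C2 := (abs_dotp_le _ _).trans (by gcongr)
      have h6 : 0 < √(s/2) := Real.sqrt_pos.2 (by linarith)
      rw [Real.norm_eq_abs]
      gcongr
  · exact (integrable_const _).add (((gam_mom.const_mul (d:ℝ)).mul_const C2).const_mul _)
  · exact Eventually.of_forall fun z r hr => hd r hr z

lemma ito {φ : ℝ → Vd d → ℝ} (h : IsTestFun φ) (x v : Vd d) {s₁ s₂ : ℝ} (h1 : 0 ≤ s₁) (h12 : s₁ ≤ s₂) :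
    ∫ z, φ s₂ (Xg x v s₂ z) ∂(gam d) - ∫ z, φ s₁ (Xg x v s₁ z) ∂(gam d) =
      ∫ s in s₁..s₂, ∫ z, genr φ v s (Xg x v s z) ∂(gam d) := by
  symm
  refine intervalIntegral.integral_eq_sub_of_hasDerivAt_of_le (f := fun s => ∫ z, φ s (Xg x v s z) ∂(gam d)) h12 ?_ ?_ ?_
  · exact (EG_cont h.1.continuous (fun s => h.2 s) x v).continuousOn
  · intro s hs
    exact ito_deriv h x v (lt_of_le_of_lt h1 hs.1)
  · exact (EG_cont (genr_cont h v) (fun s => genr_per h v s) x v).intervalIntegrable _ _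

end PE2sec

open ProbabilityTheory

section PFsec
variable {d : ℕ}

/-- explicit diffusion on the torus -/
def stX (s : ℝ) (p : (Td d × Vd d) × Vd d) : Td d := p.1.1 + piT (s • p.1.2 + √s • p.2)

lemma stX_cont : Continuous (fun q : ℝ × ((Td d × Vd d) × Vd d) => stX q.1 q.2) := by
  unfold stX
  have := continuous_piT (d := d)
  fun_prop

lemma stX_meas : Measurable (fun q : ℝ × ((Td d × Vd d) × Vd d) => stX q.1 q.2) := by
  exact stX_cont.measurable

lemma stX_meas' (s : ℝ) : Measurable (stX (d := d) s) := stX_meas.comp measurable_prodMk_left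

lemma per_stX {E : Type*} {g : Vd d → E} (hg : Per g) (s : ℝ) (p : (Td d × Vd d) × Vd d) :
    g (secT (stX s p)) = g (Xg (secT p.1.1) p.1.2 s p.2) := by
  unfold stX Xg
  rw [hg.sec_add, add_assoc]

/-- law of the explicit diffusion -/
def mG (P : Measure (Td d × Vd d)) [IsProbabilityMeasure P] (s : ℝ) : PTd d :=
  ⟨(P.prod (gam d)).map (stX s), Measure.isProbabilityMeasure_map (stX_meas' s).aemeasurable⟩

lemma mG_integral (P : Measure (Td d × Vd d)) [IsProbabilityMeasure P] (s : ℝ) {f : Td d → ℝ} (hf : Measurable f) :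
    ∫ y, f y ∂(mG P s : Measure (Td d)) = ∫ p, f (stX s p) ∂(P.prod (gam d)) := by
  show ∫ y, f y ∂((P.prod (gam d)).map (stX s)) = _
  rw [integral_map (stX_meas' s).aemeasurable hf.aestronglyMeasurable]

lemma mG_zero (P : Measure (Td d × Vd d)) [IsProbabilityMeasure P] : (mG P 0 : Measure (Td d)) = P.map Prod.fst := by
  show (P.prod (gam d)).map (stX 0) = _
  have : stX (d := d) 0 = fun p => p.1.1 := by
    funext p; simp [stX, piT_zero]
  rw [this]
  have h2 : (fun p : (Td d × Vd d) × Vd d => p.1.1) = Prod.fst ∘ Prod.fst := rfl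
  rw [h2, ← Measure.map_map measurable_fst measurable_fst]
  congr 1
  rw [Measure.map_fst_prod]; simp

/-- first moment of the gaussian -/
def Mz (d : ℕ) : ℝ := ∫ z : Vd d, ‖z‖ ∂(gam d)
lemma Mz_nonneg : 0 ≤ Mz d := integral_nonneg fun _ => norm_nonneg _

lemma ae_prod_fst {α β : Type*} [MeasurableSpace α] [MeasurableSpace β] {P : Measure α} {G : Measure β} [SFinite P] [SFinite G] {q : α → Prop}
    (h : ∀ᵐ p ∂P, q p) : ∀ᵐ p ∂(P.prod G), q p.1 :=
  Measure.quasiMeasurePreserving_fst.ae h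

lemma int_norm_snd (P : Measure (Td d × Vd d)) [IsProbabilityMeasure P] :
    Integrable (fun p : (Td d × Vd d) × Vd d => ‖p.2‖) (P.prod (gam d)) ∧ ∫ p, ‖p.2‖ ∂(P.prod (gam d)) = Mz d := by
  have h1 := (gam_mom (d := d)).comp_snd P
  refine ⟨h1, ?_⟩
  rw [integral_prod _ h1]
  simp [Mz]

lemma mG_W1 (P : Measure (Td d × Vd d)) [IsProbabilityMeasure P] {R : ℝ} (hR : ∀ᵐ p ∂P, ‖p.2‖ ≤ R) (s t : ℝ) :
    W1 (mG P s) (mG P t) ≤ |s - t| * R + |√s - √t| * Mz d := by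
  refine W1_le fun φ hφ => ?_
  obtain ⟨i1, i2⟩ := int_norm_snd P
  have hi : ∀ s, Integrable (fun p => φ (stX s p)) (P.prod (gam d)) := fun s =>
    (lip_integrable hφ (mG P s : Measure (Td d))).comp_measurable (stX_meas' s)
  rw [mG_integral P s hφ.continuous.measurable, mG_integral P t hφ.continuous.measurable, ← integral_sub (hi s) (hi t)]
  have e : |s - t| * R + |√s - √t| * Mz d = ∫ p : (Td d × Vd d) × Vd d, (|s - t| * R + |√s - √t| * ‖p.2‖) ∂(P.prod (gam d)) := by
    rw [integral_add (integrable_const _) (i1.const_mul _), integral_const, integral_const_mul, i2]; simp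
  rw [e]
  refine integral_mono_ae ((hi s).sub (hi t)) ((integrable_const _).add (i1.const_mul _)) ?_
  filter_upwards [ae_prod_fst hR] with p hp
  have h1 := hφ.dist_le_mul (stX s p) (stX t p)
  rw [Real.dist_eq, dist_eq_norm] at h1
  refine (le_abs_self _).trans (h1.trans ?_)
  have h2 : stX s p - stX t p = piT ((s - t) • p.1.2 + (√s - √t) • p.2) := by
    unfold stX
    rw [add_sub_add_left_eq_sub, ← piT_sub]
    congr 1
    module
  rw [h2, NNReal.coe_one, one_mul]
  refine (norm_piT_le _).trans ((norm_add_le _ _).trans ?_)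
  rw [norm_smul, norm_smul, Real.norm_eq_abs, Real.norm_eq_abs]
  gcongr

lemma mG_cont (P : Measure (Td d × Vd d)) [IsProbabilityMeasure P] {R : ℝ} (hR : ∀ᵐ p ∂P, ‖p.2‖ ≤ R) (I : Set ℝ) :
    W1ContOn (mG P) I := by
  intro t ht ε hε
  have hc : Continuous (fun s => |s - t| * R + |√s - √t| * Mz d) := by fun_prop
  have h1 := hc.tendsto t
  simp only [sub_self, abs_zero, zero_mul, add_zero] at h1
  obtain ⟨η, hη, h2⟩ := Metric.eventually_nhds_iff.1 (h1.eventually (gt_mem_nhds hε))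
  refine ⟨η, hη, fun s _ hs => (mG_W1 P hR s t).trans_lt (h2 ?_)⟩
  rwa [Real.dist_eq]

/-- weighted time measure -/
def tw (δ : ℝ) : Measure ℝ := (volume.restrict (Set.Ioi 0)).withDensity fun s => ENNReal.ofReal (Real.exp (-δ * s))

lemma exp_int {δ : ℝ} (hδ : 0 < δ) : Integrable (fun s => Real.exp (-δ * s)) (volume.restrict (Set.Ioi 0)) :=
  exp_neg_integrableOn_Ioi 0 hδ

lemma exp_integral {δ : ℝ} (hδ : 0 < δ) : ∫ s in Set.Ioi (0:ℝ), Real.exp (-δ * s) = 1 / δ := by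
  have := integral_exp_mul_Ioi (a := -δ) (by linarith) 0
  rw [this]; simp

lemma tw_fin {δ : ℝ} (hδ : 0 < δ) : IsFiniteMeasure (tw δ) := by
  unfold tw
  exact isFiniteMeasure_withDensity_ofReal (exp_int hδ).2

lemma tw_integral (δ : ℝ) (f : ℝ → ℝ) : ∫ s, f s ∂(tw δ) = ∫ s in Set.Ioi (0:ℝ), Real.exp (-δ * s) * f s := by
  have := integral_withDensity_eq_integral_toReal_smul (μ := volume.restrict (Set.Ioi (0:ℝ)))
    (f := fun s => ENNReal.ofReal (Real.exp (-δ * s))) (by fun_prop)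
    (Eventually.of_forall fun _ => ENNReal.ofReal_lt_top) f
  rw [tw, this]
  refine integral_congr_ae (Eventually.of_forall fun z => ?_)
  simp [ENNReal.toReal_ofReal (Real.exp_nonneg _)]

lemma tw_Ioc (δ : ℝ) {a b : ℝ} (ha : 0 ≤ a) (hab : a ≤ b) (f : ℝ → ℝ) :
    ∫ s, (Set.Ioc a b).indicator f s ∂(tw δ) = ∫ s in a..b, Real.exp (-δ * s) * f s := by
  rw [tw_integral, intervalIntegral.integral_of_le hab]
  have : (fun s => Real.exp (-δ * s) * (Set.Ioc a b).indicator f s) =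
      (Set.Ioc a b).indicator (fun s => Real.exp (-δ * s) * f s) := by
    funext s
    by_cases h : s ∈ Set.Ioc a b <;> simp [h]
  rw [this, setIntegral_indicator measurableSet_Ioc]
  congr 2
  ext s
  simp only [Set.mem_inter_iff, Set.mem_Ioi, Set.mem_Ioc]
  constructor
  · exact fun h => h.2
  · exact fun h => ⟨lt_of_le_of_lt ha h.1, h⟩

end PFsec

open ProbabilityTheory

section
variable {d : ℕ}

def twG (δ : ℝ) (P : Measure (Td d × Vd d)) : Measure (ℝ × ((Td d × Vd d) × Vd d)) := (tw δ).prod (P.prod (gam d))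

def PhiS (q : ℝ × ((Td d × Vd d) × Vd d)) : ℝ × Td d := (q.1, stX q.1 q.2)
def PhiV (q : ℝ × ((Td d × Vd d) × Vd d)) : Vd d := q.2.1.2

lemma PhiS_meas : Measurable (PhiS (d := d)) := measurable_fst.prodMk stX_meas
lemma PhiV_meas : Measurable (PhiV (d := d)) := by unfold PhiV; fun_prop

instance tw_sf (δ : ℝ) : SFinite (tw δ) := by unfold tw; infer_instance

lemma twG_fin {δ : ℝ} (hδ : 0 < δ) (P : Measure (Td d × Vd d)) [IsProbabilityMeasure P] : IsFiniteMeasure (twG δ P) := by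
  have := tw_fin hδ
  unfold twG; infer_instance

/-- integration of a function of `(s, X_s)` -/
lemma twG_map {δ : ℝ} (hδ : 0 < δ) (P : Measure (Td d × Vd d)) [IsProbabilityMeasure P] {g : ℝ × Td d → ℝ} (hg : Measurable g)
    {B : ℝ} (hB : ∀ᵐ q ∂((twG δ P).map PhiS), |g q| ≤ B) :
    ∫ q, g q ∂((twG δ P).map PhiS) = ∫ s, ∫ y, g (s, y) ∂(mG P s : Measure (Td d)) ∂(tw δ) := by
  have := tw_fin hδ
  have := twG_fin hδ P
  rw [integral_map PhiS_meas.aemeasurable hg.aestronglyMeasurable]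
  have hi : Integrable (fun q => g (PhiS q)) (twG δ P) := by
    refine Integrable.of_bound (hg.comp PhiS_meas).aestronglyMeasurable B ?_
    exact ae_of_ae_map PhiS_meas.aemeasurable hB
  unfold twG at hi ⊢
  rw [integral_prod _ hi]
  refine integral_congr_ae (Eventually.of_forall fun s => ?_)
  show ∫ p, g (PhiS (s, p)) ∂(P.prod (gam d)) = ∫ y, g (s, y) ∂(mG P s : Measure (Td d))
  rw [mG_integral P s (f := fun y => g (s, y)) (hg.comp measurable_prodMk_left)]
  rfl

variable {δ : ℝ} (P : Measure (Td d × Vd d)) [IsProbabilityMeasure P]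

lemma twG_ae {R : ℝ} (hR : ∀ᵐ p ∂P, ‖p.2‖ ≤ R) : ∀ᵐ q ∂(twG δ P), ‖PhiV q‖ ≤ R := by
  unfold twG
  have h1 : ∀ᵐ p ∂(P.prod (gam d)), ‖p.1.2‖ ≤ R := ae_prod_fst hR
  exact Measure.quasiMeasurePreserving_snd.ae h1

/-- the unified conditioning identity -/
lemma twG_cond (hδ : 0 < δ) [IsFiniteMeasure (twG δ P)] {R : ℝ} (hR : ∀ᵐ p ∂P, ‖p.2‖ ≤ R)
    {G : (ℝ × Td d) × Vd d → ℝ} (hG : Measurable G) {B : ℝ} (hB : ∀ q v, ‖v‖ ≤ R → |G (q, v)| ≤ B) :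
    (∀ᵐ q ∂((twG δ P).map PhiS), ∀ᵐ v ∂(condDistrib PhiV PhiS (twG δ P) q), ‖v‖ ≤ R) ∧
    ∫ s, ∫ p, G ((s, stX s p), p.1.2) ∂(P.prod (gam d)) ∂(tw δ) =
      ∫ q, (∫ v, G (q, v) ∂(condDistrib PhiV PhiS (twG δ P) q)) ∂((twG δ P).map PhiS) := by
  have := tw_fin hδ
  have hc := compProd_map_condDistrib (mβ := inferInstance) (X := PhiS) (μ := twG δ P) (PhiV_meas (d := d)).aemeasurable
  have hJ : Measurable (fun q : ℝ × ((Td d × Vd d) × Vd d) => (PhiS q, PhiV q)) := PhiS_meas.prodMk PhiV_meas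
  have ae1 : ∀ᵐ x ∂((twG δ P).map (fun q => (PhiS q, PhiV q))), ‖x.2‖ ≤ R := by
    rw [ae_map_iff hJ.aemeasurable (measurableSet_le (by fun_prop) measurable_const)]
    exact twG_ae P hR
  have ae2 : ∀ᵐ q ∂((twG δ P).map PhiS), ∀ᵐ v ∂(condDistrib PhiV PhiS (twG δ P) q), ‖v‖ ≤ R := by
    rw [← hc] at ae1
    exact Measure.ae_ae_of_ae_compProd ae1
  refine ⟨ae2, ?_⟩
  have hi : Integrable G ((twG δ P).map (fun q => (PhiS q, PhiV q))) := by
    refine Integrable.of_bound hG.aestronglyMeasurable B ?_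
    filter_upwards [ae1] with x hx using hB _ _ hx
  have e1 : ∫ x, G x ∂((twG δ P).map (fun q => (PhiS q, PhiV q))) = ∫ s, ∫ p, G ((s, stX s p), p.1.2) ∂(P.prod (gam d)) ∂(tw δ) := by
    rw [integral_map hJ.aemeasurable hG.aestronglyMeasurable]
    have hi2 := (integrable_map_measure hG.aestronglyMeasurable hJ.aemeasurable).1 hi
    unfold twG at hi2 ⊢
    rw [integral_prod (fun x => G (PhiS x, PhiV x)) hi2]
    rfl
  rw [← e1, ← hc]
  rw [← hc] at hi
  rw [Measure.integral_compProd hi]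

def aCE (δ : ℝ) (P : Measure (Td d × Vd d)) [IsFiniteMeasure (twG δ P)] (q : ℝ × Td d) : Vd d :=
  ∫ v, v ∂(condDistrib PhiV PhiS (twG δ P) q)

open Classical in
def alG (δ : ℝ) (P : Measure (Td d × Vd d)) [IsFiniteMeasure (twG δ P)] (R : ℝ) (s : ℝ) (y : Td d) : Vd d :=
  if ‖aCE δ P (s, y)‖ ≤ R then - aCE δ P (s, y) else 0

lemma aCE_meas [IsFiniteMeasure (twG δ P)] : Measurable (aCE δ P) := by
  have : StronglyMeasurable (fun x : (ℝ × Td d) × Vd d => x.2) := measurable_snd.stronglyMeasurable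
  exact (this.integral_kernel_prod_right' (κ := condDistrib PhiV PhiS (twG δ P))).measurable

lemma alG_meas [IsFiniteMeasure (twG δ P)] (R : ℝ) : Measurable (fun q : ℝ × Td d => alG δ P R q.1 q.2) := by
  unfold alG
  refine Measurable.ite ?_ (aCE_meas P).neg measurable_const
  exact measurableSet_le (aCE_meas P).norm measurable_const

lemma alG_bdd [IsFiniteMeasure (twG δ P)] {R : ℝ} (hR : 0 ≤ R) (s : ℝ) (y : Td d) : ‖alG δ P R s y‖ ≤ R := by
  unfold alG; split_ifs with h
  · simpa using h
  · simpa using hR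

lemma alG_ae (hδ : 0 < δ) [IsFiniteMeasure (twG δ P)] {R : ℝ} (hR : ∀ᵐ p ∂P, ‖p.2‖ ≤ R) :
    ∀ᵐ q ∂((twG δ P).map PhiS), alG δ P R q.1 q.2 = - aCE δ P q := by
  have := (twG_cond P hδ hR (G := 0) measurable_const (B := 0) (by simp)).1
  filter_upwards [this] with q hq
  have h2 : ‖aCE δ P q‖ ≤ R := by
    have := norm_integral_le_of_norm_le_const (μ := condDistrib PhiV PhiS (twG δ P) q) (f := fun v => v) hq
    simpa [aCE] using this
  unfold alG; rw [if_pos h2]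

lemma dotp_bound {a b : Vd d} {A B : ℝ} (ha : ‖a‖ ≤ A) (hb : ‖b‖ ≤ B) : |dotp a b| ≤ d * A * B := by
  refine (abs_dotp_le a b).trans ?_
  have := (norm_nonneg a).trans ha
  gcongr

lemma dotp_meas {X : Type*} [MeasurableSpace X] {f g : X → Vd d} (hf : Measurable f) (hg : Measurable g) :
    Measurable (fun x => dotp (f x) (g x)) := dotp_cont.measurable.comp (hf.prodMk hg)

lemma dotp_integral (κ : Measure (Vd d)) [IsProbabilityMeasure κ] (hi : Integrable (fun v => v) κ) (b : Vd d) :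
    ∫ v, dotp v b ∂κ = dotp (∫ v, v ∂κ) b := by
  unfold dotp
  have hI : ∀ i ∈ (Finset.univ : Finset (Fin d)), Integrable (fun v : Vd d => v i * b i) κ := fun i _ =>
    ((ContinuousLinearMap.proj (R := ℝ) (φ := fun _ : Fin d => ℝ) i).integrable_comp hi).mul_const _
  rw [integral_finsetSum _ hI]
  refine Finset.sum_congr rfl fun i _ => ?_
  have := (ContinuousLinearMap.proj (R := ℝ) (φ := fun _ : Fin d => ℝ) i).integral_comp_comm hi
  simp only [ContinuousLinearMap.proj_apply] at this
  rw [integral_mul_const, this]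


lemma twG_int (hδ : 0 < δ) {g : ℝ × Td d → ℝ} (hg : Measurable g) {B : ℝ} (hB : ∀ q, |g q| ≤ B) :
    Integrable g ((twG δ P).map PhiS) := by
  have := twG_fin hδ P
  exact Integrable.of_bound hg.aestronglyMeasurable B (Eventually.of_forall hB)

lemma alG_CE (hδ : 0 < δ) [IsFiniteMeasure (twG δ P)] {R : ℝ} (hR0 : 0 ≤ R) (hR : ∀ᵐ p ∂P, ‖p.2‖ ≤ R) {h : ℝ × Td d → Vd d} (hh : Measurable h)
    {a b : ℝ} (ha : 0 ≤ a) (hab : a ≤ b) {B : ℝ} (hB0 : 0 ≤ B) (hB : ∀ q, q.1 ∈ Set.Ioc a b → ‖h q‖ ≤ B) :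
    ∫ s in a..b, ∫ p, dotp p.1.2 (h (s, stX s p)) ∂(P.prod (gam d)) =
      - ∫ s in a..b, ∫ y, dotp (alG δ P R s y) (h (s, y)) ∂(mG P s : Measure (Td d)) := by
  have hbd : ∀ (q : ℝ × Td d) v, ‖v‖ ≤ R →
      |(Set.Ioc a b).indicator (fun s => Real.exp (δ * s)) q.1 * dotp v (h q)| ≤ Real.exp (δ * b) * (d * R * B) := by
    intro q v hv
    by_cases hq : q.1 ∈ Set.Ioc a b
    · rw [Set.indicator_of_mem hq, abs_mul, abs_of_pos (Real.exp_pos _)]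
      gcongr
      · exact hq.2
      · exact dotp_bound hv (hB _ hq)
    · rw [Set.indicator_of_notMem hq]
      simp only [zero_mul, abs_zero]; positivity
  have hind : Measurable (fun q : ℝ × Td d => (Set.Ioc a b).indicator (fun s => Real.exp (δ * s)) q.1) :=
    (Measurable.indicator (by fun_prop) measurableSet_Ioc).comp measurable_fst
  obtain ⟨k1, k2⟩ := twG_cond P hδ hR (G := fun x => (Set.Ioc a b).indicator (fun s => Real.exp (δ * s)) x.1.1 * dotp x.2 (h x.1))
    (Measurable.mul (hind.comp measurable_fst) (dotp_meas measurable_snd (hh.comp measurable_fst)))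
    (B := Real.exp (δ * b) * (d * R * B)) hbd
  simp only at k2
  have e : ∀ s x : ℝ, Real.exp (-δ * s) * (Real.exp (δ * s) * x) = x := fun s x => by
    rw [← mul_assoc, ← Real.exp_add]; simp
  have e2 : ∀ (s : ℝ) (x : ℝ → ℝ), (Set.Ioc a b).indicator (fun s => Real.exp (δ * s)) s * x s = (Set.Ioc a b).indicator (fun s => Real.exp (δ * s) * x s) s := by
    intro s x
    by_cases hs : s ∈ Set.Ioc a b <;> simp [hs]
  have l1 : ∫ s, ∫ p, (Set.Ioc a b).indicator (fun s => Real.exp (δ * s)) s * dotp p.1.2 (h (s, stX s p)) ∂(P.prod (gam d)) ∂(tw δ)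
      = ∫ s in a..b, ∫ p, dotp p.1.2 (h (s, stX s p)) ∂(P.prod (gam d)) := by
    simp_rw [integral_const_mul]
    simp_rw [e2 _ (fun s => ∫ p, dotp p.1.2 (h (s, stX s p)) ∂(P.prod (gam d)))]
    rw [tw_Ioc δ ha hab]
    simp_rw [e]
  have l2 : ∫ q, (Set.Ioc a b).indicator (fun s => Real.exp (δ * s)) q.1 * dotp (alG δ P R q.1 q.2) (h q) ∂((twG δ P).map PhiS)
      = ∫ s in a..b, ∫ y, dotp (alG δ P R s y) (h (s, y)) ∂(mG P s : Measure (Td d)) := by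
    rw [twG_map hδ P (g := fun q => (Set.Ioc a b).indicator (fun s => Real.exp (δ * s)) q.1 * dotp (alG δ P R q.1 q.2) (h q))
      (hind.mul (dotp_meas (alG_meas P R) hh)) (Eventually.of_forall fun q => hbd q _ (alG_bdd P hR0 _ _))]
    simp only
    simp_rw [integral_const_mul]
    simp_rw [e2 _ (fun s => ∫ y, dotp (alG δ P R s y) (h (s, y)) ∂(mG P s : Measure (Td d)))]
    rw [tw_Ioc δ ha hab]
    simp_rw [e]
  rw [← l1, k2, ← l2, ← integral_neg]
  refine integral_congr_ae ?_
  filter_upwards [k1, alG_ae P hδ hR] with q hq hal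
  have hi : Integrable (fun v : Vd d => v) (condDistrib PhiV PhiS (twG δ P) q) :=
    Integrable.of_bound measurable_id.aestronglyMeasurable R hq
  rw [integral_const_mul, dotp_integral _ hi, hal]
  have : dotp (-aCE δ P q) (h q) = - dotp (aCE δ P q) (h q) := by
    simp [dotp, Finset.sum_neg_distrib]
  rw [this]
  simp only [aCE]; ring

lemma Lt_bdd (S : MFGSetting d) (R : ℝ) : ∃ B : ℝ, 0 ≤ B ∧ ∀ y (v : Vd d), ‖v‖ ≤ R → |Lt S y v| ≤ B := by
  obtain ⟨c, C, hc, hC, h1, h2⟩ := Lt_growth S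
  refine ⟨C * (1 + R^2), by positivity, fun y v hv => ?_⟩
  have a1 := h1 y v
  have a2 := h2 y v
  have a3 : ‖v‖^2 ≤ R^2 := by gcongr
  have a4 : C * (1 + ‖v‖^2) ≤ C * (1 + R^2) := by gcongr
  have a5 : 0 ≤ c * ‖v‖^2 := by positivity
  have a6 : 0 ≤ C * R^2 := by positivity
  rw [abs_le]; constructor <;> linarith

lemma alG_Jensen (S : MFGSetting d) (hδ : 0 < δ) [IsFiniteMeasure (twG δ P)] {R : ℝ} (hR0 : 0 ≤ R) (hR : ∀ᵐ p ∂P, ‖p.2‖ ≤ R)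
    {τ : ℝ} (hτ : 0 ≤ τ) :
    ∫ s in (0:ℝ)..τ, Real.exp (-δ * s) * ∫ y, Lt S y (alG δ P R s y) ∂(mG P s : Measure (Td d)) ≤
      ∫ s in (0:ℝ)..τ, Real.exp (-δ * s) * ∫ p, Lt S (stX s p) (-p.1.2) ∂(P.prod (gam d)) := by
  obtain ⟨B, hB0, hB⟩ := Lt_bdd S R
  have hbd : ∀ (q : ℝ × Td d) v, ‖v‖ ≤ R →
      |(Set.Ioc 0 τ).indicator (fun _ => (1:ℝ)) q.1 * Lt S q.2 v| ≤ B := by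
    intro q v hv
    by_cases hq : q.1 ∈ Set.Ioc 0 τ
    · rw [Set.indicator_of_mem hq, one_mul]; exact hB _ _ hv
    · rw [Set.indicator_of_notMem hq]; simpa using hB0
  have hind : Measurable (fun q : ℝ × Td d => (Set.Ioc 0 τ).indicator (fun _ => (1:ℝ)) q.1) :=
    (Measurable.indicator (by fun_prop) measurableSet_Ioc).comp measurable_fst
  have hGm : Measurable (fun x : (ℝ × Td d) × Vd d => (Set.Ioc 0 τ).indicator (fun _ => (1:ℝ)) x.1.1 * Lt S x.1.2 (-x.2)) :=
    (hind.comp measurable_fst).mul ((Lt_cont S).measurable.comp (f := fun x : (ℝ × Td d) × Vd d => (x.1.2, -x.2)) (by fun_prop))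
  obtain ⟨k1, k2⟩ := twG_cond P hδ hR (G := fun x => (Set.Ioc 0 τ).indicator (fun _ => (1:ℝ)) x.1.1 * Lt S x.1.2 (-x.2))
    hGm (B := B) (fun q v hv => hbd q (-v) (by simpa using hv))
  simp only at k2
  have e2 : ∀ (s : ℝ) (x : ℝ → ℝ), (Set.Ioc 0 τ).indicator (fun _ => (1:ℝ)) s * x s = (Set.Ioc 0 τ).indicator x s := by
    intro s x
    by_cases hs : s ∈ Set.Ioc 0 τ <;> simp [hs]
  have l1 : ∫ s, ∫ p, (Set.Ioc 0 τ).indicator (fun _ => (1:ℝ)) s * Lt S (stX s p) (-p.1.2) ∂(P.prod (gam d)) ∂(tw δ)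
      = ∫ s in (0:ℝ)..τ, Real.exp (-δ * s) * ∫ p, Lt S (stX s p) (-p.1.2) ∂(P.prod (gam d)) := by
    simp_rw [integral_const_mul]
    simp_rw [e2 _ (fun s => ∫ p, Lt S (stX s p) (-p.1.2) ∂(P.prod (gam d)))]
    rw [tw_Ioc δ le_rfl hτ]
  have hm2 : Measurable (fun q : ℝ × Td d => (Set.Ioc 0 τ).indicator (fun _ => (1:ℝ)) q.1 * Lt S q.2 (alG δ P R q.1 q.2)) :=
    hind.mul (measurable_Lα S (alG_meas P R))
  have l2 : ∫ q, (Set.Ioc 0 τ).indicator (fun _ => (1:ℝ)) q.1 * Lt S q.2 (alG δ P R q.1 q.2) ∂((twG δ P).map PhiS)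
      = ∫ s in (0:ℝ)..τ, Real.exp (-δ * s) * ∫ y, Lt S y (alG δ P R s y) ∂(mG P s : Measure (Td d)) := by
    rw [twG_map hδ P (g := fun q => (Set.Ioc 0 τ).indicator (fun _ => (1:ℝ)) q.1 * Lt S q.2 (alG δ P R q.1 q.2))
      hm2 (Eventually.of_forall fun q => hbd q _ (alG_bdd P hR0 _ _))]
    simp only
    simp_rw [integral_const_mul]
    simp_rw [e2 _ (fun s => ∫ y, Lt S y (alG δ P R s y) ∂(mG P s : Measure (Td d)))]
    rw [tw_Ioc δ le_rfl hτ]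
  rw [← l1, k2, ← l2]
  have hbq : ∀ᵐ q ∂((twG δ P).map PhiS), ‖∫ v, (Set.Ioc 0 τ).indicator (fun _ => (1:ℝ)) q.1 * Lt S q.2 (-v) ∂(condDistrib PhiV PhiS (twG δ P) q)‖ ≤ B := by
    filter_upwards [k1] with q hq
    have := norm_integral_le_of_norm_le_const (μ := condDistrib PhiV PhiS (twG δ P) q)
      (f := fun v => (Set.Ioc 0 τ).indicator (fun _ => (1:ℝ)) q.1 * Lt S q.2 (-v)) (C := B)
      (by filter_upwards [hq] with v hv using hbd q _ (by simpa using hv))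
    simpa using this
  have hmq : StronglyMeasurable (fun q => ∫ v, (Set.Ioc 0 τ).indicator (fun _ => (1:ℝ)) q.1 * Lt S q.2 (-v) ∂(condDistrib PhiV PhiS (twG δ P) q)) :=
    hGm.stronglyMeasurable.integral_kernel_prod_right'
  refine integral_mono_ae (twG_int P hδ hm2 fun q => hbd q _ (alG_bdd P hR0 _ _)) (Integrable.of_bound hmq.aestronglyMeasurable B hbq) ?_
  filter_upwards [k1, alG_ae P hδ hR] with q hq hal
  rw [integral_const_mul]
  refine mul_le_mul_of_nonneg_left ?_ (Set.indicator_nonneg (fun _ _ => zero_le_one) _)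
  have hi : Integrable (fun v : Vd d => -v) (condDistrib PhiV PhiS (twG δ P) q) :=
    Integrable.of_bound measurable_neg.aestronglyMeasurable R (by simpa using hq)
  have hLc : Continuous (Lt S q.2) := (Lt_cont S).comp (by fun_prop : Continuous fun v : Vd d => (q.2, v))
  have hi2 : Integrable (fun v : Vd d => Lt S q.2 (-v)) (condDistrib PhiV PhiS (twG δ P) q) :=
    Integrable.of_bound (hLc.comp continuous_neg).measurable.aestronglyMeasurable B (by
      filter_upwards [hq] with v hv using hB _ _ (by simpa using hv))
  have hcv : ConvexOn ℝ Set.univ (Lt S q.2) := Hstar_convex S (secT q.2)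
  have := hcv.map_integral_le (μ := condDistrib PhiV PhiS (twG δ P) q) hLc.continuousOn isClosed_univ
    (f := fun v => -v) (Eventually.of_forall fun _ => Set.mem_univ _) hi hi2
  rw [integral_neg] at this
  rw [hal]; exact this
end

open ProbabilityTheory

section
variable {d : ℕ}

lemma genr_bdd {φ : ℝ → Vd d → ℝ} (h : IsTestFun φ) (R T : ℝ) : ∃ C : ℝ, 0 ≤ C ∧ ∀ s, |s| ≤ T → ∀ v : Vd d, ‖v‖ ≤ R → ∀ x,
    |genr φ v s x| ≤ C ∧ |tderiv φ s x + 1 * lapl (φ s) x| ≤ C ∧ ‖gradv (φ s) x‖ ≤ C := by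
  obtain ⟨C1, hC10, hC1⟩ := tper_bdd (tf_tderiv_cont h) (fun s => tf_tderiv_per h s) T
  obtain ⟨C2, hC20, hC2⟩ := tper_bdd (tf_grad_cont h) (fun s => (show Per (φ s) from h.2 s).gradv) T
  obtain ⟨C3, hC30, hC3⟩ := tper_bdd (tf_lapl_cont h) (fun s => (show Per (φ s) from h.2 s).lapl) T
  refine ⟨C1 + C3 + d * |R| * C2 + C2, by positivity, fun s hs v hv x => ?_⟩
  have a1 := hC1 s hs x
  have a2 := hC2 s hs x
  have a3 := hC3 s hs x
  simp only [Real.norm_eq_abs] at a1 a3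
  have a4 := dotp_bound (hv.trans (le_abs_self R)) a2
  have a5 : 0 ≤ d * |R| * C2 := by positivity
  rw [abs_le] at a1 a3 a4
  unfold genr
  simp only at a2 a4
  refine ⟨abs_le.2 ⟨by linarith, by linarith⟩, abs_le.2 ⟨by linarith, by linarith⟩, by linarith⟩

lemma genr_stX_meas {φ : ℝ → Vd d → ℝ} (h : IsTestFun φ) :
    Measurable (fun q : ℝ × ((Td d × Vd d) × Vd d) => genr φ q.2.1.2 q.1 (secT (stX q.1 q.2))) := by
  have hm : Measurable (fun q : ℝ × ((Td d × Vd d) × Vd d) => (q.1, secT (stX q.1 q.2))) :=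
    measurable_fst.prodMk (measurable_secT.comp stX_meas)
  unfold genr
  have h1 := (tf_tderiv_cont h).measurable.comp hm
  have h2 := (tf_lapl_cont h).measurable.comp hm
  have h3 := (tf_grad_cont h).measurable.comp hm
  have h4 := dotp_meas (f := fun q : ℝ × ((Td d × Vd d) × Vd d) => q.2.1.2) (by fun_prop) h3
  exact (h1.add (h2.const_mul 1)).add h4

lemma fub_P (P : Measure (Td d × Vd d)) [IsProbabilityMeasure P] {R : ℝ} (hR : ∀ᵐ p ∂P, ‖p.2‖ ≤ R)
    {g : ℝ × ((Td d × Vd d) × Vd d) → ℝ} (hg : Measurable g) {s₁ s₂ C : ℝ}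
    (hb : ∀ s ∈ Set.Ioc s₁ s₂, ∀ a : Td d × Vd d, ‖a.2‖ ≤ R → ∀ z, |g (s, (a, z))| ≤ C) :
    ∫ a, (∫ s in Set.Ioc s₁ s₂, ∫ z, g (s, (a, z)) ∂(gam d)) ∂P = ∫ s in Set.Ioc s₁ s₂, ∫ p, g (s, p) ∂(P.prod (gam d)) := by
  have e2 : ∀ s ∈ Set.Ioc s₁ s₂, ∫ p, g (s, p) ∂(P.prod (gam d)) = ∫ a, ∫ z, g (s, (a, z)) ∂(gam d) ∂P := by
    intro s hs
    refine integral_prod (fun p => g (s, p)) ?_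
    refine Integrable.of_bound (hg.comp measurable_prodMk_left).aestronglyMeasurable C ?_
    filter_upwards [ae_prod_fst hR] with p hp using hb s hs p.1 hp p.2
  rw [setIntegral_congr_fun measurableSet_Ioc e2, integral_integral_swap]
  have hm4 : StronglyMeasurable (fun q : (Td d × Vd d) × ℝ => ∫ z, g (q.2, (q.1, z)) ∂(gam d)) := by
    have : Measurable (fun q : ((Td d × Vd d) × ℝ) × Vd d => g (q.1.2, (q.1.1, q.2))) := hg.comp (by fun_prop)
    exact this.stronglyMeasurable.integral_prod_right'
  refine Integrable.of_bound hm4.aestronglyMeasurable C ?_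
  have q1 : ∀ᵐ q ∂(P.prod (volume.restrict (Set.Ioc s₁ s₂))), ‖q.1.2‖ ≤ R := ae_prod_fst hR
  have q2 : ∀ᵐ q ∂(P.prod (volume.restrict (Set.Ioc s₁ s₂))), q.2 ∈ Set.Ioc s₁ s₂ :=
    Measure.quasiMeasurePreserving_snd.ae (ae_restrict_mem measurableSet_Ioc)
  filter_upwards [q1, q2] with q hq1 hq2
  have := norm_integral_le_of_norm_le_const (μ := gam d) (f := fun z => g (q.2, (q.1, z))) (C := C)
    (Eventually.of_forall fun z => hb _ hq2 _ hq1 z)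
  simpa [Function.uncurry] using this

lemma ito_L (P : Measure (Td d × Vd d)) [IsProbabilityMeasure P] {ψ : Vd d → ℝ} (hper : Per ψ) (hcs : Continuous ψ) (s : ℝ) :
    ∫ y, ψ (secT y) ∂(mG P s : Measure (Td d)) = ∫ a, ∫ z, ψ (Xg (secT a.1) a.2 s z) ∂(gam d) ∂P ∧
      Integrable (fun a : Td d × Vd d => ∫ z, ψ (Xg (secT a.1) a.2 s z) ∂(gam d)) P := by
  obtain ⟨B, hB0, hB⟩ := hper.bdd hcs
  have hm : Measurable (fun p : (Td d × Vd d) × Vd d => ψ (secT (stX s p))) :=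
    hcs.measurable.comp (measurable_secT.comp (stX_meas' s))
  have hi : Integrable (fun p : (Td d × Vd d) × Vd d => ψ (secT (stX s p))) (P.prod (gam d)) :=
    Integrable.of_bound hm.aestronglyMeasurable B (Eventually.of_forall fun p => hB _)
  have e : ∀ p : (Td d × Vd d) × Vd d, ψ (secT (stX s p)) = ψ (Xg (secT p.1.1) p.1.2 s p.2) := fun p => per_stX hper s p
  rw [mG_integral P s (f := fun y => ψ (secT y)) (hcs.measurable.comp measurable_secT), integral_prod _ hi]
  have e' : (fun p : (Td d × Vd d) × Vd d => ψ (secT (stX s p))) = fun p => ψ (Xg (secT p.1.1) p.1.2 s p.2) := funext e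
  refine ⟨?_, ?_⟩
  · refine integral_congr_ae (Eventually.of_forall fun a => ?_)
    refine integral_congr_ae (Eventually.of_forall fun z => ?_)
    exact e (a, z)
  · rw [e'] at hi
    exact hi.integral_prod_left

lemma ito_P (P : Measure (Td d × Vd d)) [IsProbabilityMeasure P] {R : ℝ} (hR : ∀ᵐ p ∂P, ‖p.2‖ ≤ R)
    {φ : ℝ → Vd d → ℝ} (h : IsTestFun φ) {s₁ s₂ : ℝ} (h1 : 0 ≤ s₁) (h12 : s₁ ≤ s₂) :
    ∫ y, φ s₂ (secT y) ∂(mG P s₂ : Measure (Td d)) - ∫ y, φ s₁ (secT y) ∂(mG P s₁ : Measure (Td d)) =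
      ∫ s in s₁..s₂, ∫ p, genr φ p.1.2 s (secT (stX s p)) ∂(P.prod (gam d)) := by
  have hper : ∀ s, Per (φ s) := fun s => h.2 s
  have hcs : ∀ s, Continuous (φ s) := fun s => h.1.continuous.comp (continuous_const.prodMk continuous_id)
  obtain ⟨C, hC0, hC⟩ := genr_bdd h R s₂
  have hbd : ∀ s ∈ Set.Ioc s₁ s₂, ∀ a : Td d × Vd d, ‖a.2‖ ≤ R → ∀ z, |genr φ a.2 s (secT (stX s (a, z)))| ≤ C := by
    intro s hs a ha z
    exact (hC s (by rw [abs_of_nonneg (h1.trans hs.1.le)]; exact hs.2) _ ha _).1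
  have L1 := ito_L P (hper s₁) (hcs s₁) s₁
  have L2 := ito_L P (hper s₂) (hcs s₂) s₂
  rw [L1.1, L2.1, ← integral_sub L2.2 L1.2, intervalIntegral.integral_of_le h12]
  have e1 : ∀ a : Td d × Vd d, ∫ z, φ s₂ (Xg (secT a.1) a.2 s₂ z) ∂(gam d) - ∫ z, φ s₁ (Xg (secT a.1) a.2 s₁ z) ∂(gam d) =
      ∫ s in Set.Ioc s₁ s₂, ∫ z, genr φ a.2 s (secT (stX s (a, z))) ∂(gam d) := by
    intro a
    rw [ito h _ _ h1 h12, intervalIntegral.integral_of_le h12]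
    refine integral_congr_ae (Eventually.of_forall fun s => ?_)
    refine integral_congr_ae (Eventually.of_forall fun z => ?_)
    exact (per_stX (genr_per h a.2 s) s (a, z)).symm
  rw [integral_congr_ae (Eventually.of_forall e1)]
  exact fub_P P hR (g := fun q => genr φ q.2.1.2 q.1 (secT (stX q.1 q.2))) (genr_stX_meas h) hbd

end

open ProbabilityTheory

section
variable {d : ℕ}

lemma meas_slice {E : Type*} [MeasurableSpace E] {f : ℝ → Td d → E} (hf : Measurable (fun q : ℝ × Td d => f q.1 q.2)) (s : ℝ) : Measurable (fun y => f s y) :=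
  hf.comp measurable_prodMk_left

lemma alG_FP_aux (P : Measure (Td d × Vd d)) [IsProbabilityMeasure P] {δ : ℝ} (hδ : 0 < δ) [IsFiniteMeasure (twG δ P)] {R : ℝ} (hR0 : 0 ≤ R) (hR : ∀ᵐ p ∂P, ‖p.2‖ ≤ R)
    {s₁ s₂ : ℝ} (h1 : 0 ≤ s₁) (h12 : s₁ ≤ s₂) {a : ℝ × Td d → ℝ} {h : ℝ × Td d → Vd d} (htm : Measurable a) (hgm : Measurable h)
    {C : ℝ} (hC0 : 0 ≤ C) (hA : ∀ q, q.1 ∈ Set.Ioc s₁ s₂ → |a q| ≤ C) (hH : ∀ q, q.1 ∈ Set.Ioc s₁ s₂ → ‖h q‖ ≤ C) :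
    ∫ s in s₁..s₂, ∫ p, (a (s, stX s p) + dotp p.1.2 (h (s, stX s p))) ∂(P.prod (gam d)) =
      ∫ s in s₁..s₂, ∫ y, (a (s, y) - dotp (alG δ P R s y) (h (s, y))) ∂(mG P s : Measure (Td d)) := by
  have hCE := alG_CE P hδ hR0 hR (h := h) hgm h1 h12 hC0 hH
  have hm := mG_cont P hR (Set.Ici 0)
  let A : ℝ → ℝ := fun s => ∫ y, a (s, y) ∂(mG P s : Measure (Td d))
  have iA : IntervalIntegrable A volume s₁ s₂ :=
    (Mst_int hm h1 h12 (g := a)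
      (Integrable.of_bound htm.aestronglyMeasurable C (by
        filter_upwards [Mst_ae hm] with q hq using hA q hq))).1
  have iB : IntervalIntegrable (fun s => ∫ y, dotp (alG δ P R s y) (h (s, y)) ∂(mG P s : Measure (Td d))) volume s₁ s₂ :=
    (Mst_int hm h1 h12 (g := fun q => dotp (alG δ P R q.1 q.2) (h q))
      (Integrable.of_bound (dotp_meas (alG_meas P R) hgm).aestronglyMeasurable (d * R * C) (by
        filter_upwards [Mst_ae hm] with q hq using dotp_bound (alG_bdd P hR0 _ _) (hH q hq)))).1
  have e1 : ∀ s ∈ Set.Ioc s₁ s₂, ∫ p, (a (s, stX s p) + dotp p.1.2 (h (s, stX s p))) ∂(P.prod (gam d)) =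
      A s + ∫ p, dotp p.1.2 (h (s, stX s p)) ∂(P.prod (gam d)) := by
    intro s hs
    have hmA : Measurable (fun y : Td d => a (s, y)) := htm.comp measurable_prodMk_left
    have hmB : Measurable (fun y : Td d => h (s, y)) := hgm.comp measurable_prodMk_left
    simp only [A]
    rw [mG_integral P s hmA]
    refine integral_add (f := fun p => a (s, stX s p)) (g := fun p => dotp p.1.2 (h (s, stX s p))) ?_ ?_
    · exact Integrable.of_bound (hmA.comp (stX_meas' s)).aestronglyMeasurable C
        (Eventually.of_forall fun p => hA _ hs)
    · refine Integrable.of_bound (dotp_meas (by fun_prop) (hmB.comp (stX_meas' s))).aestronglyMeasurable (d * R * C) ?_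
      filter_upwards [ae_prod_fst hR] with p hp using dotp_bound hp (hH _ hs)
  have e2 : ∀ s ∈ Set.Ioc s₁ s₂, ∫ y, (a (s, y) - dotp (alG δ P R s y) (h (s, y))) ∂(mG P s : Measure (Td d))
      = A s - ∫ y, dotp (alG δ P R s y) (h (s, y)) ∂(mG P s : Measure (Td d)) := by
    intro s hs
    have hmA : Measurable (fun y : Td d => a (s, y)) := htm.comp measurable_prodMk_left
    have hmB : Measurable (fun y : Td d => dotp (alG δ P R s y) (h (s, y))) :=
      dotp_meas (meas_slice (alG_meas P R) s) (hgm.comp measurable_prodMk_left)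
    refine integral_sub (f := fun y => a (s, y)) ?_ ?_
    · exact Integrable.of_bound hmA.aestronglyMeasurable C (Eventually.of_forall fun y => hA _ hs)
    · exact Integrable.of_bound hmB.aestronglyMeasurable (d * R * C)
        (Eventually.of_forall fun y => dotp_bound (alG_bdd P hR0 _ _) (hH _ hs))
  have iD : IntervalIntegrable (fun s => ∫ p, dotp p.1.2 (h (s, stX s p)) ∂(P.prod (gam d))) volume s₁ s₂ := by
    rw [intervalIntegrable_iff_integrableOn_Ioc_of_le h12]
    have hmD : Measurable (fun q : ℝ × ((Td d × Vd d) × Vd d) => dotp q.2.1.2 (h (q.1, stX q.1 q.2))) :=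
      dotp_meas (by fun_prop) (hgm.comp (PhiS_meas (d := d)))
    refine Integrable.of_bound (hmD.stronglyMeasurable.integral_prod_right' (ν := P.prod (gam d))).aestronglyMeasurable (d * R * C) ?_
    filter_upwards [ae_restrict_mem measurableSet_Ioc] with s hs
    have := norm_integral_le_of_norm_le_const (μ := P.prod (gam d)) (f := fun p => dotp p.1.2 (h (s, stX s p))) (C := d * R * C)
      (by filter_upwards [ae_prod_fst hR] with p hp using dotp_bound hp (hH _ hs))
    simpa using this
  rw [intervalIntegral.integral_of_le h12, setIntegral_congr_fun measurableSet_Ioc e1,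
    intervalIntegral.integral_of_le h12, setIntegral_congr_fun measurableSet_Ioc e2,
    ← intervalIntegral.integral_of_le h12, ← intervalIntegral.integral_of_le h12,
    intervalIntegral.integral_add iA iD, intervalIntegral.integral_sub iA iB, hCE]
  ring

lemma alG_FP (P : Measure (Td d × Vd d)) [IsProbabilityMeasure P] {δ : ℝ} (hδ : 0 < δ) [IsFiniteMeasure (twG δ P)] {R : ℝ} (hR0 : 0 ≤ R) (hR : ∀ᵐ p ∂P, ‖p.2‖ ≤ R)
    {s₁ s₂ : ℝ} (h1 : 0 ≤ s₁) (h12 : s₁ ≤ s₂) : FPeq 1 (mG P) (alG δ P R) s₁ s₂ := by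
  intro φ h
  obtain ⟨C, hC0, hC⟩ := genr_bdd h R s₂
  have hC' : ∀ s ∈ Set.Ioc s₁ s₂, ∀ v : Vd d, ‖v‖ ≤ R → ∀ x,
    |genr φ v s x| ≤ C ∧ |tderiv φ s x + 1 * lapl (φ s) x| ≤ C ∧ ‖gradv (φ s) x‖ ≤ C := fun s hs =>
    hC s (by rw [abs_of_nonneg (h1.trans hs.1.le)]; exact hs.2)
  have hmS : Measurable (fun q : ℝ × Td d => (q.1, secT q.2)) := by
    exact measurable_fst.prodMk (measurable_secT.comp measurable_snd)
  have hgm : Measurable (fun q : ℝ × Td d => gradv (φ q.1) (secT q.2)) := (tf_grad_cont h).measurable.comp hmS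
  have htm : Measurable (fun q : ℝ × Td d => tderiv φ q.1 (secT q.2) + 1 * lapl (φ q.1) (secT q.2)) :=
    ((tf_tderiv_cont h).measurable.comp hmS).add (((tf_lapl_cont h).measurable.comp hmS).const_mul 1)
  rw [ito_P P hR h h1 h12]
  exact alG_FP_aux P hδ hR0 hR h1 h12 htm hgm hC0 (fun q hq => (hC' q.1 hq 0 (by simpa using hR0) _).2.1)
    (fun q hq => (hC' q.1 hq 0 (by simpa using hR0) _).2.2)
end

open ProbabilityTheory

section
variable {d : ℕ}

lemma Fc_contOn (S : MFGSetting d) {m : ℝ → PTd d} {I : Set ℝ} (hm : W1ContOn m I) : ContinuousOn (fun s => S.Fc (m s)) I := by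
  obtain ⟨L, hL, h⟩ := Fc_lip S
  rw [Metric.continuousOn_iff]
  intro t ht ε hε
  obtain ⟨η, hη, h'⟩ := hm t ht (ε / L) (by positivity)
  refine ⟨η, hη, fun s hs hst => ?_⟩
  rw [Real.dist_eq] at hst ⊢
  have h1 := h' s hs hst
  have h2 := h (m t) (m s)
  rw [W1_symm] at h2
  rw [lt_div_iff₀ hL] at h1
  linarith

lemma runCost_meas (S : MFGSetting d) {m : ℝ → PTd d} (hm : W1ContOn m (Set.Ici 0)) {α : ℝ → Td d → Vd d}
    (hα : Measurable (fun q : ℝ × Td d => α q.1 q.2)) :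
    AEStronglyMeasurable (runCost S m α) (volume.restrict (Set.Ioi 0)) := by
  have h1 : AEStronglyMeasurable (fun s => S.Fc (m s)) (volume.restrict (Set.Ioi 0)) :=
    ((Fc_contOn S hm).mono Set.Ioi_subset_Ici_self).aestronglyMeasurable measurableSet_Ioi
  have h2 : StronglyMeasurable (fun s => ∫ y, Lt S y (α s y) ∂(mKer m hm s)) :=
    (measurable_Lα S hα).stronglyMeasurable.integral_kernel_prod_right'
  have h3 : AEStronglyMeasurable (fun s => ∫ y, Lt S y (α s y) ∂(m s : Measure (Td d))) (volume.restrict (Set.Ioi 0)) := by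
    refine h2.aestronglyMeasurable.congr ?_
    filter_upwards [ae_restrict_mem measurableSet_Ioi] with s hs
    rw [mKer_apply m hm (le_of_lt hs)]
  exact h3.add h1

lemma mG_adm (S : MFGSetting d) (P : Measure (Td d × Vd d)) [IsProbabilityMeasure P] {δ : ℝ} (hδ : 0 < δ) [IsFiniteMeasure (twG δ P)]
    {R : ℝ} (hR0 : 0 ≤ R) (hR : ∀ᵐ p ∂P, ‖p.2‖ ≤ R) :
    AdmDisc S 1 δ (mG P 0) (mG P) (alG δ P R) := by
  have hm := mG_cont P hR (Set.Ici 0)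
  refine ⟨rfl, hm, fun s₁ s₂ h1 h12 => alG_FP P hδ hR0 hR h1 h12, alG_meas P R, ?_, ?_⟩
  · have hb : ∀ s, ∫⁻ y, ENNReal.ofReal (sqnorm (alG δ P R s y)) ∂(mG P s : Measure (Td d)) ≤ ENNReal.ofReal (d * R^2) := by
      intro s
      calc _ ≤ ∫⁻ y, ENNReal.ofReal (d * R^2) ∂(mG P s : Measure (Td d)) := by
            refine lintegral_mono fun y => ENNReal.ofReal_le_ofReal ((sqnorm_le _).trans ?_)
            have := alG_bdd (δ := δ) P hR0 s y
            gcongr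
        _ = _ := by simp
    calc _ ≤ ∫⁻ s in Set.Ioi (0:ℝ), ENNReal.ofReal (Real.exp (-δ * s)) * ENNReal.ofReal (d * R^2) :=
          lintegral_mono fun s => mul_le_mul_right (hb s) _
      _ = (∫⁻ s in Set.Ioi (0:ℝ), ENNReal.ofReal (Real.exp (-δ * s))) * ENNReal.ofReal (d * R^2) := by
          rw [lintegral_mul_const' _ _ ENNReal.ofReal_ne_top]
      _ < ⊤ := by
          refine ENNReal.mul_lt_top ?_ ENNReal.ofReal_lt_top
          have := (exp_int hδ).2
          rwa [hasFiniteIntegral_iff_ofReal (Eventually.of_forall fun s => (Real.exp_pos _).le)] at this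
  · obtain ⟨B, hB0, hB⟩ := Lt_bdd S R
    obtain ⟨M, hM⟩ := S.Fc_bounded
    refine Integrable.mul_bdd (c := B + M) (exp_int hδ) (runCost_meas S hm (alG_meas P R)) ?_
    refine Eventually.of_forall fun s => ?_
    have h1 := norm_integral_le_of_norm_le_const (μ := (mG P s : Measure (Td d))) (f := fun y => Lt S y (alG δ P R s y)) (C := B)
      (Eventually.of_forall fun y => hB y _ (alG_bdd P hR0 _ _))
    have h2 := hM (mG P s)
    simp only [probReal_univ, mul_one] at h1
    exact (norm_add_le _ _).trans (add_le_add h1 h2)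

/-- lower bound of running cost -/
lemma runCost_lower (S : MFGSetting d) : ∃ C : ℝ, 0 < C ∧ ∀ (m : ℝ → PTd d) (α : ℝ → Td d → Vd d) s, -C ≤ runCost S m α s := by
  obtain ⟨c, C, hc, hC, h1, h2⟩ := Lt_growth S
  obtain ⟨M, hM⟩ := S.Fc_bounded
  have hM0 : 0 ≤ M := (abs_nonneg _).trans (hM ⟨Measure.dirac 0, inferInstance⟩)
  refine ⟨C + M, by positivity, fun m α s => ?_⟩
  have h3 := (abs_le.1 (hM (m s))).1
  have h4 : -C ≤ ∫ y, Lt S y (α s y) ∂(m s : Measure (Td d)) := by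
    by_cases hi : Integrable (fun y => Lt S y (α s y)) (m s : Measure (Td d))
    · have := integral_mono (integrable_const (-C)) hi (fun y => by
        have := h1 y (α s y)
        have h5 : 0 ≤ c * ‖α s y‖^2 := by positivity
        simp only; linarith)
      simpa using this
    · rw [integral_undef hi]; linarith
  unfold runCost
  change -C ≤ ∫ y, S.Hstar (secT y) (α s y) ∂(m s : Measure (Td d)) at h4
  linarith

lemma costDisc_lower (S : MFGSetting d) : ∃ C : ℝ, 0 < C ∧ ∀ (δ : ℝ), 0 < δ → ∀ (μ : PTd d) (m : ℝ → PTd d) (α : ℝ → Td d → Vd d),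
    AdmDisc S 1 δ μ m α → -(C / δ) ≤ costDisc S δ m α := by
  obtain ⟨C, hC, h⟩ := runCost_lower S
  refine ⟨C, hC, fun δ hδ μ m α hA => ?_⟩
  have h1 := integral_mono ((exp_int hδ).const_mul (-C)) hA.2.2.2.2.2 (fun s => by
    have := mul_le_mul_of_nonneg_left (h m α s) (Real.exp_pos (-δ * s)).le
    simp only; linarith)
  rw [integral_const_mul, exp_integral hδ] at h1
  unfold costDisc
  refine le_trans (le_of_eq ?_) h1
  ring

lemma Vfun_le (S : MFGSetting d) {δ : ℝ} (hδ : 0 < δ) {μ : PTd d} {m : ℝ → PTd d} {α : ℝ → Td d → Vd d} (hA : AdmDisc S 1 δ μ m α) :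
    Vfun S 1 δ μ ≤ costDisc S δ m α := by
  obtain ⟨C, hC, h⟩ := costDisc_lower S
  refine csInf_le ⟨-(C / δ), ?_⟩ ⟨m, α, hA, rfl⟩
  rintro r ⟨m', α', hA', rfl⟩
  exact h δ hδ _ _ _ hA'

/-- zero control -/
lemma zero_adm (S : MFGSetting d) : ∃ C : ℝ, 0 < C ∧ ∀ (δ : ℝ), 0 < δ → ∀ (μ : PTd d), ∃ m α,
    AdmDisc S 1 δ μ m α ∧ costDisc S δ m α ≤ C / δ := by
  obtain ⟨B, hB0, hB⟩ := Lt_bdd S 0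
  obtain ⟨M, hM⟩ := S.Fc_bounded
  have hM0 : 0 ≤ M := (abs_nonneg _).trans (hM ⟨Measure.dirac 0, inferInstance⟩)
  refine ⟨B + M + 1, by positivity, fun δ hδ μ => ?_⟩
  let P : Measure (Td d × Vd d) := (μ : Measure (Td d)).map (fun y => (y, 0))
  have hmm : Measurable (fun y : Td d => (y, (0 : Vd d))) := by fun_prop
  haveI : IsProbabilityMeasure P := Measure.isProbabilityMeasure_map hmm.aemeasurable
  have hR : ∀ᵐ p ∂P, ‖p.2‖ ≤ 0 := by
    rw [ae_map_iff hmm.aemeasurable (measurableSet_le (by fun_prop) measurable_const)]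
    exact Eventually.of_forall fun y => by simp
  haveI := twG_fin hδ P
  have hA := mG_adm S P hδ le_rfl hR
  have h0 : mG P 0 = μ := by
    apply Subtype.ext
    change (mG P 0 : Measure (Td d)) = μ
    rw [mG_zero, Measure.map_map measurable_fst hmm]
    exact Measure.map_id
  rw [h0] at hA
  refine ⟨_, _, hA, ?_⟩
  unfold costDisc
  have h1 := integral_mono hA.2.2.2.2.2 ((exp_int hδ).const_mul (B + M + 1)) (fun s => by
    have h1 := norm_integral_le_of_norm_le_const (μ := (mG P s : Measure (Td d))) (f := fun y => Lt S y (alG δ P 0 s y)) (C := B)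
      (Eventually.of_forall fun y => hB y _ (alG_bdd P le_rfl _ _))
    have h2 := (abs_le.1 (hM (mG P s))).2
    simp only [probReal_univ, mul_one] at h1
    have h3 : runCost S (mG P) (alG δ P 0) s ≤ B + M + 1 := by
      have := (abs_le.1 h1).2
      unfold runCost
      change ∫ y, S.Hstar (secT y) (alG δ P 0 s y) ∂(mG P s : Measure (Td d)) ≤ B at this
      linarith
    have := mul_le_mul_of_nonneg_left h3 (Real.exp_pos (-δ * s)).le
    simp only; linarith)
  rw [integral_const_mul, exp_integral hδ] at h1
  refine h1.trans (le_of_eq ?_)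
  ring

lemma V_nonempty (S : MFGSetting d) {δ : ℝ} (hδ : 0 < δ) (μ : PTd d) : { r | ∃ m α, AdmDisc S 1 δ μ m α ∧ r = costDisc S δ m α }.Nonempty := by
  obtain ⟨C, hC, h⟩ := zero_adm S
  obtain ⟨m, α, hA, _⟩ := h δ hδ μ
  exact ⟨_, m, α, hA, rfl⟩

lemma V_bdd (S : MFGSetting d) : ∃ C : ℝ, 0 < C ∧ ∀ (δ : ℝ), 0 < δ → ∀ (μ : PTd d), |Vfun S 1 δ μ| ≤ C / δ := by
  obtain ⟨C1, hC1, h1⟩ := zero_adm S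
  obtain ⟨C2, hC2, h2⟩ := costDisc_lower S
  refine ⟨C1 + C2, by positivity, fun δ hδ μ => ?_⟩
  obtain ⟨m, α, hA, h⟩ := h1 δ hδ μ
  have a1 : 0 < C1 / δ := by positivity
  have a2 : 0 < C2 / δ := by positivity
  rw [add_div, abs_le]
  constructor
  · have : -(C2/δ) ≤ Vfun S 1 δ μ := le_csInf (V_nonempty S hδ μ) (by
      rintro r ⟨m', α', hA', rfl⟩
      exact h2 δ hδ _ _ _ hA')
    linarith
  · have := Vfun_le S hδ hA
    linarith
end

open ProbabilityTheory

section
variable {d : ℕ}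

lemma IsTestFun.shift {φ : ℝ → Vd d → ℝ} (h : IsTestFun φ) (τ : ℝ) : IsTestFun (fun s => φ (s + τ)) := by
  refine ⟨?_, fun t x z => h.2 _ x z⟩
  have : ContDiff ℝ 2 (fun q : ℝ × Vd d => ((q.1 + τ, q.2) : ℝ × Vd d)) := by fun_prop
  exact h.1.comp this

lemma tderiv_shift (φ : ℝ → Vd d → ℝ) (τ s : ℝ) (x : Vd d) : tderiv (fun s => φ (s + τ)) s x = tderiv φ (s + τ) x := by
  unfold tderiv
  exact deriv_comp_add_const (f := fun r => φ r x) (a := τ) (x := s)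

/-- integrand of FP -/
def fpI (φ : ℝ → Vd d → ℝ) (m : ℝ → PTd d) (α : ℝ → Td d → Vd d) (s : ℝ) : ℝ :=
  ∫ y, (tderiv φ s (secT y) + 1 * lapl (φ s) (secT y) - dotp (α s y) (gradv (φ s) (secT y))) ∂(m s : Measure (Td d))

lemma fpI_shift (φ : ℝ → Vd d → ℝ) (m : ℝ → PTd d) (α : ℝ → Td d → Vd d) (τ s : ℝ) :
    fpI (fun s => φ (s + τ)) (fun s => m (s + τ)) (fun s => α (s + τ)) s = fpI φ m α (s + τ) := by
  unfold fpI
  simp only [tderiv_shift]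

lemma FPeq_iff (m : ℝ → PTd d) (α : ℝ → Td d → Vd d) (s₁ s₂ : ℝ) : FPeq 1 m α s₁ s₂ ↔ ∀ φ : ℝ → Vd d → ℝ, IsTestFun φ →
    (∫ y, φ s₂ (secT y) ∂(m s₂ : Measure (Td d))) - (∫ y, φ s₁ (secT y) ∂(m s₁ : Measure (Td d))) = ∫ s in s₁..s₂, fpI φ m α s := Iff.rfl

lemma FPeq_shift {m : ℝ → PTd d} {α : ℝ → Td d → Vd d} {τ s₁ s₂ : ℝ} :
    FPeq 1 (fun s => m (s + τ)) (fun s => α (s + τ)) s₁ s₂ ↔ FPeq 1 m α (s₁ + τ) (s₂ + τ) := by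
  rw [FPeq_iff, FPeq_iff]
  constructor
  · intro h φ hφ
    have := h _ (hφ.shift τ)
    simp only [fpI_shift] at this
    rw [intervalIntegral.integral_comp_add_right (fun s => fpI φ m α s)] at this
    exact this
  · intro h φ hφ
    have := h _ (hφ.shift (-τ))
    have e : φ = fun s => (fun r => φ (r + -τ)) (s + τ) := by funext s; simp
    rw [e]
    simp only [fpI_shift (fun r => φ (r + -τ))]
    rw [intervalIntegral.integral_comp_add_right (fun s => fpI (fun r => φ (r + -τ)) m α s)]
    exact this

lemma fpI_int {m : ℝ → PTd d} (hm : W1ContOn m (Set.Ici 0)) {α : ℝ → Td d → Vd d}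
    (hα : Measurable (fun q : ℝ × Td d => α q.1 q.2)) {a b : ℝ} (ha : 0 ≤ a) (hab : a ≤ b)
    (hE : Integrable (fun q : ℝ × Td d => sqnorm (α q.1 q.2)) (Mst m hm a b)) {φ : ℝ → Vd d → ℝ} (h : IsTestFun φ) :
    IntervalIntegrable (fpI φ m α) volume a b := by
  obtain ⟨C, hC0, hC⟩ := genr_bdd h 0 b
  have hmS : Measurable (fun q : ℝ × Td d => (q.1, secT q.2)) := by
    exact measurable_fst.prodMk (measurable_secT.comp measurable_snd)
  have hgm : Measurable (fun q : ℝ × Td d => gradv (φ q.1) (secT q.2)) := (tf_grad_cont h).measurable.comp hmS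
  have htm : Measurable (fun q : ℝ × Td d => tderiv φ q.1 (secT q.2) + 1 * lapl (φ q.1) (secT q.2)) :=
    ((tf_tderiv_cont h).measurable.comp hmS).add (((tf_lapl_cont h).measurable.comp hmS).const_mul 1)
  refine (Mst_int hm ha hab (g := fun q => tderiv φ q.1 (secT q.2) + 1 * lapl (φ q.1) (secT q.2) - dotp (α q.1 q.2) (gradv (φ q.1) (secT q.2))) ?_).1
  refine Integrable.mono' (((integrable_const (C + d * C)).add (hE.const_mul (d * C)))) (htm.sub (dotp_meas hα hgm)).aestronglyMeasurable ?_
  filter_upwards [Mst_ae hm] with q hq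
  have hq' := hC q.1 (by rw [abs_of_nonneg (ha.trans hq.1.le)]; exact hq.2) 0 (by simp) (secT q.2)
  have h1 := le_sqnorm (α q.1 q.2)
  have h2 := dotp_bound (le_refl ‖α q.1 q.2‖) hq'.2.2
  have h3 : ‖α q.1 q.2‖ ≤ 1 + sqnorm (α q.1 q.2) := by nlinarith [sq_nonneg (‖α q.1 q.2‖ - 1)]
  have h4 : d * ‖α q.1 q.2‖ * C ≤ d * (1 + sqnorm (α q.1 q.2)) * C := by gcongr
  refine (norm_sub_le _ _).trans ?_
  simp only [Real.norm_eq_abs, Pi.add_apply]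
  have := hq'.2.1
  nlinarith

lemma volIoi (τ : ℝ) : (volume.restrict (Set.Ioi 0)).map (fun s : ℝ => s + τ) = volume.restrict (Set.Ioi τ) := by
  have h := (measurePreserving_add_right (volume : Measure ℝ) τ).restrict_preimage (measurableSet_Ioi (a := τ))
  have e : (fun x => x + τ) ⁻¹' Set.Ioi τ = Set.Ioi 0 := by ext s; simp
  rw [e] at h
  exact h.map_eq

lemma embAdd (τ : ℝ) : MeasurableEmbedding (fun s : ℝ => s + τ) := (Homeomorph.addRight τ).measurableEmbedding

lemma Ioi_split {τ : ℝ} (hτ : 0 ≤ τ) : Set.Ioi (0:ℝ) = Set.Ioc 0 τ ∪ Set.Ioi τ := (Set.Ioc_union_Ioi_eq_Ioi hτ).symm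

lemma expsplit (δ τ s : ℝ) : Real.exp (-δ * (s + τ)) = Real.exp (-δ * τ) * Real.exp (-δ * s) := by
  rw [← Real.exp_add]; ring_nf

lemma int_Ioi_shift {δ τ : ℝ} {f : ℝ → ℝ} :
    (Integrable (fun s => Real.exp (-δ * s) * f s) (volume.restrict (Set.Ioi τ)) ↔
      Integrable (fun s => Real.exp (-δ * s) * f (s + τ)) (volume.restrict (Set.Ioi 0))) ∧
    ∫ s in Set.Ioi τ, Real.exp (-δ * s) * f s = Real.exp (-δ * τ) * ∫ s in Set.Ioi (0:ℝ), Real.exp (-δ * s) * f (s + τ) := by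
  rw [← volIoi τ, (embAdd τ).integrable_map_iff, (embAdd τ).integral_map]
  have e : (fun s => Real.exp (-δ * s) * f s) ∘ (fun s => s + τ) = fun s => Real.exp (-δ * τ) * (Real.exp (-δ * s) * f (s + τ)) := by
    funext s; simp only [Function.comp]; rw [expsplit]; ring
  constructor
  · rw [e, integrable_const_mul_iff (Ne.isUnit (Real.exp_pos _).ne')]
  · rw [← integral_const_mul]
    exact integral_congr_ae (Eventually.of_forall fun s => congrFun e s)

lemma lint_Ioi_shift {δ τ : ℝ} {f : ℝ → ENNReal} :
    ∫⁻ s in Set.Ioi τ, ENNReal.ofReal (Real.exp (-δ * s)) * f s = ENNReal.ofReal (Real.exp (-δ * τ)) * ∫⁻ s in Set.Ioi (0:ℝ), ENNReal.ofReal (Real.exp (-δ * s)) * f (s + τ) := by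
  rw [← volIoi τ, (embAdd τ).lintegral_map, ← lintegral_const_mul' _ _ ENNReal.ofReal_ne_top]
  refine lintegral_congr fun s => ?_
  rw [expsplit, ENNReal.ofReal_mul (Real.exp_pos _).le, mul_assoc]

lemma runCost_shift (S : MFGSetting d) (m : ℝ → PTd d) (α : ℝ → Td d → Vd d) (τ s : ℝ) :
    runCost S (fun s => m (s + τ)) (fun s => α (s + τ)) s = runCost S m α (s + τ) := rfl

lemma cost_split (S : MFGSetting d) {δ : ℝ} {m : ℝ → PTd d} {α : ℝ → Td d → Vd d} {τ : ℝ} (hτ : 0 ≤ τ)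
    (hi : Integrable (fun s => Real.exp (-δ * s) * runCost S m α s) (volume.restrict (Set.Ioi 0))) :
    costDisc S δ m α = (∫ s in (0:ℝ)..τ, Real.exp (-δ * s) * runCost S m α s) +
      Real.exp (-δ * τ) * costDisc S δ (fun s => m (s + τ)) (fun s => α (s + τ)) := by
  unfold costDisc
  simp only [runCost_shift]
  rw [← (int_Ioi_shift (δ := δ) (τ := τ) (f := runCost S m α)).2, intervalIntegral.integral_of_le hτ, Ioi_split hτ]
  change IntegrableOn _ _ _ at hi
  rw [Ioi_split hτ] at hi
  exact setIntegral_union (Set.disjoint_left.2 fun x hx hx' => absurd hx' (not_lt.2 hx.2)) measurableSet_Ioi hi.left_of_union hi.right_of_union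

lemma adm_shift (S : MFGSetting d) {δ : ℝ} {μ : PTd d} {m : ℝ → PTd d} {α : ℝ → Td d → Vd d} {τ : ℝ} (hτ : 0 ≤ τ)
    (hA : AdmDisc S 1 δ μ m α) : AdmDisc S 1 δ (m τ) (fun s => m (s + τ)) (fun s => α (s + τ)) := by
  obtain ⟨h0, hm, hF, hα, hE, hi⟩ := hA
  refine ⟨by simp, ?_, ?_, ?_, ?_, ?_⟩
  · intro t ht ε hε
    obtain ⟨η, hη, h⟩ := hm (t + τ) (add_nonneg ht hτ) ε hε
    refine ⟨η, hη, fun s hs hst => h _ (add_nonneg hs hτ) (by simpa using hst)⟩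
  · intro s₁ s₂ h1 h12
    rw [FPeq_shift]
    exact hF _ _ (by linarith) (by linarith)
  · exact hα.comp (g := fun q : ℝ × Td d => α q.1 q.2) (f := fun q : ℝ × Td d => (q.1 + τ, q.2)) (by fun_prop)
  · have h1 := lint_Ioi_shift (δ := δ) (τ := τ) (f := fun s => ∫⁻ y, ENNReal.ofReal (sqnorm (α s y)) ∂(m s : Measure (Td d)))
    have h2 := lintegral_mono_set (μ := volume) (Set.Ioi_subset_Ioi hτ)
      (f := fun s => ENNReal.ofReal (Real.exp (-δ * s)) * ∫⁻ y, ENNReal.ofReal (sqnorm (α s y)) ∂(m s : Measure (Td d)))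
    have h3 := h2.trans_lt hE
    rw [h1] at h3
    exact (ENNReal.mul_lt_top_iff.1 h3).elim (fun h => h.2) (fun h => h.elim (fun h => absurd h (by simp [Real.exp_pos])) (fun h => by rw [h]; simp))
  · simp only [runCost_shift]
    rw [← int_Ioi_shift.1]
    exact IntegrableOn.mono_set hi (Set.Ioi_subset_Ioi hτ)

/-- DPP lower bound -/
lemma dpp_lower (S : MFGSetting d) {δ : ℝ} (hδ : 0 < δ) {μ : PTd d} {m : ℝ → PTd d} {α : ℝ → Td d → Vd d} {τ : ℝ} (hτ : 0 ≤ τ)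
    (hA : AdmDisc S 1 δ μ m α) :
    (∫ s in (0:ℝ)..τ, Real.exp (-δ * s) * runCost S m α s) + Real.exp (-δ * τ) * Vfun S 1 δ (m τ) ≤ costDisc S δ m α := by
  rw [cost_split S hτ hA.2.2.2.2.2]
  have := Vfun_le S hδ (adm_shift S hτ hA)
  have h2 := mul_le_mul_of_nonneg_left this (Real.exp_pos (-δ * τ)).le
  linarith
end

open ProbabilityTheory

section
variable {d : ℕ}

open Classical in
def cat {E : Type*} (τ : ℝ) (f g : ℝ → E) (s : ℝ) : E := if s ≤ τ then f s else g (s - τ)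

lemma cat_le {E : Type*} {τ : ℝ} {f g : ℝ → E} {s : ℝ} (h : s ≤ τ) : cat τ f g s = f s := if_pos h
lemma cat_gt {E : Type*} {τ : ℝ} {f g : ℝ → E} {s : ℝ} (h : τ < s) : cat τ f g s = g (s - τ) := if_neg (not_le.2 h)
lemma cat_ge {E : Type*} {τ : ℝ} {f g : ℝ → E} {s : ℝ} (h : τ ≤ s) (h0 : g 0 = f τ) : cat τ f g s = g (s - τ) := by
  rcases h.eq_or_lt with rfl | h
  · rw [cat_le le_rfl]; simp [h0]
  · exact cat_gt h

lemma cat_cont {τ : ℝ} {m1 m2 : ℝ → PTd d} (h0 : m2 0 = m1 τ) (h1 : W1ContOn m1 (Set.Ici 0)) (h2 : W1ContOn m2 (Set.Ici 0)) :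
    W1ContOn (cat τ m1 m2) (Set.Ici 0) := by
  intro t ht ε hε
  have A : ∃ η > 0, ∀ s ∈ Set.Ici (0:ℝ), |s - t| < η → s ≤ τ → W1 (cat τ m1 m2 s) (cat τ m1 m2 t) < ε := by
    rcases le_or_gt t τ with htτ | htτ
    · obtain ⟨η, hη, h⟩ := h1 t ht ε hε
      refine ⟨η, hη, fun s hs hst hsτ => ?_⟩
      rw [cat_le hsτ, cat_le htτ]; exact h s hs hst
    · refine ⟨t - τ, by linarith, fun s hs hst hsτ => ?_⟩
      rw [abs_lt] at hst; linarith
  have B : ∃ η > 0, ∀ s ∈ Set.Ici (0:ℝ), |s - t| < η → τ ≤ s → W1 (cat τ m1 m2 s) (cat τ m1 m2 t) < ε := by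
    rcases le_or_gt τ t with htτ | htτ
    · obtain ⟨η, hη, h⟩ := h2 (t - τ) (by simpa using htτ) ε hε
      refine ⟨η, hη, fun s hs hst hsτ => ?_⟩
      rw [cat_ge hsτ h0, cat_ge htτ h0]
      exact h _ (by simpa using hsτ) (by simpa using hst)
    · refine ⟨τ - t, by linarith, fun s hs hst hsτ => ?_⟩
      rw [abs_lt] at hst; linarith
  obtain ⟨η1, hη1, A⟩ := A
  obtain ⟨η2, hη2, B⟩ := B
  refine ⟨min η1 η2, lt_min hη1 hη2, fun s hs hst => ?_⟩
  rcases le_total s τ with h | h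
  · exact A s hs (hst.trans_le (min_le_left _ _)) h
  · exact B s hs (hst.trans_le (min_le_right _ _)) h

lemma adm_cat (S : MFGSetting d) {δ : ℝ} (hδ : 0 < δ) {μ : PTd d} {m1 m2 : ℝ → PTd d} {α1 α2 : ℝ → Td d → Vd d} {τ : ℝ} (hτ : 0 ≤ τ)
    (hA1 : AdmDisc S 1 δ μ m1 α1) (hA2 : AdmDisc S 1 δ (m1 τ) m2 α2) :
    AdmDisc S 1 δ μ (cat τ m1 m2) (cat τ α1 α2) ∧
    costDisc S δ (cat τ m1 m2) (cat τ α1 α2) = (∫ s in (0:ℝ)..τ, Real.exp (-δ * s) * runCost S m1 α1 s) +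
      Real.exp (-δ * τ) * costDisc S δ m2 α2 := by
  obtain ⟨h0, hm1, hF1, hα1, hE1, hi1⟩ := hA1
  obtain ⟨h02, hm2, hF2, hα2, hE2, hi2⟩ := hA2
  have hmc := cat_cont h02 hm1 hm2
  have hαc : Measurable (fun q : ℝ × Td d => cat τ α1 α2 q.1 q.2) := by
    have : (fun q : ℝ × Td d => cat τ α1 α2 q.1 q.2) = fun q => if q.1 ≤ τ then α1 q.1 q.2 else α2 (q.1 - τ) q.2 := by
      funext q; unfold cat; split_ifs <;> rfl
    rw [this]
    refine Measurable.ite (measurableSet_le measurable_fst measurable_const) hα1 ?_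
    exact hα2.comp (g := fun q : ℝ × Td d => α2 q.1 q.2) (f := fun q : ℝ × Td d => (q.1 - τ, q.2)) (by fun_prop)
  have r1 : ∀ s, s ≤ τ → runCost S (cat τ m1 m2) (cat τ α1 α2) s = runCost S m1 α1 s := by
    intro s hs; unfold runCost; rw [cat_le hs, cat_le hs]
  have r2 : ∀ s, 0 < s → runCost S (cat τ m1 m2) (cat τ α1 α2) (s + τ) = runCost S m2 α2 s := by
    intro s hs; unfold runCost; rw [cat_gt (by linarith), cat_gt (by linarith)]; simp
  have hi : Integrable (fun s => Real.exp (-δ * s) * runCost S (cat τ m1 m2) (cat τ α1 α2) s) (volume.restrict (Set.Ioi 0)) := by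
    change IntegrableOn _ _ _
    rw [Ioi_split hτ]
    refine IntegrableOn.union ?_ ?_
    · refine (IntegrableOn.mono_set (s := Set.Ioc 0 τ) hi1 (fun s hs => hs.1)).congr_fun (fun s hs => ?_) measurableSet_Ioc
      simp only [r1 s hs.2]
    · refine (int_Ioi_shift.1).2 ?_
      refine IntegrableOn.congr_fun hi2 (fun s hs => ?_) measurableSet_Ioi
      simp only [r2 s hs]
  refine ⟨⟨by rw [cat_le hτ, h0], hmc, ?_, hαc, ?_, hi⟩, ?_⟩
  · have F1 : ∀ s₁ s₂, 0 ≤ s₁ → s₁ ≤ s₂ → s₂ ≤ τ → FPeq 1 (cat τ m1 m2) (cat τ α1 α2) s₁ s₂ := by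
      intro s₁ s₂ h1 h12 h2
      rw [FPeq_iff]
      intro φ hφ
      rw [cat_le h2, cat_le (h12.trans h2)]
      rw [(FPeq_iff _ _ _ _).1 (hF1 s₁ s₂ h1 h12) φ hφ]
      refine intervalIntegral.integral_congr_ae (Eventually.of_forall fun s hs => ?_)
      rw [Set.uIoc_of_le h12] at hs
      unfold fpI
      rw [cat_le (hs.2.trans h2), cat_le (hs.2.trans h2)]
    have F2 : ∀ s₁ s₂, τ ≤ s₁ → s₁ ≤ s₂ → FPeq 1 (cat τ m1 m2) (cat τ α1 α2) s₁ s₂ := by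
      intro s₁ s₂ h1 h12
      have key : FPeq 1 (fun s => cat τ m1 m2 (s + τ)) (fun s => cat τ α1 α2 (s + τ)) (s₁ - τ) (s₂ - τ) := by
        rw [FPeq_iff]
        intro φ hφ
        simp only [sub_add_cancel]
        rw [cat_ge h1 h02, cat_ge (h1.trans h12) h02, (FPeq_iff _ _ _ _).1 (hF2 (s₁ - τ) (s₂ - τ) (by linarith) (by linarith)) φ hφ]
        refine intervalIntegral.integral_congr_ae (Eventually.of_forall fun s hs => ?_)
        rw [Set.uIoc_of_le (by linarith)] at hs
        have : τ < s + τ := by linarith [hs.1]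
        unfold fpI
        simp only [cat_gt this, add_sub_cancel_right]
      rw [FPeq_shift] at key
      simpa using key
    intro s₁ s₂ h1 h12
    rcases le_total s₂ τ with h | h
    · exact F1 s₁ s₂ h1 h12 h
    rcases le_total τ s₁ with h' | h'
    · exact F2 s₁ s₂ h' h12
    have G1 := F1 s₁ τ h1 h' le_rfl
    have G2 := F2 τ s₂ le_rfl h
    have E1 : Integrable (fun q : ℝ × Td d => sqnorm (α1 q.1 q.2)) (Mst m1 hm1 s₁ τ) := energy_int hm1 hα1 hδ hE1 h1
    have E2 : Integrable (fun q : ℝ × Td d => sqnorm (α2 q.1 q.2)) (Mst m2 hm2 0 (s₂ - τ)) := energy_int hm2 hα2 hδ hE2 le_rfl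
    rw [FPeq_iff] at G1 G2 ⊢
    intro φ hφ
    have I1 := fpI_int hm1 hα1 h1 h' E1 hφ
    have I2 := fpI_int hm2 hα2 le_rfl (by linarith) E2 (hφ.shift τ)
    have I1' : IntervalIntegrable (fpI φ (cat τ m1 m2) (cat τ α1 α2)) volume s₁ τ := by
      refine I1.congr (fun s hs => ?_)
      rw [Set.uIoc_of_le h'] at hs
      unfold fpI
      rw [cat_le hs.2, cat_le hs.2]
    have I2' : IntervalIntegrable (fpI φ (cat τ m1 m2) (cat τ α1 α2)) volume τ s₂ := by
      have J := I2.comp_sub_right τ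
      simp only [zero_add, sub_add_cancel] at J
      refine J.congr (fun s hs => ?_)
      rw [Set.uIoc_of_le h] at hs
      have : fpI (fun s => φ (s + τ)) m2 α2 (s - τ) = fpI (fun s => φ (s + τ)) (fun s => cat τ m1 m2 (s + τ)) (fun s => cat τ α1 α2 (s + τ)) (s - τ) := by
        unfold fpI
        simp only [sub_add_cancel]
        rw [cat_gt hs.1, cat_gt hs.1]
      simp only [this, fpI_shift]
      simp
    have := intervalIntegral.integral_add_adjacent_intervals I1' I2'
    rw [← this, ← G1 φ hφ, ← G2 φ hφ]
    ring
  · rw [Ioi_split hτ, lintegral_union measurableSet_Ioi (Set.disjoint_left.2 fun x hx hx' => absurd hx' (not_lt.2 hx.2)), lint_Ioi_shift]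
    refine ENNReal.add_lt_top.2 ⟨?_, ENNReal.mul_lt_top ENNReal.ofReal_lt_top ?_⟩
    · refine lt_of_le_of_lt ?_ hE1
      refine le_trans (le_of_eq ?_) (lintegral_mono_set (s := Set.Ioc 0 τ) fun s hs => hs.1)
      refine setLIntegral_congr_fun measurableSet_Ioc (fun s hs => ?_)
      simp only [cat_le hs.2]
    · refine lt_of_le_of_lt (le_of_eq ?_) hE2
      refine setLIntegral_congr_fun measurableSet_Ioi (fun s hs => ?_)
      have : τ < s + τ := by linarith [Set.mem_Ioi.1 hs]
      simp only [cat_gt this, add_sub_cancel_right]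
  · rw [cost_split S hτ hi]
    congr 1
    · refine intervalIntegral.integral_congr_ae (Eventually.of_forall fun s hs => ?_)
      rw [Set.uIoc_of_le hτ] at hs
      rw [r1 s hs.2]
    · congr 1
      unfold costDisc
      refine setIntegral_congr_fun measurableSet_Ioi (fun s hs => ?_)
      simp only [runCost_shift, r2 s hs]

/-- one-step DPP upper bound -/
lemma dpp_upper (S : MFGSetting d) {δ : ℝ} (hδ : 0 < δ) (P : Measure (Td d × Vd d)) [IsProbabilityMeasure P]
    {R : ℝ} (hR0 : 0 ≤ R) (hR : ∀ᵐ p ∂P, ‖p.2‖ ≤ R) {τ : ℝ} (hτ : 0 ≤ τ) :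
    Vfun S 1 δ (mG P 0) ≤ (∫ s in (0:ℝ)..τ, Real.exp (-δ * s) * ∫ p, Lt S (stX s p) (-p.1.2) ∂(P.prod (gam d))) +
      (∫ s in (0:ℝ)..τ, Real.exp (-δ * s) * S.Fc (mG P s)) + Real.exp (-δ * τ) * Vfun S 1 δ (mG P τ) := by
  haveI := twG_fin hδ P
  have hA := mG_adm S P hδ hR0 hR
  have hm := mG_cont P hR (Set.Ici 0)
  have hexp := Real.exp_pos (-δ * τ)
  refine le_of_forall_pos_le_add fun ε hε => ?_
  obtain ⟨r, ⟨m2, α2, hA2, rfl⟩, hr⟩ := exists_lt_of_csInf_lt (V_nonempty S hδ (mG P τ)) (show Vfun S 1 δ (mG P τ) < Vfun S 1 δ (mG P τ) + ε / Real.exp (-δ * τ) by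
    have : 0 < ε / Real.exp (-δ * τ) := by positivity
    linarith)
  obtain ⟨hc, hcost⟩ := adm_cat S hδ hτ hA hA2
  have h1 := Vfun_le S hδ hc
  rw [hcost] at h1
  have h2 := mul_le_mul_of_nonneg_left hr.le hexp.le
  rw [mul_add, mul_div_cancel₀ _ hexp.ne'] at h2
  have i2 : IntervalIntegrable (fun s => Real.exp (-δ * s) * S.Fc (mG P s)) volume 0 τ := by
    refine ContinuousOn.intervalIntegrable ?_
    rw [Set.uIcc_of_le hτ]
    refine ContinuousOn.mul (by fun_prop) ((Fc_contOn S hm).mono fun s hs => hs.1)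
  have i0 : IntervalIntegrable (fun s => Real.exp (-δ * s) * runCost S (mG P) (alG δ P R) s) volume 0 τ := by
    rw [intervalIntegrable_iff_integrableOn_Ioc_of_le hτ]
    exact IntegrableOn.mono_set hA.2.2.2.2.2 (fun s hs => hs.1)
  have h3 : ∫ s in (0:ℝ)..τ, Real.exp (-δ * s) * runCost S (mG P) (alG δ P R) s =
      (∫ s in (0:ℝ)..τ, Real.exp (-δ * s) * ∫ y, Lt S y (alG δ P R s y) ∂(mG P s : Measure (Td d))) + ∫ s in (0:ℝ)..τ, Real.exp (-δ * s) * S.Fc (mG P s) := by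
    rw [← sub_eq_iff_eq_add, ← intervalIntegral.integral_sub i0 i2]
    refine intervalIntegral.integral_congr (fun s _ => ?_)
    simp only [runCost, Lt]
    ring
  have h4 := alG_Jensen P S hδ hR0 hR hτ
  linarith
end

section
variable {d : ℕ}

lemma cont_integrable {X : Type*} [TopologicalSpace X] [CompactSpace X] [MeasurableSpace X] [OpensMeasurableSpace X]
    {f : X → ℝ} (hf : Continuous f) (μ : Measure X) [IsFiniteMeasure μ] : Integrable f μ := by
  obtain ⟨C, hC⟩ := (isCompact_univ (X := X)).exists_bound_of_continuousOn hf.continuousOn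
  exact Integrable.of_bound hf.measurable.aestronglyMeasurable C (Eventually.of_forall fun x => hC x trivial)

lemma KR_pos (μ ν : PTd d) (φ ψ : C(Td d, ℝ)) (l : ℝ) (h : ∀ x y, 0 ≤ φ x + ψ y + l * dist x y) :
    0 ≤ (∫ x, φ x ∂(μ : Measure (Td d))) + (∫ y, ψ y ∂(ν : Measure (Td d))) + l * W1 μ ν := by
  have iφ := cont_integrable φ.continuous (μ : Measure (Td d))
  have iψ := cont_integrable ψ.continuous (ν : Measure (Td d))
  rcases le_or_gt 0 l with hl | hl
  · obtain ⟨C, hC⟩ := (isCompact_univ (X := Td d)).exists_bound_of_continuousOn ψ.continuous.continuousOn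
    have hb : ∀ x, BddBelow (Set.range fun y => ψ y + l * dist x y) := fun x => ⟨-C, by
      rintro _ ⟨y, rfl⟩
      have := (abs_le.1 (hC y trivial)).1
      have : 0 ≤ l * dist x y := by positivity
      simp only
      linarith⟩
    set f : Td d → ℝ := fun x => ⨅ y, (ψ y + l * dist x y)
    have hf1 : ∀ x, f x ≤ ψ x := fun x => (ciInf_le (hb x) x).trans (by simp)
    have hf2 : ∀ x, -φ x ≤ f x := fun x => le_ciInf fun y => by linarith [h x y]
    have hf3 : ∀ x x', f x ≤ f x' + l * ‖x - x'‖ := by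
      intro x x'
      rw [← sub_le_iff_le_add]
      refine le_ciInf fun y => ?_
      rw [sub_le_iff_le_add]
      refine (ciInf_le (hb x) y).trans ?_
      have := mul_le_mul_of_nonneg_left (dist_triangle x x' y) hl
      rw [← dist_eq_norm]
      linarith
    have hf4 : ∀ x x', |f x - f x'| ≤ l * ‖x - x'‖ := fun x x' => by
      rw [abs_le]
      have h1 := hf3 x x'
      have h2 := hf3 x' x
      rw [norm_sub_rev] at h2
      constructor <;> linarith
    have hfc : Continuous f := (LipschitzWith.of_dist_le_mul (K := ⟨l, hl⟩) fun x y => by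
      rw [Real.dist_eq, dist_eq_norm]; exact hf4 x y).continuous
    have h1 := (abs_le.1 (lip_W1 hl hf4 μ ν)).2
    have h2 := integral_mono (cont_integrable hfc (ν : Measure (Td d))) iψ hf1
    have h3 := integral_mono iφ.neg (cont_integrable hfc (μ : Measure (Td d))) hf2
    simp only [Pi.neg_apply, integral_neg] at h3
    linarith
  · have hl' : 0 < -l := by linarith
    have : W1 μ ν ≤ ((∫ x, φ x ∂(μ : Measure (Td d))) + (∫ y, ψ y ∂(ν : Measure (Td d)))) / (-l) := by
      refine W1_le fun f hf => ?_
      rw [le_div_iff₀ hl']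
      have iμ := lip_integrable hf (μ : Measure (Td d))
      have iν := lip_integrable hf (ν : Measure (Td d))
      have h1 : ∀ y, (∫ x, f x ∂(μ : Measure (Td d))) * (-l) - f y * (-l) ≤ (∫ x, φ x ∂(μ : Measure (Td d))) + ψ y := by
        intro y
        have : ∫ x, (f x * (-l) - f y * (-l)) ∂(μ : Measure (Td d)) ≤ ∫ x, (φ x + ψ y) ∂(μ : Measure (Td d)) := by
          refine integral_mono ((iμ.mul_const _).sub (integrable_const _)) (iφ.add (integrable_const _)) fun x => ?_
          have h2 := hf.dist_le_mul x y
          rw [Real.dist_eq, NNReal.coe_one, one_mul] at h2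
          have h3 := mul_le_mul_of_nonneg_right ((le_abs_self _).trans h2) hl'.le
          have := h x y
          simp only
          linarith
        rw [integral_sub (iμ.mul_const _) (integrable_const _), integral_add iφ (integrable_const _), integral_mul_const] at this
        simpa using this
      have := integral_mono ((integrable_const _).sub (iν.mul_const (-l))) ((integrable_const _).add iψ) h1
      simp only [Pi.sub_apply, Pi.add_apply] at this
      rw [integral_sub (integrable_const _) (iν.mul_const _), integral_add (integrable_const _) iψ] at this
      simp only [integral_const, integral_mul_const, probReal_univ, one_smul] at this
      linarith
    rw [le_div_iff₀ hl'] at this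
    linarith

/-- the parameters' linear functional -/
def KRf (μ ν : PTd d) : (C(Td d, ℝ) × C(Td d, ℝ) × ℝ) →ₗ[ℝ] ℝ where
  toFun p := (∫ x, p.1 x ∂(μ : Measure (Td d))) + (∫ y, p.2.1 y ∂(ν : Measure (Td d))) + p.2.2 * W1 μ ν
  map_add' p q := by
    simp only [Prod.fst_add, Prod.snd_add, ContinuousMap.add_apply]
    rw [integral_add (cont_integrable p.1.continuous _) (cont_integrable q.1.continuous _),
      integral_add (cont_integrable p.2.1.continuous _) (cont_integrable q.2.1.continuous _)]
    ring
  map_smul' c p := by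
    simp only [Prod.smul_fst, Prod.smul_snd, ContinuousMap.smul_apply, smul_eq_mul, integral_const_mul, RingHom.id_apply]
    ring

def KRcone (d : ℕ) : PointedCone ℝ ((C(Td d, ℝ) × C(Td d, ℝ) × ℝ) × C(Td d × Td d, ℝ)) where
  carrier := {p | ∀ x y, 0 ≤ p.1.1 x + p.1.2.1 y + p.1.2.2 * dist x y + p.2 (x, y)}
  add_mem' := by
    intro p q hp hq x y
    have := hp x y
    have := hq x y
    simp only [Prod.fst_add, Prod.snd_add, ContinuousMap.add_apply]
    linarith
  zero_mem' := by intro x y; simp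
  smul_mem' := by
    intro c p hp x y
    have := mul_nonneg c.2 (hp x y)
    have e1 : (c • p).1.1 x = c.1 * p.1.1 x := rfl
    have e2 : (c • p).1.2.1 y = c.1 * p.1.2.1 y := rfl
    have e3 : (c • p).1.2.2 = c.1 * p.1.2.2 := rfl
    have e4 : (c • p).2 (x, y) = c.1 * p.2 (x, y) := rfl
    rw [e1, e2, e3, e4]
    linarith

lemma KRcone_mem {p : (C(Td d, ℝ) × C(Td d, ℝ) × ℝ) × C(Td d × Td d, ℝ)} :
    p ∈ KRcone d ↔ ∀ x y, 0 ≤ p.1.1 x + p.1.2.1 y + p.1.2.2 * dist x y + p.2 (x, y) := Iff.rfl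

lemma KR (μ ν : PTd d) : ∃ Γ : Measure (Td d × Td d), IsProbabilityMeasure Γ ∧
    Γ.map Prod.fst = (μ : Measure (Td d)) ∧ Γ.map Prod.snd = (ν : Measure (Td d)) ∧ ∫ p, dist p.1 p.2 ∂Γ = W1 μ ν := by
  let f : ((C(Td d, ℝ) × C(Td d, ℝ) × ℝ) × C(Td d × Td d, ℝ)) →ₗ.[ℝ] ℝ :=
    ⟨Submodule.prod ⊤ ⊥, (KRf μ ν).comp ((LinearMap.fst ℝ _ _).comp (Submodule.subtype _))⟩
  obtain ⟨g, hg1, hg2⟩ := riesz_extension (KRcone d) f (by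
    rintro ⟨⟨⟨φ, ψ, l⟩, q⟩, hp⟩ hx
    have hq : q = 0 := (Submodule.mem_bot ℝ).1 (Submodule.mem_prod.1 hp).2
    subst hq
    rw [KRcone_mem] at hx
    exact KR_pos μ ν φ ψ l fun x y => by simpa using hx x y) (by
    rintro ⟨⟨φ, ψ, l⟩, q⟩
    refine ⟨⟨((-φ + ContinuousMap.const _ ‖q‖, -ψ, -l), 0), Submodule.mem_prod.2 ⟨trivial, rfl⟩⟩, ?_⟩
    rw [KRcone_mem]
    intro x y
    have := (abs_le.1 (q.norm_coe_le_norm (x, y))).1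
    simp
    linarith)
  have hz : ∀ p q, (∀ x y, p.1 x + p.2.1 y + p.2.2 * dist x y = q (x, y)) → g (0, q) = KRf μ ν p := by
    intro p q h
    have h1 : 0 ≤ g (p, -q) := hg2 _ (by rw [KRcone_mem]; intro x y; simp [h x y])
    have h2 : 0 ≤ g (-p, q) := hg2 _ (by
      rw [KRcone_mem]; intro x y
      have := h x y
      simp
      linarith)
    have h3 : g (p, 0) = KRf μ ν p := hg1 ⟨(p, 0), Submodule.mem_prod.2 ⟨trivial, rfl⟩⟩
    have e1 : g (p, -q) = g (p, 0) - g (0, q) := by rw [← map_sub]; simp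
    have e2 : g (-p, q) = g (0, q) - g (p, 0) := by rw [← map_sub]; simp
    linarith
  let Λ0 : CompactlySupportedContinuousMap (Td d × Td d) ℝ →ₗ[ℝ] ℝ :=
    { toFun := fun h => g (0, h.toContinuousMap)
      map_add' := fun a b => by rw [← map_add]; congr 1; ext <;> simp
      map_smul' := fun c a => by rw [← map_smul]; congr 1; ext <;> simp }
  let Λ : CompactlySupportedContinuousMap (Td d × Td d) ℝ →ₚ[ℝ] ℝ := PositiveLinearMap.mk₀ Λ0 (by
    intro h hh
    refine hg2 _ ?_
    rw [KRcone_mem]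
    intro x y
    simpa using hh (x, y))
  have hΛ : ∀ q : C(Td d × Td d, ℝ), ∫ x, q x ∂(RealRMK.rieszMeasure Λ) = g (0, q) := by
    intro q
    have := RealRMK.integral_rieszMeasure Λ (CompactlySupportedContinuousMap.continuousMapEquiv q)
    exact this
  set Γ := RealRMK.rieszMeasure Λ with hΓ
  have hfin : IsFiniteMeasure Γ := ⟨by
    exact isCompact_univ.measure_lt_top⟩
  have hφ : ∀ φ : C(Td d, ℝ), ∫ x, φ x.1 ∂Γ = ∫ x, φ x ∂(μ : Measure (Td d)) := by
    intro φ
    rw [show ∫ x, φ x.1 ∂Γ = ∫ x, (φ.comp ⟨Prod.fst, continuous_fst⟩ : C(Td d × Td d, ℝ)) x ∂Γ from rfl, hΛ, hz (φ, 0, 0) _ (by simp)]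
    simp [KRf]
  have hψ : ∀ φ : C(Td d, ℝ), ∫ x, φ x.2 ∂Γ = ∫ x, φ x ∂(ν : Measure (Td d)) := by
    intro φ
    rw [show ∫ x, φ x.2 ∂Γ = ∫ x, (φ.comp ⟨Prod.snd, continuous_snd⟩ : C(Td d × Td d, ℝ)) x ∂Γ from rfl, hΛ, hz (0, φ, 0) _ (by simp)]
    simp [KRf]
  have m1 : Γ.map Prod.fst = (μ : Measure (Td d)) := by
    refine ext_of_forall_integral_eq_of_IsFiniteMeasure fun φ => ?_
    rw [integral_map measurable_fst.aemeasurable φ.continuous.measurable.aestronglyMeasurable]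
    exact hφ φ.toContinuousMap
  have m2 : Γ.map Prod.snd = (ν : Measure (Td d)) := by
    refine ext_of_forall_integral_eq_of_IsFiniteMeasure fun φ => ?_
    rw [integral_map measurable_snd.aemeasurable φ.continuous.measurable.aestronglyMeasurable]
    exact hψ φ.toContinuousMap
  refine ⟨Γ, ⟨?_⟩, m1, m2, ?_⟩
  · have := congrArg (fun m : Measure (Td d) => m Set.univ) m1
    simp only [Measure.map_apply measurable_fst MeasurableSet.univ] at this
    simpa using this
  · have := hΛ (⟨fun p => dist p.1 p.2, continuous_fst.dist continuous_snd⟩)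
    rw [hz (0, 0, 1) _ (by simp)] at this
    simpa [KRf] using this
end

section
variable {d : ℕ}

instance volAC_prob : IsProbabilityMeasure (volume : Measure (AddCircle (1:ℝ))) :=
  ⟨by rw [AddCircle.measure_univ]; simp⟩

lemma Per.lip_C1 {g : Vd d → ℝ} (hp : Per g) (hg : ContDiff ℝ 1 g) :
    ∃ C : ℝ, 0 ≤ C ∧ ∀ x x', |g x - g x'| ≤ C * ‖x - x'‖ := by
  obtain ⟨C, hC0, hC⟩ := hp.fder.bdd (hg.continuous_fderiv one_ne_zero)
  refine ⟨C, hC0, fun x x' => ?_⟩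
  exact Convex.norm_image_sub_le_of_norm_fderiv_le (𝕜 := ℝ) (s := Set.univ)
    (fun y _ => hg.differentiable one_ne_zero y) (fun y _ => hC y) convex_univ trivial trivial

/-- quantitative test functions -/
structure TB (C : ℝ) (φ : Vd d → ℝ) : Prop where
  smooth : ContDiff ℝ 2 φ
  per : Per φ
  b0 : ∀ x, |φ x| ≤ C
  l0 : ∀ x x', |φ x - φ x'| ≤ C * ‖x - x'‖
  b1 : ∀ x, ‖gradv φ x‖ ≤ C
  l1 : ∀ x x', ‖gradv φ x - gradv φ x'‖ ≤ C * ‖x - x'‖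
  b2 : ∀ x, |lapl φ x| ≤ C
  l2 : ∀ x x', |lapl φ x - lapl φ x'| ≤ C * ‖x - x'‖

lemma TB.nonneg {C : ℝ} {φ : Vd d → ℝ} (h : TB C φ) : 0 ≤ C := (abs_nonneg _).trans (h.b0 0)

lemma TB.mk' {G : Vd d → ℝ} (hp : Per G) (hG : ContDiff ℝ 4 G) : ∃ C, TB C G := by
  have h3 : ∀ v, ContDiff ℝ 3 (fun x => fderiv ℝ G x v) := fun v =>
    (hG.fderiv_right (m := 3) (by norm_num)).clm_apply contDiff_const
  have h2 : ∀ v w, ContDiff ℝ 2 (fun x => D2 G x v w) := fun v w =>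
    ((h3 v).fderiv_right (m := 2) (by norm_num)).clm_apply contDiff_const
  have hl : ContDiff ℝ 2 (lapl G) := by
    unfold lapl
    exact ContDiff.sum fun i _ => h2 _ _
  have hpi : ∀ v, Per (fun x => fderiv ℝ G x v) := fun v x z => congrArg (fun l : Vd d →L[ℝ] ℝ => l v) (hp.fder x z)
  have hg : ∀ i : Fin d, ContDiff ℝ 3 (fun x => gradv G x i) := fun i => h3 _
  obtain ⟨C0, hC0, b0⟩ := hp.bdd hG.continuous
  obtain ⟨C1, hC1, l0⟩ := hp.lip_C1 (hG.of_le (by norm_num))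
  obtain ⟨C2, hC2, b1⟩ := hp.gradv.bdd (continuous_pi fun i => (hg i).continuous)
  obtain ⟨C4, hC4, b2⟩ := hp.lapl.bdd hl.continuous
  obtain ⟨C5, hC5, l2⟩ := hp.lapl.lip_C1 (hl.of_le (by norm_num))
  have := fun i : Fin d => Per.lip_C1 (g := fun x => gradv G x i) (hpi _) ((hg i).of_le (by norm_num))
  choose C3 hC3 l1 using this
  have hs : 0 ≤ ∑ i, C3 i := Finset.sum_nonneg fun i _ => hC3 i
  set C := C0 + C1 + C2 + (∑ i, C3 i) + C4 + C5 with hC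
  have le_mul : ∀ (c : ℝ) (x x' : Vd d), c ≤ C → c * ‖x - x'‖ ≤ C * ‖x - x'‖ := fun c x x' h =>
    mul_le_mul_of_nonneg_right h (norm_nonneg _)
  refine ⟨C, hG.of_le (by norm_num), hp, fun x => (b0 x).trans (by linarith), fun x x' => (l0 x x').trans (le_mul _ _ _ (by linarith)),
    fun x => (b1 x).trans (by linarith), fun x x' => ?_, fun x => (b2 x).trans (by linarith), fun x x' => (l2 x x').trans (le_mul _ _ _ (by linarith))⟩
  refine le_trans ?_ (le_mul (∑ i, C3 i) x x' (by linarith))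
  refine (pi_norm_le_iff_of_nonneg (by positivity)).2 fun i => ?_
  refine (l1 i x x').trans (mul_le_mul_of_nonneg_right ?_ (norm_nonneg _))
  exact Finset.single_le_sum (f := C3) (fun i _ => hC3 i) (Finset.mem_univ i)

lemma fderiv_refl {G : Vd d → ℝ} (hG : Differentiable ℝ G) (c x v : Vd d) :
    fderiv ℝ (fun y => G (c - y)) x v = - fderiv ℝ G (c - x) v := by
  have h1 : HasFDerivAt (fun y : Vd d => c - y) (-ContinuousLinearMap.id ℝ (Vd d)) x := (hasFDerivAt_id x).const_sub c
  have := ((hG (c - x)).hasFDerivAt.comp x h1).fderiv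
  rw [show (fun y => G (c - y)) = G ∘ (fun y => c - y) from rfl, this]
  simp

lemma TB.reflect {C : ℝ} {G : Vd d → ℝ} (h : TB C G) (c : Vd d) : TB C (fun x => G (c - x)) := by
  have hd := h.smooth.differentiable (by norm_num)
  have hg : ∀ x, _root_.gradv (fun x => G (c - x)) x = - _root_.gradv G (c - x) := by
    intro x; funext i
    simp only [_root_.gradv, fderiv_refl hd, Pi.neg_apply]
  have hl : ∀ x, _root_.lapl (fun x => G (c - x)) x = _root_.lapl G (c - x) := by
    intro x
    unfold lapl D2
    refine Finset.sum_congr rfl fun i _ => ?_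
    simp only [fderiv_refl hd]
    rw [fderiv_fun_neg]
    simp only [ContinuousLinearMap.neg_apply]
    have h1 : Differentiable ℝ (fun y => fderiv ℝ G y (Pi.single i 1)) :=
      ((h.smooth.fderiv_right (m := 1) (by norm_num)).clm_apply contDiff_const).differentiable one_ne_zero
    rw [fderiv_refl h1, neg_neg]
  have hn : ∀ x x' : Vd d, ‖(c - x) - (c - x')‖ = ‖x - x'‖ := fun x x' => by rw [norm_sub_rev]; congr 1; abel
  refine ⟨h.smooth.comp (contDiff_const.sub contDiff_id), fun x z => ?_, fun x => h.b0 _, fun x x' => ?_, fun x => ?_, fun x x' => ?_, fun x => ?_, fun x x' => ?_⟩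
  · have := h.per (c - (x + intVec z)) z
    rw [← this]; congr 1; abel
  · rw [← hn]; exact h.l0 _ _
  · rw [hg, norm_neg]; exact h.b1 _
  · rw [hg, hg, ← hn x x', ← neg_sub', norm_neg]; exact h.l1 _ _
  · rw [hl]; exact h.b2 _
  · rw [hl, hl, ← hn]; exact h.l2 _ _

lemma TB.test {C : ℝ} {φ : Vd d → ℝ} (h : TB C φ) : IsTestFun (fun _ : ℝ => φ) :=
  ⟨h.smooth.comp contDiff_snd, fun _ => h.per⟩

lemma one_sub_cos_ge (x : ℝ) : 8 * ‖(x : AddCircle (1:ℝ))‖^2 ≤ 1 - Real.cos (2 * π * x) := by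
  have h := UnitAddCircle.norm_eq (x := x)
  rw [h]
  set r := x - round x with hr
  have hr2 : |r| ≤ 1/2 := abs_sub_round x
  have e1 : Real.cos (2 * π * x) = Real.cos (2 * (π * |r|)) := by
    have : 2 * (π * r) = 2 * π * x - (round x : ℤ) * (2 * π) := by rw [hr]; ring
    rw [show 2 * (π * |r|) = |2 * (π * r)| by rw [abs_mul, abs_mul, abs_of_pos Real.pi_pos]; norm_num, Real.cos_abs, this, Real.cos_sub_int_mul_two_pi]
  rw [e1, Real.cos_two_mul]
  have h1 : 2 * |r| ≤ Real.sin (π * |r|) := by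
    have := Real.mul_le_sin (x := π * |r|) (by positivity) (by nlinarith [Real.pi_pos])
    refine le_trans (le_of_eq ?_) this
    field_simp
  have h2 := Real.sin_sq_add_cos_sq (π * |r|)
  have h3 : (2 * |r|)^2 ≤ Real.sin (π * |r|)^2 := by gcongr
  linarith

lemma Per.contT {g : Vd d → ℝ} (hp : Per g) (hg : ContDiff ℝ 1 g) : Continuous (fun y : Td d => g (secT y)) := by
  obtain ⟨C, hC0, hC⟩ := hp.lip_C1 hg
  exact (LipschitzWith.of_dist_le_mul (K := ⟨C, hC0⟩) fun x y => by
      rw [Real.dist_eq, dist_eq_norm]; exact hp.lip hC x y).continuous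

lemma moll_exists (d : ℕ) {ε : ℝ} (hε : 0 < ε) (hε1 : ε ≤ 1) : ∃ (G : Vd d → ℝ) (C g0 : ℝ), TB C G ∧ 0 < g0 ∧ (∀ x, g0 ≤ G x) ∧
    ∫ y : Td d, G (secT y) = 1 ∧ ∫ y : Td d, ‖y‖ * G (secT y) ≤ 2 * ε := by
  set u : Vd d → ℝ := fun x => Real.smoothTransition (1 - ∑ i, (1 - Real.cos (2 * π * x i)) / (8 * ε^2)) with hu
  have us : ContDiff ℝ 4 u := by
    have h1 : ContDiff ℝ 4 (fun x : Vd d => 1 - ∑ i, (1 - Real.cos (2 * π * x i)) / (8 * ε^2)) := by fun_prop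
    exact (Real.smoothTransition.contDiff (n := 4)).comp h1
  have up : Per u := by
    intro x z
    simp only [hu, intVec, Pi.add_apply]
    congr 2
    refine Finset.sum_congr rfl fun i _ => ?_
    rw [mul_add, mul_comm (2 * π) (z i : ℝ), Real.cos_add_int_mul_two_pi]
  have u0 : ∀ x, 0 ≤ u x := fun x => Real.smoothTransition.nonneg _
  have hnn : ∀ x : ℝ, 0 ≤ (1 - Real.cos (2 * π * x)) / (8 * ε^2) := fun x => by
    have := Real.cos_le_one (2 * π * x)
    exact div_nonneg (by linarith) (by positivity)
  have usupp : ∀ y : Td d, u (secT y) ≠ 0 → ‖y‖ ≤ ε := by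
    intro y hy
    have h1 : ¬ (1 - ∑ i, (1 - Real.cos (2 * π * secT y i)) / (8 * ε^2) ≤ 0) := fun h => hy (Real.smoothTransition.zero_of_nonpos h)
    refine (pi_norm_le_iff_of_nonneg hε.le).2 fun i => ?_
    have h2 := Finset.single_le_sum (f := fun i => (1 - Real.cos (2 * π * secT y i)) / (8 * ε^2)) (fun i _ => hnn _) (Finset.mem_univ i)
    have h3 : (1 - Real.cos (2 * π * secT y i)) / (8 * ε^2) < 1 := by
      push Not at h1
      linarith
    rw [div_lt_one (by positivity)] at h3
    have h4 := one_sub_cos_ge (secT y i)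
    rw [show ((secT y i : ℝ) : AddCircle (1:ℝ)) = y i from congrFun (piT_secT y) i] at h4
    exact (le_abs_self _).trans (abs_le_of_sq_le_sq (a := ‖y i‖) (by linarith) hε.le)
  have uc : Continuous (fun y : Td d => u (secT y)) := up.contT (us.of_le (by norm_num))
  have cont_int : ∀ {f : Td d → ℝ}, Continuous f → Integrable f := by
    intro f hf
    obtain ⟨C, hC⟩ := (isCompact_univ (X := Td d)).exists_bound_of_continuousOn hf.continuousOn
    exact Integrable.of_bound hf.measurable.aestronglyMeasurable C (Eventually.of_forall fun x => hC x trivial)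
  have hc : 0 < ∫ y : Td d, u (secT y) := by
    refine uc.integral_pos_of_hasCompactSupport_nonneg_nonzero (HasCompactSupport.of_compactSpace _) (fun y => u0 _) (x := (0 : Td d)) ?_
    have : u (secT (0 : Td d)) = u 0 := by rw [← piT_zero]; exact up.sec 0
    rw [this]; simp [hu]
  set c := ∫ y : Td d, u (secT y)
  set G : Vd d → ℝ := fun x => (1 - ε) * (u x / c) + ε with hG
  have Gs : ContDiff ℝ 4 G := by
    simp only [hG]; fun_prop
  have Gp : Per G := fun x z => by simp only [hG, up x z]
  obtain ⟨C, hC⟩ := TB.mk' Gp Gs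
  have i1 : Integrable (fun y : Td d => u (secT y) / c) := (cont_int uc).div_const _
  have e1 : ∫ y : Td d, u (secT y) / c = 1 := by rw [integral_div]; exact div_self hc.ne'
  refine ⟨G, C, ε, hC, hε, fun x => ?_, ?_, ?_⟩
  · have : 0 ≤ (1 - ε) * (u x / c) := mul_nonneg (by linarith) (div_nonneg (u0 x) hc.le)
    simp only [hG]; linarith
  · simp only [hG]
    rw [integral_add (i1.const_mul _) (integrable_const _), integral_const_mul, e1]
    simp
  · have : ∀ y : Td d, ‖y‖ * G (secT y) ≤ ε * (u (secT y) / c) + ε := by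
      intro y
      have h1 : ‖y‖ * (u (secT y) / c) ≤ ε * (u (secT y) / c) := by
        by_cases h : u (secT y) = 0
        · simp [h]
        · exact mul_le_mul_of_nonneg_right (usupp y h) (div_nonneg (u0 _) hc.le)
      have h2 := norm_Td_le y
      have h3 : 0 ≤ u (secT y) / c := div_nonneg (u0 _) hc.le
      have h5 : 0 ≤ ‖y‖ * (u (secT y) / c) := mul_nonneg (norm_nonneg _) h3
      have h4 := mul_le_mul_of_nonneg_right h2 hε.le
      have h6 := mul_nonneg hε.le h5
      have e : ‖y‖ * G (secT y) = ‖y‖ * (u (secT y) / c) - ε * (‖y‖ * (u (secT y) / c)) + ‖y‖ * ε := by simp only [hG]; ring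
      rw [e]
      linarith
    refine (integral_mono (cont_int (continuous_norm.mul (Gp.contT (Gs.of_le (by norm_num))))) ((i1.const_mul _).add (integrable_const _)) this).trans ?_
    simp only [Pi.add_apply]
    rw [integral_add (i1.const_mul _) (integrable_const _), integral_const_mul, e1]
    simp; linarith
end

variable {d : ℕ}

/-- mollifiers on the torus -/
structure Mol (g : Td d → ℝ) (C g0 ε : ℝ) : Prop where
  lip : ∀ y y', |g y - g y'| ≤ C * ‖y - y'‖
  pos : 0 < g0
  lb : ∀ y, g0 ≤ g y
  ub : ∀ y, g y ≤ C
  int1 : ∫ y, g y = 1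
  mom : ∫ y, ‖y‖ * g y ≤ ε

lemma Mol.C_nonneg {g : Td d → ℝ} {C g0 ε : ℝ} (h : Mol g C g0 ε) : 0 ≤ C := h.pos.le.trans ((h.lb 0).trans (h.ub 0))

lemma cont_of_lip {g : Td d → ℝ} {C : ℝ} (h : ∀ y y', |g y - g y'| ≤ C * ‖y - y'‖) : Continuous g :=
  (LipschitzWith.of_dist_le_mul (K := C.toNNReal) fun x y => by
      rw [Real.dist_eq, dist_eq_norm]
      exact (h x y).trans (mul_le_mul_of_nonneg_right (Real.le_coe_toNNReal C) (norm_nonneg _))).continuous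

lemma Mol.cont {g : Td d → ℝ} {C g0 ε : ℝ} (h : Mol g C g0 ε) : Continuous g := cont_of_lip h.lip

lemma Mol.nn {g : Td d → ℝ} {C g0 ε : ℝ} (h : Mol g C g0 ε) (y : Td d) : 0 ≤ g y := h.pos.le.trans (h.lb y)

def rho (g : Td d → ℝ) (r : Measure (Td d × Vd d)) (x : Td d) : ℝ := ∫ p, g (x - p.1) ∂r
def gk (g : Td d → ℝ) (r : Measure (Td d × Vd d)) (x : Td d) (p : Td d × Vd d) : ℝ := g (x - p.1) / rho g r x

section
variable {g : Td d → ℝ} {C g0 ε : ℝ} (h : Mol g C g0 ε) (r : Measure (Td d × Vd d)) [IsProbabilityMeasure r]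
include h

lemma Mol.int (x : Td d) : Integrable (fun p : Td d × Vd d => g (x - p.1)) r := by
  have := h.cont
  refine Integrable.of_bound (by fun_prop) C (Eventually.of_forall fun p => ?_)
  rw [Real.norm_eq_abs, abs_of_nonneg (h.nn _)]; exact h.ub _

lemma rho_lb (x : Td d) : g0 ≤ rho g r x := by
  have := integral_mono (integrable_const g0) (h.int r x) (fun p => h.lb _)
  simpa [rho] using this

lemma rho_lip (x x' : Td d) : |rho g r x - rho g r x'| ≤ C * ‖x - x'‖ := by
  rw [rho, rho, ← integral_sub (h.int r x) (h.int r x')]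
  have := norm_integral_le_of_norm_le_const (μ := r) (f := fun p => g (x - p.1) - g (x' - p.1)) (C := C * ‖x - x'‖)
    (Eventually.of_forall fun p => by
      have := h.lip (x - p.1) (x' - p.1)
      simpa using this)
  simpa using this

lemma gk_nn (x : Td d) (p : Td d × Vd d) : 0 ≤ gk g r x p := div_nonneg (h.nn _) (h.pos.le.trans (rho_lb h r x))

lemma gk_le (x : Td d) (p : Td d × Vd d) : gk g r x p ≤ C / g0 :=
  div_le_div₀ h.C_nonneg (h.ub _) h.pos (rho_lb h r x)

lemma gk_lip (x x' : Td d) (p : Td d × Vd d) : |gk g r x p - gk g r x' p| ≤ (C / g0 + C^2 / g0^2) * ‖x - x'‖ := by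
  have h1 := rho_lb h r x
  have h2 := rho_lb h r x'
  have p0 := h.pos
  have p1 : 0 < rho g r x := by linarith
  have p2 : 0 < rho g r x' := by linarith
  have hC := h.C_nonneg
  have e : gk g r x p - gk g r x' p = (g (x - p.1) - g (x' - p.1)) / rho g r x + g (x' - p.1) * (rho g r x' - rho g r x) / (rho g r x * rho g r x') := by
    unfold gk
    field_simp
    ring
  rw [e, add_mul]
  refine (abs_add_le _ _).trans (add_le_add ?_ ?_)
  · rw [abs_div, abs_of_pos p1, div_mul_eq_mul_div]
    refine div_le_div₀ (by positivity) ?_ p0 h1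
    have := h.lip (x - p.1) (x' - p.1)
    simpa using this
  · rw [abs_div, abs_mul, abs_of_pos (mul_pos p1 p2), abs_of_nonneg (h.nn _), div_mul_eq_mul_div]
    refine div_le_div₀ (by positivity) ?_ (by positivity) ?_
    · rw [abs_sub_comm, pow_two, mul_assoc]
      exact mul_le_mul (h.ub _) (rho_lip h r x x') (abs_nonneg _) hC
    · rw [pow_two]; exact mul_le_mul h1 h2 p0.le p1.le

lemma gk_meas : Measurable (fun q : Td d × (Td d × Vd d) => gk g r q.1 q.2) := by
  have h1 := h.cont
  have h2 := cont_of_lip (rho_lip h r)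
  unfold gk
  exact Measurable.div (by fun_prop) (by fun_prop)

lemma gk_int1 (x : Td d) : ∫ p, gk g r x p ∂r = 1 := by
  have h1 := rho_lb h r x
  have p0 := h.pos
  unfold gk
  rw [integral_div]
  exact div_self (by unfold rho at h1; linarith)

lemma gk_mul_int (x : Td d) {F : Td d × Vd d → ℝ} (hF : Integrable F r) : Integrable (fun p => gk g r x p * F p) r := by
  refine hF.bdd_mul (c := C / g0) (((gk_meas h r).comp measurable_prodMk_left).aestronglyMeasurable) (Eventually.of_forall fun p => ?_)
  rw [Real.norm_eq_abs]
  show |gk g r x p| ≤ _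
  rw [abs_of_nonneg (gk_nn h r x p)]; exact gk_le h r x p

lemma gk_int (x : Td d) : Integrable (fun p => gk g r x p) r := by
  simpa using gk_mul_int h r x (integrable_const 1)

lemma lemAB {F : Td d → Td d × Vd d → ℝ} {A B : Td d × Vd d → ℝ} {c : Td d → ℝ} {A' : ℝ}
    (hm : ∀ x, Measurable (F x)) (hA : Integrable A r) (hB : Integrable B r)
    (h1 : ∀ x x' p, |F x p - F x' p| ≤ A p * ‖x - x'‖) (h2 : ∀ x p, |F x p - c x| ≤ B p)
    (h3 : ∀ x, ∫ p, gk g r x p * A p ∂r ≤ A') (x x' : Td d) :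
    |(∫ p, gk g r x p * F x p ∂r) - ∫ p, gk g r x' p * F x' p ∂r| ≤ (A' + (C / g0 + C^2 / g0^2) * ∫ p, B p ∂r) * ‖x - x'‖ := by
  have hF0 : ∀ x, Integrable (fun p => F x p - c x) r := fun x =>
    hB.mono' ((hm x).sub_const _).aestronglyMeasurable (Eventually.of_forall (h2 x))
  have hF : ∀ x, Integrable (F x) r := fun x => by
    refine ((hF0 x).add (integrable_const (c x))).congr (Eventually.of_forall fun p => ?_)
    simp
  have i1 := (gk_mul_int h r x (hF x)).sub (gk_mul_int h r x' (hF x'))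
  have i2 : ∫ p, (gk g r x p - gk g r x' p) * c x' ∂r = 0 := by
    rw [integral_mul_const, integral_sub (gk_int h r x) (gk_int h r x'), gk_int1 h, gk_int1 h]; simp
  have i3 : Integrable (fun p => (gk g r x p - gk g r x' p) * c x') r := ((gk_int h r x).sub (gk_int h r x')).mul_const _
  have e : (∫ p, gk g r x p * F x p ∂r) - ∫ p, gk g r x' p * F x' p ∂r =
      ∫ p, (gk g r x p * F x p - gk g r x' p * F x' p - (gk g r x p - gk g r x' p) * c x') ∂r := by
    rw [integral_sub (f := fun p => gk g r x p * F x p - gk g r x' p * F x' p) i1 i3, i2, sub_zero,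
      integral_sub (gk_mul_int h r x (hF x)) (gk_mul_int h r x' (hF x'))]
  rw [e]
  have j1 := (gk_mul_int h r x hA).mul_const ‖x - x'‖
  have j2 := (hB.const_mul ((C / g0 + C^2 / g0^2))).mul_const ‖x - x'‖
  have : ‖∫ p, (gk g r x p * F x p - gk g r x' p * F x' p - (gk g r x p - gk g r x' p) * c x') ∂r‖ ≤
      ∫ p, (gk g r x p * A p * ‖x - x'‖ + (C / g0 + C^2 / g0^2) * B p * ‖x - x'‖) ∂r := by
    refine norm_integral_le_of_norm_le (j1.add j2) (Eventually.of_forall fun p => ?_)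
    rw [show gk g r x p * F x p - gk g r x' p * F x' p - (gk g r x p - gk g r x' p) * c x' =
      gk g r x p * (F x p - F x' p) + (gk g r x p - gk g r x' p) * (F x' p - c x') by ring]
    refine (norm_add_le _ _).trans (add_le_add ?_ ?_)
    · rw [norm_mul, Real.norm_eq_abs, Real.norm_eq_abs, abs_of_nonneg (gk_nn h r x p), mul_assoc]
      exact mul_le_mul_of_nonneg_left (h1 x x' p) (gk_nn h r x p)
    · rw [norm_mul, Real.norm_eq_abs, Real.norm_eq_abs, mul_right_comm]
      exact mul_le_mul (gk_lip h r x x' p) (h2 x' p) (abs_nonneg _) ((abs_nonneg _).trans (gk_lip h r x x' p))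
  rw [integral_add j1 j2, integral_mul_const, integral_mul_const, integral_const_mul, ← add_mul] at this
  refine this.trans ?_
  gcongr
  exact h3 x

end

variable {d : ℕ}

def cvd (g : Td d → ℝ) (μ : Measure (Td d)) (z : Td d) : ℝ := ∫ y, g (z - y) ∂μ

section
variable {g : Td d → ℝ} {C g0 ε : ℝ} (h : Mol g C g0 ε)
include h

lemma cvd_int (μ : Measure (Td d)) [IsProbabilityMeasure μ] (z : Td d) : Integrable (fun y => g (z - y)) μ := by
  have := h.cont
  exact cont_integrable (by fun_prop) μ

lemma cvd_nn (μ : Measure (Td d)) (z : Td d) : 0 ≤ cvd g μ z := integral_nonneg fun _ => h.nn _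

lemma cvd_cont (μ : Measure (Td d)) [IsProbabilityMeasure μ] : Continuous (cvd g μ) := by
  refine cont_of_lip (C := C) fun x x' => ?_
  rw [cvd, cvd, ← integral_sub (cvd_int h μ x) (cvd_int h μ x')]
  have := norm_integral_le_of_norm_le_const (μ := μ) (f := fun p => g (x - p) - g (x' - p)) (C := C * ‖x - x'‖)
    (Eventually.of_forall fun p => by
      have := h.lip (x - p) (x' - p)
      simpa using this)
  simpa using this

lemma cvd_fub (μ : Measure (Td d)) [IsProbabilityMeasure μ] {f : Td d → ℝ} (hf : Continuous f) :
    ∫ z, cvd g μ z * f z = ∫ y, (∫ z, g z * f (z + y)) ∂μ := by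
  have hc := h.cont
  have h1 : ∀ z, cvd g μ z * f z = ∫ y, g (z - y) * f z ∂μ := fun z => by rw [cvd, integral_mul_const]
  simp only [h1]
  rw [integral_integral_swap (cont_integrable (f := fun q : Td d × Td d => g (q.1 - q.2) * f q.1) (by fun_prop) _)]
  refine integral_congr_ae (Eventually.of_forall fun y => ?_)
  have := integral_sub_right_eq_self (μ := (volume : Measure (Td d))) (fun z => g z * f (z + y)) y
  simpa using this

lemma cvd_int1 (μ : Measure (Td d)) [IsProbabilityMeasure μ] : ∫ z, cvd g μ z = 1 := by
  have := cvd_fub h μ (f := fun _ => 1) continuous_const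
  simpa [h.int1] using this

lemma cv_prob (μ : Measure (Td d)) [IsProbabilityMeasure μ] :
    IsProbabilityMeasure ((volume : Measure (Td d)).withDensity (fun z => ENNReal.ofReal (cvd g μ z))) := by
  refine ⟨?_⟩
  rw [withDensity_apply _ MeasurableSet.univ, Measure.restrict_univ,
    ← ofReal_integral_eq_lintegral_ofReal (cont_integrable (cvd_cont h μ) _) (Eventually.of_forall (cvd_nn h μ)), cvd_int1 h μ]
  simp

/-- convolution with the mollifier -/
def cv (μ : PTd d) : PTd d := ⟨(volume : Measure (Td d)).withDensity (fun z => ENNReal.ofReal (cvd g (μ : Measure (Td d)) z)), cv_prob h _⟩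

lemma cv_integral (μ : PTd d) (f : Td d → ℝ) : ∫ z, f z ∂(cv h μ : Measure (Td d)) = ∫ z, cvd g (μ : Measure (Td d)) z * f z := by
  show ∫ z, f z ∂((volume : Measure (Td d)).withDensity (fun z => ENNReal.ofReal (cvd g (μ : Measure (Td d)) z))) = _
  rw [integral_withDensity_eq_integral_toReal_smul (by have := cvd_cont h (μ : Measure (Td d)); fun_prop)
    (Eventually.of_forall fun _ => ENNReal.ofReal_lt_top)]
  refine integral_congr_ae (Eventually.of_forall fun z => ?_)
  simp [ENNReal.toReal_ofReal (cvd_nn h _ z)]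

lemma cv_W1 (μ : PTd d) : W1 (cv h μ) μ ≤ ε := by
  refine W1_le fun f hf => ?_
  have hc := h.cont
  have hfc := hf.continuous
  rw [cv_integral, cvd_fub h _ hfc, ← integral_sub]
  · have : ∀ y : Td d, (∫ z, g z * f (z + y)) - f y ≤ ε := fun y => by
      have e : (∫ z, g z * f (z + y)) - f y = ∫ z, (g z * f (z + y) - g z * f y) := by
        rw [integral_sub (cont_integrable (by fun_prop) _) (cont_integrable (by fun_prop) _), integral_mul_const, h.int1, one_mul]
      rw [e]
      refine le_trans (integral_mono (cont_integrable (by fun_prop) _) (cont_integrable (f := fun z : Td d => ‖z‖ * g z) (by fun_prop) _) fun z => ?_) h.mom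
      have h2 := hf.dist_le_mul (z + y) y
      rw [Real.dist_eq, dist_eq_norm] at h2
      simp only [add_sub_cancel_right, NNReal.coe_one, one_mul] at h2
      have h3 := mul_le_mul_of_nonneg_left ((le_abs_self _).trans h2) (h.nn z)
      linarith
    refine (integral_mono (μ := (μ : Measure (Td d))) (g := fun _ => ε) (Integrable.sub ?_ (cont_integrable hfc _)) (integrable_const _) this).trans (by simp)
    have h5 : Continuous (fun q : Td d × Td d => g q.2 * f (q.2 + q.1)) := by fun_prop
    exact (cont_integrable h5 ((μ : Measure (Td d)).prod volume)).integral_prod_left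
  · have h5 : Continuous (fun q : Td d × Td d => g q.2 * f (q.2 + q.1)) := by fun_prop
    exact (cont_integrable h5 ((μ : Measure (Td d)).prod volume)).integral_prod_left
  · exact cont_integrable hfc _

lemma lemD (μ1 μ2 μ3 μ4 : PTd d) {s M : ℝ} (hs : ∀ z, |cvd g (μ1 : Measure (Td d)) z - cvd g (μ2 : Measure (Td d)) z
      - (cvd g (μ3 : Measure (Td d)) z - cvd g (μ4 : Measure (Td d)) z)| ≤ s) {f : Td d → ℝ} (hf : Continuous f) (hM : ∀ z, |f z| ≤ M) :
    |(∫ z, f z ∂(cv h μ1 : Measure (Td d))) - (∫ z, f z ∂(cv h μ2 : Measure (Td d))) -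
      ((∫ z, f z ∂(cv h μ3 : Measure (Td d))) - (∫ z, f z ∂(cv h μ4 : Measure (Td d))))| ≤ s * M := by
  simp only [cv_integral]
  have i : ∀ μ : PTd d, Integrable (fun z => cvd g (μ : Measure (Td d)) z * f z) volume := fun μ =>
    cont_integrable ((cvd_cont h _).mul hf) _
  rw [← integral_sub (i μ1) (i μ2), ← integral_sub (i μ3) (i μ4), ← integral_sub (f := fun z => cvd g (μ1 : Measure (Td d)) z * f z - cvd g (μ2 : Measure (Td d)) z * f z)
    (g := fun z => cvd g (μ3 : Measure (Td d)) z * f z - cvd g (μ4 : Measure (Td d)) z * f z) ((i μ1).sub (i μ2)) ((i μ3).sub (i μ4))]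
  rw [← Real.norm_eq_abs]
  have key : ∀ z, ‖cvd g (μ1 : Measure (Td d)) z * f z - cvd g (μ2 : Measure (Td d)) z * f z - (cvd g (μ3 : Measure (Td d)) z * f z - cvd g (μ4 : Measure (Td d)) z * f z)‖ ≤ s * M := fun z => by
    rw [show cvd g (μ1 : Measure (Td d)) z * f z - cvd g (μ2 : Measure (Td d)) z * f z - (cvd g (μ3 : Measure (Td d)) z * f z - cvd g (μ4 : Measure (Td d)) z * f z) =
      (cvd g (μ1 : Measure (Td d)) z - cvd g (μ2 : Measure (Td d)) z - (cvd g (μ3 : Measure (Td d)) z - cvd g (μ4 : Measure (Td d)) z)) * f z by ring, norm_mul]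
    exact mul_le_mul (hs z) (hM z) (abs_nonneg _) ((abs_nonneg _).trans (hs z))
  refine (norm_integral_le_of_norm_le_const (μ := (volume : Measure (Td d))) (Eventually.of_forall key)).trans ?_
  rw [probReal_univ, mul_one]

/-- a version of `lemD` for `W1` -/
lemma lemD_W1 (μ1 μ2 : PTd d) {s : ℝ} (hs : ∀ z, |cvd g (μ1 : Measure (Td d)) z - cvd g (μ2 : Measure (Td d)) z| ≤ s) :
    W1 (cv h μ1) (cv h μ2) ≤ s := by
  refine W1_le fun f hf => ?_
  have hb : ∀ z, |f z - f 0| ≤ 1 := fun z => by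
    have h2 := hf.dist_le_mul z 0
    rw [Real.dist_eq, NNReal.coe_one, one_mul] at h2
    linarith [dist_Td_le z 0]
  have := lemD h μ1 μ2 μ1 μ1 (s := s) (fun z => by rw [sub_self, sub_zero]; exact hs z) (f := fun z => f z - f 0) (hf.continuous.sub continuous_const) hb
  rw [sub_self, sub_zero, integral_sub (lip_integrable hf _) (integrable_const _), integral_sub (lip_integrable hf _) (integrable_const _)] at this
  simp only [integral_const, probReal_univ, one_smul, mul_one] at this
  linarith [(abs_le.1 this).2]

/-- averaging against the kernel and the mollified first marginal -/
lemma cv_star (r : Measure (Td d × Vd d)) [IsProbabilityMeasure r] {μ : PTd d} (hμ : r.map Prod.fst = (μ : Measure (Td d)))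
    {F : Td d → Td d × Vd d → ℝ} {B : Td d × Vd d → ℝ} (hF : Measurable (fun q : Td d × (Td d × Vd d) => F q.1 q.2))
    (hB : Integrable B r) (hb : ∀ z p, |F z p| ≤ B p) :
    ∫ z, (∫ p, gk g r z p * F z p ∂r) ∂(cv h μ : Measure (Td d)) = ∫ p, (∫ z, g z * F (z + p.1) p) ∂r := by
  have hc := h.cont
  rw [cv_integral]
  have h1 : ∀ z, cvd g (μ : Measure (Td d)) z * ∫ p, gk g r z p * F z p ∂r = ∫ p, g (z - p.1) * F z p ∂r := fun z => by
    have e : cvd g (μ : Measure (Td d)) z = rho g r z := by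
      rw [cvd, ← hμ, integral_map measurable_fst.aemeasurable (by fun_prop)]; rfl
    have p0 : rho g r z ≠ 0 := ((h.pos).trans_le (rho_lb h r z)).ne'
    rw [e, ← integral_const_mul]
    refine integral_congr_ae (Eventually.of_forall fun p => ?_)
    simp only [gk]
    field_simp
  simp only [h1]
  rw [integral_integral_swap]
  · refine integral_congr_ae (Eventually.of_forall fun p => ?_)
    have := integral_sub_right_eq_self (μ := (volume : Measure (Td d))) (fun z => g z * F (z + p.1) p) p.1
    simpa using this
  · refine ((hB.comp_snd (volume : Measure (Td d))).const_mul C).mono' ?_ (Eventually.of_forall fun q => ?_)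
    · exact (Measurable.mul (by fun_prop) hF).aestronglyMeasurable
    · simp only [Function.uncurry, norm_mul, Real.norm_eq_abs, abs_of_nonneg (h.nn _)]
      exact mul_le_mul (h.ub _) (hb _ _) (abs_nonneg _) h.C_nonneg

end

variable {d : ℕ}
open ProbabilityTheory

lemma bind_int {α β : Type*} [MeasurableSpace α] [MeasurableSpace β] (μ : Measure α) [SFinite μ] (κ : Kernel α β) [IsSFiniteKernel κ]
    {f : β → ℝ} (hf : Measurable f) (hi : Integrable f (κ ∘ₘ μ)) : ∫ y, f y ∂(κ ∘ₘ μ) = ∫ x, (∫ y, f y ∂(κ x)) ∂μ := by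
  rw [← Measure.snd_compProd] at hi ⊢
  have := (integrable_map_measure hf.aestronglyMeasurable measurable_snd.aemeasurable).1 hi
  rw [Measure.snd, integral_map measurable_snd.aemeasurable hf.aestronglyMeasurable]
  exact Measure.integral_compProd this

/-- resampled velocity kernel -/
def kp (g : Td d → ℝ) (r : Measure (Td d × Vd d)) [IsProbabilityMeasure r] : Kernel (Td d) (Td d × Vd d) :=
  (Kernel.id ×ₖ Kernel.withDensity (Kernel.const (Td d) r) (fun x p => ENNReal.ofReal (gk g r x p))).map (fun t => (t.1, t.2.2))

/-- Euler step kernel -/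
def eK (d : ℕ) (τ : ℝ) : Kernel (Td d × Vd d) (Td d) := (Kernel.id ×ₖ Kernel.const _ (gam d)).map (stX τ)

instance (τ : ℝ) : IsMarkovKernel (eK d τ) := by
  unfold eK
  exact Kernel.IsMarkovKernel.map _ (stX_meas' τ)

lemma eK_apply (τ : ℝ) (p : Td d × Vd d) : eK d τ p = (gam d).map (fun z => stX τ (p, z)) := by
  have h1 := stX_meas' (d := d) τ
  rw [eK, Kernel.map_apply _ h1, Kernel.prod_apply, Kernel.id_apply, Kernel.const_apply, Measure.dirac_prod, Measure.map_map h1 measurable_prodMk_left]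
  rfl

lemma eK_integral (τ : ℝ) (p : Td d × Vd d) {f : Td d → ℝ} (hf : Measurable f) : ∫ y, f y ∂(eK d τ p) = ∫ z, f (stX τ (p, z)) ∂(gam d) := by
  rw [eK_apply, integral_map _ hf.aestronglyMeasurable]
  exact ((stX_meas' τ).comp measurable_prodMk_left).aemeasurable

lemma eK_comp (τ : ℝ) (P : Measure (Td d × Vd d)) [IsProbabilityMeasure P] : eK d τ ∘ₘ P = (mG P τ : Measure (Td d)) := by
  show _ = (P.prod (gam d)).map (stX τ)
  rw [eK, ← Measure.map_comp _ _ (stX_meas' τ), ← Measure.compProd_eq_comp_prod, Measure.compProd_const]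

section
variable {g : Td d → ℝ} {C g0 ε : ℝ} (h : Mol g C g0 ε) (r : Measure (Td d × Vd d)) [IsProbabilityMeasure r]
include h

lemma kp_apply (x : Td d) : kp g r x = (r.withDensity (fun p => ENNReal.ofReal (gk g r x p))).map (fun p => (x, p.2)) := by
  have h1 : Measurable (Function.uncurry fun x p => ENNReal.ofReal (gk g r x p)) := (gk_meas h r).ennreal_ofReal
  have := Kernel.IsSFiniteKernel.withDensity (Kernel.const (Td d) r) (f := fun x p => ENNReal.ofReal (gk g r x p)) (fun _ _ => ENNReal.ofReal_ne_top)
  rw [kp, Kernel.map_apply _ (by fun_prop), Kernel.prod_apply, Kernel.id_apply, Kernel.withDensity_apply _ h1, Kernel.const_apply,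
    Measure.dirac_prod, Measure.map_map (by fun_prop) (by fun_prop)]
  rfl

lemma kp_markov : IsMarkovKernel (kp g r) := by
  refine ⟨fun x => ?_⟩
  rw [kp_apply h r x]
  have : IsProbabilityMeasure (r.withDensity (fun p => ENNReal.ofReal (gk g r x p))) := by
    refine ⟨?_⟩
    rw [withDensity_apply _ MeasurableSet.univ, Measure.restrict_univ,
      ← ofReal_integral_eq_lintegral_ofReal (gk_int h r x) (Eventually.of_forall (gk_nn h r x)), gk_int1 h r x]
    simp
  exact Measure.isProbabilityMeasure_map (by fun_prop)

lemma kp_integral (x : Td d) {f : Td d × Vd d → ℝ} (hf : Measurable f) :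
    ∫ p, f p ∂(kp g r x) = ∫ p, gk g r x p * f (x, p.2) ∂r := by
  have hm : Measurable (fun p => gk g r x p) := (gk_meas h r).comp measurable_prodMk_left
  rw [kp_apply h r x, integral_map (by fun_prop) hf.aestronglyMeasurable,
    integral_withDensity_eq_integral_toReal_smul (by fun_prop) (Eventually.of_forall fun _ => ENNReal.ofReal_lt_top)]
  refine integral_congr_ae (Eventually.of_forall fun p => ?_)
  simp [ENNReal.toReal_ofReal (gk_nn h r x p)]

lemma kp_ae {R : ℝ} (hR : ∀ᵐ p ∂r, ‖p.2‖ ≤ R) (x : Td d) : ∀ᵐ p ∂(kp g r x), ‖p.2‖ ≤ R := by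
  rw [kp_apply h r x, ae_map_iff (by fun_prop) (measurableSet_le (by fun_prop) (by fun_prop))]
  exact (withDensity_absolutelyContinuous _ _).ae_le hR

lemma kp_fst (x : Td d) : (kp g r x).map Prod.fst = Measure.dirac x := by
  have := kp_markov h r
  have hp := this.isProbabilityMeasure x
  rw [kp_apply h r x, Measure.map_map (by fun_prop) (by fun_prop)]
  have h2 : (Prod.fst ∘ fun p : Td d × Vd d => (x, p.2)) = fun _ => x := rfl
  rw [h2, Measure.map_const]
  have h3 : (kp g r x) Set.univ = 1 := measure_univ
  rw [kp_apply h r x, Measure.map_apply (by fun_prop) MeasurableSet.univ, Set.preimage_univ] at h3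
  rw [h3, one_smul]

end

/-- the step operator -/
def Fop (τ : ℝ) (f : Td d → ℝ) (x : Td d) (p : Td d × Vd d) : ℝ := ∫ z, f (stX τ ((x, p.2), z)) ∂(gam d)
def Sop (g : Td d → ℝ) (r : Measure (Td d × Vd d)) (τ : ℝ) (f : Td d → ℝ) (x : Td d) : ℝ := ∫ p, gk g r x p * Fop τ f x p ∂r

lemma stX_int {f : Td d → ℝ} (hf : Continuous f) (τ : ℝ) (p : Td d × Vd d) : Integrable (fun z => f (stX τ (p, z))) (gam d) := by
  have h1 := (cont_integrable hf ((gam d).map (fun z => stX τ (p, z))))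
  exact h1.comp_measurable ((stX_meas' τ).comp measurable_prodMk_left)

lemma Fop_meas {f : Td d → ℝ} (hf : Continuous f) (τ : ℝ) : Measurable (fun q : Td d × (Td d × Vd d) => Fop τ f q.1 q.2) := by
  have h1 : Measurable (fun t : (Td d × (Td d × Vd d)) × Vd d => f (stX τ ((t.1.1, t.1.2.2), t.2))) :=
    hf.measurable.comp ((stX_meas' τ).comp (by fun_prop))
  exact h1.stronglyMeasurable.integral_prod_right'.measurable

lemma lip1 {f : Td d → ℝ} (hf : LipschitzWith 1 f) (x y : Td d) : |f x - f y| ≤ ‖x - y‖ := by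
  have h2 := hf.dist_le_mul x y
  rw [Real.dist_eq, dist_eq_norm, NNReal.coe_one, one_mul] at h2
  exact h2

lemma prob_int_le {Ω : Type*} [MeasurableSpace Ω] {μ : Measure Ω} [IsProbabilityMeasure μ] {f : Ω → ℝ} {c : ℝ} (hf : ∀ x, |f x| ≤ c) : |∫ x, f x ∂μ| ≤ c := by
  have := norm_integral_le_of_norm_le_const (μ := μ) (f := f) (C := c) (Eventually.of_forall hf)
  simpa using this

section
variable {g : Td d → ℝ} {C g0 ε : ℝ} (h : Mol g C g0 ε) (r : Measure (Td d × Vd d)) [IsProbabilityMeasure r]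

lemma v_int {R : ℝ} (hR : ∀ᵐ p ∂r, ‖p.2‖ ≤ R) : Integrable (fun p => ‖p.2‖) r :=
  Integrable.of_bound (by fun_prop) R (by filter_upwards [hR] with p hp; simpa using hp)

lemma v2_int {R : ℝ} (hR : ∀ᵐ p ∂r, ‖p.2‖ ≤ R) : Integrable (fun p => ‖p.2‖^2) r :=
  Integrable.of_bound (by fun_prop) (R^2) (by
    filter_upwards [hR] with p hp
    rw [Real.norm_eq_abs, abs_of_nonneg (by positivity)]
    exact pow_le_pow_left₀ (norm_nonneg _) hp 2)

include h

lemma Sop_lip {R τ : ℝ} (hτ : 0 ≤ τ) (hR : ∀ᵐ p ∂r, ‖p.2‖ ≤ R) {f : Td d → ℝ} (hf : LipschitzWith 1 f) (x x' : Td d) :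
    |Sop g r τ f x - Sop g r τ f x'| ≤ (1 + (C / g0 + C^2 / g0^2) * (τ * ∫ p, ‖p.2‖ ∂r)) * ‖x - x'‖ := by
  have := lemAB h r (F := Fop τ f) (A := fun _ => 1) (B := fun p => τ * ‖p.2‖) (c := fun x => ∫ z, f (x + piT (√τ • z)) ∂(gam d)) (A' := 1)
    (fun x => (Fop_meas hf.continuous τ).comp measurable_prodMk_left) (integrable_const _) ((v_int r hR).const_mul τ)
    (fun x x' p => by
      rw [one_mul, Fop, Fop, ← integral_sub (stX_int hf.continuous _ _) (stX_int hf.continuous _ _)]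
      refine prob_int_le fun z => (lip1 hf _ _).trans ?_
      simp [stX])
    (fun x p => by
      have i2 := stX_int hf.continuous τ (x, (0 : Vd d))
      simp only [stX, smul_zero, zero_add] at i2
      rw [Fop, ← integral_sub (stX_int hf.continuous _ _) i2]
      refine prob_int_le fun z => (lip1 hf _ _).trans ?_
      rw [stX, piT_add]
      have := norm_piT_le (τ • p.2)
      rw [norm_smul, Real.norm_eq_abs, abs_of_nonneg hτ] at this
      refine le_trans (le_of_eq ?_) this
      congr 1
      show x + (piT (τ • p.2) + piT (√τ • z)) - (x + piT (√τ • z)) = _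
      abel)
    (fun x => by simp [gk_int1 h r x]) x x'
  rwa [integral_const_mul] at this

lemma Sop_sub {R τ : ℝ} (hτ : 0 ≤ τ) (hR : ∀ᵐ p ∂r, ‖p.2‖ ≤ R) {f : Td d → ℝ} (hf : LipschitzWith 1 f) (x : Td d) :
    |Sop g r τ f x - f x| ≤ τ * R + √τ * Mz d := by
  have hF : ∀ p : Td d × Vd d, |Fop τ f x p - f x| ≤ τ * ‖p.2‖ + √τ * Mz d := fun p => by
    have e : Fop τ f x p - f x = ∫ z, (f (stX τ ((x, p.2), z)) - f x) ∂(gam d) := by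
      rw [integral_sub (stX_int hf.continuous _ _) (integrable_const _)]; simp [Fop]
    rw [e]
    have i := (gam_mom (d := d)).const_mul (√τ)
    have := norm_integral_le_of_norm_le (μ := gam d) (f := fun z => f (stX τ ((x, p.2), z)) - f x) (g := fun z => τ * ‖p.2‖ + √τ * ‖z‖)
      ((integrable_const _).add i) (Eventually.of_forall fun z => ?_)
    · rw [integral_add (integrable_const _) i, integral_const_mul (√τ) (fun z : Vd d => ‖z‖)] at this
      simpa [Mz] using this
    · refine (lip1 hf _ _).trans ?_
      have h3 := dist_add_piT x (τ • p.2 + √τ • z)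
      rw [dist_eq_norm] at h3
      refine h3.trans ((norm_add_le _ _).trans ?_)
      rw [norm_smul, norm_smul, Real.norm_eq_abs, Real.norm_eq_abs, abs_of_nonneg hτ, abs_of_nonneg (Real.sqrt_nonneg _)]
  have hFm : Measurable (Fop τ f x) := (Fop_meas hf.continuous τ).comp measurable_prodMk_left
  have hb : ∀ᵐ p ∂r, ‖Fop τ f x p - f x‖ ≤ τ * R + √τ * Mz d := by
    filter_upwards [hR] with p hp
    exact (hF p).trans (by gcongr)
  have hi0 : Integrable (fun p => Fop τ f x p - f x) r := Integrable.of_bound (hFm.sub_const _).aestronglyMeasurable _ hb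
  have e2 : Sop g r τ f x - f x = ∫ p, gk g r x p * (Fop τ f x p - f x) ∂r := by
    have i1 : Integrable (Fop τ f x) r := (hi0.add (integrable_const (f x))).congr (Eventually.of_forall fun p => by simp)
    simp only [mul_sub]
    rw [integral_sub (gk_mul_int h r x i1) ((gk_int h r x).mul_const _), integral_mul_const, gk_int1 h r x, one_mul]; rfl
  rw [e2]
  have := norm_integral_le_of_norm_le (μ := r) (f := fun p => gk g r x p * (Fop τ f x p - f x)) (g := fun p => gk g r x p * (τ * R + √τ * Mz d))
    ((gk_int h r x).mul_const _) (by
      filter_upwards [hb] with p hp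
      rw [norm_mul, Real.norm_eq_abs, abs_of_nonneg (gk_nn h r x p)]
      exact mul_le_mul_of_nonneg_left hp (gk_nn h r x p))
  rwa [integral_mul_const, gk_int1 h r x, one_mul] at this

lemma Sop_cv {μ : PTd d} (hμ : r.map Prod.fst = (μ : Measure (Td d))) (τ : ℝ) {f : Td d → ℝ} (hf : Continuous f) :
    ∫ x, Sop g r τ f x ∂(cv h μ : Measure (Td d)) = ∫ x, f x ∂(cv h (mG r τ) : Measure (Td d)) := by
  have hc := h.cont
  obtain ⟨B, hB⟩ := (isCompact_univ (X := Td d)).exists_bound_of_continuousOn hf.continuousOn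
  have hB' : ∀ y, |f y| ≤ B := fun y => hB y trivial
  have := cv_star h r hμ (F := Fop τ f) (B := fun _ => B) (Fop_meas hf τ) (integrable_const _) (fun z p => prob_int_le fun _ => hB' _)
  unfold Sop
  have h5 : Continuous (fun q : Td d × Td d => g q.2 * f (q.2 + q.1)) := by fun_prop
  rw [this, cv_integral, cvd_fub h _ hf, mG_integral r τ (f := fun y => ∫ z, g z * f (z + y)) h5.measurable.stronglyMeasurable.integral_prod_right'.measurable]
  have hi : Integrable (fun q => ∫ z, g z * f (z + stX τ q)) (r.prod (gam d)) :=
    ((cont_integrable h5 ((mG r τ : Measure (Td d)).prod volume)).integral_prod_left).comp_measurable (stX_meas' τ)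
  rw [integral_prod _ hi]
  refine integral_congr_ae (Eventually.of_forall fun p => ?_)
  simp only [Fop, ← integral_const_mul]
  rw [integral_integral_swap]
  · refine integral_congr_ae (Eventually.of_forall fun z => ?_)
    refine integral_congr_ae (Eventually.of_forall fun y => ?_)
    simp [stX, add_assoc]
  · have hs := stX_cont (d := d)
    have h7 : Continuous (fun q : Td d × Vd d => stX τ ((q.1 + p.1, p.2), q.2)) :=
      hs.comp (f := fun q : Td d × Vd d => (τ, ((q.1 + p.1, p.2), q.2))) (by fun_prop)
    refine Integrable.of_bound (Continuous.aestronglyMeasurable (by unfold Function.uncurry; fun_prop)) (C * B) (Eventually.of_forall fun q => ?_)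
    simp only [Function.uncurry, norm_mul, Real.norm_eq_abs, abs_of_nonneg (h.nn _)]
    exact mul_le_mul (h.ub _) (hB' _) (abs_nonneg _) h.C_nonneg

lemma Sop_bind (τ : ℝ) {f : Td d → ℝ} (hf : Continuous f) (ξ : Measure (Td d)) [IsProbabilityMeasure ξ] :
    ∫ y, f y ∂(eK d τ ∘ₘ (kp g r ∘ₘ ξ)) = ∫ x, Sop g r τ f x ∂ξ := by
  have := kp_markov h r
  have hm : Measurable (fun p : Td d × Vd d => ∫ z, f (stX τ (p, z)) ∂(gam d)) :=
    ((hf.measurable.comp (stX_meas' τ)).stronglyMeasurable.integral_prod_right').measurable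
  obtain ⟨B, hB⟩ := (isCompact_univ (X := Td d)).exists_bound_of_continuousOn hf.continuousOn
  rw [bind_int _ _ hf.measurable (cont_integrable hf _)]
  simp only [eK_integral τ _ hf.measurable]
  rw [bind_int _ _ hm (Integrable.of_bound hm.aestronglyMeasurable B (Eventually.of_forall fun p => prob_int_le fun _ => hB _ trivial))]
  refine integral_congr_ae (Eventually.of_forall fun x => ?_)
  simp only [kp_integral h r x hm]
  rfl

end

variable {d : ℕ}
open ProbabilityTheory

/-- cost functions on the torus -/
structure LC (l : Td d → Vd d → ℝ) (CL : ℝ) : Prop where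
  meas : Measurable (fun q : Td d × Vd d => l q.1 q.2)
  nn : ∀ y q, 0 ≤ l y q
  gr : ∀ y q, l y q ≤ CL * (1 + ‖q‖^2)
  md : ∀ y y' q, l y' q ≤ l y q + ‖y' - y‖ * (CL * (1 + ‖q‖^2))

lemma LC.pos {l : Td d → Vd d → ℝ} {CL : ℝ} (h : LC l CL) : 0 ≤ CL := by
  have := (h.nn 0 0).trans (h.gr 0 0)
  simpa using this

section
variable {g : Td d → ℝ} {C g0 ε : ℝ} (h : Mol g C g0 ε) (r : Measure (Td d × Vd d)) [IsProbabilityMeasure r]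
variable {l : Td d → Vd d → ℝ} {CL : ℝ} (hl : LC l CL) {R : ℝ} (hR : ∀ᵐ p ∂r, ‖p.2‖ ≤ R)

include hR in
lemma A_int (CL : ℝ) : Integrable (fun p => CL * (1 + ‖p.2‖^2)) r :=
  ((integrable_const 1).add (v2_int r hR)).const_mul CL

include hl in
lemma LC.int {R : ℝ} (hR : ∀ᵐ p ∂r, ‖p.2‖ ≤ R) : Integrable (fun p => l p.1 (-p.2)) r := by
  refine (A_int r hR CL).mono' (hl.meas.comp (by fun_prop : Measurable fun p : Td d × Vd d => (p.1, -p.2))).aestronglyMeasurable (Eventually.of_forall fun p => ?_)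
  rw [Real.norm_eq_abs, abs_of_nonneg (hl.nn _ _)]
  simpa using hl.gr p.1 (-p.2)

include h hl hR

lemma step_cost {μ : PTd d} (hμ : r.map Prod.fst = (μ : Measure (Td d))) (ξ : PTd d) :
    ∫ p, l p.1 (-p.2) ∂(kp g r ∘ₘ (ξ : Measure (Td d))) ≤ (∫ p, l p.1 (-p.2) ∂r) + ε * (∫ p, CL * (1 + ‖p.2‖^2) ∂r)
      + (C / g0 + (C / g0 + C^2 / g0^2)) * (∫ p, CL * (1 + ‖p.2‖^2) ∂r) * W1 ξ (cv h μ) := by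
  have hk := kp_markov h r
  have hA := A_int r hR CL
  have hA0 : ∀ p : Td d × Vd d, 0 ≤ CL * (1 + ‖p.2‖^2) := fun p => mul_nonneg hl.pos (by positivity)
  have hm : Measurable (fun p : Td d × Vd d => l p.1 (-p.2)) := hl.meas.comp (by fun_prop : Measurable fun p : Td d × Vd d => (p.1, -p.2))
  have hFm : Measurable (fun q : Td d × (Td d × Vd d) => l q.1 (-q.2.2)) := hm.comp (by fun_prop : Measurable fun q : Td d × (Td d × Vd d) => (q.1, q.2.2))
  have hae : ∀ᵐ p ∂(kp g r ∘ₘ (ξ : Measure (Td d))), ‖p.2‖ ≤ R := by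
    rw [Measure.ae_comp_iff (measurableSet_le (by fun_prop) (by fun_prop))]
    exact Eventually.of_forall (kp_ae h r hR)
  have e1 : ∫ p, l p.1 (-p.2) ∂(kp g r ∘ₘ (ξ : Measure (Td d))) = ∫ x, (∫ p, gk g r x p * l x (-p.2) ∂r) ∂(ξ : Measure (Td d)) := by
    rw [bind_int _ _ hm (LC.int _ hl hae)]
    refine integral_congr_ae (Eventually.of_forall fun x => ?_)
    simp only [kp_integral h r x hm]
  have hb : ∀ (x : Td d) (p : Td d × Vd d), |l x (-p.2)| ≤ CL * (1 + ‖p.2‖^2) := fun x p => by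
    rw [abs_of_nonneg (hl.nn _ _)]; simpa using hl.gr x (-p.2)
  have hlip := lemAB h r (F := fun x p => l x (-p.2)) (A := fun p => CL * (1 + ‖p.2‖^2)) (B := fun p => CL * (1 + ‖p.2‖^2)) (c := fun _ => 0)
    (A' := C / g0 * ∫ p, CL * (1 + ‖p.2‖^2) ∂r) (fun x => hFm.comp measurable_prodMk_left) hA hA
    (fun x x' p => by
      have a1 := hl.md x x' (-p.2)
      have a2 := hl.md x' x (-p.2)
      rw [norm_neg] at a1 a2
      rw [norm_sub_rev] at a1
      rw [abs_le]; constructor <;> linarith)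
    (fun x p => by simpa using hb x p)
    (fun x => by
      rw [← integral_const_mul]
      exact integral_mono (gk_mul_int h r x hA) (hA.const_mul _) fun p => mul_le_mul_of_nonneg_right (gk_le h r x p) (hA0 p))
  have hp := h.pos
  have hC := h.C_nonneg
  have hI : 0 ≤ ∫ p, CL * (1 + ‖p.2‖^2) ∂r := integral_nonneg hA0
  have w := lip_W1 (by positivity) hlip ξ (cv h μ)
  have e2 := cv_star h r hμ (F := fun x p => l x (-p.2)) hFm hA hb
  have e3 : ∫ p, (∫ z, g z * l (z + p.1) (-p.2)) ∂r ≤ (∫ p, l p.1 (-p.2) ∂r) + ε * (∫ p, CL * (1 + ‖p.2‖^2) ∂r) := by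
    rw [← integral_const_mul, ← integral_add (LC.int r hl hR) (hA.const_mul _)]
    have hgc := h.cont
    have key : ∀ p : Td d × Vd d, (∫ z, g z * l (z + p.1) (-p.2)) ≤ l p.1 (-p.2) + ε * (CL * (1 + ‖p.2‖^2)) := fun p => by
      have b1 : Integrable (fun z : Td d => g z * l (z + p.1) (-p.2)) volume := by
        refine Integrable.of_bound (Measurable.aestronglyMeasurable (hgc.measurable.mul (hm.comp (by fun_prop : Measurable fun z : Td d => (z + p.1, p.2))))) (C * (CL * (1 + ‖p.2‖^2))) (Eventually.of_forall fun z => ?_)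
        rw [norm_mul, Real.norm_eq_abs, Real.norm_eq_abs, abs_of_nonneg (h.nn _)]
        exact mul_le_mul (h.ub _) (hb _ _) (abs_nonneg _) hC
      have b2 : Integrable (fun z : Td d => g z * l p.1 (-p.2)) volume := cont_integrable (by fun_prop) _
      have b3 : Integrable (fun z : Td d => ‖z‖ * g z * (CL * (1 + ‖p.2‖^2))) volume := cont_integrable (by fun_prop) _
      have := integral_mono b1 (b2.add b3) fun z => by
        have c1 := hl.md p.1 (z + p.1) (-p.2)
        rw [add_sub_cancel_right, norm_neg] at c1
        have c2 := mul_le_mul_of_nonneg_left c1 (h.nn z)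
        show _ ≤ g z * l p.1 (-p.2) + ‖z‖ * g z * (CL * (1 + ‖p.2‖^2))
        linarith
      rw [integral_add' b2 b3, integral_mul_const, integral_mul_const, h.int1, one_mul] at this
      have c3 := mul_le_mul_of_nonneg_right h.mom (hA0 p)
      linarith
    refine integral_mono_of_nonneg (Eventually.of_forall fun p => integral_nonneg fun z => mul_nonneg (h.nn _) (hl.nn _ _)) ((LC.int r hl hR).add (hA.const_mul _)) (Eventually.of_forall key)
  rw [e1]
  have w2 := (abs_le.1 w).2
  rw [e2] at w2
  rw [← add_mul] at w2
  linarith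

omit hl
lemma step_W1 {τ : ℝ} (hτ : 0 ≤ τ) (hR0 : 0 ≤ R) (ξ ξ' μ0 μ1 μr : PTd d) (hμ : r.map Prod.fst = (μr : Measure (Td d)))
    (hξ : (ξ' : Measure (Td d)) = eK d τ ∘ₘ (kp g r ∘ₘ (ξ : Measure (Td d)))) {E1 E2 : ℝ}
    (h1 : ∀ z, |cvd g (mG r τ : Measure (Td d)) z - cvd g (μr : Measure (Td d)) z - (cvd g (μ1 : Measure (Td d)) z - cvd g (μ0 : Measure (Td d)) z)| ≤ E1)
    (h2 : ∀ z, |cvd g (μ0 : Measure (Td d)) z - cvd g (μr : Measure (Td d)) z| ≤ E2) :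
    W1 ξ' (cv h μ1) ≤ (1 + (C / g0 + C^2 / g0^2) * (τ * ∫ p, ‖p.2‖ ∂r)) * W1 ξ (cv h μ0) + E1 + E2 * (τ * R + √τ * Mz d) := by
  refine W1_le fun f hf => ?_
  have hp := h.pos
  have hC := h.C_nonneg
  have hI : 0 ≤ ∫ p, ‖p.2‖ ∂r := integral_nonneg fun _ => norm_nonneg _
  have hSl := Sop_lip h r hτ hR hf
  have hSc := cont_of_lip hSl
  have iS : ∀ μ : PTd d, Integrable (Sop g r τ f) (μ : Measure (Td d)) := fun μ => cont_integrable hSc _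
  have iF : ∀ μ : PTd d, Integrable f (μ : Measure (Td d)) := fun μ => cont_integrable hf.continuous _
  have a1 := (abs_le.1 (lip_W1 (by positivity) hSl ξ (cv h μ0))).2
  have a2 := (abs_le.1 (lemD h μ0 μr μ0 μ0 (fun z => by rw [sub_self, sub_zero]; exact h2 z) (f := fun z => Sop g r τ f z - f z) (hSc.sub hf.continuous) (Sop_sub h r hτ hR hf))).2
  have a3 := (abs_le.1 (lemD h (mG r τ) μr μ1 μ0 h1 (f := fun z => f z - f 0) (hf.continuous.sub continuous_const) (M := 1) (fun z => (lip1 hf z 0).trans (by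
    have := norm_Td_le (z - 0); linarith)))).2
  simp only [integral_sub (iS _) (iF _), integral_sub (iF _) (integrable_const _), integral_const, probReal_univ, one_smul] at a2 a3
  rw [sub_self, sub_zero, Sop_cv h r hμ τ hf.continuous] at a2
  rw [hξ, Sop_bind h r τ hf.continuous]
  linarith

end

open ProbabilityTheory
section
variable {d : ℕ}

def trv (R : ℝ) (u : Vd d) : Vd d := if ‖u‖ ≤ R then -u else 0

lemma trv_meas (R : ℝ) : Measurable (trv (d := d) R) :=
  Measurable.ite (measurableSet_le (by fun_prop) (by fun_prop)) (by fun_prop) (by fun_prop)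

lemma trv_le {R : ℝ} (hR : 0 ≤ R) (u : Vd d) : ‖trv R u‖ ≤ R := by
  unfold trv; split_ifs with h
  · simpa using h
  · simpa using hR

lemma trv_le' (R : ℝ) (u : Vd d) : ‖trv R u‖ ≤ ‖u‖ := by
  unfold trv; split_ifs with h <;> simp

lemma trv_ex {R : ℝ} (hR : 0 < R) (u : Vd d) : ‖trv R u + u‖ ≤ ‖u‖^2 / R := by
  unfold trv; split_ifs with h
  · simp; positivity
  · rw [zero_add, le_div_iff₀ hR]; push Not at h; nlinarith [norm_nonneg u]

lemma trv_ex' (R : ℝ) (u : Vd d) : ‖trv R u + u‖ ≤ ‖u‖ := by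
  unfold trv; split_ifs with h <;> simp

variable {m : ℝ → PTd d} (hm : W1ContOn m (Set.Ici 0)) {α : ℝ → Td d → Vd d}

/-- averaged truncated measure -/
def rK (α : ℝ → Td d → Vd d) (R a b : ℝ) : Measure (Td d × Vd d) :=
  ENNReal.ofReal ((b - a)⁻¹) • (Mst m hm a b).map (fun q => (q.2, trv R (α q.1 q.2)))

variable (hα : Measurable (fun q : ℝ × Td d => α q.1 q.2))
  (hE : ∀ a b : ℝ, 0 ≤ a → Integrable (fun q : ℝ × Td d => sqnorm (α q.1 q.2)) (Mst m hm a b))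
  (hFP : ∀ s₁ s₂ : ℝ, 0 ≤ s₁ → s₁ ≤ s₂ → FPeq 1 m α s₁ s₂)

section
include hα
lemma rK_map_meas (R : ℝ) : Measurable (fun q : ℝ × Td d => (q.2, trv R (α q.1 q.2))) :=
  measurable_snd.prodMk ((trv_meas R).comp hα)

lemma rK_prob (R : ℝ) {a b : ℝ} (hab : a < b) : IsProbabilityMeasure (rK hm α R a b) := by
  refine ⟨?_⟩
  have h1 := Mst_real hm hab.le
  rw [rK, Measure.smul_apply, Measure.map_apply (rK_map_meas hα R) MeasurableSet.univ, Set.preimage_univ, smul_eq_mul,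
    ← ofReal_measureReal (by finiteness), h1, ← ENNReal.ofReal_mul (by have := sub_pos.2 hab; positivity),
    inv_mul_cancel₀ (sub_pos.2 hab).ne', ENNReal.ofReal_one]

lemma rK_integral (R : ℝ) {a b : ℝ} (hab : a < b) {f : Td d × Vd d → ℝ} (hf : Measurable f) :
    ∫ p, f p ∂(rK hm α R a b) = (b - a)⁻¹ * ∫ q, f (q.2, trv R (α q.1 q.2)) ∂(Mst m hm a b) := by
  rw [rK, integral_smul_measure, integral_map (rK_map_meas hα R).aemeasurable hf.aestronglyMeasurable,
    ENNReal.toReal_ofReal (by have := sub_pos.2 hab; positivity), smul_eq_mul]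

lemma rK_ae {R : ℝ} (hR : 0 ≤ R) (a b : ℝ) : ∀ᵐ p ∂(rK hm α R a b), ‖p.2‖ ≤ R := by
  refine Measure.ae_smul_measure ?_ _
  rw [ae_map_iff (rK_map_meas hα R).aemeasurable (measurableSet_le (by fun_prop) (by fun_prop))]
  exact Eventually.of_forall fun q => trv_le hR _
end

section
include hα hE
lemma a2_int {a b : ℝ} (ha : 0 ≤ a) : Integrable (fun q : ℝ × Td d => ‖α q.1 q.2‖^2) (Mst m hm a b) := by
  refine Integrable.mono' (hE a b ha) (by fun_prop) (Eventually.of_forall fun q => ?_)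
  rw [Real.norm_eq_abs, abs_of_nonneg (by positivity)]; exact le_sqnorm _

lemma a1_int {a b : ℝ} (ha : 0 ≤ a) : Integrable (fun q : ℝ × Td d => ‖α q.1 q.2‖) (Mst m hm a b) := by
  refine Integrable.mono' ((integrable_const 1).add (a2_int hm hα hE (b := b) ha)) (by fun_prop) (Eventually.of_forall fun q => ?_)
  simp only [Pi.add_apply, norm_norm]
  nlinarith [sq_nonneg (‖α q.1 q.2‖ - 1)]

lemma ax_int (R : ℝ) {a b : ℝ} (ha : 0 ≤ a) : Integrable (fun q : ℝ × Td d => ‖trv R (α q.1 q.2) + α q.1 q.2‖) (Mst m hm a b) := by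
  refine Integrable.mono' (a1_int hm hα hE ha) (by have := (trv_meas R).comp hα; fun_prop) (Eventually.of_forall fun q => ?_)
  rw [norm_norm]; exact trv_ex' _ _

include hFP
lemma fp_mst {C : ℝ} {φ : Vd d → ℝ} (h : TB C φ) {a b : ℝ} (ha : 0 ≤ a) (hab : a ≤ b) :
    Integrable (fun q : ℝ × Td d => lapl φ (secT q.2) - dotp (α q.1 q.2) (gradv φ (secT q.2))) (Mst m hm a b) ∧
    (∫ y, φ (secT y) ∂(m b : Measure (Td d))) - (∫ y, φ (secT y) ∂(m a : Measure (Td d))) =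
      ∫ q, (lapl φ (secT q.2) - dotp (α q.1 q.2) (gradv φ (secT q.2))) ∂(Mst m hm a b) := by
  have hT := h.test
  have hgc : Continuous (gradv φ) := (tf_grad_cont hT).comp (continuous_const.prodMk continuous_id : Continuous fun x : Vd d => ((0:ℝ), x))
  have hlc : Continuous (lapl φ) := (tf_lapl_cont hT).comp (continuous_const.prodMk continuous_id : Continuous fun x : Vd d => ((0:ℝ), x))
  have hS : Measurable (fun q : ℝ × Td d => secT q.2) := measurable_secT.comp measurable_snd
  have hi : Integrable (fun q : ℝ × Td d => lapl φ (secT q.2) - dotp (α q.1 q.2) (gradv φ (secT q.2))) (Mst m hm a b) := by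
    refine Integrable.mono' ((integrable_const C).add ((a1_int hm hα hE (b := b) ha).mul_const (d * C)))
      ((hlc.measurable.comp hS).sub (dotp_meas hα (hgc.measurable.comp hS))).aestronglyMeasurable (Eventually.of_forall fun q => ?_)
    refine (norm_sub_le _ _).trans ?_
    have h1 := h.b2 (secT q.2)
    have h2 := abs_dotp_le (α q.1 q.2) (gradv φ (secT q.2))
    have h3 : d * ‖α q.1 q.2‖ * ‖gradv φ (secT q.2)‖ ≤ d * ‖α q.1 q.2‖ * C := by gcongr; exact h.b1 _
    simp only [Real.norm_eq_abs, Pi.add_apply]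
    linarith
  refine ⟨hi, ?_⟩
  have := (FPeq_iff m α a b).1 (hFP a b ha hab) _ hT
  rw [this, ← (Mst_int hm ha hab hi).2]
  simp only [fpI, tderiv, deriv_const, zero_add, one_mul]

lemma fp_E2 {C : ℝ} {φ : Vd d → ℝ} (h : TB C φ) {a b s : ℝ} (ha : 0 ≤ a) (has : a ≤ s) (hsb : s ≤ b) :
    |(∫ y, φ (secT y) ∂(m s : Measure (Td d))) - (∫ y, φ (secT y) ∂(m a : Measure (Td d)))| ≤
      C * ((b - a) + d * ∫ q, ‖α q.1 q.2‖ ∂(Mst m hm a b)) := by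
  obtain ⟨h1, h2⟩ := fp_mst hm hα hE hFP h ha has
  have i1 := a1_int hm hα hE (b := s) ha
  have i2 := a1_int hm hα hE (b := b) ha
  have hC := h.nonneg
  have key : ∀ q : ℝ × Td d, ‖lapl φ (secT q.2) - dotp (α q.1 q.2) (gradv φ (secT q.2))‖ ≤ C + ‖α q.1 q.2‖ * (d * C) := fun q => by
    refine (norm_sub_le _ _).trans ?_
    have h1 := h.b2 (secT q.2)
    have h2 := abs_dotp_le (α q.1 q.2) (gradv φ (secT q.2))
    have h3 : d * ‖α q.1 q.2‖ * ‖gradv φ (secT q.2)‖ ≤ d * ‖α q.1 q.2‖ * C := by gcongr; exact h.b1 _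
    simp only [Real.norm_eq_abs]
    linarith
  have h3 := norm_integral_le_of_norm_le (μ := Mst m hm a s) ((integrable_const C).add (i1.mul_const (d * C))) (Eventually.of_forall key)
  simp only [Pi.add_apply] at h3
  rw [integral_add (integrable_const C) (i1.mul_const (d * C)), integral_const, integral_mul_const, Mst_real hm has, smul_eq_mul] at h3
  rw [h2]
  refine h3.trans ?_
  have h4 : ∫ q, ‖α q.1 q.2‖ ∂(Mst m hm a s) ≤ ∫ q, ‖α q.1 q.2‖ ∂(Mst m hm a b) := by
    have j2 := Mst_int hm ha (has.trans hsb) i2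
    rw [← (Mst_int hm ha has i1).2, ← j2.2]
    refine intervalIntegral.integral_mono_interval le_rfl has hsb ?_ j2.1
    exact Eventually.of_forall fun s => integral_nonneg fun _ => norm_nonneg _
  have h5 : (s - a) * C ≤ (b - a) * C := by gcongr
  have h6 : (∫ q, ‖α q.1 q.2‖ ∂(Mst m hm a s)) * (d * C) ≤ (∫ q, ‖α q.1 q.2‖ ∂(Mst m hm a b)) * (d * C) := by gcongr
  linarith

lemma fp_E2r {C : ℝ} {φ : Vd d → ℝ} (h : TB C φ) (R : ℝ) {a b : ℝ} (ha : 0 ≤ a) (hab : a < b) :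
    |(∫ p, φ (secT p.1) ∂(rK hm α R a b)) - (∫ y, φ (secT y) ∂(m a : Measure (Td d)))| ≤
      C * ((b - a) + d * ∫ q, ‖α q.1 q.2‖ ∂(Mst m hm a b)) := by
  have hpm : Measurable (fun y : Td d => φ (secT y)) := h.smooth.continuous.measurable.comp measurable_secT
  rw [rK_integral hm hα R hab (f := fun p => φ (secT p.1)) (hpm.comp measurable_fst)]
  have hi : Integrable (fun q : ℝ × Td d => φ (secT q.2)) (Mst m hm a b) :=
    Integrable.of_bound (hpm.comp measurable_snd).aestronglyMeasurable C (Eventually.of_forall fun q => h.b0 _)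
  set c := ∫ y, φ (secT y) ∂(m a : Measure (Td d))
  set E := C * ((b - a) + d * ∫ q, ‖α q.1 q.2‖ ∂(Mst m hm a b))
  have hp := sub_pos.2 hab
  have e : (b - a)⁻¹ * (∫ q, φ (secT q.2) ∂(Mst m hm a b)) - c = (b - a)⁻¹ * ∫ s in a..b, ((∫ y, φ (secT y) ∂(m s : Measure (Td d))) - c) := by
    rw [intervalIntegral.integral_sub (Mst_int hm ha hab.le hi).1 (by simp), (Mst_int hm ha hab.le hi).2, intervalIntegral.integral_const, smul_eq_mul]
    field_simp
  have h1 := intervalIntegral.norm_integral_le_of_norm_le_const (a := a) (b := b) (f := fun s => (∫ y, φ (secT y) ∂(m s : Measure (Td d))) - c) (C := E)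
    (fun s hs => by
      rw [Set.uIoc_of_le hab.le] at hs
      exact fp_E2 hm hα hE hFP h ha hs.1.le hs.2)
  show |(b - a)⁻¹ * (∫ q, φ (secT q.2) ∂(Mst m hm a b)) - c| ≤ E
  rw [e, abs_mul, abs_of_pos (inv_pos.2 hp)]
  rw [Real.norm_eq_abs, abs_of_pos hp] at h1
  calc (b - a)⁻¹ * _ ≤ (b - a)⁻¹ * (E * (b - a)) := by gcongr
    _ = E := by field_simp

end
end

open ProbabilityTheory
section
variable {d : ℕ}

lemma ito_E1 (P : Measure (Td d × Vd d)) [IsProbabilityMeasure P] {R : ℝ} (hR : ∀ᵐ p ∂P, ‖p.2‖ ≤ R) (hR0 : 0 ≤ R)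
    {C : ℝ} {φ : Vd d → ℝ} (h : TB C φ) {τ : ℝ} (hτ : 0 ≤ τ) :
    |(∫ y, φ (secT y) ∂(mG P τ : Measure (Td d))) - (∫ p, φ (secT p.1) ∂P)
      - τ * ∫ p, (lapl φ (secT p.1) + dotp p.2 (gradv φ (secT p.1))) ∂P| ≤ τ * (C * (1 + d * R) * (τ * R + √τ * Mz d)) := by
  have hT := h.test
  have hC := h.nonneg
  have hgc : Continuous (gradv φ) := (tf_grad_cont hT).comp (continuous_const.prodMk continuous_id : Continuous fun x : Vd d => ((0:ℝ), x))
  have hlc : Continuous (lapl φ) := (tf_lapl_cont hT).comp (continuous_const.prodMk continuous_id : Continuous fun x : Vd d => ((0:ℝ), x))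
  have hpm : Measurable (fun y : Td d => φ (secT y)) := h.smooth.continuous.measurable.comp measurable_secT
  have ge : ∀ v s x, genr (fun _ => φ) v s x = lapl φ x + dotp v (gradv φ x) := fun v s x => by
    simp [genr, tderiv]
  have h0 : ∫ y, φ (secT y) ∂(mG P 0 : Measure (Td d)) = ∫ p, φ (secT p.1) ∂P := by
    rw [mG_zero, integral_map measurable_fst.aemeasurable hpm.aestronglyMeasurable]
  have hito := ito_P P hR hT le_rfl hτ
  simp only [ge] at hito
  rw [h0] at hito
  rw [hito]
  obtain ⟨j1, j2⟩ := int_norm_snd P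
  have hm1 : ∀ f : (Td d × Vd d) × Vd d → Td d, Measurable f → Measurable (fun p : (Td d × Vd d) × Vd d => lapl φ (secT (f p)) + dotp p.1.2 (gradv φ (secT (f p)))) :=
    fun f hf => (hlc.measurable.comp (measurable_secT.comp hf)).add (dotp_meas (by fun_prop) (hgc.measurable.comp (measurable_secT.comp hf)))
  have hb : ∀ x v : Vd d, ‖v‖ ≤ R → |lapl φ x + dotp v (gradv φ x)| ≤ C + d * R * C := fun x v hv => by
    refine (abs_add_le _ _).trans (add_le_add (h.b2 x) ((abs_dotp_le _ _).trans ?_))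
    have := h.b1 x
    gcongr
  have hR' := ae_prod_fst (G := gam d) hR
  have hi : ∀ f : (Td d × Vd d) × Vd d → Td d, Measurable f → Integrable (fun p : (Td d × Vd d) × Vd d => lapl φ (secT (f p)) + dotp p.1.2 (gradv φ (secT (f p)))) (P.prod (gam d)) :=
    fun f hf => Integrable.of_bound (hm1 f hf).aestronglyMeasurable (C + d * R * C) (by
      filter_upwards [hR'] with p hp
      exact hb _ _ hp)
  have e0 : ∫ p, (lapl φ (secT p.1) + dotp p.2 (gradv φ (secT p.1))) ∂P =
      ∫ p, (lapl φ (secT p.1.1) + dotp p.1.2 (gradv φ (secT p.1.1))) ∂(P.prod (gam d)) := by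
    rw [integral_prod _ (hi (fun p => p.1.1) (by fun_prop))]
    simp
  set c := ∫ p, (lapl φ (secT p.1.1) + dotp p.1.2 (gradv φ (secT p.1.1))) ∂(P.prod (gam d))
  have key : ∀ s ∈ Set.uIoc 0 τ, ‖(∫ p, (lapl φ (secT (stX s p)) + dotp p.1.2 (gradv φ (secT (stX s p)))) ∂(P.prod (gam d))) - c‖ ≤
      C * (1 + d * R) * (τ * R + √τ * Mz d) := by
    intro s hs
    rw [Set.uIoc_of_le hτ] at hs
    rw [← integral_sub (hi _ (stX_meas' s)) (hi (fun p => p.1.1) (by fun_prop))]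
    have hbd : ∀ᵐ p ∂(P.prod (gam d)), ‖(lapl φ (secT (stX s p)) + dotp p.1.2 (gradv φ (secT (stX s p)))) - (lapl φ (secT p.1.1) + dotp p.1.2 (gradv φ (secT p.1.1)))‖ ≤
        C * (1 + d * R) * (s * R) + C * (1 + d * R) * √s * ‖p.2‖ := by
      filter_upwards [hR'] with p hp
      rw [per_stX h.per.lapl, per_stX h.per.gradv]
      set X := Xg (secT p.1.1) p.1.2 s p.2 with hX
      have hn : ‖X - secT p.1.1‖ ≤ s * R + √s * ‖p.2‖ := by
        rw [hX, Xg, add_assoc, add_sub_cancel_left]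
        refine (norm_add_le _ _).trans ?_
        rw [norm_smul, norm_smul, Real.norm_of_nonneg hs.1.le, Real.norm_of_nonneg (Real.sqrt_nonneg s)]
        have := hs.1.le
        gcongr
      have h1 := h.l2 X (secT p.1.1)
      have h2 := h.l1 X (secT p.1.1)
      have h3 : dotp p.1.2 (gradv φ X) - dotp p.1.2 (gradv φ (secT p.1.1)) = dotp p.1.2 (gradv φ X - gradv φ (secT p.1.1)) := by
        unfold dotp; rw [← Finset.sum_sub_distrib]; exact Finset.sum_congr rfl fun i _ => by simp [mul_sub]
      have h4 := abs_dotp_le p.1.2 (gradv φ X - gradv φ (secT p.1.1))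
      rw [add_sub_add_comm, h3, Real.norm_eq_abs]
      refine (abs_add_le _ _).trans ?_
      calc _ ≤ C * ‖X - secT p.1.1‖ + d * R * (C * ‖X - secT p.1.1‖) := by
            refine add_le_add h1 (h4.trans ?_); gcongr
        _ = C * (1 + d * R) * ‖X - secT p.1.1‖ := by ring
        _ ≤ C * (1 + d * R) * (s * R + √s * ‖p.2‖) := by gcongr
        _ = _ := by ring
    have h5 := norm_integral_le_of_norm_le ((integrable_const (C * (1 + d * R) * (s * R))).add (j1.const_mul (C * (1 + d * R) * √s))) hbd
    simp only [Pi.add_apply] at h5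
    rw [integral_add (integrable_const _) (j1.const_mul _), integral_const, integral_const_mul, j2] at h5
    rw [probReal_univ, one_smul] at h5
    refine h5.trans ?_
    have : √s ≤ √τ := Real.sqrt_le_sqrt hs.2
    have h6 : s * R + √s * Mz d ≤ τ * R + √τ * Mz d := by
      have := hs.2; have := Mz_nonneg (d := d); gcongr
    have h7 : C * (1 + d * R) * (s * R + √s * Mz d) ≤ C * (1 + d * R) * (τ * R + √τ * Mz d) := by gcongr
    linarith
  have hint : IntervalIntegrable (fun s => ∫ p, (lapl φ (secT (stX s p)) + dotp p.1.2 (gradv φ (secT (stX s p)))) ∂(P.prod (gam d))) volume 0 τ := by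
    have hmm : Measurable (fun q : ℝ × ((Td d × Vd d) × Vd d) => lapl φ (secT (stX q.1 q.2)) + dotp q.2.1.2 (gradv φ (secT (stX q.1 q.2)))) :=
      (hlc.measurable.comp (measurable_secT.comp stX_meas)).add (dotp_meas (by fun_prop) (hgc.measurable.comp (measurable_secT.comp stX_meas)))
    rw [intervalIntegrable_iff_integrableOn_Ioc_of_le hτ]
    refine Integrable.of_bound hmm.stronglyMeasurable.integral_prod_right'.aestronglyMeasurable (C + d * R * C) (Eventually.of_forall fun s => ?_)
    have := norm_integral_le_of_norm_le_const (μ := P.prod (gam d)) (f := fun p => lapl φ (secT (stX s p)) + dotp p.1.2 (gradv φ (secT (stX s p)))) (C := C + d * R * C) (by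
      filter_upwards [hR'] with p hp
      exact hb _ _ hp)
    simpa using this
  have h8 := intervalIntegral.norm_integral_le_of_norm_le_const key
  rw [intervalIntegral.integral_sub hint (by simp), intervalIntegral.integral_const, sub_zero, smul_eq_mul, abs_of_nonneg hτ, Real.norm_eq_abs] at h8
  rw [e0]
  linarith

variable {m : ℝ → PTd d} (hm : W1ContOn m (Set.Ici 0)) {α : ℝ → Td d → Vd d}
  (hα : Measurable (fun q : ℝ × Td d => α q.1 q.2))
  (hE : ∀ a b : ℝ, 0 ≤ a → Integrable (fun q : ℝ × Td d => sqnorm (α q.1 q.2)) (Mst m hm a b))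
  (hFP : ∀ s₁ s₂ : ℝ, 0 ≤ s₁ → s₁ ≤ s₂ → FPeq 1 m α s₁ s₂)
include hα hE hFP

lemma fp_E1 {C : ℝ} {φ : Vd d → ℝ} (h : TB C φ) {R : ℝ} (hR0 : 0 ≤ R) {a b : ℝ} (ha : 0 ≤ a) (hab : a < b) [IsProbabilityMeasure (rK hm α R a b)] :
    |(∫ y, φ (secT y) ∂(mG (rK hm α R a b) (b - a) : Measure (Td d))) - (∫ p, φ (secT p.1) ∂(rK hm α R a b))
      - ((∫ y, φ (secT y) ∂(m b : Measure (Td d))) - (∫ y, φ (secT y) ∂(m a : Measure (Td d))))| ≤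
      (b - a) * (C * (1 + d * R) * ((b - a) * R + √(b - a) * Mz d)) + d * C * ∫ q, ‖trv R (α q.1 q.2) + α q.1 q.2‖ ∂(Mst m hm a b) := by
  have h1 := ito_E1 (rK hm α R a b) (rK_ae hm hα hR0 a b) hR0 h (sub_pos.2 hab).le
  obtain ⟨i1, h2⟩ := fp_mst hm hα hE hFP h ha hab.le
  have hT := h.test
  have hC := h.nonneg
  have hgc : Continuous (gradv φ) := (tf_grad_cont hT).comp (continuous_const.prodMk continuous_id : Continuous fun x : Vd d => ((0:ℝ), x))
  have hlc : Continuous (lapl φ) := (tf_lapl_cont hT).comp (continuous_const.prodMk continuous_id : Continuous fun x : Vd d => ((0:ℝ), x))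
  have ht := (trv_meas R).comp hα
  rw [rK_integral hm hα R hab (f := fun p => lapl φ (secT p.1) + dotp p.2 (gradv φ (secT p.1)))
    ((hlc.measurable.comp (measurable_secT.comp measurable_fst)).add (dotp_meas (by fun_prop) (hgc.measurable.comp (measurable_secT.comp measurable_fst)))),
    mul_inv_cancel_left₀ (sub_pos.2 hab).ne'] at h1
  simp only at h1
  have i3 := ax_int hm hα hE R (b := b) ha
  have hmm : Measurable (fun q : ℝ × Td d => lapl φ (secT q.2) + dotp (trv R (α q.1 q.2)) (gradv φ (secT q.2))) :=
    (hlc.measurable.comp (measurable_secT.comp measurable_snd)).add (dotp_meas ht (hgc.measurable.comp (measurable_secT.comp measurable_snd)))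
  have i2 : Integrable (fun q : ℝ × Td d => lapl φ (secT q.2) + dotp (trv R (α q.1 q.2)) (gradv φ (secT q.2))) (Mst m hm a b) := by
    refine Integrable.of_bound hmm.aestronglyMeasurable (C + d * R * C) (Eventually.of_forall fun q => ?_)
    refine (abs_add_le _ _).trans (add_le_add (h.b2 _) ((abs_dotp_le _ _).trans ?_))
    have := h.b1 (secT q.2)
    have := trv_le hR0 (α q.1 q.2)
    gcongr
  have h3 := norm_integral_le_of_norm_le (μ := Mst m hm a b) (f := fun q => (lapl φ (secT q.2) + dotp (trv R (α q.1 q.2)) (gradv φ (secT q.2))) -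
      (lapl φ (secT q.2) - dotp (α q.1 q.2) (gradv φ (secT q.2)))) (i3.const_mul (d * C)) (Eventually.of_forall fun q => by
    have e : (lapl φ (secT q.2) + dotp (trv R (α q.1 q.2)) (gradv φ (secT q.2))) -
      (lapl φ (secT q.2) - dotp (α q.1 q.2) (gradv φ (secT q.2))) = dotp (trv R (α q.1 q.2) + α q.1 q.2) (gradv φ (secT q.2)) := by
      have : dotp (trv R (α q.1 q.2) + α q.1 q.2) (gradv φ (secT q.2)) = dotp (trv R (α q.1 q.2)) (gradv φ (secT q.2)) + dotp (α q.1 q.2) (gradv φ (secT q.2)) := by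
        unfold dotp; rw [← Finset.sum_add_distrib]; exact Finset.sum_congr rfl fun i _ => by simp [add_mul]
      rw [this]; ring
    rw [e]
    refine (abs_dotp_le _ _).trans ?_
    have := h.b1 (secT q.2)
    calc _ ≤ d * ‖trv R (α q.1 q.2) + α q.1 q.2‖ * C := by gcongr
      _ = _ := by ring)
  rw [integral_sub i2 i1, integral_const_mul, ← h2, Real.norm_eq_abs] at h3
  rw [abs_le] at h1 h3 ⊢
  constructor <;> linarith [h1.1, h1.2, h3.1, h3.2]
end

open ProbabilityTheory
section
variable {d : ℕ}

lemma TB.mol {C g0 ε : ℝ} {G : Vd d → ℝ} (h : TB C G) (h0 : 0 < g0) (hlb : ∀ x, g0 ≤ G x) (h1 : ∫ y : Td d, G (secT y) = 1)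
    (h2 : ∫ y : Td d, ‖y‖ * G (secT y) ≤ ε) : Mol (fun y : Td d => G (secT y)) C g0 ε :=
  ⟨h.per.lip h.l0, h0, fun y => hlb _, fun y => (le_abs_self _).trans (h.b0 _), h1, h2⟩

lemma TB.cvd {C : ℝ} {G : Vd d → ℝ} (h : TB C G) (μ : Measure (Td d)) (z : Td d) :
    cvd (fun y : Td d => G (secT y)) μ z = ∫ y, (fun x => G (secT z - x)) (secT y) ∂μ := by
  unfold _root_.cvd
  refine integral_congr_ae (Eventually.of_forall fun y => ?_)
  show G (secT (z - y)) = G (secT z - secT y)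
  refine h.per.eq ?_
  rw [piT_sub, piT_secT, piT_secT, piT_secT]

/-- chain of kernels -/
def qK (g : Td d → ℝ) (τ : ℝ) (r : ℕ → Measure (Td d × Vd d)) [∀ k, IsProbabilityMeasure (r k)] : ℕ → Kernel (Td d) (Td d)
  | 0 => Kernel.id
  | k+1 => eK d τ ∘ₖ (kp g (r k) ∘ₖ qK g τ r k)

def wK (g : Td d → ℝ) (τ : ℝ) (r : ℕ → Measure (Td d × Vd d)) [∀ k, IsProbabilityMeasure (r k)] (k : ℕ) : Kernel (Td d) (Td d × Vd d) :=
  kp g (r k) ∘ₖ qK g τ r k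

section
variable {g : Td d → ℝ} {C g0 ε : ℝ} (h : Mol g C g0 ε) (τ : ℝ) (r : ℕ → Measure (Td d × Vd d)) [∀ k, IsProbabilityMeasure (r k)]
include h

lemma qK_markov (k : ℕ) : IsMarkovKernel (qK g τ r k) := by
  induction k with
  | zero => rw [qK]; infer_instance
  | succ k ih =>
    rw [qK]
    have := kp_markov h (r k)
    infer_instance

lemma wK_markov (k : ℕ) : IsMarkovKernel (wK g τ r k) := by
  have := qK_markov h τ r k
  have := kp_markov h (r k)
  rw [wK]; infer_instance

lemma kp_fst_comp (r : Measure (Td d × Vd d)) [IsProbabilityMeasure r] (ξ : Measure (Td d)) : (kp g r ∘ₘ ξ).map Prod.fst = ξ := by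
  rw [Measure.map_comp _ _ measurable_fst]
  have : (kp g r).map Prod.fst = Kernel.id := by
    ext1 x
    rw [Kernel.map_apply _ measurable_fst, kp_fst h r x, Kernel.id_apply]
  rw [this, Measure.id_comp]

lemma wK_fst (k : ℕ) (x : Td d) : (wK g τ r k x).map Prod.fst = qK g τ r k x := by
  rw [wK, Kernel.comp_apply]
  exact kp_fst_comp h (r k) _

lemma wK_zero (x : Td d) : (wK g τ r 0 x).map Prod.fst = Measure.dirac x := by
  rw [wK_fst h, qK, Kernel.id_apply]

lemma wK_succ (k : ℕ) (x : Td d) : (wK g τ r (k+1) x).map Prod.fst = eK d τ ∘ₘ wK g τ r k x := by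
  rw [wK_fst h, qK, Kernel.comp_apply]; rfl

lemma wK_ae {R : ℝ} (hR : ∀ k, ∀ᵐ p ∂(r k), ‖p.2‖ ≤ R) (k : ℕ) (x : Td d) : ∀ᵐ p ∂(wK g τ r k x), ‖p.2‖ ≤ R := by
  rw [wK, Kernel.comp_apply, Measure.ae_comp_iff (measurableSet_le (by fun_prop) (by fun_prop))]
  exact Eventually.of_forall (kp_ae h (r k) (hR k))

omit h in
lemma wK_comp (k : ℕ) (μ : Measure (Td d)) : wK g τ r k ∘ₘ μ = kp g (r k) ∘ₘ (qK g τ r k ∘ₘ μ) := by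
  rw [wK, Measure.comp_assoc]

lemma wK_comp_fst (k : ℕ) (μ : Measure (Td d)) : (wK g τ r k ∘ₘ μ).map Prod.fst = qK g τ r k ∘ₘ μ := by
  rw [wK_comp, kp_fst_comp h]

/-- chain law -/
def xK (μ : PTd d) (k : ℕ) : PTd d := ⟨qK g τ r k ∘ₘ (μ : Measure (Td d)), by have := qK_markov h τ r k; infer_instance⟩

lemma xK_zero (μ : PTd d) : xK h τ r μ 0 = μ := by
  apply Subtype.ext
  show qK g τ r 0 ∘ₘ (μ : Measure (Td d)) = _
  rw [qK, Measure.id_comp]; rfl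

lemma xK_succ (μ : PTd d) (k : ℕ) : (xK h τ r μ (k+1) : Measure (Td d)) = eK d τ ∘ₘ (kp g (r k) ∘ₘ (xK h τ r μ k : Measure (Td d))) := by
  show qK g τ r (k+1) ∘ₘ (μ : Measure (Td d)) = eK d τ ∘ₘ (kp g (r k) ∘ₘ (qK g τ r k ∘ₘ (μ : Measure (Td d))))
  rw [qK, Measure.comp_assoc, Measure.comp_assoc, Kernel.comp_assoc]
end

lemma gronwall_disc {e a s : ℕ → ℝ} {L : ℝ} (hL : 0 ≤ L) (ha : ∀ k, 0 ≤ a k) (hs : ∀ k, 0 ≤ s k) (h0 : e 0 ≤ 0) {N : ℕ}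
    (h : ∀ k < N, e (k+1) ≤ (1 + L * a k) * e k + s k) : ∀ k ≤ N, e k ≤ Real.exp (L * ∑ j ∈ Finset.range k, a j) * ∑ j ∈ Finset.range k, s j := by
  intro k
  induction k with
  | zero => intro _; simpa using h0
  | succ k ih =>
    intro hk
    have h1 := ih (by omega)
    have h2 := h k (by omega)
    rw [Finset.sum_range_succ, Finset.sum_range_succ, mul_add L, Real.exp_add]
    set A := Real.exp (L * ∑ j ∈ Finset.range k, a j)
    set T := ∑ j ∈ Finset.range k, s j
    have hA : 1 ≤ A := Real.one_le_exp (mul_nonneg hL (Finset.sum_nonneg fun i _ => ha i))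
    have hT : 0 ≤ T := Finset.sum_nonneg fun i _ => hs i
    have hq : 0 ≤ L * a k := mul_nonneg hL (ha k)
    have h3 : 1 + L * a k ≤ Real.exp (L * a k) := by linarith [Real.add_one_le_exp (L * a k)]
    have h4 : 1 ≤ Real.exp (L * a k) := by linarith
    calc e (k+1) ≤ (1 + L * a k) * e k + s k := h2
      _ ≤ (1 + L * a k) * (A * T) + s k := by gcongr
      _ ≤ Real.exp (L * a k) * (A * T) + 1 * 1 * s k := by rw [one_mul, one_mul]; gcongr
      _ ≤ Real.exp (L * a k) * (A * T) + A * Real.exp (L * a k) * s k := by have := hs k; gcongr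
      _ = _ := by ring

lemma Mst_sum {m : ℝ → PTd d} (hm : W1ContOn m (Set.Ici 0)) {f : ℝ × Td d → ℝ} (hf : ∀ a b : ℝ, 0 ≤ a → Integrable f (Mst m hm a b)) {τ : ℝ} (hτ : 0 ≤ τ) (n : ℕ) :
    ∑ k ∈ Finset.range n, ∫ q, f q ∂(Mst m hm (k * τ) ((k + 1) * τ)) = ∫ q, f q ∂(Mst m hm 0 (n * τ)) := by
  have h0 : ∀ k : ℕ, (0:ℝ) ≤ k * τ := fun k => by positivity
  have h1 : ∀ k : ℕ, (k:ℝ) * τ ≤ (k + 1) * τ := fun k => by gcongr; linarith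
  have := intervalIntegral.sum_integral_adjacent_intervals (a := fun k : ℕ => (k:ℝ) * τ) (n := n) (μ := volume) (f := fun s => ∫ y, f (s, y) ∂(m s : Measure (Td d)))
    (fun k _ => by push_cast; exact (Mst_int hm (h0 k) (h1 k) (hf _ _ (h0 k))).1)
  rw [← (Mst_int hm le_rfl (h0 n) (hf _ _ le_rfl)).2]
  simp only [Nat.cast_zero, zero_mul] at this
  rw [← this]
  refine Finset.sum_congr rfl fun k _ => ?_
  push_cast
  exact (Mst_int hm (h0 k) (h1 k) (hf _ _ (h0 k))).2.symm
end

open ProbabilityTheory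
section
variable {d : ℕ} {m : ℝ → PTd d} (hm : W1ContOn m (Set.Ici 0)) {α : ℝ → Td d → Vd d}
  (hα : Measurable (fun q : ℝ × Td d => α q.1 q.2))
  (hE : ∀ a b : ℝ, 0 ≤ a → Integrable (fun q : ℝ × Td d => sqnorm (α q.1 q.2)) (Mst m hm a b))
  (hFP : ∀ s₁ s₂ : ℝ, 0 ≤ s₁ → s₁ ≤ s₂ → FPeq 1 m α s₁ s₂)

def rN (α : ℝ → Td d → Vd d) (R τ : ℝ) (k : ℕ) : Measure (Td d × Vd d) := rK hm α R (k * τ) ((k + 1) * τ)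
def aN (α : ℝ → Td d → Vd d) (τ : ℝ) (k : ℕ) : ℝ := ∫ q, ‖α q.1 q.2‖ ∂(Mst m hm (k * τ) ((k + 1) * τ))
def bN (α : ℝ → Td d → Vd d) (R τ : ℝ) (k : ℕ) : ℝ := ∫ q, ‖trv R (α q.1 q.2) + α q.1 q.2‖ ∂(Mst m hm (k * τ) ((k + 1) * τ))

def fstP (r : Measure (Td d × Vd d)) [IsProbabilityMeasure r] : PTd d := ⟨r.map Prod.fst, Measure.isProbabilityMeasure_map measurable_fst.aemeasurable⟩

variable {C g0 ε : ℝ} {G : Vd d → ℝ} (hG : TB C G) (h : Mol (fun y : Td d => G (secT y)) C g0 ε)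
include hα hE hFP hG

lemma cvd_E2 {a b s : ℝ} (ha : 0 ≤ a) (has : a ≤ s) (hsb : s ≤ b) (z : Td d) :
    |cvd (fun y : Td d => G (secT y)) (m a : Measure (Td d)) z - cvd (fun y : Td d => G (secT y)) (m s : Measure (Td d)) z| ≤
      C * ((b - a) + d * ∫ q, ‖α q.1 q.2‖ ∂(Mst m hm a b)) := by
  rw [hG.cvd, hG.cvd, abs_sub_comm]
  exact fp_E2 hm hα hE hFP (hG.reflect (secT z)) ha has hsb

omit hα hE hFP in
lemma cvd_fst (r : Measure (Td d × Vd d)) [IsProbabilityMeasure r] (z : Td d) :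
    cvd (fun y : Td d => G (secT y)) (fstP r : Measure (Td d)) z = ∫ p, (fun x => G (secT z - x)) (secT p.1) ∂r := by
  rw [hG.cvd]
  show ∫ y, (fun x => G (secT z - x)) (secT y) ∂(r.map Prod.fst) = _
  rw [integral_map measurable_fst.aemeasurable]
  exact ((hG.reflect (secT z)).smooth.continuous.measurable.comp measurable_secT).aestronglyMeasurable

variable {R τ : ℝ} (hR0 : 0 ≤ R) (hτ : 0 < τ) [hr : ∀ k, IsProbabilityMeasure (rN hm α R τ k)]
include hτ

lemma cvd_E2r (k : ℕ) (z : Td d) :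
    |cvd (fun y : Td d => G (secT y)) (m (k * τ) : Measure (Td d)) z - cvd (fun y : Td d => G (secT y)) (fstP (rN hm α R τ k) : Measure (Td d)) z| ≤
      C * (τ + d * aN hm α τ k) := by
  rw [cvd_fst hG, hG.cvd, abs_sub_comm]
  have := fp_E2r hm hα hE hFP (hG.reflect (secT z)) R (a := k * τ) (b := (k+1) * τ) (by positivity) (by nlinarith)
  rwa [show ((k:ℝ) + 1) * τ - k * τ = τ by ring] at this

include hR0
lemma cvd_E1 (k : ℕ) (z : Td d) :
    |cvd (fun y : Td d => G (secT y)) (mG (rN hm α R τ k) τ : Measure (Td d)) z - cvd (fun y : Td d => G (secT y)) (fstP (rN hm α R τ k) : Measure (Td d)) z -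
      (cvd (fun y : Td d => G (secT y)) (m ((k + 1) * τ) : Measure (Td d)) z - cvd (fun y : Td d => G (secT y)) (m (k * τ) : Measure (Td d)) z)| ≤
      τ * (C * (1 + d * R) * (τ * R + √τ * Mz d)) + d * C * bN hm α R τ k := by
  rw [cvd_fst hG, hG.cvd, hG.cvd, hG.cvd]
  have : IsProbabilityMeasure (rK hm α R (k * τ) ((k + 1) * τ)) := hr k
  have := fp_E1 hm hα hE hFP (hG.reflect (secT z)) hR0 (a := k * τ) (b := (k+1) * τ) (by positivity) (by nlinarith)
  rwa [show ((k:ℝ) + 1) * τ - k * τ = τ by ring] at this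

omit hG in
lemma aN_le (k : ℕ) : τ * ∫ p, ‖p.2‖ ∂(rN hm α R τ k) ≤ aN hm α τ k := by
  rw [rN, rK_integral hm hα R (by nlinarith) (by fun_prop), show ((k:ℝ) + 1) * τ - k * τ = τ by ring, mul_inv_cancel_left₀ hτ.ne']
  refine integral_mono_of_nonneg (Eventually.of_forall fun q => norm_nonneg _) (a1_int hm hα hE (by positivity)) (Eventually.of_forall fun q => trv_le' _ _)

lemma chain_step (μ : PTd d) (k : ℕ) :
    W1 (xK h τ (rN hm α R τ) μ (k+1)) (cv h (m ((k+1:ℕ) * τ))) ≤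
      (1 + (C / g0 + C^2 / g0^2) * aN hm α τ k) * W1 (xK h τ (rN hm α R τ) μ k) (cv h (m (k * τ))) +
      (τ * (C * (1 + d * R) * (τ * R + √τ * Mz d)) + d * C * bN hm α R τ k + C * (τ + d * aN hm α τ k) * (τ * R + √τ * Mz d)) := by
  have hae : ∀ᵐ p ∂(rN hm α R τ k), ‖p.2‖ ≤ R := rK_ae hm hα hR0 _ _
  have h1 := step_W1 h (rN hm α R τ k) hae hτ.le hR0 (xK h τ (rN hm α R τ) μ k) (xK h τ (rN hm α R τ) μ (k+1)) (m (k * τ)) (m ((k+1) * τ)) (fstP (rN hm α R τ k)) rfl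
    (xK_succ h τ (rN hm α R τ) μ k) (cvd_E1 hm hα hE hFP hG hR0 hτ k) (cvd_E2r hm hα hE hFP hG hτ k)
  push_cast
  refine h1.trans ?_
  have := aN_le hm hα hE hFP hR0 hτ k
  have h3 := h.pos
  have h4 := hG.nonneg
  have h5 := W1_nonneg (xK h τ (rN hm α R τ) μ k) (cv h (m (k * τ)))
  have h6 : (1 + (C / g0 + C^2 / g0^2) * (τ * ∫ p, ‖p.2‖ ∂(rN hm α R τ k))) * W1 (xK h τ (rN hm α R τ) μ k) (cv h (m (k * τ))) ≤
     (1 + (C / g0 + C^2 / g0^2) * aN hm α τ k) * W1 (xK h τ (rN hm α R τ) μ k) (cv h (m (k * τ))) := by gcongr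
  linarith
end

open ProbabilityTheory
section
variable {d : ℕ} {m : ℝ → PTd d} (hm : W1ContOn m (Set.Ici 0)) {α : ℝ → Td d → Vd d}
  (hα : Measurable (fun q : ℝ × Td d => α q.1 q.2))
  (hE : ∀ a b : ℝ, 0 ≤ a → Integrable (fun q : ℝ × Td d => sqnorm (α q.1 q.2)) (Mst m hm a b))
  (hFP : ∀ s₁ s₂ : ℝ, 0 ≤ s₁ → s₁ ≤ s₂ → FPeq 1 m α s₁ s₂)

include hα hE
lemma bsum_le {R : ℝ} (hR : 0 < R) {a b : ℝ} (ha : 0 ≤ a) : ∫ q, ‖trv R (α q.1 q.2) + α q.1 q.2‖ ∂(Mst m hm a b) ≤ (∫ q, ‖α q.1 q.2‖^2 ∂(Mst m hm a b)) / R := by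
  rw [← integral_div]
  exact integral_mono (ax_int hm hα hE R ha) ((a2_int hm hα hE ha).div_const R) fun q => trv_ex hR _

lemma Mst_mono {f : ℝ × Td d → ℝ} (hf : ∀ a b : ℝ, 0 ≤ a → Integrable f (Mst m hm a b)) (h0 : ∀ q, 0 ≤ f q) {a b c e : ℝ} (ha : 0 ≤ a) (hab : a ≤ b) (hbc : b ≤ c) (hce : c ≤ e) :
    ∫ q, f q ∂(Mst m hm b c) ≤ ∫ q, f q ∂(Mst m hm a e) := by
  have j2 := Mst_int hm ha (hab.trans (hbc.trans hce)) (hf a e ha)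
  have j1 := Mst_int hm (ha.trans hab) hbc (hf b c (ha.trans hab))
  rw [← j1.2, ← j2.2]
  refine intervalIntegral.integral_mono_interval hab hbc hce ?_ j2.1
  exact Eventually.of_forall fun s => integral_nonneg fun _ => h0 _

lemma a_small {R : ℝ} (hR : 0 < R) {a s : ℝ} (ha : 0 ≤ a) (has : a ≤ s) (hs : s ≤ 1) :
    ∫ q, ‖α q.1 q.2‖ ∂(Mst m hm a s) ≤ (s - a) * R + (∫ q, ‖α q.1 q.2‖^2 ∂(Mst m hm 0 1)) / R := by
  have i1 := a2_int hm hα hE (b := s) ha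
  have h2 := Mst_mono hm hα hE (f := fun q => ‖α q.1 q.2‖^2) (fun a b h => a2_int hm hα hE h) (fun q => by positivity) le_rfl ha has hs
  have h3 := bsum_le hm hα hE hR (b := s) ha
  have h1 : ∫ q, ‖α q.1 q.2‖ ∂(Mst m hm a s) ≤ ∫ q, (R + ‖trv R (α q.1 q.2) + α q.1 q.2‖) ∂(Mst m hm a s) := by
    refine integral_mono (a1_int hm hα hE ha) ((integrable_const R).add (ax_int hm hα hE R ha)) fun q => ?_
    have e : α q.1 q.2 = (trv R (α q.1 q.2) + α q.1 q.2) - trv R (α q.1 q.2) := by abel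
    have h5 := norm_sub_le (trv R (α q.1 q.2) + α q.1 q.2) (trv R (α q.1 q.2))
    rw [← e] at h5
    have h6 := trv_le hR.le (α q.1 q.2)
    show ‖α q.1 q.2‖ ≤ R + ‖trv R (α q.1 q.2) + α q.1 q.2‖
    linarith
  rw [integral_add (integrable_const R) (ax_int hm hα hE R ha), integral_const, Mst_real hm has, smul_eq_mul] at h1
  have h4 : (∫ q, ‖α q.1 q.2‖^2 ∂(Mst m hm a s)) / R ≤ (∫ q, ‖α q.1 q.2‖^2 ∂(Mst m hm 0 1)) / R := by gcongr
  linarith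

variable {C g0 ε : ℝ} {G : Vd d → ℝ} (hG : TB C G) (h : Mol (fun y : Td d => G (secT y)) C g0 ε)
variable {R τ : ℝ} (hR : 0 < R) (hτ : 0 < τ) [hr : ∀ k, IsProbabilityMeasure (rN hm α R τ k)] {N : ℕ} (hN : N * τ = 1)
include hFP hG hτ hR hN

lemma chain_e {k : ℕ} (hk : k ≤ N) :
    W1 (xK h τ (rN hm α R τ) (cv h (m 0)) k) (cv h (m (k * τ))) ≤ Real.exp ((C / g0 + C^2 / g0^2) * ∫ q, ‖α q.1 q.2‖ ∂(Mst m hm 0 1)) *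
      (C * (2 + d * R + d * ∫ q, ‖α q.1 q.2‖ ∂(Mst m hm 0 1)) * (τ * R + √τ * Mz d) + d * C * ((∫ q, ‖α q.1 q.2‖^2 ∂(Mst m hm 0 1)) / R)) := by
  have hg := h.pos
  have hC := hG.nonneg
  have hM := Mz_nonneg (d := d)
  have ha : ∀ k, 0 ≤ aN hm α τ k := fun k => integral_nonneg fun _ => norm_nonneg _
  have hb : ∀ k, 0 ≤ bN hm α R τ k := fun k => integral_nonneg fun _ => norm_nonneg _
  set s : ℕ → ℝ := fun k => τ * (C * (1 + d * R) * (τ * R + √τ * Mz d)) + d * C * bN hm α R τ k + C * (τ + d * aN hm α τ k) * (τ * R + √τ * Mz d) with hs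
  have hs0 : ∀ k, 0 ≤ s k := fun k => by have := ha k; have := hb k; positivity
  have h1 := gronwall_disc (e := fun k => W1 (xK h τ (rN hm α R τ) (cv h (m 0)) k) (cv h (m (k * τ)))) (a := aN hm α τ) (s := s) (L := C / g0 + C^2 / g0^2) (N := N)
    (by positivity) ha hs0 (by simp [xK_zero, W1_self]) (fun k _ => chain_step hm hα hE hFP hG h hR.le hτ (cv h (m 0)) k) k hk
  refine h1.trans ?_
  have sA : ∑ j ∈ Finset.range N, aN hm α τ j = ∫ q, ‖α q.1 q.2‖ ∂(Mst m hm 0 1) := by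
    have := Mst_sum hm (f := fun q => ‖α q.1 q.2‖) (fun a b h => a1_int hm hα hE h) hτ.le N
    rw [hN] at this; exact this
  have sB : ∑ j ∈ Finset.range N, bN hm α R τ j ≤ (∫ q, ‖α q.1 q.2‖^2 ∂(Mst m hm 0 1)) / R := by
    have := Mst_sum hm (f := fun q => ‖trv R (α q.1 q.2) + α q.1 q.2‖) (fun a b h => ax_int hm hα hE R h) hτ.le N
    rw [hN] at this
    refine (le_of_eq this).trans (bsum_le hm hα hE hR le_rfl)
  have mono : ∀ f : ℕ → ℝ, (∀ k, 0 ≤ f k) → ∑ j ∈ Finset.range k, f j ≤ ∑ j ∈ Finset.range N, f j := fun f hf =>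
    Finset.sum_le_sum_of_subset_of_nonneg (Finset.range_mono hk) fun i _ _ => hf i
  have m1 := mono _ ha
  have m2 := mono _ hs0
  rw [sA] at m1
  have sS : ∑ j ∈ Finset.range N, s j = (N * τ) * (C * (1 + d * R) * (τ * R + √τ * Mz d)) + d * C * ∑ j ∈ Finset.range N, bN hm α R τ j
      + C * (N * τ + d * ∑ j ∈ Finset.range N, aN hm α τ j) * (τ * R + √τ * Mz d) := by
    simp only [hs, Finset.sum_add_distrib, ← Finset.mul_sum, ← Finset.sum_mul, Finset.sum_const, Finset.card_range, nsmul_eq_mul]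
    ring
  rw [sS, hN, sA] at m2
  have m3 : d * C * ∑ j ∈ Finset.range N, bN hm α R τ j ≤ d * C * ((∫ q, ‖α q.1 q.2‖^2 ∂(Mst m hm 0 1)) / R) := by gcongr
  have h0 : 0 ≤ ∑ j ∈ Finset.range k, s j := Finset.sum_nonneg fun i _ => hs0 i
  have m4 : ∑ j ∈ Finset.range k, s j ≤ C * (2 + d * R + d * ∫ q, ‖α q.1 q.2‖ ∂(Mst m hm 0 1)) * (τ * R + √τ * Mz d) + d * C * ((∫ q, ‖α q.1 q.2‖^2 ∂(Mst m hm 0 1)) / R) := by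
    linarith
  gcongr

lemma chain_W {ε1 : ℝ} (hε : Real.exp ((C / g0 + C^2 / g0^2) * ∫ q, ‖α q.1 q.2‖ ∂(Mst m hm 0 1)) *
      (C * (2 + d * R + d * ∫ q, ‖α q.1 q.2‖ ∂(Mst m hm 0 1)) * (τ * R + √τ * Mz d) + d * C * ((∫ q, ‖α q.1 q.2‖^2 ∂(Mst m hm 0 1)) / R)) +
      C * (τ + d * (τ * R + (∫ q, ‖α q.1 q.2‖^2 ∂(Mst m hm 0 1)) / R)) ≤ ε1) :
    (∀ k < N, W1 (xK h τ (rN hm α R τ) (cv h (m 0)) k) (cv h (fstP (rN hm α R τ k))) ≤ ε1) ∧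
    (∀ k ≤ N, ∀ s, k * τ ≤ s → s ≤ (k + 1) * τ → s ≤ 1 → W1 (xK h τ (rN hm α R τ) (cv h (m 0)) k) (m s) ≤ ε1 + ε) := by
  have hC := hG.nonneg
  have hkt : ∀ k : ℕ, (0:ℝ) ≤ k * τ := fun k => by positivity
  have E : ∀ (k : ℕ) s, k * τ ≤ s → s ≤ (k + 1) * τ → s ≤ 1 → C * ((s - k * τ) + d * ∫ q, ‖α q.1 q.2‖ ∂(Mst m hm (k * τ) s)) ≤
      C * (τ + d * (τ * R + (∫ q, ‖α q.1 q.2‖^2 ∂(Mst m hm 0 1)) / R)) := fun k s h1 h2 h3 => by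
    have h4 := a_small hm hα hE hR (hkt k) h1 h3
    have h5 : s - k * τ ≤ τ := by linarith
    have h6 : ∫ q, ‖α q.1 q.2‖ ∂(Mst m hm (k * τ) s) ≤ τ * R + (∫ q, ‖α q.1 q.2‖^2 ∂(Mst m hm 0 1)) / R := by
      have : (s - k * τ) * R ≤ τ * R := by gcongr
      linarith
    gcongr
  refine ⟨fun k hk => ?_, fun k hk s h1 h2 h3 => ?_⟩
  · have e1 := chain_e hm hα hE hFP hG h hR hτ hN hk.le
    have e2 := lemD_W1 h _ _ (cvd_E2r hm hα hE hFP hG hτ (R := R) k)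
    have e3 := W1_triangle (xK h τ (rN hm α R τ) (cv h (m 0)) k) (cv h (m (k * τ))) (cv h (fstP (rN hm α R τ k)))
    have hk' : ((k:ℝ) + 1) * τ ≤ 1 := by
      have : (k:ℝ) + 1 ≤ N := by exact_mod_cast hk
      exact (mul_le_mul_of_nonneg_right this hτ.le).trans hN.le
    have e4 := E k ((k+1) * τ) (by nlinarith) le_rfl hk'
    rw [show ((k:ℝ) + 1) * τ - k * τ = τ by ring] at e4
    have e5 : C * (τ + d * aN hm α τ k) ≤ C * (τ + d * (τ * R + (∫ q, ‖α q.1 q.2‖^2 ∂(Mst m hm 0 1)) / R)) := e4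
    linarith
  · have e1 := chain_e hm hα hE hFP hG h hR hτ hN hk
    have e2 := lemD_W1 h _ _ (cvd_E2 hm hα hE hFP hG (hkt k) h1 le_rfl)
    have e3 := W1_triangle (xK h τ (rN hm α R τ) (cv h (m 0)) k) (cv h (m (k * τ))) (m s)
    have e6 := W1_triangle (cv h (m (k * τ))) (cv h (m s)) (m s)
    have e7 := cv_W1 h (m s)
    have e4 := E k s h1 h2 h3
    linarith
end

open ProbabilityTheory
section

def wgt (δ τ : ℝ) (k : ℕ) : ℝ := ∫ s in (k * τ)..((k + 1) * τ), Real.exp (-δ * s)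

lemma wgt_nn (δ : ℝ) {τ : ℝ} (hτ : 0 ≤ τ) (k : ℕ) : 0 ≤ wgt δ τ k :=
  intervalIntegral.integral_nonneg (by nlinarith) fun _ _ => (Real.exp_pos _).le

lemma wgt_le {δ τ : ℝ} (hδ : 0 ≤ δ) (hτ : 0 ≤ τ) (k : ℕ) : wgt δ τ k ≤ τ * Real.exp (-δ * (k * τ)) := by
  have hk : (k:ℝ) * τ ≤ (k + 1) * τ := by nlinarith
  have := intervalIntegral.integral_mono_on hk (f := fun s => Real.exp (-δ * s)) (g := fun _ => Real.exp (-δ * (k * τ)))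
    (μ := volume) (Continuous.intervalIntegrable (by fun_prop) _ _) (by simp) (fun s hs => Real.exp_le_exp.2 (by nlinarith [hs.1]))
  rw [intervalIntegral.integral_const, smul_eq_mul, show ((k:ℝ) + 1) * τ - k * τ = τ by ring] at this
  exact this

lemma wgt_le' {δ τ : ℝ} (hδ : 0 ≤ δ) (hτ : 0 ≤ τ) (k : ℕ) : wgt δ τ k ≤ τ := by
  refine (wgt_le hδ hτ k).trans ?_
  have : Real.exp (-δ * (k * τ)) ≤ 1 := Real.exp_le_one_iff.2 (by have : 0 ≤ δ * (k * τ) := by positivity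
                                                                  linarith)
  nlinarith

variable {d : ℕ} {m : ℝ → PTd d} (hm : W1ContOn m (Set.Ici 0)) {α : ℝ → Td d → Vd d}
  (hα : Measurable (fun q : ℝ × Td d => α q.1 q.2))
  (hE : ∀ a b : ℝ, 0 ≤ a → Integrable (fun q : ℝ × Td d => sqnorm (α q.1 q.2)) (Mst m hm a b))
  {l : Td d → Vd d → ℝ} {CL : ℝ} (hl : LC l CL)
include hα hE hl

lemma el_int {δ : ℝ} (hδ : 0 ≤ δ) {a b : ℝ} (ha : 0 ≤ a) : Integrable (fun q : ℝ × Td d => Real.exp (-δ * q.1) * l q.2 (α q.1 q.2)) (Mst m hm a b) ∧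
    ∫ q, Real.exp (-δ * q.1) * l q.2 (α q.1 q.2) ∂(Mst m hm a b) ≤ ∫ q, CL * (1 + ‖α q.1 q.2‖^2) ∂(Mst m hm a b) := by
  have i2 := ((integrable_const 1).add (a2_int hm hα hE (b := b) ha)).const_mul CL
  have key : ∀ᵐ q ∂(Mst m hm a b), Real.exp (-δ * q.1) * l q.2 (α q.1 q.2) ≤ CL * (1 + ‖α q.1 q.2‖^2) := by
    filter_upwards [Mst_ae hm] with q hq
    have h1 : Real.exp (-δ * q.1) ≤ 1 := Real.exp_le_one_iff.2 (by have := ha.trans hq.1.le; nlinarith)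
    have h2 := hl.gr q.2 (α q.1 q.2)
    have h3 := hl.nn q.2 (α q.1 q.2)
    calc _ ≤ 1 * l q.2 (α q.1 q.2) := by gcongr
      _ ≤ _ := by rwa [one_mul]
  have i1 : Integrable (fun q : ℝ × Td d => Real.exp (-δ * q.1) * l q.2 (α q.1 q.2)) (Mst m hm a b) := by
    refine Integrable.mono' i2 ?_ ?_
    · have : Measurable (fun q : ℝ × Td d => l q.2 (α q.1 q.2)) := hl.meas.comp (measurable_snd.prodMk hα)
      exact ((by fun_prop : Measurable fun q : ℝ × Td d => Real.exp (-δ * q.1)).mul this).aestronglyMeasurable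
    · filter_upwards [key] with q hq
      rw [Real.norm_eq_abs, abs_of_nonneg (mul_nonneg (Real.exp_pos _).le (hl.nn _ _))]
      exact hq
  exact ⟨i1, integral_mono_ae i1 i2 key⟩

variable {g : Td d → ℝ} {C g0 ε : ℝ} (h : Mol g C g0 ε)
variable {R τ : ℝ} (hR : 1 ≤ R) (hτ : 0 < τ) [hr : ∀ k, IsProbabilityMeasure (rN hm α R τ k)] {N : ℕ} (hN : N * τ = 1)
include h hR hτ

lemma cost_step {δ : ℝ} (hδ : 0 ≤ δ) (k : ℕ) {ξ : PTd d} {ε1 : ℝ} (hε : 0 ≤ ε) (hε1 : 0 ≤ ε1) (hW : W1 ξ (cv h (fstP (rN hm α R τ k))) ≤ ε1) :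
    wgt δ τ k * ∫ p, l p.1 (-p.2) ∂(kp g (rN hm α R τ k) ∘ₘ (ξ : Measure (Td d))) ≤
      ∫ q, (Real.exp (δ * τ) * (Real.exp (-δ * q.1) * l q.2 (α q.1 q.2)) + (CL * (‖α q.1 q.2‖^2 / R) +
        (ε + (C / g0 + (C / g0 + C^2 / g0^2)) * ε1) * (CL * (1 + ‖α q.1 q.2‖^2)))) ∂(Mst m hm (k * τ) ((k+1) * τ)) := by
  have hk0 : (0:ℝ) ≤ k * τ := by positivity
  have hkk : (k:ℝ) * τ < (k + 1) * τ := by nlinarith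
  have hae : ∀ᵐ p ∂(rN hm α R τ k), ‖p.2‖ ≤ R := rK_ae hm hα (by linarith) _ _
  have h1 := step_cost h (rN hm α R τ k) hl hae (μ := fstP (rN hm α R τ k)) rfl ξ
  have hg := h.pos
  have hC := h.C_nonneg
  have hCL := hl.pos
  set A := ∫ p, CL * (1 + ‖p.2‖^2) ∂(rN hm α R τ k) with hA
  have hA0 : 0 ≤ A := integral_nonneg fun p => by positivity
  have w0 := wgt_nn δ hτ.le k
  set K := ε + (C / g0 + (C / g0 + C^2 / g0^2)) * ε1 with hK
  have hK0 : 0 ≤ K := by positivity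
  have h2 : ∫ p, l p.1 (-p.2) ∂(kp g (rN hm α R τ k) ∘ₘ (ξ : Measure (Td d))) ≤ (∫ p, l p.1 (-p.2) ∂(rN hm α R τ k)) + K * A := by
    have : (C / g0 + (C / g0 + C^2 / g0^2)) * A * W1 ξ (cv h (fstP (rN hm α R τ k))) ≤ (C / g0 + (C / g0 + C^2 / g0^2)) * A * ε1 := by gcongr
    rw [hK]; linarith
  have i1 := (el_int hm hα hE hl hδ (b := (k+1) * τ) hk0).1
  have i2 := a2_int hm hα hE (b := (k+1) * τ) hk0
  have hlm : Measurable (fun p : Td d × Vd d => l p.1 (-p.2)) := hl.meas.comp (by fun_prop : Measurable fun p : Td d × Vd d => (p.1, -p.2))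
  have eA : τ * A ≤ ∫ q, CL * (1 + ‖α q.1 q.2‖^2) ∂(Mst m hm (k * τ) ((k+1) * τ)) := by
    rw [hA, rN, rK_integral hm hα R hkk (f := fun p => CL * (1 + ‖p.2‖^2)) (by fun_prop), show ((k:ℝ) + 1) * τ - k * τ = τ by ring, mul_inv_cancel_left₀ hτ.ne']
    refine integral_mono_of_nonneg (Eventually.of_forall fun q => by positivity) (((integrable_const 1).add i2).const_mul CL) (Eventually.of_forall fun q => ?_)
    have := trv_le' R (α q.1 q.2)
    show CL * (1 + ‖trv R (α q.1 q.2)‖^2) ≤ CL * (1 + ‖α q.1 q.2‖^2)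
    gcongr
  have eL : wgt δ τ k * ∫ p, l p.1 (-p.2) ∂(rN hm α R τ k) ≤ ∫ q, (Real.exp (δ * τ) * (Real.exp (-δ * q.1) * l q.2 (α q.1 q.2)) + CL * (‖α q.1 q.2‖^2 / R)) ∂(Mst m hm (k * τ) ((k+1) * τ)) := by
    rw [rN, rK_integral hm hα R hkk hlm, show ((k:ℝ) + 1) * τ - k * τ = τ by ring, ← mul_assoc, ← div_eq_mul_inv, ← integral_const_mul]
    have hc : wgt δ τ k / τ ≤ Real.exp (-δ * (k * τ)) := by rw [div_le_iff₀ hτ, mul_comm]; exact wgt_le hδ hτ.le k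
    have hc1 : wgt δ τ k / τ ≤ 1 := by rw [div_le_iff₀ hτ, one_mul]; exact wgt_le' hδ hτ.le k
    refine integral_mono_of_nonneg (Eventually.of_forall fun q => mul_nonneg (by positivity) (hl.nn _ _)) ((i1.const_mul _).add ((i2.div_const R).const_mul CL)) ?_
    filter_upwards [Mst_ae hm] with q hq
    show wgt δ τ k / τ * l q.2 (-trv R (α q.1 q.2)) ≤ Real.exp (δ * τ) * (Real.exp (-δ * q.1) * l q.2 (α q.1 q.2)) + CL * (‖α q.1 q.2‖^2 / R)
    have h3 := hl.nn q.2 (α q.1 q.2)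
    have h4 : 0 ≤ CL * (‖α q.1 q.2‖^2 / R) := by positivity
    rw [← mul_assoc, ← Real.exp_add]
    have h5 : wgt δ τ k / τ ≤ Real.exp (δ * τ + -δ * q.1) := hc.trans (Real.exp_le_exp.2 (by nlinarith [hq.2]))
    by_cases hq' : ‖α q.1 q.2‖ ≤ R
    · rw [trv, if_pos hq', neg_neg]
      have : wgt δ τ k / τ * l q.2 (α q.1 q.2) ≤ Real.exp (δ * τ + -δ * q.1) * l q.2 (α q.1 q.2) := by gcongr
      linarith
    · rw [trv, if_neg hq', neg_zero]
      push Not at hq'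
      have h6 := hl.gr q.2 0
      simp only [norm_zero, ne_eq, OfNat.ofNat_ne_zero, not_false_eq_true, zero_pow, add_zero, mul_one] at h6
      have h7 : 1 ≤ ‖α q.1 q.2‖^2 / R := by rw [le_div_iff₀ (by linarith)]; nlinarith
      have h8 : wgt δ τ k / τ * l q.2 0 ≤ 1 * l q.2 0 := by have := hl.nn q.2 0; gcongr
      have h9 : CL * 1 ≤ CL * (‖α q.1 q.2‖^2 / R) := by gcongr
      have h10 : 0 ≤ Real.exp (δ * τ + -δ * q.1) * l q.2 (α q.1 q.2) := by positivity
      linarith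
  have i3 := ((i1.const_mul (Real.exp (δ * τ))).add ((i2.div_const R).const_mul CL))
  have i4 := (((integrable_const 1).add i2).const_mul CL).const_mul K
  have e5 := integral_add i3 i4
  simp only [Pi.add_apply, add_assoc] at e5
  rw [e5, integral_const_mul K]
  have h6 : wgt δ τ k * (K * A) ≤ K * ∫ q, CL * (1 + ‖α q.1 q.2‖^2) ∂(Mst m hm (k * τ) ((k+1) * τ)) := by
    calc wgt δ τ k * (K * A) ≤ τ * (K * A) := by have := wgt_le' hδ hτ.le k; gcongr
      _ = K * (τ * A) := by ring
      _ ≤ _ := by gcongr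
  have h7 := mul_le_mul_of_nonneg_left h2 w0
  rw [mul_add] at h7
  linarith

include hN
lemma chain_cost {δ : ℝ} (hδ : 0 ≤ δ) (ξ : ℕ → PTd d) {ε1 : ℝ} (hε : 0 ≤ ε) (hε1 : 0 ≤ ε1) (hW : ∀ k < N, W1 (ξ k) (cv h (fstP (rN hm α R τ k))) ≤ ε1) :
    ∑ k ∈ Finset.range N, wgt δ τ k * ∫ p, l p.1 (-p.2) ∂(kp g (rN hm α R τ k) ∘ₘ (ξ k : Measure (Td d))) ≤
      (∫ q, Real.exp (-δ * q.1) * l q.2 (α q.1 q.2) ∂(Mst m hm 0 1)) + CL * ((∫ q, ‖α q.1 q.2‖^2 ∂(Mst m hm 0 1)) / R) +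
      ((Real.exp (δ * τ) - 1) + (ε + (C / g0 + (C / g0 + C^2 / g0^2)) * ε1)) * (CL * (1 + ∫ q, ‖α q.1 q.2‖^2 ∂(Mst m hm 0 1))) := by
  set K := ε + (C / g0 + (C / g0 + C^2 / g0^2)) * ε1 with hK
  have i1 := fun a b ha => (el_int hm hα hE hl hδ (a := a) (b := b) ha).1
  have i2 := fun a b (ha : 0 ≤ a) => a2_int hm hα hE (a := a) (b := b) ha
  have i3 := fun a b ha => ((i1 a b ha).const_mul (Real.exp (δ * τ)))
  have i4 := fun a b ha => ((i2 a b ha).div_const R).const_mul CL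
  have i5 := fun a b ha => (((integrable_const 1).add (i2 a b ha)).const_mul CL).const_mul K
  have hS := Mst_sum hm (f := fun q => Real.exp (δ * τ) * (Real.exp (-δ * q.1) * l q.2 (α q.1 q.2)) + (CL * (‖α q.1 q.2‖^2 / R) + K * (CL * (1 + ‖α q.1 q.2‖^2))))
    (fun a b ha => (i3 a b ha).add ((i4 a b ha).add (i5 a b ha))) hτ.le N
  rw [hN] at hS
  refine (Finset.sum_le_sum fun k hk => cost_step hm hα hE hl h hR hτ hδ k hε hε1 (hW k (Finset.mem_range.1 hk))).trans ?_
  have e0 := integral_add (i3 0 1 le_rfl) ((i4 0 1 le_rfl).add (i5 0 1 le_rfl))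
  simp only [Pi.add_apply] at e0
  rw [hS, e0, integral_const_mul (Real.exp (δ*τ))]
  have e1 := integral_add (i4 0 1 le_rfl) (i5 0 1 le_rfl)
  simp only [Pi.add_apply] at e1
  have e2 := integral_add (integrable_const (1:ℝ)) (i2 0 1 le_rfl)
  rw [integral_const, Mst_real hm zero_le_one] at e2
  rw [integral_const_mul, integral_const_mul, integral_const_mul, integral_div, e2] at e1
  rw [e1]
  have e3 := (el_int hm hα hE hl hδ (a := 0) (b := 1) le_rfl).2
  rw [integral_const_mul, e2] at e3
  have e4 : 0 ≤ Real.exp (δ * τ) - 1 := by linarith [Real.one_le_exp (mul_nonneg hδ hτ.le)]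
  have e5 := mul_le_mul_of_nonneg_left e3 e4
  simp only [sub_zero, smul_eq_mul, mul_one] at e5 ⊢
  linarith
end

open ProbabilityTheory

structure Chn {d : ℕ} (τ R : ℝ) (w : ℕ → Kernel (Td d) (Td d × Vd d)) : Prop where
  mkv : ∀ k, IsMarkovKernel (w k)
  zero : ∀ x, (w 0 x).map Prod.fst = Measure.dirac x
  succ : ∀ k x, (w (k+1) x).map Prod.fst = eK d τ ∘ₘ w k x
  ae : ∀ k x, ∀ᵐ p ∂(w k x), ‖p.2‖ ≤ R

lemma small_tau {f : ℝ → ℝ} (hf : ContinuousAt f 0) {c : ℝ} (h0 : f 0 < c) {ρ : ℝ} (hρ : 0 < ρ) : ∃ (τ : ℝ) (N : ℕ), 0 < τ ∧ τ ≤ ρ ∧ N * τ = 1 ∧ f τ < c := by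
  obtain ⟨r, hr, h⟩ := Metric.eventually_nhds_iff.1 (hf.eventually (gt_mem_nhds h0))
  obtain ⟨n, hn⟩ := exists_nat_one_div_lt (lt_min hr hρ)
  have hp : (0:ℝ) < 1 / (n + 1) := by positivity
  refine ⟨1 / (n + 1), n + 1, hp, (hn.trans_le (min_le_right _ _)).le, by push_cast; field_simp, h ?_⟩
  rw [Real.dist_eq, sub_zero, abs_of_pos hp]
  exact hn.trans_le (min_le_left _ _)

lemma ex_big (a b : ℝ) {ε : ℝ} (hε : 0 < ε) (ha : 0 ≤ a) (hb : 0 ≤ b) : ∃ R : ℝ, 1 ≤ R ∧ a / R ≤ ε ∧ b / R ≤ ε := by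
  have h1 : 0 ≤ a / ε := by positivity
  have h2 : 0 ≤ b / ε := by positivity
  refine ⟨1 + a / ε + b / ε, by linarith, ?_, ?_⟩ <;> rw [div_le_iff₀ (by linarith)] <;> [have := mul_div_cancel₀ a hε.ne'; have := mul_div_cancel₀ b hε.ne'] <;> nlinarith

lemma ex_small (a : ℝ) {ε : ℝ} (hε : 0 < ε) (ha : 0 ≤ a) : ∃ r : ℝ, 0 < r ∧ r ≤ 1 ∧ r ≤ ε ∧ r * a ≤ ε := by
  refine ⟨min 1 (min ε (ε / (a + 1))), by positivity, min_le_left _ _, (min_le_right _ _).trans (min_le_left _ _), ?_⟩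
  calc _ ≤ ε / (a + 1) * a := by gcongr; exact (min_le_right _ _).trans (min_le_right _ _)
    _ ≤ ε / (a + 1) * (a + 1) := by gcongr; linarith
    _ = ε := by field_simp

lemma chain_thm {d : ℕ} {m : ℝ → PTd d} (hm : W1ContOn m (Set.Ici 0)) {α : ℝ → Td d → Vd d}
    (hα : Measurable (fun q : ℝ × Td d => α q.1 q.2))
    (hE : ∀ a b : ℝ, 0 ≤ a → Integrable (fun q : ℝ × Td d => sqnorm (α q.1 q.2)) (Mst m hm a b))
    (hFP : ∀ s₁ s₂ : ℝ, 0 ≤ s₁ → s₁ ≤ s₂ → FPeq 1 m α s₁ s₂)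
    {l : Td d → Vd d → ℝ} {CL : ℝ} (hl : LC l CL) {δ : ℝ} (hδ : 0 ≤ δ) {ε : ℝ} (hε : 0 < ε) :
    ∃ μ : PTd d, W1 μ (m 0) ≤ ε ∧ ∃ R : ℝ, 0 ≤ R ∧ ∀ ρ : ℝ, 0 < ρ → ∃ (τ : ℝ) (N : ℕ) (w : ℕ → Kernel (Td d) (Td d × Vd d)),
      0 < τ ∧ τ ≤ ρ ∧ N * τ = 1 ∧ Chn τ R w ∧
      (∀ k ≤ N, ∀ ξ : PTd d, (ξ : Measure (Td d)) = (w k ∘ₘ (μ : Measure (Td d))).map Prod.fst → ∀ s, k * τ ≤ s → s ≤ (k+1) * τ → s ≤ 1 → W1 ξ (m s) ≤ ε) ∧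
      ∑ k ∈ Finset.range N, wgt δ τ k * ∫ p, l p.1 (-p.2) ∂(w k ∘ₘ (μ : Measure (Td d))) ≤ (∫ q, Real.exp (-δ * q.1) * l q.2 (α q.1 q.2) ∂(Mst m hm 0 1)) + ε := by
  set A0 := ∫ q, ‖α q.1 q.2‖ ∂(Mst m hm 0 1) with hA0
  set E0 := ∫ q, ‖α q.1 q.2‖^2 ∂(Mst m hm 0 1) with hE0
  have A0n : 0 ≤ A0 := integral_nonneg fun _ => norm_nonneg _
  have E0n : 0 ≤ E0 := integral_nonneg fun _ => by positivity
  have hCL := hl.pos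
  set B0 := CL * (1 + E0) with hB0
  have B0n : 0 ≤ B0 := by positivity
  obtain ⟨ε0, e01, e02, e03, e04⟩ := ex_small B0 (show 0 < ε / 8 by positivity) B0n
  obtain ⟨G, C, g0, hG, hg0, hlb, hG1, hG2⟩ := moll_exists d e01 e02
  have h := hG.mol hg0 hlb hG1 hG2
  have hC := hG.nonneg
  set Lg := C / g0 + C^2 / g0^2 with hLg
  set L2 := C / g0 + Lg with hL2
  have L2n : 0 ≤ L2 := by positivity
  obtain ⟨ε1, e11, e12, e13, e14⟩ := ex_small (L2 * B0) (show 0 < ε / 4 by positivity) (by positivity)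
  refine ⟨cv h (m 0), (cv_W1 h (m 0)).trans (by linarith), ?_⟩
  obtain ⟨R, hR1, hR2, hR3⟩ := ex_big ((Real.exp (Lg * A0) * (d * C) + C * d) * E0) (CL * E0) (show 0 < ε1 / 2 by positivity) (by positivity) (by positivity)
  refine ⟨R, by linarith, fun ρ hρ => ?_⟩
  obtain ⟨τ, N, hτ, hτρ, hN, hf⟩ := small_tau (f := fun τ => Real.exp (Lg * A0) * (C * (2 + d * R + d * A0) * (τ * R + √τ * Mz d)) + C * (τ + d * (τ * R)) + (Real.exp (δ * τ) - 1) * (B0 + 1))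
    (c := ε1 / 2) (by fun_prop) (by simp; linarith) hρ
  have hfa : 0 ≤ (Real.exp (δ * τ) - 1) * (B0 + 1) := mul_nonneg (by linarith [Real.one_le_exp (mul_nonneg hδ hτ.le)]) (by linarith)
  have hMz := Mz_nonneg (d := d)
  have hfb : 0 ≤ Real.exp (Lg * A0) * (C * (2 + d * R + d * A0) * (τ * R + √τ * Mz d)) + C * (τ + d * (τ * R)) := by positivity
  haveI hr : ∀ k, IsProbabilityMeasure (rN hm α R τ k) := fun k => rK_prob hm hα R (by nlinarith)
  have hW := chain_W hm hα hE hFP hG h (R := R) (by linarith) hτ hN (ε1 := ε1) (by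
    rw [← hA0, ← hE0]
    have : Real.exp (Lg * A0) * (C * (2 + d * R + d * A0) * (τ * R + √τ * Mz d) + d * C * (E0 / R)) + C * (τ + d * (τ * R + E0 / R)) =
      (Real.exp (Lg * A0) * (C * (2 + d * R + d * A0) * (τ * R + √τ * Mz d)) + C * (τ + d * (τ * R))) + (Real.exp (Lg * A0) * (d * C) + C * d) * E0 / R := by ring
    linarith)
  refine ⟨τ, N, wK (fun y => G (secT y)) τ (rN hm α R τ), hτ, hτρ, hN, ⟨wK_markov h τ _, wK_zero h τ _, wK_succ h τ _, wK_ae h τ _ fun k => rK_ae hm hα (by linarith) _ _⟩, ?_, ?_⟩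
  · intro k hk ξ hξ s h1 h2 h3
    rw [wK_comp_fst h] at hξ
    have : ξ = xK h τ (rN hm α R τ) (cv h (m 0)) k := Subtype.ext hξ
    rw [this]
    exact (hW.2 k hk s h1 h2 h3).trans (by linarith)
  · have hc := chain_cost hm hα hE hl h hR1 hτ hN hδ (xK h τ (rN hm α R τ) (cv h (m 0))) (by linarith) e11.le hW.1
    simp only [wK_comp]
    refine hc.trans ?_
    rw [← hE0, ← hLg, ← hL2, ← hB0]
    have h1 : (Real.exp (δ * τ) - 1) * B0 ≤ (Real.exp (δ * τ) - 1) * (B0 + 1) := by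
      have : 0 ≤ Real.exp (δ * τ) - 1 := by linarith [Real.one_le_exp (mul_nonneg hδ hτ.le)]
      gcongr; linarith
    have h2 : CL * (E0 / R) = CL * E0 / R := by ring
    rw [h2]
    linarith

open ProbabilityTheory

lemma dpp_step {d : ℕ} (S : MFGSetting d) : ∃ C : ℝ, 0 < C ∧ ∀ {δ : ℝ}, 0 < δ → ∀ (P : Measure (Td d × Vd d)) [IsProbabilityMeasure P]
    {R : ℝ}, 0 ≤ R → (∀ᵐ p ∂P, ‖p.2‖ ≤ R) → ∀ {τ : ℝ}, 0 < τ → ∀ {m : ℝ → PTd d}, W1ContOn m (Set.Ici 0) → ∀ {LF : ℝ}, 0 ≤ LF → (∀ μ ν : PTd d, |S.Fc ν - S.Fc μ| ≤ LF * W1 μ ν) →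
    ∀ {a : ℝ}, 0 ≤ a → ∀ {D : ℝ}, (∀ s, a ≤ s → s ≤ a + τ → W1 (mG P 0) (m s) ≤ D) →
    Real.exp (-δ * a) * Vfun S 1 δ (mG P 0) ≤ (∫ s in a..(a + τ), Real.exp (-δ * s)) * (∫ p, Lt S p.1 (-p.2) ∂P) + (∫ s in a..(a + τ), Real.exp (-δ * s) * S.Fc (m s)) +
      τ * ((τ * R + √τ * Mz d) * (R^2 + C + LF) + LF * D) + Real.exp (-δ * (a + τ)) * Vfun S 1 δ (mG P τ) := by
  obtain ⟨C, hC, hmod⟩ := Lt_mod S one_pos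
  obtain ⟨c, C2, hc, hC2, g1, g2⟩ := Lt_growth S
  refine ⟨C, hC, fun {δ} hδ P _ {R} hR0 hR {τ} hτ {m} hm {LF} hLF hF {a} ha {D} hD => ?_⟩
  have hMz := Mz_nonneg (d := d)
  have hLc := Lt_cont S
  have hD0 : 0 ≤ D := (W1_nonneg _ _).trans (hD a le_rfl (by linarith))
  set e := τ * R + √τ * Mz d with he
  have he0 : 0 ≤ e := by positivity
  set I0 := ∫ p, Lt S p.1 (-p.2) ∂P with hI0
  have bd : ∀ (y : Td d) (v : Vd d), ‖v‖ ≤ R → ‖Lt S y (-v)‖ ≤ C2 * (1 + R^2) := fun y v hv => by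
    have h1 := g1 y (-v)
    have h2 := g2 y (-v)
    rw [norm_neg] at h1 h2
    have h3 : C2 * (1 + ‖v‖^2) ≤ C2 * (1 + R^2) := by gcongr
    have h4 : 0 ≤ c * ‖v‖^2 := by positivity
    have h5 : C2 ≤ C2 * (1 + R^2) := by nlinarith [sq_nonneg R]
    rw [Real.norm_eq_abs, abs_le]; constructor <;> linarith
  have hR' : ∀ᵐ p ∂(P.prod (gam d)), ‖p.1.2‖ ≤ R := ae_prod_fst hR
  have hfc : Continuous (fun q : ℝ × ((Td d × Vd d) × Vd d) => Lt S (stX q.1 q.2) (-q.2.1.2)) := hLc.comp (stX_cont.prodMk (by fun_prop))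
  have hi : ∀ s, Integrable (fun p => Lt S (stX s p) (-p.1.2)) (P.prod (gam d)) := fun s =>
    Integrable.of_bound (hfc.comp (by fun_prop : Continuous fun p : (Td d × Vd d) × Vd d => (s, p))).aestronglyMeasurable _ (hR'.mono fun p hp => bd _ _ hp)
  set I := fun s => ∫ p, Lt S (stX s p) (-p.1.2) ∂(P.prod (gam d)) with hI
  have Im : StronglyMeasurable I := hfc.stronglyMeasurable.integral_prod_right'
  have Ib : ∀ s, ‖I s‖ ≤ C2 * (1 + R^2) := fun s => by
    have := norm_integral_le_of_norm_le_const (μ := P.prod (gam d)) (f := fun p => Lt S (stX s p) (-p.1.2)) (hR'.mono fun p hp => bd _ _ hp)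
    simpa using this
  have hi0 : Integrable (fun p : (Td d × Vd d) × Vd d => Lt S p.1.1 (-p.1.2)) (P.prod (gam d)) :=
    Integrable.of_bound (hLc.comp (by fun_prop : Continuous fun p : (Td d × Vd d) × Vd d => (p.1.1, -p.1.2))).aestronglyMeasurable _ (hR'.mono fun p hp => bd _ _ hp)
  have hI00 : ∫ p, Lt S p.1.1 (-p.1.2) ∂(P.prod (gam d)) = I0 := by
    rw [integral_prod _ hi0]; simp [hI0]
  obtain ⟨n1, n2⟩ := int_norm_snd P
  have Ile : ∀ s ∈ Set.Icc 0 τ, I s ≤ I0 + e * (R^2 + C) := fun s hs => by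
    have hj := ((integrable_const (τ * R)).add (n1.const_mul √τ)).mul_const (R^2 + C)
    have h1 : I s ≤ ∫ p, (Lt S p.1.1 (-p.1.2) + (τ * R + √τ * ‖p.2‖) * (R^2 + C)) ∂(P.prod (gam d)) := by
      refine integral_mono_ae (hi s) (hi0.add hj) (hR'.mono fun p hp => ?_)
      have h2 := hmod p.1.1 (stX s p) (-p.1.2) 0 (by simp)
      rw [add_zero, norm_zero, add_zero, one_mul, norm_neg] at h2
      have h3 : ‖stX s p - p.1.1‖ ≤ τ * R + √τ * ‖p.2‖ := by
        rw [stX, add_sub_cancel_left]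
        refine (norm_piT_le _).trans ((norm_add_le _ _).trans ?_)
        rw [norm_smul, norm_smul, Real.norm_of_nonneg hs.1, Real.norm_of_nonneg (Real.sqrt_nonneg _)]
        have := Real.sqrt_le_sqrt hs.2
        have := hs.2
        gcongr
      refine h2.trans ?_
      show _ ≤ Lt S p.1.1 (-p.1.2) + (τ * R + √τ * ‖p.2‖) * (R^2 + C)
      gcongr
    refine h1.trans (le_of_eq ?_)
    have e1 := integral_add hi0 hj
    simp only [Pi.add_apply] at e1
    have e2 := integral_add (integrable_const (μ := P.prod (gam d)) (τ * R)) (n1.const_mul √τ)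
    rw [e1, hI00, integral_mul_const, e2, integral_const_mul √τ, n2]
    simp [he]
  have Fle : ∀ s ∈ Set.Icc 0 τ, S.Fc (mG P s) ≤ S.Fc (m (a + s)) + LF * (e + D) := fun s hs => by
    have h1 := (abs_le.1 (hF (m (a + s)) (mG P s))).2
    have h2 := W1_triangle (m (a + s)) (mG P 0) (mG P s)
    have h3 := mG_W1 P hR 0 s
    have h4 := hD (a + s) (by linarith [hs.1]) (by linarith [hs.2])
    rw [W1_symm] at h4
    rw [zero_sub, abs_neg, abs_of_nonneg hs.1, Real.sqrt_zero, zero_sub, abs_neg, abs_of_nonneg (Real.sqrt_nonneg _)] at h3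
    have h5 : s * R + √s * Mz d ≤ e := by
      have := Real.sqrt_le_sqrt hs.2
      have := hs.2
      rw [he]; gcongr
    have h6 : LF * W1 (m (a + s)) (mG P s) ≤ LF * (e + D) := by gcongr; linarith
    linarith
  have ecs : Continuous fun s => Real.exp (-δ * s) := by fun_prop
  have j1 : IntervalIntegrable (fun s => Real.exp (-δ * s) * I s) volume 0 τ :=
    ((intervalIntegrable_const (c := C2 * (1 + R^2))).mono_fun' Im.aestronglyMeasurable (Eventually.of_forall Ib)).continuousOn_mul ecs.continuousOn
  have cF : ∀ {μ : ℝ → PTd d} {b : ℝ}, W1ContOn μ (Set.Ici 0) → 0 ≤ b → IntervalIntegrable (fun s => Real.exp (-δ * s) * S.Fc (μ (b + s))) volume 0 τ := fun {μ b} hμ hb => by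
    refine ContinuousOn.intervalIntegrable (ecs.continuousOn.mul ?_)
    rw [Set.uIcc_of_le hτ.le]
    exact (Fc_contOn S hμ).comp (by fun_prop) fun s hs => Set.mem_Ici.2 (by linarith [hs.1])
  have j2 := cF (mG_cont P hR (Set.Ici 0)) le_rfl
  simp only [zero_add] at j2
  have j3 := cF hm ha
  have j4 : IntervalIntegrable (fun s => Real.exp (-δ * s) * I0) volume 0 τ := (ecs.mul continuous_const).intervalIntegrable _ _
  have j5 : IntervalIntegrable (fun _ => e * (R^2 + C + LF) + LF * D) volume 0 τ := intervalIntegrable_const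
  have key := intervalIntegral.integral_mono_on hτ.le (j1.add j2) ((j4.add j3).add j5) fun s hs => by
    have h1 : Real.exp (-δ * s) ≤ 1 := Real.exp_le_one_iff.2 (by nlinarith [hs.1])
    have h2 := Ile s hs
    have h3 := Fle s hs
    have h4 : 0 ≤ e * (R^2 + C + LF) + LF * D := by positivity
    show Real.exp (-δ * s) * I s + Real.exp (-δ * s) * S.Fc (mG P s) ≤ Real.exp (-δ * s) * I0 + Real.exp (-δ * s) * S.Fc (m (a + s)) + (e * (R^2 + C + LF) + LF * D)
    have h5 := mul_le_mul_of_nonneg_left (add_le_add h2 h3) (Real.exp_pos (-δ * s)).le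
    have h6 := mul_le_mul_of_nonneg_right h1 h4
    linarith
  rw [intervalIntegral.integral_add j1 j2, intervalIntegral.integral_add (j4.add j3) j5, intervalIntegral.integral_add j4 j3, intervalIntegral.integral_mul_const, intervalIntegral.integral_const, sub_zero, smul_eq_mul] at key
  have hV := dpp_upper S hδ P hR0 hR hτ.le
  have h1 : Real.exp (-δ * a) ≤ 1 := Real.exp_le_one_iff.2 (by nlinarith)
  have sh : ∀ f : ℝ → ℝ, ∫ s in a..(a + τ), Real.exp (-δ * s) * f s = Real.exp (-δ * a) * ∫ s in (0:ℝ)..τ, Real.exp (-δ * s) * f (a + s) := fun f => by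
    have := intervalIntegral.integral_comp_add_left (a := 0) (b := τ) (fun s => Real.exp (-δ * s) * f s) a
    rw [add_zero] at this
    rw [← this, ← intervalIntegral.integral_const_mul]
    refine intervalIntegral.integral_congr fun s _ => ?_
    show Real.exp (-δ * (a + s)) * f (a + s) = Real.exp (-δ * a) * (Real.exp (-δ * s) * f (a + s))
    rw [← mul_assoc, ← Real.exp_add, mul_add]
  have s1 := sh fun _ => 1
  simp only [mul_one] at s1
  rw [s1, sh, mul_add (-δ), Real.exp_add]
  have h4 : 0 ≤ τ * (e * (R^2 + C + LF) + LF * D) := by positivity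
  have h5 := mul_le_mul_of_nonneg_left (hV.trans (add_le_add_left key _)) (Real.exp_pos (-δ * a)).le
  have h6 := mul_le_mul_of_nonneg_right h1 h4
  linarith

lemma dpp_chain {d : ℕ} (S : MFGSetting d) : ∃ C : ℝ, 0 < C ∧ ∀ {δ : ℝ}, 0 < δ → ∀ (P : ℕ → Measure (Td d × Vd d)) [∀ k, IsProbabilityMeasure (P k)]
    {R : ℝ}, 0 ≤ R → (∀ k, ∀ᵐ p ∂(P k), ‖p.2‖ ≤ R) → ∀ {τ : ℝ}, 0 < τ → ∀ {N : ℕ}, N * τ = 1 → (∀ k, mG (P (k+1)) 0 = mG (P k) τ) →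
    ∀ {m : ℝ → PTd d}, W1ContOn m (Set.Ici 0) → ∀ {LF : ℝ}, 0 ≤ LF → (∀ μ ν : PTd d, |S.Fc ν - S.Fc μ| ≤ LF * W1 μ ν) →
    ∀ {D : ℝ}, (∀ k < N, ∀ s, k * τ ≤ s → s ≤ (k + 1) * τ → W1 (mG (P k) 0) (m s) ≤ D) →
    Vfun S 1 δ (mG (P 0) 0) ≤ ∑ k ∈ Finset.range N, wgt δ τ k * (∫ p, Lt S p.1 (-p.2) ∂(P k)) + (∫ s in (0:ℝ)..1, Real.exp (-δ * s) * S.Fc (m s)) +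
      ((τ * R + √τ * Mz d) * (R^2 + C + LF) + LF * D) + Real.exp (-δ) * Vfun S 1 δ (mG (P N) 0) := by
  obtain ⟨C, hC, h⟩ := dpp_step S
  refine ⟨C, hC, fun {δ} hδ P _ {R} hR0 hR {τ} hτ {N} hN hP {m} hm {LF} hLF hF {D} hD => ?_⟩
  set E := (τ * R + √τ * Mz d) * (R^2 + C + LF) + LF * D with hEd
  have hi : ∀ {a b : ℝ}, 0 ≤ a → a ≤ b → IntervalIntegrable (fun s => Real.exp (-δ * s) * S.Fc (m s)) volume a b := fun {a b} ha hab => by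
    refine ContinuousOn.intervalIntegrable (ContinuousOn.mul (by fun_prop) ((Fc_contOn S hm).mono fun s hs => ?_))
    rw [Set.uIcc_of_le hab] at hs
    exact Set.mem_Ici.2 (ha.trans hs.1)
  have key : ∀ n ≤ N, Vfun S 1 δ (mG (P 0) 0) ≤ ∑ k ∈ Finset.range n, wgt δ τ k * (∫ p, Lt S p.1 (-p.2) ∂(P k)) + (∫ s in (0:ℝ)..(n * τ), Real.exp (-δ * s) * S.Fc (m s)) +
      n * τ * E + Real.exp (-δ * (n * τ)) * Vfun S 1 δ (mG (P n) 0) := by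
    intro n
    induction n with
    | zero => intro _; simp
    | succ n ih =>
      intro hn
      have h0 : (0:ℝ) ≤ n * τ := by positivity
      have e1 : ((n:ℝ) + 1) * τ = n * τ + τ := by ring
      have h1 := h hδ (P n) hR0 (hR n) hτ hm hLF hF h0 (D := D) (fun s h1 h2 => hD n hn s h1 (by rwa [e1]))
      have h2 := ih (by omega)
      rw [Finset.sum_range_succ, hP]
      push_cast
      have h3 := intervalIntegral.integral_add_adjacent_intervals (hi le_rfl h0) (hi h0 (show (n:ℝ) * τ ≤ (n + 1) * τ by linarith))
      rw [wgt]
      rw [e1] at h3 ⊢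
      rw [← h3]
      linarith
  have := key N le_rfl
  rw [hN] at this
  simpa using this

open ProbabilityTheory
section

lemma bind_bd {α β : Type*} [MeasurableSpace α] [MeasurableSpace β] (μ : Measure α) [IsProbabilityMeasure μ] (κ : Kernel α β) [IsMarkovKernel κ]
    {f : β → ℝ} (hf : Measurable f) {B : ℝ} (hB : ∀ a, ∀ᵐ y ∂(κ a), ‖f y‖ ≤ B) : ∫ y, f y ∂(κ ∘ₘ μ) = ∫ x, (∫ y, f y ∂(κ x)) ∂μ ∧
    Integrable (fun x => ∫ y, f y ∂(κ x)) μ ∧ Measurable (fun x => ∫ y, f y ∂(κ x)) ∧ ∀ a, Integrable f (κ a) := by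
  have hm : StronglyMeasurable (fun x => ∫ y, f y ∂(κ x)) := hf.stronglyMeasurable.integral_kernel
  refine ⟨bind_int μ κ hf (Integrable.of_bound hf.aestronglyMeasurable B ?_), Integrable.of_bound hm.aestronglyMeasurable B (Eventually.of_forall fun x => ?_), hm.measurable,
    fun a => Integrable.of_bound hf.aestronglyMeasurable B (hB a)⟩
  · rw [Measure.ae_comp_iff (measurableSet_le (by fun_prop) (by fun_prop))]
    exact Eventually.of_forall hB
  · simpa using norm_integral_le_of_norm_le_const (hB x)

variable {d : ℕ}

def bK (τ : ℝ) : ℕ → Kernel (Td d) (Td d × Vd d)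
  | 0 => Kernel.deterministic (fun y => (y, 0)) (by fun_prop)
  | k+1 => (eK d τ ∘ₖ bK τ k).map fun y => (y, 0)

lemma bK_chn (τ : ℝ) : Chn τ 0 (bK (d := d) τ) := by
  have hz : Measurable fun y : Td d => (y, (0 : Vd d)) := by fun_prop
  have mk : ∀ k, IsMarkovKernel (bK (d := d) τ k) := fun k => by
    induction k with
    | zero => rw [bK]; infer_instance
    | succ k ih => rw [bK]; exact Kernel.IsMarkovKernel.map _ hz
  have hs : MeasurableSet {p : Td d × Vd d | ‖p.2‖ ≤ 0} := measurableSet_le (by fun_prop) (by fun_prop)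
  refine ⟨mk, fun x => ?_, fun k x => ?_, fun k x => ?_⟩
  · rw [bK, Kernel.deterministic_apply, Measure.map_dirac' measurable_fst]
  · rw [bK, Kernel.map_apply _ hz, Measure.map_map measurable_fst hz, Kernel.comp_apply]
    exact Measure.map_id
  · cases k with
    | zero => rw [bK, Kernel.deterministic_apply, ae_dirac_iff hs]; simp
    | succ k =>
      rw [bK, Kernel.map_apply _ hz, ae_map_iff hz.aemeasurable hs]; simp

def gS (τ : ℝ) (k : ℕ) (a : (Td d × Td d) × (Td d × Vd d)) : Td d × Vd d :=
  (a.2.1 + piT ((1 - k * τ) • repT (a.1.2 - a.1.1)), a.2.2 - repT (a.1.2 - a.1.1))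

lemma gS_meas (τ : ℝ) (k : ℕ) : Measurable (gS (d := d) τ k) := by
  have h1 : Measurable fun a : (Td d × Td d) × (Td d × Vd d) => repT (a.1.2 - a.1.1) := measurable_repT.comp (by fun_prop)
  have h2 : Measurable fun a : (Td d × Td d) × (Td d × Vd d) => piT ((1 - k * τ) • repT (a.1.2 - a.1.1)) := measurable_piT.comp (by fun_prop)
  unfold gS
  fun_prop

lemma gS_meas2 (τ : ℝ) (k : ℕ) (a : Td d × Td d) : Measurable (fun p => gS τ k (a, p)) := (gS_meas τ k).comp measurable_prodMk_left

variable (τ : ℝ) (w : ℕ → Kernel (Td d) (Td d × Vd d)) (B : Set (Td d)) (hB : MeasurableSet B)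

def gK (k : ℕ) : Kernel (Td d × Td d) (Td d × Vd d) := (Kernel.id ×ₖ (w k).comap Prod.fst measurable_fst).map (gS τ k)

open Classical in
def uK (k : ℕ) : Kernel (Td d × Td d) (Td d × Vd d) :=
  Kernel.piecewise (s := Prod.fst ⁻¹' B) (measurable_fst hB) ((bK τ k).comap Prod.snd measurable_snd) (gK τ w k)

variable {τ w B} {R : ℝ} (hw : Chn τ R w)

include hw
lemma gK_apply (k : ℕ) (a : Td d × Td d) : gK τ w k a = (w k a.1).map (fun p => gS τ k (a, p)) := by
  have := hw.mkv
  rw [gK, Kernel.map_apply _ (gS_meas τ k), Kernel.prod_apply, Kernel.id_apply, Kernel.comap_apply, Measure.dirac_prod, Measure.map_map (gS_meas τ k) measurable_prodMk_left]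
  rfl

omit hw in
lemma uK_bad (k : ℕ) {a : Td d × Td d} (ha : a.1 ∈ B) : uK τ w B hB k a = bK τ k a.2 := by
  classical
  rw [uK, Kernel.piecewise_apply, if_pos (by exact ha), Kernel.comap_apply]

lemma uK_good (k : ℕ) {a : Td d × Td d} (ha : a.1 ∉ B) : uK τ w B hB k a = (w k a.1).map (fun p => gS τ k (a, p)) := by
  classical
  rw [uK, Kernel.piecewise_apply, if_neg (by exact ha), gK_apply hw]

lemma uK_markov (k : ℕ) : IsMarkovKernel (uK τ w B hB k) := by
  have := hw.mkv
  have := (bK_chn (d := d) τ).mkv k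
  have : IsMarkovKernel (gK τ w k) := by rw [gK]; exact Kernel.IsMarkovKernel.map _ (gS_meas τ k)
  rw [uK]; infer_instance

lemma uK_zero (a : Td d × Td d) : (uK τ w B hB 0 a).map Prod.fst = Measure.dirac a.2 := by
  by_cases ha : a.1 ∈ B
  · rw [uK_bad hB 0 ha, (bK_chn τ).zero]
  · have hg := gS_meas2 τ 0 a
    rw [uK_good hB hw 0 ha, Measure.map_map measurable_fst hg]
    have : Prod.fst ∘ (fun p => gS τ 0 (a, p)) = (fun y => y + (a.2 - a.1)) ∘ Prod.fst := by
      funext p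
      simp [gS, piT_repT]
    rw [this, ← Measure.map_map (by fun_prop) measurable_fst, hw.zero, Measure.map_dirac' (by fun_prop)]
    simp

lemma uK_succ (k : ℕ) (a : Td d × Td d) : (uK τ w B hB (k+1) a).map Prod.fst = eK d τ ∘ₘ uK τ w B hB k a := by
  by_cases ha : a.1 ∈ B
  · rw [uK_bad hB _ ha, uK_bad hB _ ha, (bK_chn τ).succ]
  · have hg := fun k => gS_meas2 τ k a
    have := hw.mkv
    have := uK_markov hB hw k
    have hst := stX_meas' (d := d) τ
    set c := piT ((1 - (k + 1) * τ) • repT (a.2 - a.1)) with hc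
    have e1 : Prod.fst ∘ (fun p => gS τ (k+1) (a, p)) = (fun y => y + c) ∘ Prod.fst := by
      funext p
      simp [gS, hc]
    have e2 : stX τ ∘ (Prod.map (fun p => gS τ k (a, p)) id) = (fun y => y + c) ∘ stX (d := d) τ := by
      funext p
      simp only [Function.comp_apply, stX, gS, Prod.map, id, hc]
      rw [add_assoc, add_assoc, ← piT_add, ← piT_add]
      congr 2
      module
    have e3 : eK d τ ∘ₘ uK τ w B hB k a = ((uK τ w B hB k a).prod (gam d)).map (stX τ) := eK_comp τ _
    have e4 : eK d τ ∘ₘ w k a.1 = ((w k a.1).prod (gam d)).map (stX τ) := eK_comp τ _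
    have e5 := Measure.map_prod_map (w k a.1) (gam d) (hg k) measurable_id
    rw [Measure.map_id] at e5
    rw [e3, uK_good hB hw _ ha, uK_good hB hw _ ha, Measure.map_map measurable_fst (hg (k+1))]
    erw [e1, e5]
    rw [← Measure.map_map (by fun_prop) measurable_fst, hw.succ, e4, Measure.map_map (by fun_prop) hst, Measure.map_map hst ((hg k).prodMap measurable_id)]
    erw [e2]

lemma uK_ae (hR : 0 ≤ R) (k : ℕ) (a : Td d × Td d) : ∀ᵐ p ∂(uK τ w B hB k a), ‖p.2‖ ≤ R + 1 := by
  by_cases ha : a.1 ∈ B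
  · rw [uK_bad hB _ ha]
    exact ((bK_chn τ).ae k a.2).mono fun p hp => by linarith
  · rw [uK_good hB hw _ ha, ae_map_iff (gS_meas2 τ k a).aemeasurable (measurableSet_le (by fun_prop) (by fun_prop))]
    refine (hw.ae k a.1).mono fun p hp => (norm_sub_le _ _).trans ?_
    rw [norm_repT]
    have := norm_Td_le (a.2 - a.1)
    show ‖p.2‖ + ‖a.2 - a.1‖ ≤ _
    linarith
end

open ProbabilityTheory
section
variable {d : ℕ} {τ : ℝ} {w : ℕ → Kernel (Td d) (Td d × Vd d)} {B : Set (Td d)} (hB : MeasurableSet B) {R : ℝ} (hw : Chn τ R w)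
  (Γ : Measure (Td d × Td d)) [IsProbabilityMeasure Γ] {μ ν : PTd d} (hμ : Γ.map Prod.fst = μ) (hν : Γ.map Prod.snd = ν)
include hw

lemma uP_prob (k : ℕ) : IsProbabilityMeasure (uK τ w B hB k ∘ₘ Γ) := by
  have := uK_markov hB hw k
  infer_instance

lemma uP_zero [∀ k, IsProbabilityMeasure (uK τ w B hB k ∘ₘ Γ)] (hν : Γ.map Prod.snd = ν) : mG (uK τ w B hB 0 ∘ₘ Γ) 0 = ν := by
  apply Subtype.ext
  have : (uK τ w B hB 0).map Prod.fst = Kernel.deterministic Prod.snd measurable_snd := Kernel.ext fun a => by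
    rw [Kernel.map_apply _ measurable_fst, uK_zero hB hw, Kernel.deterministic_apply]
  show (mG (uK τ w B hB 0 ∘ₘ Γ) 0 : Measure (Td d)) = ν
  rw [mG_zero, Measure.map_comp _ _ measurable_fst, this, Measure.deterministic_comp_eq_map, hν]

lemma uP_succ [∀ k, IsProbabilityMeasure (uK τ w B hB k ∘ₘ Γ)] (k : ℕ) : mG (uK τ w B hB (k+1) ∘ₘ Γ) 0 = mG (uK τ w B hB k ∘ₘ Γ) τ := by
  apply Subtype.ext
  have : (uK τ w B hB (k+1)).map Prod.fst = eK d τ ∘ₖ uK τ w B hB k := Kernel.ext fun a => by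
    rw [Kernel.map_apply _ measurable_fst, uK_succ hB hw, Kernel.comp_apply]
  show (mG (uK τ w B hB (k+1) ∘ₘ Γ) 0 : Measure (Td d)) = (mG (uK τ w B hB k ∘ₘ Γ) τ : Measure (Td d))
  rw [mG_zero, Measure.map_comp _ _ measurable_fst, this, ← eK_comp, Measure.comp_assoc]

lemma uP_ae (hR : 0 ≤ R) (k : ℕ) : ∀ᵐ p ∂(uK τ w B hB k ∘ₘ Γ), ‖p.2‖ ≤ R + 1 := by
  rw [Measure.ae_comp_iff (measurableSet_le (by fun_prop) (by fun_prop))]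
  exact Eventually.of_forall (uK_ae hB hw hR k)

omit hw in
lemma hn_int : Integrable (fun a : Td d × Td d => ‖a.2 - a.1‖) Γ :=
  Integrable.of_bound (by fun_prop) (1/2) (Eventually.of_forall fun a => by rw [norm_norm]; exact norm_Td_le _)

include hμ
lemma uP_W1 [∀ k, IsProbabilityMeasure (uK τ w B hB k ∘ₘ Γ)] (k : ℕ) (hk : k * τ ≤ 1) (hk0 : 0 ≤ k * τ) {ξ : PTd d} (hξ : (ξ : Measure (Td d)) = (w k ∘ₘ (μ : Measure (Td d))).map Prod.fst) :
    W1 (mG (uK τ w B hB k ∘ₘ Γ) 0) ξ ≤ (1 - k * τ) * ∫ a, ‖a.2 - a.1‖ ∂Γ + Γ.real (Prod.fst ⁻¹' B) := by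
  refine W1_le fun φ hφ => ?_
  have := hw.mkv
  have := uK_markov hB hw k
  have hBm : MeasurableSet (Prod.fst ⁻¹' B : Set (Td d × Td d)) := measurable_fst hB
  obtain ⟨b, hb⟩ := isCompact_univ.exists_bound_of_continuousOn hφ.continuous.continuousOn
  have hφm := hφ.continuous.measurable
  have hfm : Measurable fun p : Td d × Vd d => φ p.1 := hφm.comp measurable_fst
  obtain ⟨u1, u2, -, u4⟩ := bind_bd Γ (uK τ w B hB k) hfm fun a => Eventually.of_forall fun p => hb p.1 trivial
  obtain ⟨w1, w2, w3, w4⟩ := bind_bd (μ : Measure (Td d)) (w k) hfm fun a => Eventually.of_forall fun p => hb p.1 trivial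
  rw [mG_zero, hξ, integral_map measurable_fst.aemeasurable hφm.aestronglyMeasurable, integral_map measurable_fst.aemeasurable hφm.aestronglyMeasurable, u1, w1]
  rw [← hμ] at w2 ⊢
  have w5 : Integrable (fun a : Td d × Td d => ∫ p, φ p.1 ∂(w k a.1)) Γ := w2.comp_measurable measurable_fst
  rw [integral_map measurable_fst.aemeasurable w3.aestronglyMeasurable, ← integral_sub u2 w5, ← integral_const_mul, ← integral_indicator_one hBm]
  have i1 := (hn_int Γ).const_mul (1 - k * τ)
  have i2 : Integrable ((Prod.fst ⁻¹' B : Set (Td d × Td d)).indicator (1 : Td d × Td d → ℝ)) Γ := (integrable_const 1).indicator hBm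
  rw [← integral_add i1 i2]
  refine integral_mono (u2.sub w5) (i1.add i2) fun a => ?_
  show (∫ p, φ p.1 ∂(uK τ w B hB k a)) - ∫ p, φ p.1 ∂(w k a.1) ≤ (1 - k * τ) * ‖a.2 - a.1‖ + (Prod.fst ⁻¹' B : Set (Td d × Td d)).indicator 1 a
  by_cases ha : a.1 ∈ B
  · rw [Set.indicator_of_mem (by exact ha)]
    have := lip_int_diff_le hφ ⟨(uK τ w B hB k a).map Prod.fst, Measure.isProbabilityMeasure_map measurable_fst.aemeasurable⟩ ⟨(w k a.1).map Prod.fst, Measure.isProbabilityMeasure_map measurable_fst.aemeasurable⟩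
    simp only [ProbabilityMeasure.coe_mk] at this
    rw [integral_map measurable_fst.aemeasurable hφm.aestronglyMeasurable, integral_map measurable_fst.aemeasurable hφm.aestronglyMeasurable] at this
    have h2 : 0 ≤ (1 - k * τ) * ‖a.2 - a.1‖ := mul_nonneg (by linarith) (norm_nonneg _)
    simp only [Pi.one_apply]
    linarith
  · rw [Set.indicator_of_notMem (by exact ha), uK_good hB hw k ha, integral_map (gS_meas2 τ k a).aemeasurable hfm.aestronglyMeasurable, add_zero]
    have hgi : Integrable (fun p => φ (gS τ k (a, p)).1) (w k a.1) :=
      Integrable.of_bound (hfm.comp (gS_meas2 τ k a)).aestronglyMeasurable b (Eventually.of_forall fun p => hb _ trivial)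
    rw [← integral_sub hgi (w4 a.1)]
    have := integral_mono (hgi.sub (w4 a.1)) (integrable_const ((1 - k * τ) * ‖a.2 - a.1‖)) fun p => by
      have h1 := (le_abs_self _).trans (hφ.dist_le_mul (gS τ k (a, p)).1 p.1)
      rw [NNReal.coe_one, one_mul, dist_eq_norm, gS, add_sub_cancel_left] at h1
      have h2 := norm_piT_le ((1 - k * τ) • repT (a.2 - a.1))
      rw [norm_smul, norm_repT, Real.norm_of_nonneg (by linarith)] at h2
      exact h1.trans h2
    simpa using this

lemma uP_cost {l : Td d → Vd d → ℝ} {CL : ℝ} (hl : LC l CL) (hR : 0 ≤ R) {c Ce C1 M : ℝ} (hCe : 0 ≤ Ce) (h1 : ∀ y q, c * ‖q‖^2 ≤ l y q)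
    (h2 : ∀ (y y' : Td d) (q k : Vd d), ‖k‖ ≤ 1 → l y' (q + k) ≤ l y q + (‖y' - y‖ + ‖k‖) * (c / 4 * ‖q‖^2 + Ce)) (h3 : ∀ y, l y 0 ≤ C1) (hC1 : 0 ≤ C1) (hM0 : 0 ≤ M)
    {N : ℕ} (hN : N * τ = 1) (hτ : 0 < τ) {δ : ℝ} (hδ : 0 ≤ δ)
    (hBd : ∀ x, x ∈ B ↔ M < ∑ k ∈ Finset.range N, wgt δ τ k * ∫ p, l p.1 (-p.2) ∂(w k x)) :
    ∑ k ∈ Finset.range N, wgt δ τ k * ∫ p, l p.1 (-p.2) ∂(uK τ w B hB k ∘ₘ Γ) ≤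
      (∑ k ∈ Finset.range N, wgt δ τ k * ∫ p, l p.1 (-p.2) ∂(w k ∘ₘ (μ : Measure (Td d)))) + (M / 2 + 2 * Ce) * (∫ a, ‖a.2 - a.1‖ ∂Γ) - (M - C1) * Γ.real (Prod.fst ⁻¹' B) := by
  have := hw.mkv
  have := uK_markov hB hw
  have hBm : MeasurableSet (Prod.fst ⁻¹' B : Set (Td d × Td d)) := measurable_fst hB
  have hCL := hl.pos
  set f : Td d × Vd d → ℝ := fun p => l p.1 (-p.2) with hf
  have hfm : Measurable f := hl.meas.comp (by fun_prop : Measurable fun p : Td d × Vd d => (p.1, -p.2))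
  have fb : ∀ (p : Td d × Vd d), ‖p.2‖ ≤ R + 1 → ‖f p‖ ≤ CL * (1 + (R + 1)^2) := fun p hp => by
    rw [Real.norm_of_nonneg (hl.nn _ _)]
    refine (hl.gr _ _).trans ?_
    rw [norm_neg]; gcongr
  have u := fun k => bind_bd Γ (uK τ w B hB k) hfm fun a => (uK_ae hB hw hR k a).mono fb
  have v := fun k => bind_bd (μ : Measure (Td d)) (w k) hfm fun x => (hw.ae k x).mono fun p hp => fb p (by linarith)
  have v2 : ∀ k, Integrable (fun a : Td d × Td d => ∫ p, f p ∂(w k a.1)) Γ := fun k => by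
    have := (v k).2.1
    rw [← hμ] at this
    exact this.comp_measurable measurable_fst
  have v1 : ∀ k, ∫ p, f p ∂(w k ∘ₘ (μ : Measure (Td d))) = ∫ a, (∫ p, f p ∂(w k a.1)) ∂Γ := fun k => by
    rw [(v k).1, ← hμ, integral_map measurable_fst.aemeasurable (v k).2.2.1.aestronglyMeasurable]
  have s1 : ∑ k ∈ Finset.range N, wgt δ τ k * ∫ p, f p ∂(uK τ w B hB k ∘ₘ Γ) = ∫ a, (∑ k ∈ Finset.range N, wgt δ τ k * ∫ p, f p ∂(uK τ w B hB k a)) ∂Γ := by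
    rw [integral_finset_sum _ fun k _ => (u k).2.1.const_mul _]
    exact Finset.sum_congr rfl fun k _ => by rw [(u k).1, integral_const_mul]
  have s2 : ∑ k ∈ Finset.range N, wgt δ τ k * ∫ p, f p ∂(w k ∘ₘ (μ : Measure (Td d))) = ∫ a, (∑ k ∈ Finset.range N, wgt δ τ k * ∫ p, f p ∂(w k a.1)) ∂Γ := by
    rw [integral_finset_sum _ fun k _ => (v2 k).const_mul _]
    exact Finset.sum_congr rfl fun k _ => by rw [v1 k, integral_const_mul]
  have i0 := integrable_finset_sum (Finset.range N) fun k _ => (u k).2.1.const_mul (wgt δ τ k)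
  have i3 := integrable_finset_sum (Finset.range N) fun k _ => (v2 k).const_mul (wgt δ τ k)
  have i1 := (hn_int Γ).const_mul (M / 2 + 2 * Ce)
  have i2 : Integrable ((Prod.fst ⁻¹' B : Set (Td d × Td d)).indicator (1 : Td d × Td d → ℝ)) Γ := (integrable_const 1).indicator hBm
  have i4 := i2.const_mul (M - C1)
  rw [s1, s2, ← integral_indicator_one hBm, ← integral_const_mul, ← integral_const_mul, ← integral_add i3 i1]
  erw [← integral_sub (i3.add i1) i4]
  refine integral_mono i0 ((i3.add i1).sub i4) fun a => ?_
  set J := ∑ k ∈ Finset.range N, wgt δ τ k * ∫ p, f p ∂(w k a.1) with hJ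
  show ∑ k ∈ Finset.range N, wgt δ τ k * ∫ p, f p ∂(uK τ w B hB k a) ≤ J + (M / 2 + 2 * Ce) * ‖a.2 - a.1‖ - (M - C1) * (Prod.fst ⁻¹' B : Set (Td d × Td d)).indicator 1 a
  have wn := wgt_nn δ hτ.le
  have ws : ∑ k ∈ Finset.range N, wgt δ τ k ≤ 1 := by
    refine (Finset.sum_le_sum fun k _ => wgt_le' hδ hτ.le k).trans ?_
    simp [hN]
  have hh := norm_nonneg (a.2 - a.1)
  have J0 : 0 ≤ J := Finset.sum_nonneg fun k _ => mul_nonneg (wn k) (integral_nonneg fun p => hl.nn _ _)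
  by_cases ha : a.1 ∈ B
  · rw [Set.indicator_of_mem (by exact ha), Pi.one_apply]
    have hM := (hBd a.1).1 ha
    rw [← hJ] at hM
    have h5 : ∑ k ∈ Finset.range N, wgt δ τ k * ∫ p, f p ∂(uK τ w B hB k a) ≤ C1 := by
      calc _ ≤ ∑ k ∈ Finset.range N, wgt δ τ k * C1 := by
            refine Finset.sum_le_sum fun k _ => mul_le_mul_of_nonneg_left ?_ (wn k)
            have := integral_mono_ae ((u k).2.2.2 a) (integrable_const C1) (by
              rw [uK_bad hB k ha]
              filter_upwards [(bK_chn τ).ae k a.2] with p hp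
              simp only [hf, norm_le_zero_iff.1 hp, neg_zero]
              exact h3 _)
            simpa using this
        _ = (∑ k ∈ Finset.range N, wgt δ τ k) * C1 := by rw [Finset.sum_mul]
        _ ≤ 1 * C1 := by gcongr
        _ = C1 := one_mul _
    have h6 : 0 ≤ (M / 2 + 2 * Ce) * ‖a.2 - a.1‖ := by positivity
    linarith
  · rw [Set.indicator_of_notMem (by exact ha), mul_zero, sub_zero]
    have hM : J ≤ M := not_lt.1 fun h => ha ((hBd a.1).2 h)
    set n := ‖a.2 - a.1‖ with hn
    calc _ ≤ ∑ k ∈ Finset.range N, ((1 + n / 2) * (wgt δ τ k * ∫ p, f p ∂(w k a.1)) + wgt δ τ k * (2 * Ce * n)) := by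
          refine Finset.sum_le_sum fun k hk => ?_
          have hkt : (k:ℝ) * τ ≤ 1 := by
            rw [← hN]; have := (Finset.mem_range.1 hk).le; gcongr
          have hk0 : 0 ≤ (k:ℝ) * τ := by positivity
          have : ∫ p, f p ∂(uK τ w B hB k a) ≤ (1 + n / 2) * (∫ p, f p ∂(w k a.1)) + 2 * Ce * n := by
            have j1 := (u k).2.2.2 a
            rw [uK_good hB hw k ha] at j1 ⊢
            rw [integral_map (gS_meas2 τ k a).aemeasurable hfm.aestronglyMeasurable]
            have j2 := (((v k).2.2.2 a.1).const_mul (1 + n / 2)).add (integrable_const (2 * Ce * n))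
            have := integral_mono (j1.comp_measurable (gS_meas2 τ k a)) j2 fun p => by
              show l (p.1 + piT ((1 - k * τ) • repT (a.2 - a.1))) (-(p.2 - repT (a.2 - a.1))) ≤ (1 + n / 2) * l p.1 (-p.2) + 2 * Ce * n
              have q1 := h2 p.1 (p.1 + piT ((1 - k * τ) • repT (a.2 - a.1))) (-p.2) (repT (a.2 - a.1)) (by rw [norm_repT]; linarith [norm_Td_le (a.2 - a.1)])
              rw [add_sub_cancel_left, norm_repT, ← hn] at q1
              have q2 := norm_piT_le ((1 - k * τ) • repT (a.2 - a.1))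
              rw [norm_smul, norm_repT, Real.norm_of_nonneg (by linarith), ← hn] at q2
              have q3 := h1 p.1 (-p.2)
              have q4 : ‖piT ((1 - k * τ) • repT (a.2 - a.1))‖ + n ≤ 2 * n := by nlinarith
              have q5 : (‖piT ((1 - k * τ) • repT (a.2 - a.1))‖ + n) * (c / 4 * ‖-p.2‖^2 + Ce) ≤ 2 * n * (l p.1 (-p.2) / 4 + Ce) := by
                have : 0 ≤ l p.1 (-p.2) / 4 + Ce := by have := hl.nn p.1 (-p.2); positivity
                refine (mul_le_mul_of_nonneg_left (show c / 4 * ‖-p.2‖^2 + Ce ≤ l p.1 (-p.2) / 4 + Ce by linarith) (by positivity)).trans ?_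
                gcongr
              rw [show -(p.2 - repT (a.2 - a.1)) = -p.2 + repT (a.2 - a.1) by abel]
              linarith
            refine this.trans (le_of_eq ?_)
            have e := integral_add (((v k).2.2.2 a.1).const_mul (1 + n / 2)) (integrable_const (2 * Ce * n))
            simp only [integral_const, probReal_univ, one_smul] at e
            rw [integral_const_mul] at e
            exact e
          have := mul_le_mul_of_nonneg_left this (wn k)
          linarith
      _ = (1 + n / 2) * J + (∑ k ∈ Finset.range N, wgt δ τ k) * (2 * Ce * n) := by
          rw [Finset.sum_add_distrib, ← Finset.mul_sum, ← Finset.sum_mul]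
      _ ≤ (1 + n / 2) * J + 1 * (2 * Ce * n) := by gcongr
      _ ≤ J + (M / 2 + 2 * Ce) * n := by nlinarith
end

open ProbabilityTheory

lemma cost01 {d : ℕ} (S : MFGSetting d) {m : ℝ → PTd d} (hm : W1ContOn m (Set.Ici 0)) {α : ℝ → Td d → Vd d}
    (hα : Measurable (fun q : ℝ × Td d => α q.1 q.2)) (hE : ∀ a b : ℝ, 0 ≤ a → Integrable (fun q : ℝ × Td d => sqnorm (α q.1 q.2)) (Mst m hm a b))
    {C CL : ℝ} (hl : LC (fun y q => Lt S y q + C) CL) {δ : ℝ} (hδ : 0 ≤ δ) {τ : ℝ} (hτ : 0 < τ) {N : ℕ} (hN : N * τ = 1) :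
    (∫ q, Real.exp (-δ * q.1) * (Lt S q.2 (α q.1 q.2) + C) ∂(Mst m hm 0 1)) + (∫ s in (0:ℝ)..1, Real.exp (-δ * s) * S.Fc (m s)) =
      (∫ s in (0:ℝ)..1, Real.exp (-δ * s) * runCost S m α s) + C * ∑ k ∈ Finset.range N, wgt δ τ k := by
  have hexm : Measurable fun q : ℝ × Td d => Real.exp (-δ * q.1) := by fun_prop
  have iC : ∀ a b : ℝ, 0 ≤ a → Integrable (fun q : ℝ × Td d => Real.exp (-δ * q.1)) (Mst m hm a b) := fun a b ha =>
    Integrable.of_bound hexm.aestronglyMeasurable 1 (by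
      filter_upwards [Mst_ae hm] with q hq
      rw [Real.norm_of_nonneg (Real.exp_pos _).le]
      exact Real.exp_le_one_iff.2 (by nlinarith [hq.1]))
  have il := (el_int hm hα hE hl hδ (a := 0) (b := 1) le_rfl).1
  have iL : Integrable (fun q : ℝ × Td d => Real.exp (-δ * q.1) * Lt S q.2 (α q.1 q.2)) (Mst m hm 0 1) := by
    refine (il.sub ((iC 0 1 le_rfl).mul_const C)).congr (Eventually.of_forall fun q => ?_)
    show Real.exp (-δ * q.1) * (Lt S q.2 (α q.1 q.2) + C) - Real.exp (-δ * q.1) * C = _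
    ring
  have e1 := integral_add iL ((iC 0 1 le_rfl).mul_const C)
  obtain ⟨a1, a2⟩ := Mst_int hm le_rfl zero_le_one iL
  simp only [integral_const_mul] at a1 a2
  have hS := Mst_sum hm iC hτ.le N
  rw [hN] at hS
  have hw : ∀ k : ℕ, ∫ q, Real.exp (-δ * q.1) ∂(Mst m hm (k * τ) ((k + 1) * τ)) = wgt δ τ k := fun k => by
    have h0 : (0:ℝ) ≤ k * τ := by positivity
    rw [← (Mst_int hm h0 (by nlinarith) (iC _ _ h0)).2]
    simp [wgt]
  simp only [hw] at hS
  have iF : IntervalIntegrable (fun s => Real.exp (-δ * s) * S.Fc (m s)) volume 0 1 := by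
    refine ContinuousOn.intervalIntegrable (ContinuousOn.mul (by fun_prop) ((Fc_contOn S hm).mono fun s hs => ?_))
    rw [Set.uIcc_of_le zero_le_one] at hs
    exact Set.mem_Ici.2 hs.1
  have e2 := intervalIntegral.integral_add a1 iF
  rw [a2] at e2
  simp only [mul_add, runCost]
  simp only [Lt] at e1 e2 ⊢
  rw [e1, e2, integral_mul_const, hS]
  ring

set_option maxHeartbeats 1600000 in
lemma step_thm {d : ℕ} (S : MFGSetting d) : ∃ K : ℝ, 0 < K ∧ ∀ δ : ℝ, 0 < δ → ∀ B : ℝ, (∀ μ ν : PTd d, Vfun S 1 δ ν - Vfun S 1 δ μ ≤ K * W1 μ ν + B) →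
    ∀ μ ν : PTd d, Vfun S 1 δ ν - Vfun S 1 δ μ ≤ K * W1 μ ν + Real.exp (-δ) * B := by
  obtain ⟨LF, hLF, hF⟩ := Fc_lip S
  obtain ⟨c, C, hc, hC, g1, g2⟩ := Lt_growth S
  obtain ⟨Ce, hCe, me⟩ := Lt_mod S (show 0 < c / 4 by positivity)
  obtain ⟨Cm, hCm, mm⟩ := Lt_mod S one_pos
  obtain ⟨Cd, hCd, hdc⟩ := dpp_chain S
  set K := 2 * C + 3 * LF + 4 * Ce with hK
  have hK0 : 0 < K := by positivity
  refine ⟨K, hK0, fun δ hδ B hV μ ν => ?_⟩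
  set l : Td d → Vd d → ℝ := fun y q => Lt S y q + C with hld
  have hl : LC l (2 * C + 1 + Cm) := by
    refine ⟨(Lt_cont S).measurable.add_const C, fun y q => ?_, fun y q => ?_, fun y y' q => ?_⟩
    · have := g1 y q
      have : 0 ≤ c * ‖q‖^2 := by positivity
      show 0 ≤ Lt S y q + C
      linarith
    · have := g2 y q
      show Lt S y q + C ≤ _
      nlinarith [sq_nonneg ‖q‖]
    · have h1 := mm y y' q 0 (by simp)
      rw [add_zero, norm_zero, add_zero, one_mul] at h1
      have h2 : ‖y' - y‖ * (‖q‖^2 + Cm) ≤ ‖y' - y‖ * ((2 * C + 1 + Cm) * (1 + ‖q‖^2)) := by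
        gcongr; nlinarith [sq_nonneg ‖q‖]
      show Lt S y' q + C ≤ Lt S y q + C + _
      linarith
  set M := 2 * C + LF + K with hM
  refine le_of_forall_pos_le_add fun ε' hε' => ?_
  set ε := ε' / (3 + LF + 2 * K) with hε
  have hε0 : 0 < ε := by positivity
  have hεε : (3 + LF + 2 * K) * ε = ε' := mul_div_cancel₀ _ (by positivity)
  obtain ⟨_, ⟨m, α, hA, rfl⟩, hr⟩ := exists_lt_of_csInf_lt (V_nonempty S hδ μ) (show Vfun S 1 δ μ < Vfun S 1 δ μ + ε by linarith)
  obtain ⟨hm0, hm, hFP, hα, hEn, -⟩ := id hA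
  have hE := fun a b (ha : 0 ≤ a) => energy_int hm hα hδ hEn (b := b) ha
  obtain ⟨μ', hμ', R, hR, hch⟩ := chain_thm hm hα hE hFP hl hδ.le hε0
  have hfc : ContinuousAt (fun τ : ℝ => (τ * (R + 1) + √τ * Mz d) * ((R + 1)^2 + Cd + LF)) 0 := by fun_prop
  obtain ⟨ρ, hρ, hfρ⟩ := Metric.eventually_nhds_iff.1 (hfc.eventually (gt_mem_nhds (show _ < ε by simpa using hε0)))
  obtain ⟨τ, N, w, hτ, hτρ, hN, hw, hW, hcost⟩ := hch (ρ / 2) (by positivity)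
  have herr := hfρ (show dist τ 0 < ρ by rw [Real.dist_eq, sub_zero, abs_of_pos hτ]; linarith)
  obtain ⟨Γ, hΓ, hΓ1, hΓ2, hΓd⟩ := KR μ' ν
  have := hw.mkv
  have hfm : Measurable fun p : Td d × Vd d => l p.1 (-p.2) := hl.meas.comp (by fun_prop : Measurable fun p : Td d × Vd d => (p.1, -p.2))
  set Bd : Set (Td d) := {x | M < ∑ k ∈ Finset.range N, wgt δ τ k * ∫ p, l p.1 (-p.2) ∂(w k x)} with hBd
  have hB : MeasurableSet Bd := measurableSet_lt measurable_const (Finset.measurable_sum _ fun k _ => (hfm.stronglyMeasurable.integral_kernel (κ := w k)).measurable.const_mul _)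
  haveI : ∀ k, IsProbabilityMeasure (uK τ w Bd hB k ∘ₘ Γ) := uP_prob hB hw Γ
  have hae := uP_ae hB hw Γ hR
  set H := ∫ a, ‖a.2 - a.1‖ ∂Γ with hH
  have hHW : H = W1 μ' ν := by
    rw [← hΓd, hH]
    exact integral_congr_ae (Eventually.of_forall fun a => by simp only [dist_eq_norm]; exact norm_sub_rev _ _)
  have hH0 : 0 ≤ H := integral_nonneg fun _ => norm_nonneg _
  set b := Γ.real (Prod.fst ⁻¹' Bd) with hb
  have key : ∀ k ≤ N, ∀ s, k * τ ≤ s → s ≤ (k + 1) * τ → s ≤ 1 → W1 (mG (uK τ w Bd hB k ∘ₘ Γ) 0) (m s) ≤ (1 - k * τ) * H + b + ε := fun k hk s s1 s2 s3 => by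
    have hp : IsProbabilityMeasure ((w k ∘ₘ (μ' : Measure (Td d))).map Prod.fst) := Measure.isProbabilityMeasure_map measurable_fst.aemeasurable
    have h1 := uP_W1 hB hw Γ hΓ1 k (by linarith) (by positivity) (ξ := ⟨_, hp⟩) rfl
    have h2 := hW k hk ⟨_, hp⟩ rfl s s1 s2 s3
    exact (W1_triangle _ ⟨_, hp⟩ _).trans (by linarith)
  have hd := hdc hδ (fun k => uK τ w Bd hB k ∘ₘ Γ) (show 0 ≤ R + 1 by linarith) hae hτ hN (uP_succ hB hw Γ) hm hLF.le hF (D := H + b + ε) (fun k hk s s1 s2 => by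
    have hk1 : ((k:ℝ) + 1) * τ ≤ 1 := by
      have h : ((k:ℝ) + 1) ≤ N := by exact_mod_cast hk
      exact (mul_le_mul_of_nonneg_right h hτ.le).trans_eq hN
    have := key k hk.le s s1 s2 (s2.trans hk1)
    have h0 : 0 ≤ (k:ℝ) * τ := by positivity
    have h00 := mul_nonneg h0 hH0
    rw [sub_mul, one_mul] at this
    linarith only [this, h00])
  rw [uP_zero hB hw Γ hΓ2] at hd
  have hu := uP_cost hB hw Γ hΓ1 hl hR (c := c) hCe.le (fun y q => by have := g1 y q; show _ ≤ Lt S y q + C; linarith)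
    (fun y y' q k hk => by have := me y y' q k hk; show Lt S y' (q + k) + C ≤ Lt S y q + C + _; linarith)
    (C1 := 2 * C) (fun y => by have := g2 y 0; rw [norm_zero] at this; show Lt S y 0 + C ≤ _; linarith) (by positivity) (M := M) (by positivity) hN hτ hδ.le (fun x => Iff.rfl)
  have hP : ∑ k ∈ Finset.range N, wgt δ τ k * ∫ p, l p.1 (-p.2) ∂(uK τ w Bd hB k ∘ₘ Γ) =
      (∑ k ∈ Finset.range N, wgt δ τ k * ∫ p, Lt S p.1 (-p.2) ∂(uK τ w Bd hB k ∘ₘ Γ)) + C * ∑ k ∈ Finset.range N, wgt δ τ k := by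
    rw [Finset.mul_sum, ← Finset.sum_add_distrib]
    refine Finset.sum_congr rfl fun k _ => ?_
    have hLi : Integrable (fun p : Td d × Vd d => Lt S p.1 (-p.2)) (uK τ w Bd hB k ∘ₘ Γ) := by
      have : Integrable (fun p : Td d × Vd d => l p.1 (-p.2)) (uK τ w Bd hB k ∘ₘ Γ) :=
        Integrable.of_bound hfm.aestronglyMeasurable ((2 * C + 1 + Cm) * (1 + (R + 1)^2)) ((hae k).mono fun p hp => by
          rw [Real.norm_of_nonneg (hl.nn _ _)]
          refine (hl.gr _ _).trans ?_
          rw [norm_neg]; gcongr)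
      refine (this.sub (integrable_const C)).congr (Eventually.of_forall fun p => ?_)
      show Lt S p.1 (-p.2) + C - C = _
      ring
    simp only [hld]
    rw [integral_add hLi (integrable_const C)]
    simp
    ring
  have hc01 := cost01 S hm hα hE hl hδ.le hτ hN
  have hlow := dpp_lower S hδ zero_le_one hA
  rw [mul_one] at hlow
  have hVN := hV (m 1) (mG (uK τ w Bd hB N ∘ₘ Γ) 0)
  have hkN := key N le_rfl 1 hN.le (by linarith) le_rfl
  rw [hN, sub_self, zero_mul, zero_add, W1_symm] at hkN
  have hVN2 : Vfun S 1 δ (mG (uK τ w Bd hB N ∘ₘ Γ) 0) ≤ Vfun S 1 δ (m 1) + B + K * (b + ε) := by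
    have := mul_le_mul_of_nonneg_left hkN hK0.le
    linarith
  have hVN3 := mul_le_mul_of_nonneg_left hVN2 (Real.exp_pos (-δ)).le
  have hexp : Real.exp (-δ) * (K * (b + ε)) ≤ K * (b + ε) := by
    have h1 : Real.exp (-δ) ≤ 1 := Real.exp_le_one_iff.2 (by linarith)
    have h2 : 0 ≤ K * (b + ε) := by have : 0 ≤ b := measureReal_nonneg; positivity
    exact (mul_le_mul_of_nonneg_right h1 h2).trans_eq (one_mul _)
  have hHle : K * H ≤ K * (W1 μ ν + ε) := by
    rw [hHW]
    have := W1_triangle μ' μ ν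
    rw [hm0] at hμ'
    gcongr; linarith
  have hKH : (M / 2 + 2 * Ce) * H + LF * H = K * H := by rw [hM, hK]; ring
  have hMb : (M - 2 * C) * b = LF * b + K * b := by rw [hM]; ring
  linarith

lemma final_thm {d : ℕ} (S : MFGSetting d) : ∃ K : ℝ, 0 < K ∧ ∀ δ : ℝ, 0 < δ → ∀ m₁ m₂ : PTd d, |Vfun S 1 δ m₂ - Vfun S 1 δ m₁| ≤ K * W1 m₁ m₂ := by
  obtain ⟨K, hK, h⟩ := step_thm S
  obtain ⟨C, hC, hV⟩ := V_bdd S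
  refine ⟨K, hK, fun δ hδ => ?_⟩
  have it : ∀ (n : ℕ) (μ ν : PTd d), Vfun S 1 δ ν - Vfun S 1 δ μ ≤ K * W1 μ ν + Real.exp (-δ)^n * (2 * (C / δ)) := fun n => by
    induction n with
    | zero =>
      intro μ ν
      have h1 := abs_le.1 (hV δ hδ μ)
      have h2 := abs_le.1 (hV δ hδ ν)
      have := mul_nonneg hK.le (W1_nonneg μ ν)
      rw [pow_zero]; linarith [h1.1, h2.2]
    | succ n ih =>
      rw [pow_succ', mul_assoc]
      exact h δ hδ _ ih
  have lim : ∀ μ ν : PTd d, Vfun S 1 δ ν - Vfun S 1 δ μ ≤ K * W1 μ ν := fun μ ν => by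
    have h1 := ((tendsto_pow_atTop_nhds_zero_of_lt_one (Real.exp_pos (-δ)).le (by rw [← Real.exp_zero]; exact Real.exp_lt_exp.2 (by linarith))).mul_const (2 * (C / δ))).const_add (K * W1 μ ν)
    rw [zero_mul, add_zero] at h1
    exact ge_of_tendsto' h1 fun n => it n μ ν
  intro m₁ m₂
  have h1 := lim m₂ m₁
  rw [W1_symm] at h1
  exact abs_le.2 ⟨by linarith, lim m₁ m₂⟩

/-- Theorem 1.5 of the paper.  The family `{𝒱_δ}_{δ>0}` is uniformly
Lipschitz continuous with respect to the 1-Wasserstein distance on `P(𝕋^d)`. -/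
theorem Vdelta_uniformly_lipschitz (d : ℕ) (S : MFGSetting d) :
    ∃ K : ℝ, 0 < K ∧ ∀ δ : ℝ, 0 < δ → ∀ m₁ m₂ : PTd d,
      |Vfun S 1 δ m₂ - Vfun S 1 δ m₁| ≤ K * W1 m₁ m₂ := by
  exact final_thm S
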